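/- Let m ≥ 2 be an integer, Δ > 1, and for each j ∈ 𝒞 let p_j ∈ (2^{m−1}, ∞] be exponents with ∑_{j∈𝒞} 1/p_j = 1. Then there exists a constant C such that: for every real m×2m matrix Π such that Π_j Π^T is Δ-regular for each j ∈ 𝒞, for every Calderón–Zygmund kernel K̂ of order 2^{6m} in ℝ^m, and for every tuple (F_j)_{j∈𝒞} of real-valued smooth compactly supported functions on ℝ^m, one has |∫_{ℝ^m} φ̂(−Π^T η) K̂(η) dη| ≤ C ∏_{j∈𝒞} ‖F_j‖_{L^{p_j}(ℝ^m)}, where φ := ∏_{j∈𝒞} F_j ∘ Π_j (a Schwartz function on ℝ^{2m}) and φ̂ is its Fourier transform. -/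

import Mathlib

open MeasureTheory Matrix
open scoped ENNReal NNReal BigOperators

noncomputable section

namespace SBL

/-- The set of corners of the `m`-dimensional cube: functions `{1,…,m} → {0,1}`. -/
abbrev Corner (m : ℕ) := Fin m → Fin 2

/-- Index type for `ℝ^{2m}`: coordinates `x^0_i` (left) and `x^1_i` (right). -/
abbrev Idx (m : ℕ) := Fin m ⊕ Fin m

/-- The coordinate of `ℝ^{2m}` selected by the corner `j` at position `i`. -/
def sel {m : ℕ} (j : Corner m) (i : Fin m) : Idx m :=
  if j i = 0 then Sum.inl i else Sum.inr i

/-- The projection `Π_j : ℝ^{2m} → ℝ^m`, `Π_j x = (x_1^{j(1)},…,x_m^{j(m)})`. -/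
def proj {m : ℕ} (j : Corner m) (x : Idx m → ℝ) : Fin m → ℝ := fun i => x (sel j i)

/-- The projection `Π_j` as an `m × 2m` matrix. -/
def projM {m : ℕ} (j : Corner m) : Matrix (Fin m) (Idx m) ℝ :=
  Matrix.of fun i k => if k = sel j i then 1 else 0

/-- `A_j := Π_j J`, the `m × m` matrix obtained by applying `Π_j` to (the columns of) a
`2m × m` matrix `J`, i.e. selecting rows of `J` according to the corner `j`. -/
def Amat {m : ℕ} (J : Matrix (Idx m) (Fin m) ℝ) (j : Corner m) : Matrix (Fin m) (Fin m) ℝ :=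
  Matrix.of fun i k => J (sel j i) k

/-- Euclidean norm on a finite pi type. -/
def en {ι : Type*} [Fintype ι] (x : ι → ℝ) : ℝ := Real.sqrt (∑ i, (x i) ^ 2)

/-- Operator norm of a matrix with respect to the Euclidean norms. -/
def opNorm {ι κ : Type*} [Fintype ι] [Fintype κ] [DecidableEq κ] (A : Matrix ι κ ℝ) : ℝ :=
  ‖LinearMap.toContinuousLinearMap (Matrix.toEuclideanLin A)‖

/-- `Δ`-regularity of a square matrix: `max(‖A‖, |det A|⁻¹) ≤ Δ` (in particular `det A ≠ 0`). -/
def IsReg {m : ℕ} (Δ : ℝ) (A : Matrix (Fin m) (Fin m) ℝ) : Prop :=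
  opNorm A ≤ Δ ∧ A.det ≠ 0 ∧ |A.det|⁻¹ ≤ Δ

/-- A Calderón–Zygmund kernel of order `n` in `ℝ^m`, given by its multiplier `K̂` on
`ℝ^m ∖ {0}`: it is `n` times continuously differentiable there and satisfies the symbol
estimates `‖D^k K̂(η)‖ ≤ |η|^{-k}` for all `k ≤ n`. -/
def IsCZ {m : ℕ} (n : ℕ) (Khat : (Fin m → ℝ) → ℂ) : Prop :=
  ContDiffOn ℝ n Khat {0}ᶜ ∧
  ∀ k : ℕ, k ≤ n → ∀ η : Fin m → ℝ, η ≠ 0 →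
    ‖iteratedFDerivWithin ℝ k Khat {0}ᶜ η‖ ≤ (en η) ^ (-(k : ℝ))

/-- Fourier transform of a (nice) function on `ℝ^{2m}`. -/
def fourierT {m : ℕ} (φ : (Idx m → ℝ) → ℝ) (ξ : Idx m → ℝ) : ℂ :=
  ∫ x : Idx m → ℝ, Complex.exp (-2 * Real.pi * Complex.I * (∑ k, x k * ξ k)) * (φ x : ℂ)

/-- The principal value `p.v. ∫_{ℝ^{2m}} (∏_j F_j(Π_j x)) K(Πx) dx`, defined as
`∫_{ℝ^m} φ̂(−Π^T η) K̂(η) dη` with `φ = ∏_j F_j ∘ Π_j`. -/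
def pv {m : ℕ} (P : Matrix (Fin m) (Idx m) ℝ) (Khat : (Fin m → ℝ) → ℂ)
    (F : Corner m → (Fin m → ℝ) → ℝ) : ℂ :=
  ∫ η : Fin m → ℝ, fourierT (fun x => ∏ j, F j (proj j x)) (-(P.transpose.mulVec η)) * Khat η

/-- Upper `m×m` block `J^0` of a `2m×m` matrix. -/
def Jb0 {m : ℕ} (J : Matrix (Idx m) (Fin m) ℝ) : Matrix (Fin m) (Fin m) ℝ :=
  J.submatrix Sum.inl id

/-- Lower `m×m` block `J^1` of a `2m×m` matrix. -/
def Jb1 {m : ℕ} (J : Matrix (Idx m) (Fin m) ℝ) : Matrix (Fin m) (Fin m) ℝ :=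
  J.submatrix Sum.inr id

/-- `Π^J := (I, −J^0 (J^1)⁻¹)`. -/
def PiJ {m : ℕ} (J : Matrix (Idx m) (Fin m) ℝ) : Matrix (Fin m) (Idx m) ℝ :=
  Matrix.fromCols 1 (-(Jb0 J * (Jb1 J)⁻¹))

/-- The dyadic cube with parameters `Q = (k, n)`: `∏_i [2^k n_i, 2^k (n_i+1))`. -/
def dC {m : ℕ} (Q : ℤ × (Fin m → ℤ)) : Set (Fin m → ℝ) :=
  {x | ∀ i, (2:ℝ)^Q.1 * (Q.2 i : ℝ) ≤ x i ∧ x i < (2:ℝ)^Q.1 * ((Q.2 i : ℝ) + 1)}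

/-- `Q*`: the cube with the same center as `Q` and three times the side length. -/
def dCstar {m : ℕ} (Q : ℤ × (Fin m → ℤ)) : Set (Fin m → ℝ) :=
  {x | ∀ i, (2:ℝ)^Q.1 * ((Q.2 i : ℝ) - 1) ≤ x i ∧ x i < (2:ℝ)^Q.1 * ((Q.2 i : ℝ) + 2)}

/-- A (1/2-)sparse collection of dyadic cubes. -/
def IsSparse {m : ℕ} (S : Set (ℤ × (Fin m → ℤ))) : Prop :=
  ∀ Q ∈ S,
    (∑' Q' : {q : ℤ × (Fin m → ℤ) // q ∈ S ∧ dC q ⊆ dC Q}, volume (dC Q'.val)) ≤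
      2 * volume (dC Q)

/-- The average `[F]_S := (|S|⁻¹ ∫_S |F|^{2^{m-1}})^{2^{1-m}}`. -/
def avg {m : ℕ} (S : Set (Fin m → ℝ)) (F : (Fin m → ℝ) → ℝ) : ℝ :=
  (((volume S).toReal)⁻¹ * ∫ x in S, |F x| ^ (2^(m-1) : ℕ)) ^ ((2:ℝ) ^ ((1:ℤ) - (m:ℤ)))

/-- The closed axis-parallel box `∏_i [a_i, b_i]`. -/
def box {m : ℕ} (a b : Fin m → ℝ) : Set (Fin m → ℝ) := {x | ∀ i, a i ≤ x i ∧ x i ≤ b i}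

/-- Reciprocal eccentricity `ε_R = (min_i |I_i|)/(max_i |I_i|)` of the box `∏_i [a_i,b_i]`. -/
def ecc {m : ℕ} (a b : Fin m → ℝ) : ℝ := (⨅ i, (b i - a i)) / (⨆ i, (b i - a i))

/-- Modified strong maximal function evaluated on a set `S`:
`sup { (ε_R^α)^{2^{1-m}} [F]_R : R ∈ ℛ, S ⊆ R }` (as an extended real). -/
def Mal {m : ℕ} (α : ℝ) (F : (Fin m → ℝ) → ℝ) (S : Set (Fin m → ℝ)) : ℝ≥0∞ :=
  ⨆ (a : Fin m → ℝ) (b : Fin m → ℝ) (_ : ∀ i, a i < b i) (_ : S ⊆ box a b),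
    ENNReal.ofReal ((ecc a b ^ α) ^ ((2:ℝ) ^ ((1:ℤ) - (m:ℤ))) * avg (box a b) F)

/-- `M_α(F)(A𝒯) := sup_{Q ∈ 𝒯} M_α(F)(AQ)`. -/
def MalTree {m : ℕ} (α : ℝ) (F : (Fin m → ℝ) → ℝ) (A : Matrix (Fin m) (Fin m) ℝ)
    (T : Set (ℤ × (Fin m → ℤ))) : ℝ≥0∞ :=
  ⨆ Q ∈ T, Mal α F (A.mulVec '' dC Q)

/-- A convex tree of dyadic cubes with top cube `Qt`. -/
def ConvexTree {m : ℕ} (T : Set (ℤ × (Fin m → ℤ))) (Qt : ℤ × (Fin m → ℤ)) : Prop :=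
  Qt ∈ T ∧ (∀ Q ∈ T, dC Q ⊆ dC Qt) ∧
  ∀ Q ∈ T, ∀ Q' : ℤ × (Fin m → ℤ), dC Q ⊆ dC Q' → dC Q' ⊆ dC Qt → Q' ∈ T

/-- The Gaussian `g(x) = e^{−π|x|²}` on `ℝ^{2m}`. -/
def gss {m : ℕ} (x : Idx m → ℝ) : ℝ := Real.exp (-Real.pi * ∑ k, (x k) ^ 2)

/-- The mixed partial derivative `∂^0_i ∂^1_i g`. -/
def ddg {m : ℕ} (i : Fin m) (x : Idx m → ℝ) : ℝ :=
  fderiv ℝ (fun y : Idx m → ℝ => fderiv ℝ gss y (Pi.single (Sum.inl i) (1:ℝ))) x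
    (Pi.single (Sum.inr i) (1:ℝ))

/-- Isotropic `L¹` dilation on `ℝ^{2m}`: `φ_t(x) = t^{-2m} φ(t⁻¹ x)`. -/
def dil {m : ℕ} (t : ℝ) (φ : (Idx m → ℝ) → ℝ) (x : Idx m → ℝ) : ℝ :=
  (t ^ (2*m))⁻¹ * φ (t⁻¹ • x)

/-- Matrix dilation: `φ_D(x) = (det D)⁻¹ φ(D⁻¹ x)`. -/
def dilM {m : ℕ} (D : Matrix (Idx m) (Idx m) ℝ) (φ : (Idx m → ℝ) → ℝ) (x : Idx m → ℝ) : ℝ :=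
  (D.det)⁻¹ * φ (D⁻¹.mulVec x)

/-- The region `Ω_𝒯 = ∪_{Q∈𝒯} Q × (ℓ(Q)/2, ℓ(Q))` in the upper half space. -/
def Omega {m : ℕ} (T : Set (ℤ × (Fin m → ℤ))) : Set ((Fin m → ℝ) × ℝ) :=
  ⋃ Q ∈ T, (dC Q) ×ˢ Set.Ioo ((2:ℝ)^Q.1 / 2) ((2:ℝ)^Q.1)

/-- The localized form `Λ_𝒯((F_j)_j)`. -/
def LambdaT {m : ℕ} (J : Matrix (Idx m) (Fin m) ℝ) (T : Set (ℤ × (Fin m → ℤ)))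
    (c : ℝ → ℂ) (u : Idx m → ℝ) (i : Fin m) (F : Corner m → (Fin m → ℝ) → ℝ) : ℂ :=
  ∫ z in Omega T, c z.2 * Complex.ofReal ((1 + en u ^ (4*m))⁻¹ * (z.2)⁻¹ *
    ∫ x : Idx m → ℝ, (∏ j, F j (proj j x)) * dil z.2 (ddg i) (x - J.mulVec z.1 + z.2 • u))

/-- `T_k := ∪ {Q ∈ 𝒯 : ℓ(Q) = 2^k}`. -/
def Tkset {m : ℕ} (T : Set (ℤ × (Fin m → ℤ))) (k : ℤ) : Set (Fin m → ℝ) :=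
  ⋃ Q ∈ {q ∈ T | q.1 = k}, dC Q

/-- The form `Λ̃_𝒯((F_j)_j)` with localization in the `x` variables. -/
def LambdaTilde {m : ℕ} (J : Matrix (Idx m) (Fin m) ℝ) (T : Set (ℤ × (Fin m → ℤ)))
    (c : ℝ → ℂ) (u : Idx m → ℝ) (i : Fin m) (F : Corner m → (Fin m → ℝ) → ℝ) : ℂ :=
  ∑' k : ℤ, ∫ t in Set.Ioc ((2:ℝ)^(k-1)) ((2:ℝ)^k),
    c t * Complex.ofReal ((1 + en u ^ (4*m))⁻¹ * t⁻¹ *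
      ∫ p : Fin m → ℝ, ∫ x : Idx m → ℝ,
        (∏ j, Set.indicator ((Amat J j).mulVec '' Tkset T k) (F j) (proj j x)) *
          dil t (ddg i) (x - J.mulVec p + t • u))

/-- The form `Λ(𝒯,J,K)((F_j)_j)` from the induction proposition. -/
def LambdaK {m : ℕ} (J : Matrix (Idx m) (Fin m) ℝ) (T : Set (ℤ × (Fin m → ℤ)))
    (K : ℝ → (Idx m → ℝ) → ℂ) (F : Corner m → (Fin m → ℝ) → ℝ) : ℂ :=
  ∑' k : ℤ, ∫ x : Idx m → ℝ,
    Complex.ofReal (∏ j, Set.indicator ((Amat J j).mulVec '' Tkset T k) (F j) (proj j x)) *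
      ∫ t in Set.Ioc ((2:ℝ)^(k-1)) ((2:ℝ)^k), K t x * (t : ℂ)⁻¹

/-- The reflected corner `i∗j`, differing from `j` exactly at position `i`. -/
def istar {m : ℕ} (i : Fin m) (j : Corner m) : Corner m :=
  fun k => if k = i then 1 - j i else j k

/-- The diagonal matrix `Θ̃` with entry 0 at positions `i ≤ l` and 1 at positions `i > l`
(1-based), i.e. 0 for `i < l` and 1 otherwise in 0-based indexing. -/
def Th {m : ℕ} (l : ℕ) : Matrix (Fin m) (Fin m) ℝ :=
  Matrix.diagonal fun i => if (i : ℕ) < l then 0 else 1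

/-- The block diagonal matrix `Θ = diag(Θ̃, Θ̃)`. -/
def ThB {m : ℕ} (l : ℕ) : Matrix (Idx m) (Idx m) ℝ :=
  Matrix.diagonal (Sum.elim (fun i : Fin m => if (i:ℕ) < l then (0:ℝ) else 1)
    (fun i : Fin m => if (i:ℕ) < l then (0:ℝ) else 1))

end SBL

namespace SBL

/-! ### Hermite functions -/

/-- The polynomial factor of the `b`-th derivative of `x ↦ exp (-π x ^ 2)`. -/
def hermPoly : ℕ → Polynomial ℝ
  | 0 => 1
  | b + 1 => Polynomial.derivative (hermPoly b) -
      Polynomial.C (2 * Real.pi) * Polynomial.X * hermPoly b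

/-- The `b`-th derivative of the Gaussian `x ↦ exp (-π x ^ 2)`. -/
def herm (b : ℕ) (x : ℝ) : ℝ := (hermPoly b).eval x * Real.exp (-Real.pi * x ^ 2)

theorem herm_zero (x : ℝ) : herm 0 x = Real.exp (-Real.pi * x ^ 2) := by
  simp [herm, hermPoly]

theorem hasDerivAt_herm (b : ℕ) (x : ℝ) : HasDerivAt (herm b) (herm (b + 1) x) x := by
  have h1 : HasDerivAt (fun x : ℝ => Real.exp (-Real.pi * x ^ 2))
      (Real.exp (-Real.pi * x ^ 2) * (-Real.pi * (2 * x))) x := by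
    have := ((hasDerivAt_pow 2 x).const_mul (-Real.pi)).exp
    simpa using this
  have h2 := ((hermPoly b).hasDerivAt x).mul h1
  refine h2.congr_deriv ?_
  simp only [herm, hermPoly, Polynomial.eval_sub, Polynomial.eval_mul, Polynomial.eval_C,
    Polynomial.eval_X]
  ring

theorem continuous_herm (b : ℕ) : Continuous (herm b) :=
  continuous_iff_continuousAt.2 fun x => (hasDerivAt_herm b x).continuousAt

theorem hermPoly_add_two (b : ℕ) : hermPoly (b + 2) =
    -(Polynomial.C (2 * Real.pi) * (Polynomial.X * hermPoly (b + 1) +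
      Polynomial.C ((b : ℝ) + 1) * hermPoly b)) := by
  induction b with
  | zero => simp [hermPoly]; ring
  | succ b ih =>
    have e : hermPoly (b + 1 + 2) = Polynomial.derivative (hermPoly (b + 2)) -
      Polynomial.C (2 * Real.pi) * Polynomial.X * hermPoly (b + 2) := rfl
    have e1 : hermPoly (b + 2) = Polynomial.derivative (hermPoly (b + 1)) -
      Polynomial.C (2 * Real.pi) * Polynomial.X * hermPoly (b + 1) := rfl
    have e0 : hermPoly (b + 1) = Polynomial.derivative (hermPoly b) -
      Polynomial.C (2 * Real.pi) * Polynomial.X * hermPoly b := rfl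
    have d1 : Polynomial.derivative (hermPoly (b + 1)) = hermPoly (b + 2) +
      Polynomial.C (2 * Real.pi) * Polynomial.X * hermPoly (b + 1) := by rw [e1]; ring
    have d0 : Polynomial.derivative (hermPoly b) = hermPoly (b + 1) +
      Polynomial.C (2 * Real.pi) * Polynomial.X * hermPoly b := by rw [e0]; ring
    have key : Polynomial.derivative (hermPoly (b + 2)) =
        -(Polynomial.C (2 * Real.pi) * (hermPoly (b + 1) + Polynomial.X * (hermPoly (b + 2) +
          Polynomial.C (2 * Real.pi) * Polynomial.X * hermPoly (b + 1)) +
          Polynomial.C ((b : ℝ) + 1) * (hermPoly (b + 1) +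
      Polynomial.C (2 * Real.pi) * Polynomial.X * hermPoly b))) := by
      conv_lhs => rw [ih]
      rw [Polynomial.derivative_neg, Polynomial.derivative_C_mul, Polynomial.derivative_add,
        Polynomial.derivative_mul, Polynomial.derivative_C_mul, Polynomial.derivative_X, d1, d0]
      ring
    rw [e, key]
    have hc : Polynomial.C (((b + 1 : ℕ) : ℝ) + 1) = Polynomial.C ((b : ℝ) + 1) + 1 := by
      push_cast; simp [Polynomial.C_add]
    rw [hc]
    linear_combination (-Polynomial.C (2 * Real.pi) * Polynomial.X) * ih

theorem herm_add_two (b : ℕ) (y : ℝ) :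
    herm (b + 2) y = -(2 * Real.pi) * (y * herm (b + 1) y + ((b : ℝ) + 1) * herm b y) := by
  simp only [herm, hermPoly_add_two, Polynomial.eval_neg, Polynomial.eval_mul, Polynomial.eval_C,
    Polynomial.eval_X, Polynomial.eval_add]
  ring

theorem exists_abs_poly_mul_gauss_le (p : Polynomial ℝ) {a : ℝ} (ha : 0 < a) :
    ∃ C : ℝ, 0 < C ∧ ∀ x : ℝ, |p.eval x| * Real.exp (-a * x ^ 2) ≤ C := by
  induction p using Polynomial.induction_on' with
  | add p q hp hq =>
    obtain ⟨C, hC, h⟩ := hp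
    obtain ⟨D, hD, h'⟩ := hq
    refine ⟨C + D, by positivity, fun x => ?_⟩
    rw [Polynomial.eval_add]
    have := abs_add_le (p.eval x) (q.eval x)
    nlinarith [h x, h' x, Real.exp_pos (-a * x ^ 2)]
  | monomial n c =>
    -- `|x| ^ n ≤ 1 + x ^ (2 n)` and `x ^ (2 n) a ^ n ≤ n! exp (a x ^ 2)`
    refine ⟨|c| * (1 + n.factorial / a ^ n) + 1, by positivity, fun x => ?_⟩
    have h1 : |x| ^ n ≤ 1 + (x ^ 2) ^ n := by
      rw [← sq_abs, ← pow_mul, mul_comm, pow_mul]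
      nlinarith [sq_nonneg (|x| ^ n - 1), sq_nonneg (|x| ^ n)]
    have h2 : (a * x ^ 2) ^ n / n.factorial ≤ Real.exp (a * x ^ 2) :=
      Real.pow_div_factorial_le_exp _ (by positivity) n
    have h3 : (x ^ 2) ^ n ≤ n.factorial / a ^ n * Real.exp (a * x ^ 2) := by
      rw [mul_pow, div_le_iff₀ (by positivity)] at h2
      rw [div_mul_eq_mul_div, le_div_iff₀ (by positivity)]
      linarith
    have h4 : Real.exp (a * x ^ 2) * Real.exp (-a * x ^ 2) = 1 := by
      rw [← Real.exp_add]; simp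
    have h5 : Real.exp (-a * x ^ 2) ≤ 1 := by
      apply Real.exp_le_one_iff.2; nlinarith [sq_nonneg x]
    have h6 : |x| ^ n * Real.exp (-a * x ^ 2) ≤ 1 + n.factorial / a ^ n := by
      calc |x| ^ n * Real.exp (-a * x ^ 2)
          ≤ (1 + n.factorial / a ^ n * Real.exp (a * x ^ 2)) * Real.exp (-a * x ^ 2) := by
            gcongr; linarith
        _ = Real.exp (-a * x ^ 2) + n.factorial / a ^ n *
            (Real.exp (a * x ^ 2) * Real.exp (-a * x ^ 2)) := by ring
        _ ≤ _ := by rw [h4]; linarith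
    rw [Polynomial.eval_monomial, abs_mul, abs_pow, mul_assoc]
    nlinarith [abs_nonneg c]

theorem exists_abs_herm_le (b : ℕ) : ∃ C : ℝ, 0 < C ∧ ∀ x, |herm b x| ≤ C * herm 0 (x / 2) := by
  obtain ⟨C, hC, h⟩ := exists_abs_poly_mul_gauss_le (hermPoly b)
    (a := 3 / 4 * Real.pi) (by positivity)
  refine ⟨C, hC, fun x => ?_⟩
  rw [herm_zero, herm, abs_mul, Real.abs_exp]
  have : Real.exp (-Real.pi * x ^ 2) =
      Real.exp (-(3 / 4 * Real.pi) * x ^ 2) * Real.exp (-Real.pi * (x / 2) ^ 2) := by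
    rw [← Real.exp_add]; ring_nf
  rw [this, ← mul_assoc]
  exact mul_le_mul_of_nonneg_right (h x) (Real.exp_pos _).le

/-- A constant with `|herm b x| ≤ hermC b * exp (-π (x / 2) ^ 2)`. -/
def hermC (b : ℕ) : ℝ := (exists_abs_herm_le b).choose

theorem hermC_pos (b : ℕ) : 0 < hermC b := (exists_abs_herm_le b).choose_spec.1

theorem abs_herm_le (b : ℕ) (x : ℝ) : |herm b x| ≤ hermC b * herm 0 (x / 2) :=
  (exists_abs_herm_le b).choose_spec.2 x

theorem herm_zero_pos (x : ℝ) : 0 < herm 0 x := by rw [herm_zero]; exact Real.exp_pos _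

theorem herm_zero_le_one (x : ℝ) : herm 0 x ≤ 1 := by
  rw [herm_zero]; apply Real.exp_le_one_iff.2; nlinarith [sq_nonneg x, Real.pi_pos]

theorem abs_herm_le_hermC (b : ℕ) (x : ℝ) : |herm b x| ≤ hermC b :=
  (abs_herm_le b x).trans (mul_le_of_le_one_right (hermC_pos b).le (herm_zero_le_one _))

theorem herm_zero_half_le (x : ℝ) : herm 0 (x / 2) ≤ 4 * Real.exp (-|x|) := by
  have hπ := Real.pi_gt_three
  have h : herm 0 (x / 2) ≤ Real.exp (1 - |x|) := by
    rw [herm_zero]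
    apply Real.exp_le_exp.2
    have := sq_abs x
    nlinarith [sq_nonneg (|x| - 2), sq_nonneg (|x|), abs_nonneg x, sq_nonneg x,
      mul_nonneg (sub_nonneg.2 hπ.le) (sq_nonneg x)]
  refine h.trans ?_
  rw [sub_eq_add_neg, Real.exp_add]
  have := Real.exp_one_lt_d9
  gcongr
  linarith

/-- The `L¹`-normalised dilate of `herm b` at scale `exp s` centred at `c`. -/
def hermS (b : ℕ) (c s y : ℝ) : ℝ := Real.exp (-s) * herm b (Real.exp (-s) * (y - c))

theorem continuous_hermS (b : ℕ) :
    Continuous fun z : ℝ × ℝ × ℝ => hermS b z.1 z.2.1 z.2.2 := by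
  unfold hermS
  have := continuous_herm b
  fun_prop

theorem abs_hermS_le (b : ℕ) (c s y : ℝ) :
    |hermS b c s y| ≤ 2 * hermC b * hermS 0 c (s + Real.log 2) y := by
  unfold hermS
  rw [abs_mul, Real.abs_exp, neg_add, Real.exp_add, Real.exp_neg (Real.log 2),
    Real.exp_log two_pos]
  have := abs_herm_le b (Real.exp (-s) * (y - c))
  have h : Real.exp (-s) * 2⁻¹ * (y - c) = Real.exp (-s) * (y - c) / 2 := by ring
  rw [h]
  calc _ ≤ Real.exp (-s) * (hermC b * herm 0 (Real.exp (-s) * (y - c) / 2)) := by gcongr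
    _ = _ := by ring

theorem hermS_zero_pos (c s y : ℝ) : 0 < hermS 0 c s y :=
  mul_pos (Real.exp_pos _) (herm_zero_pos _)

theorem abs_hermS_le_exp (b : ℕ) (c s y : ℝ) : |hermS b c s y| ≤ hermC b * Real.exp (-s) := by
  unfold hermS
  rw [abs_mul, Real.abs_exp, mul_comm]
  exact mul_le_mul_of_nonneg_right (abs_herm_le_hermC _ _) (Real.exp_pos _).le

/-- Derivative of `hermS` along an affine curve of centres and logarithmic scales. -/
theorem hasDerivAt_hermS (b : ℕ) (c₀ c₁ s₀ s₁ y t : ℝ) :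
    HasDerivAt (fun t => hermS b (c₀ + t * c₁) (s₀ + t * s₁) y)
      (-c₁ * Real.exp (-(s₀ + t * s₁)) * hermS (b + 1) (c₀ + t * c₁) (s₀ + t * s₁) y +
        s₁ * (b * hermS b (c₀ + t * c₁) (s₀ + t * s₁) y +
          (2 * Real.pi)⁻¹ * hermS (b + 2) (c₀ + t * c₁) (s₀ + t * s₁) y)) t := by
  have e1 : HasDerivAt (fun t : ℝ => Real.exp (-(s₀ + t * s₁)))
      (Real.exp (-(s₀ + t * s₁)) * (-s₁)) t := by
    have := (((hasDerivAt_id t).mul_const s₁).const_add s₀).neg.exp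
    simpa using this
  have e2 : HasDerivAt (fun t : ℝ => y - (c₀ + t * c₁)) (-c₁) t := by
    have := (((hasDerivAt_id t).mul_const c₁).const_add c₀).const_sub y
    simpa using this
  have e3 := e1.mul ((hasDerivAt_herm b _).comp t (e1.mul e2))
  refine HasDerivAt.congr_deriv (f' := _) e3 ?_
  simp only [hermS, Function.comp_apply, herm_add_two]
  have hπ : Real.pi ≠ 0 := Real.pi_ne_zero
  simp only [Pi.mul_apply]
  field_simp
  ring

end SBL

namespace SBL

/-! ### Gaussian forms -/

variable {m : ℕ}

/-- The form `∫ H(x) ∏ w_κ(x_κ) dx` on `ℝ^{2m}`. -/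
def gform (H : (Fin m → Fin 2 → ℝ) → ℝ) (w : Fin m × Fin 2 → ℝ → ℝ) : ℝ :=
  ∫ x : Fin m → Fin 2 → ℝ, H x * ∏ κ : Fin m × Fin 2, w κ (x κ.1 κ.2)

/-- The product of dilated Hermite functions. -/
def hermProd (b : Fin m × Fin 2 → ℕ) (c : Fin m × Fin 2 → ℝ) (χ : Fin m → ℝ)
    (x : Fin m → Fin 2 → ℝ) : ℝ :=
  ∏ κ : Fin m × Fin 2, hermS (b κ) (c κ) (χ κ.1) (x κ.1 κ.2)

/-- The form with Hermite weights of orders `b`, centres `c` and logarithmic scales `χ`. -/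
def hform (H : (Fin m → Fin 2 → ℝ) → ℝ) (b : Fin m × Fin 2 → ℕ) (c : Fin m × Fin 2 → ℝ)
    (χ : Fin m → ℝ) : ℝ :=
  gform H fun κ => hermS (b κ) (c κ) (χ κ.1)

theorem hform_eq (H : (Fin m → Fin 2 → ℝ) → ℝ) (b : Fin m × Fin 2 → ℕ)
    (c : Fin m × Fin 2 → ℝ) (χ : Fin m → ℝ) :
    hform H b c χ = ∫ x, H x * hermProd b c χ x := rfl

theorem continuous_hermProd (b : Fin m × Fin 2 → ℕ) :
    Continuous fun z : (Fin m × Fin 2 → ℝ) × (Fin m → ℝ) × (Fin m → Fin 2 → ℝ) =>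
      hermProd b z.1 z.2.1 z.2.2 := by
  unfold hermProd
  refine continuous_finsetProd _ fun κ _ => ?_
  exact (continuous_hermS (b κ)).comp (f := fun z : (Fin m × Fin 2 → ℝ) × (Fin m → ℝ) ×
    (Fin m → Fin 2 → ℝ) => (z.1 κ, z.2.1 κ.1, z.2.2 κ.1 κ.2)) (by fun_prop)

theorem abs_hermProd_le (b : Fin m × Fin 2 → ℕ) (c : Fin m × Fin 2 → ℝ) (χ : Fin m → ℝ)
    {R : ℝ} (hR : ∀ i, -R ≤ χ i) (x : Fin m → Fin 2 → ℝ) :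
    |hermProd b c χ x| ≤ ∏ κ, hermC (b κ) * Real.exp R := by
  unfold hermProd
  rw [Finset.abs_prod]
  refine Finset.prod_le_prod (fun _ _ => abs_nonneg _) fun κ _ => ?_
  refine (abs_hermS_le_exp _ _ _ _).trans ?_
  have := hermC_pos (b κ)
  gcongr
  linarith [hR κ.1]

theorem integrable_mul_hermProd {H : (Fin m → Fin 2 → ℝ) → ℝ} (hH : Integrable H)
    (b : Fin m × Fin 2 → ℕ) (c : Fin m × Fin 2 → ℝ) (χ : Fin m → ℝ) :
    Integrable fun x => H x * hermProd b c χ x := by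
  refine hH.mul_bdd (c := ∏ κ, hermC (b κ) * Real.exp (∑ i, |χ i|)) ?_ ?_
  · exact ((continuous_hermProd b).comp (f := fun x => (c, χ, x))
      (by fun_prop)).aestronglyMeasurable
  · refine Filter.Eventually.of_forall fun x => ?_
    refine abs_hermProd_le b c χ (fun i => ?_) x
    have := Finset.single_le_sum (f := fun i => |χ i|) (fun _ _ => abs_nonneg _)
      (Finset.mem_univ i)
    linarith [neg_abs_le (χ i)]

theorem hermProd_add_single (b : Fin m × Fin 2 → ℕ) (κ : Fin m × Fin 2) (a : ℕ)
    (c : Fin m × Fin 2 → ℝ) (χ : Fin m → ℝ) (x : Fin m → Fin 2 → ℝ) :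
    hermProd (b + Pi.single κ a) c χ x =
      (∏ κ' ∈ Finset.univ.erase κ, hermS (b κ') (c κ') (χ κ'.1) (x κ'.1 κ'.2)) *
        hermS (b κ + a) (c κ) (χ κ.1) (x κ.1 κ.2) := by
  unfold hermProd
  rw [← Finset.prod_erase_mul _ _ (Finset.mem_univ κ)]
  congr 1
  · refine Finset.prod_congr rfl fun κ' hκ' => ?_
    have : κ' ≠ κ := Finset.ne_of_mem_erase hκ'
    simp [this]
  · simp

theorem hasDerivAt_hermProd (b : Fin m × Fin 2 → ℕ) (c₀ c₁ : Fin m × Fin 2 → ℝ)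
    (χ₀ χ₁ : Fin m → ℝ) (x : Fin m → Fin 2 → ℝ) (t : ℝ) :
    HasDerivAt (fun t : ℝ => hermProd b (c₀ + t • c₁) (χ₀ + t • χ₁) x)
      (∑ κ, (-c₁ κ * Real.exp (-(χ₀ + t • χ₁) κ.1) *
          hermProd (b + Pi.single κ 1) (c₀ + t • c₁) (χ₀ + t • χ₁) x +
        χ₁ κ.1 * (b κ * hermProd b (c₀ + t • c₁) (χ₀ + t • χ₁) x +
          (2 * Real.pi)⁻¹ *
            hermProd (b + Pi.single κ 2) (c₀ + t • c₁) (χ₀ + t • χ₁) x))) t := by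
  have h := HasDerivAt.fun_finsetProd (u := (Finset.univ : Finset (Fin m × Fin 2)))
    (fun κ _ => hasDerivAt_hermS (b κ) (c₀ κ) (c₁ κ) (χ₀ κ.1) (χ₁ κ.1) (x κ.1 κ.2) t)
  refine h.congr_deriv ?_
  refine Finset.sum_congr rfl fun κ _ => ?_
  have e0 : hermProd b (c₀ + t • c₁) (χ₀ + t • χ₁) x =
      hermProd (b + Pi.single κ 0) (c₀ + t • c₁) (χ₀ + t • χ₁) x := by simp
  rw [e0]
  simp only [hermProd_add_single, smul_eq_mul, Pi.add_apply, Pi.smul_apply, add_zero]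
  ring

theorem hasDerivAt_hform {H : (Fin m → Fin 2 → ℝ) → ℝ} (hH : Integrable H)
    (b : Fin m × Fin 2 → ℕ) (c₀ c₁ : Fin m × Fin 2 → ℝ) (χ₀ χ₁ : Fin m → ℝ) (t : ℝ) :
    HasDerivAt (fun t : ℝ => hform H b (c₀ + t • c₁) (χ₀ + t • χ₁))
      (∑ κ, (-c₁ κ * Real.exp (-(χ₀ + t • χ₁) κ.1) *
          hform H (b + Pi.single κ 1) (c₀ + t • c₁) (χ₀ + t • χ₁) +
        χ₁ κ.1 * (b κ * hform H b (c₀ + t • c₁) (χ₀ + t • χ₁) +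
          (2 * Real.pi)⁻¹ *
            hform H (b + Pi.single κ 2) (c₀ + t • c₁) (χ₀ + t • χ₁)))) t := by
  set R : ℝ := ∑ i, (|χ₀ i| + (|t| + 1) * |χ₁ i|) with hR
  have hRt : ∀ t' ∈ Metric.ball t 1, ∀ i, -R ≤ (χ₀ + t' • χ₁) i := by
    intro t' ht' i
    have h1 : |t'| ≤ |t| + 1 := by
      have := abs_sub_abs_le_abs_sub t' t
      rw [Metric.mem_ball, Real.dist_eq] at ht'
      linarith
    have h2 := Finset.single_le_sum (f := fun i => |χ₀ i| + (|t| + 1) * |χ₁ i|)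
      (fun _ _ => by positivity) (Finset.mem_univ i)
    have h3 : |t' * χ₁ i| ≤ (|t| + 1) * |χ₁ i| := by rw [abs_mul]; gcongr
    simp only [Pi.add_apply, Pi.smul_apply, smul_eq_mul]
    have h2' : |χ₀ i| + (|t| + 1) * |χ₁ i| ≤ R := h2
    linarith [neg_abs_le (χ₀ i), neg_abs_le (t' * χ₁ i)]
  set D : (Fin m × Fin 2 → ℕ) → ℝ := fun b => ∏ κ, hermC (b κ) * Real.exp R with hD
  have hD0 : ∀ b, 0 ≤ D b := fun b =>
    Finset.prod_nonneg fun κ _ => mul_nonneg (hermC_pos _).le (Real.exp_pos _).le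
  set P' : ℝ → (Fin m → Fin 2 → ℝ) → ℝ := fun t x =>
    ∑ κ, (-c₁ κ * Real.exp (-(χ₀ + t • χ₁) κ.1) *
          hermProd (b + Pi.single κ 1) (c₀ + t • c₁) (χ₀ + t • χ₁) x +
        χ₁ κ.1 * (b κ * hermProd b (c₀ + t • c₁) (χ₀ + t • χ₁) x +
          (2 * Real.pi)⁻¹ *
            hermProd (b + Pi.single κ 2) (c₀ + t • c₁) (χ₀ + t • χ₁) x)) with hP'
  set B : ℝ := ∑ κ, (|c₁ κ| * Real.exp R * D (b + Pi.single κ 1) +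
    |χ₁ κ.1| * (b κ * D b + (2 * Real.pi)⁻¹ * D (b + Pi.single κ 2))) with hB
  have hcont : ∀ (b : Fin m × Fin 2 → ℕ) (t : ℝ),
      Continuous fun x => hermProd b (c₀ + t • c₁) (χ₀ + t • χ₁) x := fun b t =>
    (continuous_hermProd b).comp (f := fun x => (c₀ + t • c₁, χ₀ + t • χ₁, x)) (by fun_prop)
  have key := hasDerivAt_integral_of_dominated_loc_of_deriv_le (μ := volume)
    (F := fun t x => H x * hermProd b (c₀ + t • c₁) (χ₀ + t • χ₁) x)
    (F' := fun t x => H x * P' t x) (x₀ := t) (s := Metric.ball t 1)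
    (bound := fun x => |H x| * B) (Metric.ball_mem_nhds t one_pos)
    (Filter.Eventually.of_forall fun t' =>
      hH.aestronglyMeasurable.mul (hcont b t').aestronglyMeasurable)
    (integrable_mul_hermProd hH _ _ _) ?_ ?_ (hH.abs.mul_const B) ?_
  · refine key.2.congr_deriv ?_
    simp only [hP', Finset.mul_sum]
    rw [integral_finsetSum]
    · refine Finset.sum_congr rfl fun κ _ => ?_
      have i0 := integrable_mul_hermProd hH b (c₀ + t • c₁) (χ₀ + t • χ₁)
      have i1 := integrable_mul_hermProd hH (b + Pi.single κ 1) (c₀ + t • c₁) (χ₀ + t • χ₁)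
      have i2 := integrable_mul_hermProd hH (b + Pi.single κ 2) (c₀ + t • c₁) (χ₀ + t • χ₁)
      simp only [hform_eq]
      rw [← integral_const_mul, ← integral_const_mul, ← integral_const_mul,
        ← integral_add (i0.const_mul _) (i2.const_mul _), ← integral_const_mul]
      have i3 : Integrable (fun x => χ₁ κ.1 *
          (b κ * (H x * hermProd b (c₀ + t • c₁) (χ₀ + t • χ₁) x) + (2 * Real.pi)⁻¹ *
            (H x * hermProd (b + Pi.single κ 2) (c₀ + t • c₁) (χ₀ + t • χ₁) x))) :=
        ((i0.const_mul _).add (i2.const_mul _)).const_mul _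
      rw [← integral_add (i1.const_mul _) i3]
      congr 1
      ext x
      ring
    · intro κ _
      have i0 := integrable_mul_hermProd hH b (c₀ + t • c₁) (χ₀ + t • χ₁)
      have i1 := integrable_mul_hermProd hH (b + Pi.single κ 1) (c₀ + t • c₁) (χ₀ + t • χ₁)
      have i2 := integrable_mul_hermProd hH (b + Pi.single κ 2) (c₀ + t • c₁) (χ₀ + t • χ₁)
      refine ((i1.const_mul (-c₁ κ * Real.exp (-(χ₀ + t • χ₁) κ.1))).add
        (((i0.const_mul (b κ : ℝ)).add (i2.const_mul (2 * Real.pi)⁻¹)).const_mul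
          (χ₁ κ.1))).congr (Filter.Eventually.of_forall fun x => ?_)
      simp only [Pi.add_apply]
      ring
  · refine hH.aestronglyMeasurable.mul (Continuous.aestronglyMeasurable ?_)
    refine continuous_finsetSum _ fun κ _ => ?_
    have h0 := hcont b t
    have h1 := hcont (b + Pi.single κ 1) t
    have h2 := hcont (b + Pi.single κ 2) t
    fun_prop
  · refine Filter.Eventually.of_forall fun x t' ht' => ?_
    rw [Real.norm_eq_abs, abs_mul]
    refine mul_le_mul_of_nonneg_left ?_ (abs_nonneg _)
    refine (Finset.abs_sum_le_sum_abs _ _).trans (Finset.sum_le_sum fun κ _ => ?_)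
    have hb := hRt t' ht'
    refine (abs_add_le _ _).trans (add_le_add ?_ ?_)
    · rw [abs_mul, abs_mul, abs_neg, Real.abs_exp]
      gcongr
      · linarith [hb κ.1]
      · exact abs_hermProd_le _ _ _ hb x
    · rw [abs_mul]
      refine mul_le_mul_of_nonneg_left ?_ (abs_nonneg _)
      refine (abs_add_le _ _).trans (add_le_add ?_ ?_)
      · rw [abs_mul, Nat.abs_cast]
        gcongr
        exact abs_hermProd_le _ _ _ hb x
      · rw [abs_mul, abs_of_pos (by positivity : (0:ℝ) < (2 * Real.pi)⁻¹)]
        gcongr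
        exact abs_hermProd_le _ _ _ hb x
  · exact Filter.Eventually.of_forall fun x t' _ =>
      (hasDerivAt_hermProd b c₀ c₁ χ₀ χ₁ x t').const_mul (H x)

theorem continuous_hform {H : (Fin m → Fin 2 → ℝ) → ℝ} (hH : Integrable H)
    (b : Fin m × Fin 2 → ℕ) :
    Continuous fun z : (Fin m × Fin 2 → ℝ) × (Fin m → ℝ) => hform H b z.1 z.2 := by
  rw [continuous_iff_continuousAt]
  rintro ⟨c, χ⟩
  simp only [hform_eq]
  set R : ℝ := ∑ i, |χ i| + 1 with hR
  refine continuousAt_of_dominated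
    (bound := fun x => |H x| * ∏ κ, hermC (b κ) * Real.exp R) ?_ ?_ (hH.abs.mul_const _) ?_
  · refine Filter.Eventually.of_forall fun z => hH.aestronglyMeasurable.mul ?_
    exact ((continuous_hermProd b).comp (f := fun x => (z.1, z.2, x))
      (by fun_prop)).aestronglyMeasurable
  · have : ∀ᶠ z : (Fin m × Fin 2 → ℝ) × (Fin m → ℝ) in nhds (c, χ), ∀ i, -R ≤ z.2 i := by
      rw [Filter.eventually_all]
      intro i
      have h1 : Filter.Tendsto (fun z : (Fin m × Fin 2 → ℝ) × (Fin m → ℝ) => z.2 i)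
        (nhds (c, χ)) (nhds (χ i)) :=
        Continuous.tendsto' (by fun_prop) _ _ rfl
      refine (h1.eventually (lt_mem_nhds (a := -R) ?_)).mono fun z hz => le_of_lt hz
      have := Finset.single_le_sum (f := fun i => |χ i|) (fun _ _ => abs_nonneg _)
        (Finset.mem_univ i)
      linarith [neg_abs_le (χ i)]
    refine this.mono fun z hz => Filter.Eventually.of_forall fun x => ?_
    rw [Real.norm_eq_abs, abs_mul]
    exact mul_le_mul_of_nonneg_left (abs_hermProd_le _ _ _ hz x) (abs_nonneg _)
  · refine Filter.Eventually.of_forall fun x => ContinuousAt.mul continuousAt_const ?_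
    exact ((continuous_hermProd b).comp (f := fun z : (Fin m × Fin 2 → ℝ) × (Fin m → ℝ) =>
      (z.1, z.2, x)) (by fun_prop)).continuousAt

/-- The tensor-type function `x ↦ ∏_j F_j(Π_j x)`. -/
def cornerProd (F : Corner m → (Fin m → ℝ) → ℝ) (x : Fin m → Fin 2 → ℝ) : ℝ :=
  ∏ j : Corner m, F j fun i => x i (j i)

theorem continuous_cornerProd {F : Corner m → (Fin m → ℝ) → ℝ} (hF : ∀ j, Continuous (F j)) :
    Continuous (cornerProd F) :=
  continuous_finsetProd _ fun j _ => (hF j).comp (by fun_prop)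

theorem hasCompactSupport_cornerProd {F : Corner m → (Fin m → ℝ) → ℝ}
    (hF : ∀ j, HasCompactSupport (F j)) : HasCompactSupport (cornerProd F) := by
  let S : Fin 2 → Set (Fin m → ℝ) := fun ε => tsupport (F fun _ => ε)
  have hS : ∀ i : Fin m, IsCompact (Set.pi Set.univ fun ε : Fin 2 => (fun y => y i) '' S ε) :=
    fun i => isCompact_univ_pi fun ε => (hF fun _ => ε).isCompact.image (continuous_apply i)
  refine HasCompactSupport.of_support_subset_isCompact (isCompact_univ_pi hS) fun x hx => ?_
  rw [Set.mem_univ_pi]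
  intro i
  rw [Set.mem_univ_pi]
  intro ε
  have : F (fun _ => ε) (fun i => x i ε) ≠ 0 := by
    intro h0
    apply hx
    exact Finset.prod_eq_zero (Finset.mem_univ (fun _ => ε)) h0
  exact ⟨_, subset_tsupport _ this, rfl⟩

theorem integrable_cornerProd {F : Corner m → (Fin m → ℝ) → ℝ} (hF : ∀ j, Continuous (F j))
    (hF' : ∀ j, HasCompactSupport (F j)) : Integrable (cornerProd F) :=
  (continuous_cornerProd hF).integrable_of_hasCompactSupport (hasCompactSupport_cornerProd hF')

end SBL

namespace SBL

/-! ### The Cauchy–Schwarz step -/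

variable {m : ℕ}

/-- Insert the value `y` at the coordinate `l`. -/
def glue {E : Type*} (l : Fin m) (z : {i : Fin m // ¬ i = l} → E) (y : E) (i : Fin m) : E :=
  if h : i = l then y else z ⟨i, h⟩

theorem integral_eq_integral_glue (l : Fin m) {f : (Fin m → Fin 2 → ℝ) → ℝ}
    (hf : Integrable f) :
    Integrable (fun z : {i : Fin m // ¬ i = l} → Fin 2 → ℝ =>
        ∫ y : Fin 2 → ℝ, f (glue l z y)) ∧
      ∫ x, f x = ∫ z : {i : Fin m // ¬ i = l} → Fin 2 → ℝ, ∫ y : Fin 2 → ℝ, f (glue l z y) := by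
  let e := MeasurableEquiv.piEquivPiSubtypeProd (fun _ : Fin m => Fin 2 → ℝ) (fun i => i = l)
  have he : MeasurePreserving e volume volume := by
    convert volume_preserving_piEquivPiSubtypeProd (fun _ : Fin m => Fin 2 → ℝ) (fun i => i = l) <;> rfl
  let u := MeasurableEquiv.funUnique {i : Fin m // i = l} (Fin 2 → ℝ)
  have hu : MeasurePreserving u volume volume :=
    volume_preserving_funUnique {i : Fin m // i = l} (Fin 2 → ℝ)
  have hcomp : MeasurePreserving (e.trans (u.prodCongr (MeasurableEquiv.refl _)))
      volume volume := by
    refine he.trans ?_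
    exact hu.prod (MeasurePreserving.id _)
  have hsymm := hcomp.symm
  set e' := (e.trans (u.prodCongr (MeasurableEquiv.refl _))) with he'
  have hval : ∀ y z, e'.symm (y, z) = glue l z y := by
    intro y z
    ext i
    rfl
  have h1 : ∫ x, f x = ∫ q : (Fin 2 → ℝ) × ({i : Fin m // ¬ i = l} → Fin 2 → ℝ),
      f (glue l q.2 q.1) := by
    rw [← hsymm.integral_comp e'.symm.measurableEmbedding]
    rfl
  have h2 : Integrable (fun q : (Fin 2 → ℝ) × ({i : Fin m // ¬ i = l} → Fin 2 → ℝ) =>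
      f (glue l q.2 q.1)) := by
    exact (hsymm.integrable_comp_emb e'.symm.measurableEmbedding).2 hf
  refine ⟨?_, ?_⟩
  · exact Integrable.integral_prod_right h2
  · rw [h1]
    exact integral_prod_symm _ h2

/-- The product of those `F_j` whose corner satisfies `j_l = ε`. -/
def halfProd (F : Corner m → (Fin m → ℝ) → ℝ) (l : Fin m) (ε : Fin 2)
    (z : {i : Fin m // ¬ i = l} → Fin 2 → ℝ) (y : ℝ) : ℝ :=
  ∏ j : Corner m with j l = 0, F (Function.update j l ε) fun i => glue l z (fun _ => y) i (j i)

theorem cornerProd_glue (F : Corner m → (Fin m → ℝ) → ℝ) (l : Fin m)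
    (z : {i : Fin m // ¬ i = l} → Fin 2 → ℝ) (y : Fin 2 → ℝ) :
    cornerProd F (glue l z y) = ∏ ε, halfProd F l ε z (y ε) := by
  have hpt : ∀ (ε : Fin 2) (j : Corner m), (fun i => glue l z (fun _ => y ε) i (j i)) =
      fun i => glue l z y i (Function.update j l ε i) := by
    intro ε j
    ext i
    by_cases h : i = l
    · subst h; simp [glue]
    · simp [glue, h]
  unfold cornerProd
  rw [← Finset.prod_filter_mul_prod_filter_not Finset.univ (fun j : Corner m => j l = 0),
    Fin.prod_univ_two]
  congr 1
  · refine Finset.prod_congr rfl fun j hj => ?_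
    have hj' : j l = 0 := by simpa using hj
    rw [hpt, ← hj', Function.update_eq_self]
  · refine Finset.prod_nbij' (fun j => Function.update j l 0) (fun j => Function.update j l 1)
      ?_ ?_ ?_ ?_ ?_
    · intro j _; simp
    · intro j _; simp
    · intro j hj
      have hj' : j l = 1 := by have : ¬ j l = 0 := by simpa using hj
                               omega
      simp [← hj']
    · intro j hj
      have hj' : j l = 0 := by simpa using hj
      simp [← hj']
    · intro j hj
      have hj' : j l = 1 := by have : ¬ j l = 0 := by simpa using hj
                               omega
      rw [hpt]
      simp [← hj']

/-- The product of the weights away from the coordinate `l`. -/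
def offProd (w : Fin m × Fin 2 → ℝ → ℝ) (l : Fin m)
    (z : {i : Fin m // ¬ i = l} → Fin 2 → ℝ) : ℝ :=
  ∏ κ : {i : Fin m // ¬ i = l} × Fin 2, w (κ.1.1, κ.2) (z κ.1 κ.2)

theorem prod_weights_glue (w : Fin m × Fin 2 → ℝ → ℝ) (l : Fin m)
    (z : {i : Fin m // ¬ i = l} → Fin 2 → ℝ) (y : Fin 2 → ℝ) :
    ∏ κ : Fin m × Fin 2, w κ (glue l z y κ.1 κ.2) = offProd w l z * ∏ ε, w (l, ε) (y ε) := by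
  unfold offProd
  rw [Fintype.prod_prod_type, Fintype.prod_prod_type,
    ← Fintype.prod_subtype_mul_prod_subtype (fun i => i = l), mul_comm]
  congr 1
  · refine Finset.prod_congr rfl fun i _ => Finset.prod_congr rfl fun ε _ => ?_
    simp [glue, i.2]
  · refine (Finset.prod_eq_single (⟨l, rfl⟩ : {i : Fin m // i = l}) ?_
      fun h => absurd (by convert Finset.mem_univ _) h).trans ?_
    · exact fun i _ hi => absurd (Subtype.ext i.2) hi
    · exact Finset.prod_congr rfl fun ε _ => by simp [glue]

/-- The integral over one of the two variables at the coordinate `l`. -/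
def halfInt (F : Corner m → (Fin m → ℝ) → ℝ) (w : Fin m × Fin 2 → ℝ → ℝ) (l : Fin m) (ε : Fin 2)
    (z : {i : Fin m // ¬ i = l} → Fin 2 → ℝ) : ℝ :=
  ∫ y : ℝ, halfProd F l ε z y * w (l, ε) y

theorem gform_eq_integral_halfInt {F : Corner m → (Fin m → ℝ) → ℝ} (hF : ∀ j, Continuous (F j))
    (hF' : ∀ j, HasCompactSupport (F j)) {w : Fin m × Fin 2 → ℝ → ℝ}
    (hw : ∀ κ, Continuous (w κ)) (l : Fin m) :
    Integrable (fun z => offProd w l z * ∏ ε, halfInt F w l ε z) ∧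
      gform (cornerProd F) w = ∫ z, offProd w l z * ∏ ε, halfInt F w l ε z := by
  have hInt : Integrable fun x : Fin m → Fin 2 → ℝ =>
      cornerProd F x * ∏ κ : Fin m × Fin 2, w κ (x κ.1 κ.2) := by
    refine Continuous.integrable_of_hasCompactSupport ?_
      (hasCompactSupport_cornerProd hF').mul_right
    refine (continuous_cornerProd hF).mul (continuous_finsetProd _ fun κ _ => ?_)
    exact (hw κ).comp (by fun_prop)
  have hinner : ∀ z : {i : Fin m // ¬ i = l} → Fin 2 → ℝ,
      ∫ y : Fin 2 → ℝ, cornerProd F (glue l z y) *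
        ∏ κ : Fin m × Fin 2, w κ (glue l z y κ.1 κ.2) =
      offProd w l z * ∏ ε, halfInt F w l ε z := by
    intro z
    have := integral_fintype_prod_volume_eq_prod (ι := Fin 2) (E := fun _ => ℝ) (𝕜 := ℝ)
      (fun ε y => halfProd F l ε z y * w (l, ε) y)
    unfold halfInt
    rw [← this, ← integral_const_mul]
    congr 1
    ext y
    rw [cornerProd_glue, prod_weights_glue, Finset.prod_mul_distrib]
    ring
  have h := integral_eq_integral_glue l hInt
  simp only [hinner] at h
  exact h

/-- The functions `F` with the `l`-th entry of the corner frozen to `ε`. -/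
def freezeF (F : Corner m → (Fin m → ℝ) → ℝ) (l : Fin m) (ε : Fin 2) :
    Corner m → (Fin m → ℝ) → ℝ := fun j => F (Function.update j l ε)

theorem halfProd_freezeF (F : Corner m → (Fin m → ℝ) → ℝ) (l : Fin m) (ε ε' : Fin 2) :
    halfProd (freezeF F l ε) l ε' = halfProd F l ε := by
  ext z y
  simp [halfProd, freezeF]

theorem offProd_mono {w W : Fin m × Fin 2 → ℝ → ℝ} {l : Fin m}
    (h : ∀ κ : Fin m × Fin 2, κ.1 ≠ l → ∀ y, |w κ y| ≤ W κ y)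
    (z : {i : Fin m // ¬ i = l} → Fin 2 → ℝ) : |offProd w l z| ≤ offProd W l z := by
  unfold offProd
  rw [Finset.abs_prod]
  exact Finset.prod_le_prod (fun _ _ => abs_nonneg _) fun κ _ => h _ κ.1.2 _

theorem mul_abs_gform_le {F : Corner m → (Fin m → ℝ) → ℝ} (hF : ∀ j, Continuous (F j))
    (hF' : ∀ j, HasCompactSupport (F j)) {w W : Fin m × Fin 2 → ℝ → ℝ}
    (hw : ∀ κ, Continuous (w κ)) (hW : ∀ κ, Continuous (W κ)) {l : Fin m}
    (h : ∀ κ : Fin m × Fin 2, κ.1 ≠ l → ∀ y, |w κ y| ≤ W κ y) {a : Fin 2 → ℝ}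
    (ha : ∀ ε, 0 ≤ a ε) :
    (∏ ε, a ε) * |gform (cornerProd F) w| ≤
      ∑ ε, a ε ^ 2 * gform (cornerProd (freezeF F l ε))
        (fun κ => if κ.1 = l then w (l, ε) else W κ) := by
  have hWε : ∀ ε : Fin 2, ∀ κ : Fin m × Fin 2,
      Continuous ((fun κ : Fin m × Fin 2 => if κ.1 = l then w (l, ε) else W κ) κ) := by
    intro ε κ
    dsimp only
    split_ifs
    · exact hw _
    · exact hW _
  have hrhs : ∀ ε : Fin 2, Integrable (fun z => offProd W l z * halfInt F w l ε z ^ 2) ∧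
      gform (cornerProd (freezeF F l ε)) (fun κ => if κ.1 = l then w (l, ε) else W κ) =
        ∫ z, offProd W l z * halfInt F w l ε z ^ 2 := by
    intro ε
    have h1 := gform_eq_integral_halfInt (F := freezeF F l ε) (fun j => hF _) (fun j => hF' _)
      (hWε ε) l
    have h2 : ∀ ε', halfInt (freezeF F l ε) (fun κ => if κ.1 = l then w (l, ε) else W κ) l ε' =
        halfInt F w l ε := by
      intro ε'
      ext z
      simp [halfInt, halfProd_freezeF]
    have h3 : offProd (fun κ => if κ.1 = l then w (l, ε) else W κ) l = offProd W l := by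
      ext z
      unfold offProd
      refine Finset.prod_congr rfl fun κ _ => ?_
      simp [κ.1.2]
    simpa [h2, h3, Fin.prod_univ_two, sq] using h1
  obtain ⟨hi, he⟩ := gform_eq_integral_halfInt hF hF' hw l
  simp only [(hrhs _).2]
  rw [he, ← abs_of_nonneg (Finset.prod_nonneg fun ε _ => ha ε), ← abs_mul,
    ← integral_const_mul]
  simp only [← integral_const_mul]
  rw [← integral_finsetSum _ fun ε _ => (hrhs ε).1.const_mul _]
  refine (abs_integral_le_integral_abs).trans (integral_mono ?_ ?_ fun z => ?_)
  · exact (hi.const_mul _).abs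
  · exact integrable_finsetSum _ fun ε _ => (hrhs ε).1.const_mul _
  · have hm := offProd_mono h z
    simp only [Fin.prod_univ_two, Fin.sum_univ_two]
    set u := halfInt F w l 0 z
    set v := halfInt F w l 1 z
    have hW0 : 0 ≤ offProd W l z := (abs_nonneg _).trans hm
    rw [abs_mul, abs_mul (offProd w l z), abs_of_nonneg (mul_nonneg (ha 0) (ha 1))]
    have h2 : a 0 * a 1 * |u * v| ≤ (a 0 * u) ^ 2 + (a 1 * v) ^ 2 := by
      rw [abs_mul, mul_pow, mul_pow, ← sq_abs u, ← sq_abs v]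
      nlinarith [sq_nonneg (a 0 * |u| - a 1 * |v|), sq_nonneg (a 0 * |u|), sq_nonneg (a 1 * |v|)]
    calc a 0 * a 1 * (|offProd w l z| * |u * v|)
        = |offProd w l z| * (a 0 * a 1 * |u * v|) := by ring
      _ ≤ offProd W l z * ((a 0 * u) ^ 2 + (a 1 * v) ^ 2) := by
          have := mul_nonneg (mul_nonneg (ha 0) (ha 1)) (abs_nonneg (u * v))
          gcongr
      _ = _ := by ring

/-- A form with frozen functions and equal weights at the coordinate `l` is a square. -/
theorem gform_nonneg {F : Corner m → (Fin m → ℝ) → ℝ} (hF : ∀ j, Continuous (F j))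
    (hF' : ∀ j, HasCompactSupport (F j)) {w : Fin m × Fin 2 → ℝ → ℝ}
    (hw : ∀ κ, Continuous (w κ)) {l : Fin m} (hfr : ∀ j ε, F (Function.update j l ε) = F j)
    (hl : w (l, 0) = w (l, 1)) (hpos : ∀ κ : Fin m × Fin 2, κ.1 ≠ l → ∀ y, 0 ≤ w κ y) :
    0 ≤ gform (cornerProd F) w := by
  rw [(gform_eq_integral_halfInt hF hF' hw l).2]
  refine integral_nonneg fun z => mul_nonneg ?_ ?_
  · exact Finset.prod_nonneg fun κ _ => hpos _ κ.1.2 _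
  · have : halfInt F w l 0 z = halfInt F w l 1 z := by
      simp [halfInt, halfProd, hfr, hl]
    rw [Fin.prod_univ_two, this]
    exact mul_self_nonneg _

end SBL

namespace SBL

/-! ### Single-scale estimate -/

variable {m : ℕ}

/-- The corner opposite to `j`. -/
def opp (j : Corner m) : Corner m := fun i => 1 - j i

theorem opp_opp (j : Corner m) : opp (opp j) = j := by
  ext i
  simp [opp]

theorem measurePreserving_corner_opp (j : Corner m) :
    MeasurePreserving (fun x : Fin m → Fin 2 → ℝ => ((fun i => x i (j i)), fun i => x i (opp j i)))
      volume volume := by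
  have h1 : ∀ i : Fin m, MeasurePreserving (fun y : Fin 2 → ℝ => (y (j i), y (opp j i)))
      volume volume := by
    intro i
    have h2 : MeasurePreserving (fun y : Fin 2 → ℝ => (y 0, y 1)) volume volume :=
      volume_preserving_finTwoArrow ℝ
    rcases Fin.exists_fin_two.1 ⟨j i, rfl⟩ with h | h
    · simpa [opp, h] using h2
    · have h3 : MeasurePreserving (fun y : Fin 2 → ℝ => (y 1, y 0)) volume volume :=
        (Measure.measurePreserving_swap (μ := (volume : Measure ℝ))
          (ν := (volume : Measure ℝ))).comp h2
      simpa [opp, h] using h3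
  exact (volume_measurePreserving_arrowProdEquivProdArrow ℝ ℝ (Fin m)).comp
    (volume_preserving_pi h1)

theorem lintegral_corner_mul_opp (j : Corner m) {f g : (Fin m → ℝ) → ℝ≥0∞} (hf : Measurable f)
    (hg : Measurable g) :
    ∫⁻ x : Fin m → Fin 2 → ℝ, f (fun i => x i (j i)) * g (fun i => x i (opp j i)) =
      (∫⁻ y, f y) * ∫⁻ y, g y := by
  have h := (measurePreserving_corner_opp j).lintegral_comp
    (f := fun z : (Fin m → ℝ) × (Fin m → ℝ) => f z.1 * g z.2) (by fun_prop)
  rw [h]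
  exact lintegral_prod_mul hf.aemeasurable hg.aemeasurable

/-- A Loomis--Whitney type inequality for the cubical projections. -/
theorem lintegral_cornerProd_le (hm : 1 ≤ m) {f : Corner m → (Fin m → ℝ) → ℝ≥0∞}
    (hf : ∀ j, Measurable (f j)) :
    ∫⁻ x : Fin m → Fin 2 → ℝ, ∏ j, f j (fun i => x i (j i)) ≤
      ∏ j, (∫⁻ y, f j y ^ (2 ^ (m - 1) : ℕ)) ^ ((2 ^ (m - 1) : ℝ)⁻¹) := by
  set q : ℕ := 2 ^ (m - 1) with hq
  have hq0 : (0 : ℝ) < q := by positivity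
  have h2q : (2 : ℝ) ^ m = 2 * q := by
    rw [hq]; push_cast; rw [← pow_succ', Nat.sub_add_cancel hm]
  have hcast : ((2 : ℝ) ^ (m - 1)) = q := by rw [hq]; push_cast; rfl
  rw [hcast]
  have hm1 : ∀ j : Corner m, Measurable fun x : Fin m → Fin 2 → ℝ => f j (fun i => x i (j i)) :=
    fun j => (hf j).comp (by fun_prop)
  set g : Corner m → (Fin m → Fin 2 → ℝ) → ℝ≥0∞ := fun j x =>
    f j (fun i => x i (j i)) ^ q * f (opp j) (fun i => x i (opp j i)) ^ q with hg
  have hgm : ∀ j, Measurable (g j) := fun j => ((hm1 j).pow_const q).mul ((hm1 _).pow_const q)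
  have hsum : ∑ _j : Corner m, (2 * (q : ℝ))⁻¹ = 1 := by
    simp only [Finset.sum_const, Finset.card_univ, nsmul_eq_mul, Fintype.card_fun, Fintype.card_fin]
    push_cast
    rw [h2q]
    field_simp
  have hol := ENNReal.lintegral_prod_norm_pow_le (μ := volume) Finset.univ
    (f := g) (fun j _ => (hgm j).aemeasurable) (p := fun _ => (2 * (q : ℝ))⁻¹) hsum
    (fun _ _ => by positivity)
  have hopp : ∀ h : Corner m → ℝ≥0∞, ∏ j, h (opp j) = ∏ j, h j := fun h =>
    Fintype.prod_equiv ⟨opp, opp, opp_opp, opp_opp⟩ _ _ fun _ => rfl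
  have hexp : ∀ a : ℝ≥0∞, (a ^ q) ^ (2 * (q : ℝ))⁻¹ = a ^ (2 : ℝ)⁻¹ := by
    intro a
    rw [← ENNReal.rpow_natCast, ← ENNReal.rpow_mul]
    congr 1
    field_simp
  have hleft : ∀ x, ∏ j, g j x ^ (2 * (q : ℝ))⁻¹ = ∏ j, f j (fun i => x i (j i)) := by
    intro x
    simp only [hg]
    simp only [ENNReal.mul_rpow_of_nonneg _ _ (by positivity : (0 : ℝ) ≤ (2 * (q : ℝ))⁻¹), hexp]
    rw [Finset.prod_mul_distrib, hopp (fun j => f j (fun i => x i (j i)) ^ (2 : ℝ)⁻¹),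
      ← Finset.prod_mul_distrib]
    refine Finset.prod_congr rfl fun j _ => ?_
    rw [← ENNReal.rpow_add_of_nonneg _ _ (by positivity) (by positivity)]
    norm_num
  simp only [hleft] at hol
  refine hol.trans (le_of_eq ?_)
  have hi : ∀ j, ∫⁻ x, g j x = (∫⁻ y, f j y ^ q) * ∫⁻ y, f (opp j) y ^ q := fun j =>
    lintegral_corner_mul_opp j ((hf j).pow_const q) ((hf (opp j)).pow_const q)
  simp only [hi, ENNReal.mul_rpow_of_nonneg _ _ (by positivity : (0 : ℝ) ≤ (2 * (q : ℝ))⁻¹)]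
  rw [Finset.prod_mul_distrib, hopp (fun j => (∫⁻ y, f j y ^ q) ^ (2 * (q : ℝ))⁻¹),
    ← Finset.prod_mul_distrib]
  refine Finset.prod_congr rfl fun j _ => ?_
  rw [← ENNReal.rpow_add_of_nonneg _ _ (by positivity) (by positivity)]
  congr 1
  field_simp
  norm_num

theorem summable_exp_neg_mul_pow (k : ℕ) :
    Summable fun n : ℕ => Real.exp (-n) * (2 * ((n : ℝ) + 1)) ^ k := by
  have h := (Real.summable_pow_mul_exp_neg_nat_mul k (r := 1) one_pos)
  have h2 := ((summable_nat_add_iff 1).2 h).mul_left (Real.exp 1 * 2 ^ k)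
  refine h2.congr fun n => ?_
  have : Real.exp (-n) = Real.exp 1 * Real.exp (-1 * ((n + 1 : ℕ) : ℝ)) := by
    rw [← Real.exp_add]; congr 1; push_cast; ring
  rw [this, mul_pow]
  push_cast
  ring

/-- The constant in the single-scale estimate. -/
def scaleC (b : Fin m × Fin 2 → ℕ) (K : ℝ) : ℝ :=
  (∏ κ, 4 * hermC (b κ)) * K ^ 2 * ∑' n : ℕ, Real.exp (-n) * (2 * ((n : ℝ) + 1)) ^ (2 * m)

theorem scaleC_nonneg (b : Fin m × Fin 2 → ℕ) (K : ℝ) : 0 ≤ scaleC b K := by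
  unfold scaleC
  have h1 : 0 ≤ ∏ κ, 4 * hermC (b κ) :=
    Finset.prod_nonneg fun κ _ => mul_nonneg (by norm_num) (hermC_pos _).le
  have h2 : 0 ≤ ∑' n : ℕ, Real.exp (-n) * (2 * ((n : ℝ) + 1)) ^ (2 * m) :=
    tsum_nonneg fun n => by positivity
  positivity

theorem enorm_hermProd_le (b : Fin m × Fin 2 → ℕ) (c : Fin m × Fin 2 → ℝ) (χ : Fin m → ℝ)
    (x : Fin m → Fin 2 → ℝ) :
    ‖hermProd b c χ x‖ₑ ≤ ∑' n : ℕ, ENNReal.ofReal ((∏ κ, 4 * hermC (b κ)) *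
      Real.exp (-n) * (∏ i, Real.exp (-χ i)) ^ 2) *
        ∏ j : Corner m, Set.indicator (Set.Icc
          (fun i => c (i, j i) - (n + 1) * Real.exp (χ i))
          (fun i => c (i, j i) + (n + 1) * Real.exp (χ i))) 1 (fun i => x i (j i)) := by
  set Y : Fin m × Fin 2 → ℝ := fun κ => Real.exp (-χ κ.1) * (x κ.1 κ.2 - c κ) with hY
  set n : ℕ := ⌊∑ κ, |Y κ|⌋₊ with hn
  have hs0 : 0 ≤ ∑ κ, |Y κ| := Finset.sum_nonneg fun _ _ => abs_nonneg _
  have hYn : ∀ κ, |Y κ| ≤ n + 1 := fun κ =>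
    (Finset.single_le_sum (f := fun κ => |Y κ|) (fun _ _ => abs_nonneg _)
      (Finset.mem_univ κ)).trans (Nat.lt_floor_add_one _).le
  refine le_trans ?_ (ENNReal.le_tsum n)
  have hind : ∏ j : Corner m, Set.indicator (Set.Icc
          (fun i => c (i, j i) - ((n : ℝ) + 1) * Real.exp (χ i))
          (fun i => c (i, j i) + ((n : ℝ) + 1) * Real.exp (χ i)))
            (1 : (Fin m → ℝ) → ℝ≥0∞) (fun i => x i (j i)) = 1 := by
    refine Finset.prod_eq_one fun j _ => ?_
    rw [Set.indicator_of_mem]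
    · rfl
    · rw [← Set.pi_univ_Icc, Set.mem_univ_pi]
      intro i
      have h1 := hYn (i, j i)
      have h2 : x i (j i) - c (i, j i) = Real.exp (χ i) * Y (i, j i) := by
        simp only [hY]
        rw [← mul_assoc, ← Real.exp_add]
        simp
      have h3 := abs_le.1 h1
      have h4 := Real.exp_pos (χ i)
      constructor <;> nlinarith
  rw [hind, mul_one, ← ofReal_norm]
  refine ENNReal.ofReal_le_ofReal ?_
  rw [Real.norm_eq_abs]
  unfold hermProd
  rw [Finset.abs_prod]
  have h1 : ∀ κ : Fin m × Fin 2, |hermS (b κ) (c κ) (χ κ.1) (x κ.1 κ.2)| ≤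
      4 * hermC (b κ) * Real.exp (-|Y κ|) * Real.exp (-χ κ.1) := by
    intro κ
    unfold hermS
    rw [abs_mul, Real.abs_exp, mul_comm]
    refine mul_le_mul_of_nonneg_right ?_ (Real.exp_pos _).le
    have h2 := abs_herm_le (b κ) (Y κ)
    have h3 := herm_zero_half_le (Y κ)
    have h4 := hermC_pos (b κ)
    calc _ ≤ _ := h2
      _ ≤ hermC (b κ) * (4 * Real.exp (-|Y κ|)) := by gcongr
      _ = _ := by ring
  have h5 : ∏ κ : Fin m × Fin 2, Real.exp (-χ κ.1) = (∏ i, Real.exp (-χ i)) ^ 2 := by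
    rw [Fintype.prod_prod_type]
    simp [Finset.prod_pow]
  calc ∏ κ : Fin m × Fin 2, |hermS (b κ) (c κ) (χ κ.1) (x κ.1 κ.2)|
      ≤ ∏ κ : Fin m × Fin 2, (4 * hermC (b κ) * Real.exp (-|Y κ|) * Real.exp (-χ κ.1)) :=
        Finset.prod_le_prod (fun _ _ => abs_nonneg _) fun κ _ => h1 κ
    _ = (∏ κ, 4 * hermC (b κ)) * Real.exp (-∑ κ, |Y κ|) * (∏ i, Real.exp (-χ i)) ^ 2 := by
        rw [Finset.prod_mul_distrib, Finset.prod_mul_distrib, h5, ← Real.exp_sum,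
          Finset.sum_neg_distrib]
    _ ≤ _ := by
        have h6 : (0 : ℝ) ≤ ∏ κ, 4 * hermC (b κ) :=
          Finset.prod_nonneg fun κ _ => mul_nonneg (by norm_num) (hermC_pos _).le
        gcongr
        exact Nat.floor_le hs0

theorem abs_hform_le (hm : 1 ≤ m) {F : Corner m → (Fin m → ℝ) → ℝ} (hF : ∀ j, Continuous (F j))
    (b : Fin m × Fin 2 → ℕ) (c : Fin m × Fin 2 → ℝ) (χ : Fin m → ℝ) {K : ℝ} (hK : 0 ≤ K)
    (B : Corner m → ℝ)
    (hB : ∀ j, ∀ s : Fin m → ℝ, (∀ i, Real.exp (χ i) ≤ s i) →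
      ∫ y in Set.Icc (fun i => c (i, j i) - s i) (fun i => c (i, j i) + s i),
        |F j y| ^ (2 ^ (m - 1) : ℕ) ≤
        K * Real.exp ((2 ^ (m - 1) : ℕ) * B j) * ∏ i, (2 * s i)) :
    |hform (cornerProd F) b c χ| ≤ scaleC b K * Real.exp (∑ j, B j) := by
  set q : ℕ := 2 ^ (m - 1) with hq
  have hq0 : (0 : ℝ) < q := by positivity
  have h2q : (2 : ℕ) ^ m = 2 * q := by
    rw [hq, ← pow_succ', Nat.sub_add_cancel hm]
  have hcast : ((2 : ℝ) ^ (m - 1)) = q := by rw [hq]; push_cast; rfl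
  set D : ℝ := ∏ κ, 4 * hermC (b κ) with hD
  have hD0 : 0 ≤ D := Finset.prod_nonneg fun κ _ => mul_nonneg (by norm_num) (hermC_pos _).le
  set E : ℝ := ∏ i, Real.exp (-χ i) with hE
  set bx : ℕ → Corner m → Set (Fin m → ℝ) := fun n j => Set.Icc
          (fun i => c (i, j i) - (n + 1) * Real.exp (χ i))
          (fun i => c (i, j i) + (n + 1) * Real.exp (χ i)) with hbx
  have hbxm : ∀ n j, MeasurableSet (bx n j) := fun n j => measurableSet_Icc
  -- the contribution of one box
  have hone : ∀ n : ℕ, ∫⁻ x : Fin m → Fin 2 → ℝ, ∏ j : Corner m,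
      Set.indicator (bx n j) (fun y => ‖F j y‖ₑ) (fun i => x i (j i)) ≤
      ENNReal.ofReal (K ^ 2 * Real.exp (∑ j, B j) * ((2 * ((n : ℝ) + 1)) ^ m * E⁻¹) ^ 2) := by
    intro n
    have hbox : ∀ j, ∫⁻ y, Set.indicator (bx n j) (fun y => ‖F j y‖ₑ) y ^ q ≤
        ENNReal.ofReal (K * Real.exp (q * B j) * ((2 * ((n : ℝ) + 1)) ^ m * E⁻¹)) := by
      intro j
      have h1 := hB j (fun i => (n + 1) * Real.exp (χ i)) (fun i => by
        have := Real.exp_pos (χ i); nlinarith [Nat.cast_nonneg (α := ℝ) n])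
      have h2 : ∏ i, (2 * (((n : ℝ) + 1) * Real.exp (χ i))) =
          (2 * ((n : ℝ) + 1)) ^ m * E⁻¹ := by
        simp only [← mul_assoc]
        rw [Finset.prod_mul_distrib]
        simp [hE, Real.exp_neg]
      rw [h2] at h1
      refine le_trans (le_of_eq ?_) (ENNReal.ofReal_le_ofReal h1)
      rw [ofReal_integral_eq_lintegral_ofReal]
      · rw [← lintegral_indicator (hbxm n j)]
        refine lintegral_congr fun y => ?_
        by_cases hy : y ∈ bx n j
        · rw [Set.indicator_of_mem hy, Set.indicator_of_mem hy,
            ENNReal.ofReal_pow (abs_nonneg _), ← Real.norm_eq_abs, ofReal_norm]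
        · rw [Set.indicator_of_notMem hy, Set.indicator_of_notMem hy]
          exact zero_pow (by positivity)
      · exact ((hF j).abs.pow q).continuousOn.integrableOn_compact isCompact_Icc
      · exact Filter.Eventually.of_forall fun y => by positivity
    have hmeas : ∀ j, Measurable (Set.indicator (bx n j) (fun y => ‖F j y‖ₑ)) := fun j =>
      (hF j).measurable.enorm.indicator (hbxm n j)
    refine (lintegral_cornerProd_le hm hmeas).trans ?_
    rw [hcast]
    have hX0 : 0 ≤ (2 * ((n : ℝ) + 1)) ^ m * E⁻¹ := by
      have : 0 ≤ E := Finset.prod_nonneg fun _ _ => (Real.exp_pos _).le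
      positivity
    calc ∏ j, (∫⁻ y, Set.indicator (bx n j) (fun y => ‖F j y‖ₑ) y ^ q) ^ (q : ℝ)⁻¹
        ≤ ∏ j : Corner m, ENNReal.ofReal ((K * ((2 * ((n : ℝ) + 1)) ^ m * E⁻¹)) ^ (q : ℝ)⁻¹ *
            Real.exp (B j)) := by
          refine Finset.prod_le_prod' fun j _ => ?_
          refine (ENNReal.rpow_le_rpow (hbox j) (by positivity)).trans (le_of_eq ?_)
          rw [ENNReal.ofReal_rpow_of_nonneg (by positivity) (by positivity)]
          congr 1
          rw [mul_right_comm, Real.mul_rpow (by positivity) (Real.exp_pos _).le, ← Real.exp_mul]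
          congr 2
          field_simp
      _ = ENNReal.ofReal (((K * ((2 * ((n : ℝ) + 1)) ^ m * E⁻¹)) ^ (q : ℝ)⁻¹) ^ (2 * q) *
            Real.exp (∑ j, B j)) := by
          rw [← ENNReal.ofReal_prod_of_nonneg fun j _ => by positivity, Finset.prod_mul_distrib,
            ← Real.exp_sum]
          simp [h2q]
      _ = _ := by
          congr 1
          rw [mul_comm 2 q, pow_mul, Real.rpow_inv_natCast_pow (by positivity) (by positivity)]
          ring
  have hEpos : 0 < E := Finset.prod_pos fun _ _ => Real.exp_pos _
  rw [← ENNReal.ofReal_le_ofReal_iff (mul_nonneg (scaleC_nonneg _ _) (Real.exp_pos _).le),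
    ← Real.norm_eq_abs, ofReal_norm, hform_eq]
  refine (enorm_integral_le_lintegral_enorm _).trans ?_
  calc ∫⁻ x : Fin m → Fin 2 → ℝ, ‖cornerProd F x * hermProd b c χ x‖ₑ
      ≤ ∫⁻ x : Fin m → Fin 2 → ℝ, ∑' n : ℕ, ENNReal.ofReal (D * Real.exp (-n) * E ^ 2) * ∏ j : Corner m,
          Set.indicator (bx n j) (fun y => ‖F j y‖ₑ) (fun i => x i (j i)) := by
        refine lintegral_mono fun x => ?_
        rw [enorm_mul]
        refine (mul_le_mul_right (enorm_hermProd_le b c χ x) _).trans (le_of_eq ?_)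
        rw [← ENNReal.tsum_mul_left]
        congr 1
        ext n
        rw [mul_left_comm]
        congr 1
        have : ‖cornerProd F x‖ₑ = ∏ j, ‖F j fun i => x i (j i)‖ₑ := by
          unfold cornerProd
          simp only [enorm_eq_nnnorm, nnnorm_prod]
          push_cast
          rfl
        rw [this, ← Finset.prod_mul_distrib]
        refine Finset.prod_congr rfl fun j _ => ?_
        by_cases hy : (fun i => x i (j i)) ∈ bx n j
        · rw [Set.indicator_of_mem hy, Set.indicator_of_mem hy]; simp
        · rw [Set.indicator_of_notMem hy, Set.indicator_of_notMem hy]; simp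
    _ = ∑' n : ℕ, ENNReal.ofReal (D * Real.exp (-n) * E ^ 2) *
          ∫⁻ x : Fin m → Fin 2 → ℝ, ∏ j : Corner m,
          Set.indicator (bx n j) (fun y => ‖F j y‖ₑ) (fun i => x i (j i)) := by
        have hmeas : ∀ n, Measurable fun x : Fin m → Fin 2 → ℝ => ∏ j : Corner m,
            Set.indicator (bx n j) (fun y => ‖F j y‖ₑ) (fun i => x i (j i)) := fun n =>
          Finset.measurable_fun_prod _ fun j _ =>
            ((hF j).measurable.enorm.indicator (hbxm n j)).comp (by fun_prop)
        rw [lintegral_tsum fun n => ((hmeas n).const_mul _).aemeasurable]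
        congr 1
        ext n
        rw [lintegral_const_mul _ (hmeas n)]
    _ ≤ ∑' n : ℕ, ENNReal.ofReal (D * K ^ 2 * Real.exp (∑ j, B j) *
          (Real.exp (-n) * (2 * ((n : ℝ) + 1)) ^ (2 * m))) := by
        refine ENNReal.tsum_le_tsum fun n => ?_
        refine (mul_le_mul_right (hone n) _).trans (le_of_eq ?_)
        rw [← ENNReal.ofReal_mul (by positivity)]
        congr 1
        rw [mul_comm 2 m, pow_mul]
        field_simp
    _ = ENNReal.ofReal (scaleC b K * Real.exp (∑ j, B j)) := by
        rw [← ENNReal.ofReal_tsum_of_nonneg (fun n => by positivity)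
          ((summable_exp_neg_mul_pow (2 * m)).mul_left _), tsum_mul_left]
        congr 1
        rw [scaleC]
        ring

end SBL

namespace SBL

/-! ### Multi-scale data and the multi-scale forms -/

variable {m : ℕ}

/-- The data entering the multi-scale estimate: linear forms `J`, functions `F`, finitely many
scales `exp (s₀ + n)`, and exponential weights `β` which dominate the local `L^q` averages of the
functions, `q = 2 ^ (m - 1)`, and whose oscillation is controlled by `e`. -/
structure ScaleData (m : ℕ) (C₀ : ℝ) where
  J : Fin m × Fin 2 → (Fin m → ℝ) →L[ℝ] ℝ
  F : Corner m → (Fin m → ℝ) → ℝ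
  s₀ : ℝ
  N : ℕ
  β : Corner m → ℕ → (Fin m → ℝ) → ℝ
  e : ℕ → (Fin m → ℝ) → ℝ
  I : ℝ
  one_le : 1 ≤ C₀
  one_le_m : 1 ≤ m
  continuous_F : ∀ j, Continuous (F j)
  hasCompactSupport_F : ∀ j, HasCompactSupport (F j)
  abs_J_le : ∀ κ v, |J κ v| ≤ C₀ * ‖v‖
  exists_dual : ∀ (j : Corner m) (i : Fin m), ∃ v : Fin m → ℝ, ‖v‖ ≤ C₀ ∧
    ∀ i', J (i', j i') v = if i' = i then 1 else 0
  contDiff_β : ∀ j n, ContDiff ℝ 1 (β j n)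
  integral_box_le : ∀ (j : Corner m) (n : ℕ) p, ∀ s : Fin m → ℝ, (∀ i, Real.exp (s₀ + n - 1) ≤ s i) →
    ∫ y in Set.Icc (fun i => J (i, j i) p - s i) (fun i => J (i, j i) p + s i),
      |F j y| ^ (2 ^ (m - 1) : ℕ) ≤
      C₀ * Real.exp ((2 ^ (m - 1) : ℕ) * β j n p) * ∏ i, (2 * s i)
  abs_fderiv_β_le : ∀ j (n : ℕ) p v, Real.exp (s₀ + n) * |fderiv ℝ (β j n) p v| ≤ e n p * ‖v‖
  abs_β_sub_le : ∀ j n p, |β j (n + 1) p - β j n p| ≤ e n p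
  e_le : ∀ n p, e n p ≤ C₀
  integrable_exp : ∀ n, Integrable fun p => Real.exp (∑ j, β j n p)
  integral_exp_le : ∀ n, ∫ p, Real.exp (∑ j, β j n p) ≤ I
  integrable_exp_mul : ∀ n, Integrable fun p => Real.exp (∑ j, β j n p) * e n p
  sum_integral_le : ∑ n ∈ Finset.range N, ∫ p, Real.exp (∑ j, β j n p) * e n p ≤ I

namespace ScaleData

variable {C₀ : ℝ} (D : ScaleData m C₀) (σ : Fin m → Fin 2 → Fin 2)

theorem e_nonneg (n : ℕ) (p : Fin m → ℝ) : 0 ≤ D.e n p :=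
  (abs_nonneg _).trans (D.abs_β_sub_le (fun _ => 0) n p)

theorem I_nonneg : 0 ≤ D.I :=
  (integral_nonneg fun _ => (Real.exp_pos _).le).trans (D.integral_exp_le 0)

/-- The `n`-th logarithmic scale. -/
def sc (n : ℕ) : ℝ := D.s₀ + n

/-- The total exponential weight. -/
def lam (n : ℕ) (p : Fin m → ℝ) : ℝ := ∑ j, D.β j n p

/-- The action of a state on corners. -/
def act (σ : Fin m → Fin 2 → Fin 2) (j : Corner m) : Corner m := fun i => σ i (j i)

/-- The weight attached to the functions selected by the state `σ`. -/
def lamS (n : ℕ) (p : Fin m → ℝ) : ℝ := ∑ j, D.β (act σ j) n p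

/-- The compensating weight of the state `σ`. -/
def om (n : ℕ) (p : Fin m → ℝ) : ℝ := Real.exp (D.lam n p - D.lamS σ n p)

/-- The functions selected by the state `σ`. -/
def FS (j : Corner m) : (Fin m → ℝ) → ℝ := D.F (act σ j)

/-- The linear forms selected by the state `σ`. -/
def JS (κ : Fin m × Fin 2) : (Fin m → ℝ) →L[ℝ] ℝ := D.J (κ.1, σ κ.1 κ.2)

/-- The single-scale form of the state `σ` at position `p` and scale `exp r`. -/
def G (η : Fin m → ℝ) (b : Fin m × Fin 2 → ℕ) (r : ℝ) (p : Fin m → ℝ) : ℝ :=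
  hform (cornerProd (D.FS σ)) b (fun κ => D.JS σ κ p) (fun i => r + η i)

/-- The measure on the space of fractional scales and positions. -/
def mu (m : ℕ) : Measure (ℝ × (Fin m → ℝ)) :=
  (volume.restrict (Set.Icc (0 : ℝ) 1)).prod volume

/-- The multi-scale form. -/
def L (η : Fin m → ℝ) (b : Fin m × Fin 2 → ℕ) : ℝ :=
  ∑ n ∈ Finset.range D.N, ∫ z : ℝ × (Fin m → ℝ), D.om σ n z.2 * D.G σ η b (D.sc n + z.1) z.2 ∂(mu m)

theorem integrable_cornerProd_FS : Integrable (cornerProd (D.FS σ)) :=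
  integrable_cornerProd (fun _ => D.continuous_F _) fun _ => D.hasCompactSupport_F _

theorem continuous_β (j : Corner m) (n : ℕ) : Continuous (D.β j n) := (D.contDiff_β j n).continuous

theorem continuous_om (n : ℕ) : Continuous (D.om σ n) := by
  unfold om lam lamS
  have := D.continuous_β
  fun_prop

theorem continuous_G (η : Fin m → ℝ) (b : Fin m × Fin 2 → ℕ) :
    Continuous fun z : ℝ × (Fin m → ℝ) => D.G σ η b z.1 z.2 := by
  exact (continuous_hform (D.integrable_cornerProd_FS σ) b).comp
    (f := fun z : ℝ × (Fin m → ℝ) => ((fun κ => D.JS σ κ z.2), fun i => z.1 + η i)) (by fun_prop)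

theorem abs_G_le {η : Fin m → ℝ} (b : Fin m × Fin 2 → ℕ) (n : ℕ) {r : ℝ} (p : Fin m → ℝ)
    (h : ∀ i, D.sc n - 1 ≤ r + η i) :
    |D.G σ η b r p| ≤ scaleC b C₀ * Real.exp (D.lamS σ n p) := by
  refine abs_hform_le D.one_le_m (fun _ => D.continuous_F _) b _ _
    (zero_le_one.trans D.one_le) (fun j => D.β (act σ j) n p) fun j s hs => ?_
  exact D.integral_box_le (act σ j) n p s fun i =>
    (Real.exp_le_exp.2 (h i)).trans (hs i)

theorem om_mul_exp (n : ℕ) (p : Fin m → ℝ) :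
    D.om σ n p * Real.exp (D.lamS σ n p) = Real.exp (D.lam n p) := by
  rw [om, ← Real.exp_add, sub_add_cancel]

theorem om_pos (n : ℕ) (p : Fin m → ℝ) : 0 < D.om σ n p := Real.exp_pos _

theorem abs_om_mul_G_le {η : Fin m → ℝ} (b : Fin m × Fin 2 → ℕ) (n : ℕ) {r : ℝ}
    (p : Fin m → ℝ) (h : ∀ i, D.sc n - 1 ≤ r + η i) :
    |D.om σ n p * D.G σ η b r p| ≤ scaleC b C₀ * Real.exp (D.lam n p) := by
  rw [abs_mul, abs_of_pos (D.om_pos σ n p), ← D.om_mul_exp σ n p, mul_left_comm]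
  exact mul_le_mul_of_nonneg_left (D.abs_G_le σ b n p h) (D.om_pos σ n p).le

theorem ae_mem_mu : ∀ᵐ z ∂(mu m), z.1 ∈ Set.Icc (0 : ℝ) 1 := by
  have : (Prod.fst ⁻¹' (Set.Icc (0 : ℝ) 1) : Set (ℝ × (Fin m → ℝ))) ∈ ae (mu m) :=
    Measure.quasiMeasurePreserving_fst.ae (p := fun x : ℝ => x ∈ Set.Icc (0 : ℝ) 1)
      (ae_restrict_mem measurableSet_Icc)
  exact this

instance : IsFiniteMeasure (volume.restrict (Set.Icc (0 : ℝ) 1)) :=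
  ⟨by simp⟩

theorem integrable_comp_snd_mu {f : (Fin m → ℝ) → ℝ} (hf : Integrable f) :
    Integrable (fun z : ℝ × (Fin m → ℝ) => f z.2) (mu m) :=
  hf.comp_snd _

theorem integral_comp_snd_mu (f : (Fin m → ℝ) → ℝ) : ∫ z, f z.2 ∂(mu m) = ∫ p, f p := by
  have := integral_prod_mul (μ := volume.restrict (Set.Icc (0 : ℝ) 1))
    (ν := (volume : Measure (Fin m → ℝ))) (fun _ => (1 : ℝ)) f
  simpa [mu] using this

theorem continuous_om_mul_G (η : Fin m → ℝ) (b : Fin m × Fin 2 → ℕ) (n : ℕ) :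
    Continuous fun z : ℝ × (Fin m → ℝ) => D.om σ n z.2 * D.G σ η b (D.sc n + z.1) z.2 :=
  ((D.continuous_om σ n).comp continuous_snd).mul ((D.continuous_G σ η b).comp
    (f := fun z : ℝ × (Fin m → ℝ) => (D.sc n + z.1, z.2)) (by fun_prop))

theorem integrable_om_mul_G {η : Fin m → ℝ} (hη : ∀ i, -1 ≤ η i) (b : Fin m × Fin 2 → ℕ)
    (n : ℕ) :
    Integrable (fun z : ℝ × (Fin m → ℝ) => D.om σ n z.2 * D.G σ η b (D.sc n + z.1) z.2) (mu m) := by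
  refine Integrable.mono' (integrable_comp_snd_mu ((D.integrable_exp n).const_mul (scaleC b C₀)))
    (D.continuous_om_mul_G σ η b n).aestronglyMeasurable ?_
  filter_upwards [ae_mem_mu] with z hz
  exact D.abs_om_mul_G_le σ b n z.2 fun i => by linarith [hη i, hz.1]

/-- A crude bound for the multi-scale form, depending on the number of scales. -/
theorem abs_L_le {η : Fin m → ℝ} (hη : ∀ i, -1 ≤ η i) (b : Fin m × Fin 2 → ℕ) :
    |D.L σ η b| ≤ D.N * (scaleC b C₀ * D.I) := by
  refine (Finset.abs_sum_le_sum_abs _ _).trans ?_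
  have : ∀ n ∈ Finset.range D.N,
      |∫ z : ℝ × (Fin m → ℝ), D.om σ n z.2 * D.G σ η b (D.sc n + z.1) z.2 ∂(mu m)| ≤ scaleC b C₀ * D.I := by
    intro n _
    rw [← Real.norm_eq_abs]
    refine (norm_integral_le_of_norm_le
      (integrable_comp_snd_mu ((D.integrable_exp n).const_mul (scaleC b C₀))) ?_).trans ?_
    · filter_upwards [ae_mem_mu] with z hz
      exact D.abs_om_mul_G_le σ b n z.2 fun i => by linarith [hη i, hz.1]
    · rw [integral_comp_snd_mu fun p => scaleC b C₀ * Real.exp (∑ j, D.β j n p),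
        integral_const_mul]
      exact mul_le_mul_of_nonneg_left (D.integral_exp_le n) (scaleC_nonneg _ _)
  refine (Finset.sum_le_sum this).trans ?_
  simp

end ScaleData
end SBL

namespace SBL
namespace ScaleData

variable {m : ℕ} {C₀ : ℝ} (D : ScaleData m C₀) (σ : Fin m → Fin 2 → Fin 2)

/-! ### Relations between the multi-scale forms -/

theorem integrable_om_mul_G_right {η : Fin m → ℝ} (b : Fin m × Fin 2 → ℕ)
    (n : ℕ) {r : ℝ} (h : ∀ i, D.sc n - 1 ≤ r + η i) :
    Integrable (fun p => D.om σ n p * D.G σ η b r p) := by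
  refine Integrable.mono' ((D.integrable_exp n).const_mul (scaleC b C₀))
    ((D.continuous_om σ n).mul ((D.continuous_G σ η b).comp
      (Continuous.prodMk_right r))).aestronglyMeasurable ?_
  exact Filter.Eventually.of_forall fun p => D.abs_om_mul_G_le σ b n p h

/-- The derivative of the exponent of the compensating weight. -/
def dW (n : ℕ) (v p : Fin m → ℝ) : ℝ :=
  ∑ j, fderiv ℝ (D.β j n) p v - ∑ j, fderiv ℝ (D.β (act σ j) n) p v

theorem hasLineDerivAt_om (n : ℕ) (v p : Fin m → ℝ) :
    HasLineDerivAt ℝ (D.om σ n) (D.om σ n p * D.dW σ n v p) p v := by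
  have h1 : ∀ j, HasFDerivAt (D.β j n) (fderiv ℝ (D.β j n) p) p := fun j =>
    ((D.contDiff_β j n).differentiable (by norm_num) p).hasFDerivAt
  have h2 : HasFDerivAt (fun p => D.lam n p - D.lamS σ n p)
      (∑ j, fderiv ℝ (D.β j n) p - ∑ j, fderiv ℝ (D.β (act σ j) n) p) p :=
    (HasFDerivAt.fun_sum fun j _ => h1 j).sub (HasFDerivAt.fun_sum fun j _ => h1 (act σ j))
  have h3 := (h2.exp).hasLineDerivAt v
  have h4 : D.om σ n p * D.dW σ n v p = (Real.exp (D.lam n p - D.lamS σ n p) •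
      (∑ j, fderiv ℝ (D.β j n) p - ∑ j, fderiv ℝ (D.β (act σ j) n) p)) v := by
    simp [om, dW]
  rw [h4]
  exact h3

theorem abs_dW_le (n : ℕ) (v p : Fin m → ℝ) :
    Real.exp (D.sc n) * |D.dW σ n v p| ≤ 2 * 2 ^ m * (D.e n p * ‖v‖) := by
  have h1 : ∀ f : Corner m → Corner m,
      Real.exp (D.sc n) * |∑ j, fderiv ℝ (D.β (f j) n) p v| ≤ 2 ^ m * (D.e n p * ‖v‖) := by
    intro f
    refine (mul_le_mul_of_nonneg_left (Finset.abs_sum_le_sum_abs _ _)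
      (Real.exp_pos _).le).trans ?_
    rw [Finset.mul_sum]
    refine (Finset.sum_le_sum fun j _ => D.abs_fderiv_β_le (f j) n p v).trans ?_
    simp
  have h2 := h1 id
  have h3 := h1 (act σ)
  simp only [id] at h2
  calc _ ≤ Real.exp (D.sc n) * (|∑ j, fderiv ℝ (D.β j n) p v| +
        |∑ j, fderiv ℝ (D.β (act σ j) n) p v|) :=
      mul_le_mul_of_nonneg_left (abs_sub _ _) (Real.exp_pos _).le
    _ ≤ _ := by rw [mul_add]; linarith

theorem continuous_dW (n : ℕ) (v : Fin m → ℝ) : Continuous (D.dW σ n v) := by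
  have : ∀ j, Continuous fun p => fderiv ℝ (D.β j n) p v := fun j =>
    ((D.contDiff_β j n).continuous_fderiv (by norm_num)).clm_apply continuous_const
  unfold dW
  fun_prop

theorem hasLineDerivAt_G (η : Fin m → ℝ) (b : Fin m × Fin 2 → ℕ) (r : ℝ) (v p : Fin m → ℝ) :
    HasLineDerivAt ℝ (D.G σ η b r)
      (∑ κ, -D.JS σ κ v * Real.exp (-(r + η κ.1)) * D.G σ η (b + Pi.single κ 1) r p) p v := by
  have h := hasDerivAt_hform (D.integrable_cornerProd_FS σ) b (fun κ => D.JS σ κ p)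
    (fun κ => D.JS σ κ v) (fun i => r + η i) 0 0
  have h1 : (fun t : ℝ => D.G σ η b r (p + t • v)) = fun t =>
      hform (cornerProd (D.FS σ)) b ((fun κ => D.JS σ κ p) + t • fun κ => D.JS σ κ v)
        ((fun i => r + η i) + t • 0) := by
    funext t
    have : (fun κ => D.JS σ κ (p + t • v)) =
        (fun κ => D.JS σ κ p) + t • fun κ => D.JS σ κ v := by
      ext κ; simp
    rw [G, this, smul_zero, add_zero]
  rw [HasLineDerivAt, h1]
  refine h.congr_deriv ?_
  simp [G]

theorem integral_om_mul_deriv {η : Fin m → ℝ} (b : Fin m × Fin 2 → ℕ)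
    (n : ℕ) {r : ℝ} (v : Fin m → ℝ) (hr : r ≤ D.sc n + 1) (h : ∀ i, D.sc n - 1 ≤ r + η i) :
    |∫ p, D.om σ n p * ∑ κ, D.JS σ κ v * Real.exp (-η κ.1) *
        D.G σ η (b + Pi.single κ 1) r p| ≤
      Real.exp 1 * (2 * 2 ^ m) * scaleC b C₀ * ‖v‖ *
        ∫ p, Real.exp (∑ j, D.β j n p) * D.e n p := by
  set A : (Fin m → ℝ) → ℝ := fun p => ∑ κ, D.JS σ κ v * Real.exp (-η κ.1) *
        D.G σ η (b + Pi.single κ 1) r p with hA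
  set K := Real.exp 1 * (2 * 2 ^ m) * scaleC b C₀ * ‖v‖ with hK
  have hbound : ∀ p, |Real.exp r * (D.om σ n p * D.dW σ n v p * D.G σ η b r p)| ≤
      K * (Real.exp (∑ j, D.β j n p) * D.e n p) := by
    intro p
    have h1 := D.abs_om_mul_G_le σ b n p h
    have h2 := D.abs_dW_le σ n v p
    have h3 : Real.exp r ≤ Real.exp 1 * Real.exp (D.sc n) := by
      rw [← Real.exp_add]; exact Real.exp_le_exp.2 (by linarith)
    calc |Real.exp r * (D.om σ n p * D.dW σ n v p * D.G σ η b r p)|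
        = Real.exp r * |D.dW σ n v p| * |D.om σ n p * D.G σ η b r p| := by
          simp only [abs_mul, Real.abs_exp]; ring
      _ ≤ (Real.exp 1 * Real.exp (D.sc n)) * |D.dW σ n v p| *
          (scaleC b C₀ * Real.exp (D.lam n p)) := by gcongr
      _ = Real.exp 1 * (Real.exp (D.sc n) * |D.dW σ n v p|) *
          (scaleC b C₀ * Real.exp (D.lam n p)) := by ring
      _ ≤ Real.exp 1 * (2 * 2 ^ m * (D.e n p * ‖v‖)) *
          (scaleC b C₀ * Real.exp (D.lam n p)) := by
          have := scaleC_nonneg b C₀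
          gcongr
      _ = _ := by rw [hK, lam]; ring
  have hGc : ∀ b, Continuous fun p => D.G σ η b r p := fun b =>
    (D.continuous_G σ η b).comp (Continuous.prodMk_right r)
  have hint1 : Integrable fun p => Real.exp r * (D.om σ n p * D.dW σ n v p * D.G σ η b r p) :=
    Integrable.mono' ((D.integrable_exp_mul n).const_mul K)
      (continuous_const.mul (((D.continuous_om σ n).mul (D.continuous_dW σ n v)).mul
        (hGc b))).aestronglyMeasurable (Filter.Eventually.of_forall hbound)
  have hint1' : Integrable fun p => D.om σ n p * D.dW σ n v p * D.G σ η b r p := by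
    have := hint1.const_mul (Real.exp (-r))
    simpa [← mul_assoc, ← Real.exp_add] using this
  have hint2 : Integrable fun p => D.om σ n p * A p := by
    have : ∀ p, D.om σ n p * A p = ∑ κ, D.JS σ κ v * Real.exp (-η κ.1) *
        (D.om σ n p * D.G σ η (b + Pi.single κ 1) r p) := by
      intro p
      rw [hA, Finset.mul_sum]
      exact Finset.sum_congr rfl fun κ _ => by ring
    simp only [this]
    exact integrable_finsetSum _ fun κ _ =>
      (D.integrable_om_mul_G_right σ (b + Pi.single κ 1) n h).const_mul _
  have hA' : ∀ p, (∑ κ, -D.JS σ κ v * Real.exp (-(r + η κ.1)) *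
      D.G σ η (b + Pi.single κ 1) r p) = -Real.exp (-r) * A p := by
    intro p
    rw [hA, Finset.mul_sum]
    refine Finset.sum_congr rfl fun κ _ => ?_
    rw [neg_add, Real.exp_add]
    ring
  have key := integral_bilinear_hasLineDerivAt_right_eq_neg_left_of_integrable
    (μ := (volume : Measure (Fin m → ℝ))) (f := D.om σ n) (f' := fun p => D.om σ n p * D.dW σ n v p)
    (g := D.G σ η b r) (g' := fun p => -Real.exp (-r) * A p) (v := v)
    (B := ContinuousLinearMap.mul ℝ ℝ) (by simpa using hint1')
    (by simpa [mul_left_comm] using hint2.const_mul (-Real.exp (-r)))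
    (by simpa using D.integrable_om_mul_G_right σ b n h)
    (fun p _ => D.hasLineDerivAt_om σ n v p)
    (fun p _ => by rw [← hA' p]; exact D.hasLineDerivAt_G σ η b r v p)
  simp only [ContinuousLinearMap.mul_apply'] at key
  have key2 : ∫ p, D.om σ n p * A p =
      ∫ p, Real.exp r * (D.om σ n p * D.dW σ n v p * D.G σ η b r p) := by
    rw [integral_const_mul, ← neg_neg (∫ p, D.om σ n p * D.dW σ n v p * D.G σ η b r p), ← key]
    simp only [mul_left_comm _ (-Real.exp (-r))]
    rw [integral_const_mul, neg_mul, neg_neg, ← mul_assoc, ← Real.exp_add]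
    simp
  rw [key2, ← integral_const_mul, ← Real.norm_eq_abs]
  exact norm_integral_le_of_norm_le ((D.integrable_exp_mul n).const_mul K)
    (Filter.Eventually.of_forall hbound)

/-- Translation relation: integration by parts in the position variable. -/
theorem abs_sum_JS_mul_L_le {η : Fin m → ℝ} (hη : ∀ i, 0 ≤ η i) (b : Fin m × Fin 2 → ℕ)
    (v : Fin m → ℝ) :
    |∑ κ, D.JS σ κ v * Real.exp (-η κ.1) * D.L σ η (b + Pi.single κ 1)| ≤
      Real.exp 1 * (2 * 2 ^ m) * scaleC b C₀ * ‖v‖ * D.I := by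
  set K := Real.exp 1 * (2 * 2 ^ m) * scaleC b C₀ * ‖v‖ with hK
  have hK0 : 0 ≤ K := by have := scaleC_nonneg b C₀; positivity
  have hη1 : ∀ i, -1 ≤ η i := fun i => by linarith [hη i]
  set A : ℕ → ℝ → (Fin m → ℝ) → ℝ := fun n r p =>
    D.om σ n p * ∑ κ, D.JS σ κ v * Real.exp (-η κ.1) * D.G σ η (b + Pi.single κ 1) r p with hA
  have hA' : ∀ n r p, A n r p = ∑ κ, D.JS σ κ v * Real.exp (-η κ.1) *
      (D.om σ n p * D.G σ η (b + Pi.single κ 1) r p) := by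
    intro n r p
    rw [hA]
    simp only [Finset.mul_sum]
    exact Finset.sum_congr rfl fun κ _ => by ring
  have hAint : ∀ n, Integrable (fun z : ℝ × (Fin m → ℝ) => A n (D.sc n + z.1) z.2) (mu m) := by
    intro n
    simp only [hA']
    exact integrable_finsetSum _ fun κ _ =>
      (D.integrable_om_mul_G σ hη1 (b + Pi.single κ 1) n).const_mul _
  have h1 : ∑ κ, D.JS σ κ v * Real.exp (-η κ.1) * D.L σ η (b + Pi.single κ 1) =
      ∑ n ∈ Finset.range D.N, ∫ z : ℝ × (Fin m → ℝ), A n (D.sc n + z.1) z.2 ∂(mu m) := by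
    simp only [L, Finset.mul_sum]
    rw [Finset.sum_comm]
    refine Finset.sum_congr rfl fun n _ => ?_
    simp only [hA']
    rw [integral_finsetSum]
    · simp only [integral_const_mul]
    · exact fun κ _ => (D.integrable_om_mul_G σ hη1 (b + Pi.single κ 1) n).const_mul _
  rw [h1]
  refine (Finset.abs_sum_le_sum_abs _ _).trans ?_
  refine (Finset.sum_le_sum (g := fun n => K * ∫ p, Real.exp (∑ j, D.β j n p) * D.e n p)
    fun n _ => ?_).trans ?_
  · have h2 : ∫ z : ℝ × (Fin m → ℝ), A n (D.sc n + z.1) z.2 ∂(mu m) =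
        ∫ θ in Set.Icc (0 : ℝ) 1, ∫ p, A n (D.sc n + θ) p := integral_prod _ (hAint n)
    rw [h2, ← Real.norm_eq_abs]
    refine (norm_setIntegral_le_of_norm_le_const (C := K *
      ∫ p, Real.exp (∑ j, D.β j n p) * D.e n p) (by simp) fun θ hθ => ?_).trans (by simp)
    exact D.integral_om_mul_deriv σ b n v (by linarith [hθ.2]) fun i => by
      linarith [hη i, hθ.1]
  · rw [← Finset.mul_sum]
    exact mul_le_mul_of_nonneg_left D.sum_integral_le hK0

end ScaleData
end SBL

namespace SBL

theorem abs_exp_sub_one_le_mul_exp (x : ℝ) : |Real.exp x - 1| ≤ |x| * Real.exp |x| := by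
  have h1 := Real.add_one_le_exp x
  have h2 := Real.add_one_le_exp (-x)
  have h3 : Real.exp (-x) * Real.exp x = 1 := by rw [← Real.exp_add]; simp
  have h4 := Real.exp_pos x
  rcases le_total 0 x with h | h
  · rw [abs_of_nonneg h, abs_of_nonneg (by linarith)]
    nlinarith
  · rw [abs_of_nonpos h, abs_of_nonpos (by linarith [Real.exp_le_one_iff.2 h])]
    nlinarith

namespace ScaleData

variable {m : ℕ} {C₀ : ℝ} (D : ScaleData m C₀) (σ : Fin m → Fin 2 → Fin 2)

theorem hasDerivAt_G (η χ : Fin m → ℝ) (b : Fin m × Fin 2 → ℕ) (r t : ℝ) (p : Fin m → ℝ) :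
    HasDerivAt (fun t : ℝ => D.G σ (η + t • χ) b r p)
      (∑ κ, χ κ.1 * (b κ * D.G σ (η + t • χ) b r p +
        (2 * Real.pi)⁻¹ * D.G σ (η + t • χ) (b + Pi.single κ 2) r p)) t := by
  have h := hasDerivAt_hform (D.integrable_cornerProd_FS σ) b (fun κ => D.JS σ κ p)
    0 (fun i => r + η i) χ t
  have h0 : ∀ t : ℝ, (fun i => r + (η + t • χ) i) = (fun i => r + η i) + t • χ := fun t => by
    ext i; simp [add_assoc]
  simp only [G, h0]
  simpa using h

theorem hasDerivAt_G_scale (η : Fin m → ℝ) (b : Fin m × Fin 2 → ℕ) (r : ℝ) (p : Fin m → ℝ) :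
    HasDerivAt (fun r : ℝ => D.G σ η b r p)
      (∑ κ, (b κ * D.G σ η b r p +
        (2 * Real.pi)⁻¹ * D.G σ η (b + Pi.single κ 2) r p)) r := by
  have h := hasDerivAt_hform (D.integrable_cornerProd_FS σ) b (fun κ => D.JS σ κ p)
    0 η 1 r
  have h0 : ∀ t : ℝ, (fun i => t + η i) = η + t • (1 : Fin m → ℝ) := fun t => by
    ext i; simp [add_comm]
  simp only [G, h0]
  simpa using h

theorem abs_om_succ_sub_le (n : ℕ) (p : Fin m → ℝ) :
    |D.om σ (n + 1) p - D.om σ n p| ≤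
      2 * 2 ^ m * Real.exp (2 * 2 ^ m * C₀) * D.e n p * D.om σ n p := by
  set x := (D.lam (n + 1) p - D.lamS σ (n + 1) p) - (D.lam n p - D.lamS σ n p) with hx
  have h1 : D.om σ (n + 1) p - D.om σ n p = D.om σ n p * (Real.exp x - 1) := by
    rw [mul_sub, om, om, ← Real.exp_add, hx]; simp
  have h2 : ∀ f : Corner m → Corner m,
      |∑ j, D.β (f j) (n + 1) p - ∑ j, D.β (f j) n p| ≤ 2 ^ m * D.e n p := by
    intro f
    rw [← Finset.sum_sub_distrib]
    refine (Finset.abs_sum_le_sum_abs _ _).trans ?_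
    refine (Finset.sum_le_sum fun j _ => D.abs_β_sub_le (f j) n p).trans ?_
    simp
  have h3 : |x| ≤ 2 * 2 ^ m * D.e n p := by
    have h4 := h2 id
    have h5 := h2 (act σ)
    simp only [id] at h4
    have h6 : x = (∑ j, D.β j (n + 1) p - ∑ j, D.β j n p) -
        (∑ j, D.β (act σ j) (n + 1) p - ∑ j, D.β (act σ j) n p) := by
      rw [hx, lam, lam, lamS, lamS]; ring
    rw [h6]
    refine (abs_sub _ _).trans ?_
    linarith
  have h4 : |x| ≤ 2 * 2 ^ m * C₀ := h3.trans (by gcongr; exact D.e_le n p)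
  rw [h1, abs_mul, abs_of_pos (D.om_pos σ n p), mul_comm]
  refine mul_le_mul_of_nonneg_right ?_ (D.om_pos σ n p).le
  refine (abs_exp_sub_one_le_mul_exp x).trans ?_
  calc |x| * Real.exp |x| ≤ (2 * 2 ^ m * D.e n p) * Real.exp (2 * 2 ^ m * C₀) := by
        have := D.e_nonneg n p
        gcongr
    _ = _ := by ring

/-- Dilation relation: telescoping over the scales. -/
theorem abs_dilation_le {η : Fin m → ℝ} (hη : ∀ i, 0 ≤ η i) (b : Fin m × Fin 2 → ℕ) :
    |∑ κ, (b κ * D.L σ η b + (2 * Real.pi)⁻¹ * D.L σ η (b + Pi.single κ 2))| ≤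
      scaleC b C₀ * (2 + 2 * 2 ^ m * Real.exp (2 * 2 ^ m * C₀)) * D.I := by
  have hη1 : ∀ i, -1 ≤ η i := fun i => by linarith [hη i]
  set A : ℝ → (Fin m → ℝ) → ℝ := fun r p => ∑ κ, (b κ * D.G σ η b r p +
        (2 * Real.pi)⁻¹ * D.G σ η (b + Pi.single κ 2) r p) with hA
  have hA' : ∀ n r p, D.om σ n p * A r p = ∑ κ, (b κ * (D.om σ n p * D.G σ η b r p) +
        (2 * Real.pi)⁻¹ * (D.om σ n p * D.G σ η (b + Pi.single κ 2) r p)) := by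
    intro n r p
    rw [hA]
    simp only [Finset.mul_sum]
    exact Finset.sum_congr rfl fun κ _ => by ring
  have hInt : ∀ n κ, Integrable (fun z : ℝ × (Fin m → ℝ) =>
      b κ * (D.om σ n z.2 * D.G σ η b (D.sc n + z.1) z.2) +
        (2 * Real.pi)⁻¹ * (D.om σ n z.2 * D.G σ η (b + Pi.single κ 2) (D.sc n + z.1) z.2))
      (mu m) := fun n κ => ((D.integrable_om_mul_G σ hη1 b n).const_mul _).add
        ((D.integrable_om_mul_G σ hη1 (b + Pi.single κ 2) n).const_mul _)
  have hAint : ∀ n, Integrable (fun z : ℝ × (Fin m → ℝ) => D.om σ n z.2 * A (D.sc n + z.1) z.2)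
      (mu m) := by
    intro n
    simp only [hA']
    exact integrable_finsetSum _ fun κ _ => hInt n κ
  have h1 : ∑ κ, (b κ * D.L σ η b + (2 * Real.pi)⁻¹ * D.L σ η (b + Pi.single κ 2)) =
      ∑ n ∈ Finset.range D.N,
        ∫ z : ℝ × (Fin m → ℝ), D.om σ n z.2 * A (D.sc n + z.1) z.2 ∂(mu m) := by
    simp only [L, Finset.mul_sum, ← Finset.sum_add_distrib]
    rw [Finset.sum_comm]
    refine Finset.sum_congr rfl fun n _ => ?_
    simp only [hA']
    rw [integral_finsetSum]
    · refine Finset.sum_congr rfl fun κ _ => ?_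
      rw [integral_add ((D.integrable_om_mul_G σ hη1 b n).const_mul _)
        ((D.integrable_om_mul_G σ hη1 (b + Pi.single κ 2) n).const_mul _)]
      simp only [integral_const_mul]
    · exact fun κ _ => hInt n κ
  have hAc : ∀ p, Continuous fun r => A r p := by
    intro p
    have : ∀ b, Continuous fun r => D.G σ η b r p := fun b =>
      (D.continuous_G σ η b).comp (Continuous.prodMk_left p)
    rw [hA]
    fun_prop
  have hsc : ∀ n, D.sc n + 1 = D.sc (n + 1) := fun n => by simp [sc, add_assoc]
  have h2 : ∀ n, ∫ z : ℝ × (Fin m → ℝ), D.om σ n z.2 * A (D.sc n + z.1) z.2 ∂(mu m) =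
      ∫ p, D.om σ n p * (D.G σ η b (D.sc (n + 1)) p - D.G σ η b (D.sc n) p) := by
    intro n
    have h3 : ∫ z : ℝ × (Fin m → ℝ), D.om σ n z.2 * A (D.sc n + z.1) z.2 ∂(mu m) =
        ∫ p, ∫ θ in Set.Icc (0 : ℝ) 1, D.om σ n p * A (D.sc n + θ) p :=
      integral_prod_symm _ (hAint n)
    rw [h3]
    congr 1
    ext p
    rw [integral_const_mul, integral_Icc_eq_integral_Ioc,
      ← intervalIntegral.integral_of_le zero_le_one]
    congr 1
    rw [intervalIntegral.integral_comp_add_left (fun r => A r p), add_zero, hsc]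
    exact intervalIntegral.integral_eq_sub_of_hasDerivAt
      (fun r _ => D.hasDerivAt_G_scale σ η b r p) ((hAc p).intervalIntegrable _ _)
  have hG : ∀ n, Integrable fun p => D.om σ n p * D.G σ η b (D.sc n) p := fun n =>
    D.integrable_om_mul_G_right σ b n fun i => by linarith [hη i]
  have hscle : ∀ n i, D.sc n - 1 ≤ D.sc (n + 1) + η i := fun n i => by
    rw [← hsc]; linarith [hη i]
  have hG' : ∀ n, Integrable fun p => D.om σ n p * D.G σ η b (D.sc (n + 1)) p := fun n =>
    D.integrable_om_mul_G_right σ b n (hscle n)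
  have h3 : ∀ n, ∫ p, D.om σ n p * (D.G σ η b (D.sc (n + 1)) p - D.G σ η b (D.sc n) p) =
      ((∫ p, D.om σ (n + 1) p * D.G σ η b (D.sc (n + 1)) p) -
        ∫ p, D.om σ n p * D.G σ η b (D.sc n) p) -
      ∫ p, (D.om σ (n + 1) p - D.om σ n p) * D.G σ η b (D.sc (n + 1)) p := by
    intro n
    simp only [mul_sub, sub_mul]
    rw [integral_sub (hG' n) (hG n), integral_sub (hG (n + 1)) (hG' n)]
    ring
  have hend : ∀ n, |∫ p, D.om σ n p * D.G σ η b (D.sc n) p| ≤ scaleC b C₀ * D.I := by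
    intro n
    rw [← Real.norm_eq_abs]
    refine (norm_integral_le_of_norm_le ((D.integrable_exp n).const_mul (scaleC b C₀))
      (Filter.Eventually.of_forall fun p =>
        D.abs_om_mul_G_le σ b n p fun i => by linarith [hη i])).trans ?_
    rw [integral_const_mul]
    exact mul_le_mul_of_nonneg_left (D.integral_exp_le n) (scaleC_nonneg _ _)
  set K := scaleC b C₀ * (2 * 2 ^ m * Real.exp (2 * 2 ^ m * C₀)) with hK
  have hK0 : 0 ≤ K := mul_nonneg (scaleC_nonneg _ _) (by positivity)
  have hmid : ∀ n, |∫ p, (D.om σ (n + 1) p - D.om σ n p) * D.G σ η b (D.sc (n + 1)) p| ≤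
      K * ∫ p, Real.exp (∑ j, D.β j n p) * D.e n p := by
    intro n
    rw [← Real.norm_eq_abs, ← integral_const_mul]
    refine norm_integral_le_of_norm_le ((D.integrable_exp_mul n).const_mul K)
      (Filter.Eventually.of_forall fun p => ?_)
    rw [Real.norm_eq_abs, abs_mul]
    refine (mul_le_mul (D.abs_om_succ_sub_le σ n p) (D.abs_G_le σ b n p (hscle n))
      (abs_nonneg _) ((abs_nonneg _).trans (D.abs_om_succ_sub_le σ n p))).trans (le_of_eq ?_)
    have := D.om_mul_exp σ n p
    rw [lam] at this
    rw [← this, hK]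
    ring
  rw [h1, Finset.sum_congr rfl fun n _ => (h2 n).trans (h3 n), Finset.sum_sub_distrib,
    Finset.sum_range_sub (fun n => ∫ p, D.om σ n p * D.G σ η b (D.sc n) p)]
  refine (abs_sub _ _).trans ?_
  have h4 := (Finset.abs_sum_le_sum_abs (fun n =>
    ∫ p, (D.om σ (n + 1) p - D.om σ n p) * D.G σ η b (D.sc (n + 1)) p) (Finset.range D.N)).trans
    (Finset.sum_le_sum fun n _ => hmid n)
  rw [← Finset.mul_sum] at h4
  have h5 := mul_le_mul_of_nonneg_left D.sum_integral_le hK0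
  have h6 := (abs_sub (∫ p, D.om σ D.N p * D.G σ η b (D.sc D.N) p)
    (∫ p, D.om σ 0 p * D.G σ η b (D.sc 0) p)).trans (add_le_add (hend _) (hend _))
  calc _ ≤ (scaleC b C₀ * D.I + scaleC b C₀ * D.I) + K * D.I := add_le_add h6 (h4.trans h5)
    _ = _ := by rw [hK]; ring

/-- Differentiation of the multi-scale form in the relative scales. -/
theorem hasDerivAt_L {η χ : Fin m → ℝ} (hχ : ∀ i, |χ i| ≤ 1) {t : ℝ}
    (hη : ∀ i, 0 ≤ (η + t • χ) i) (b : Fin m × Fin 2 → ℕ) :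
    HasDerivAt (fun t : ℝ => D.L σ (η + t • χ) b)
      (∑ κ, χ κ.1 * (b κ * D.L σ (η + t • χ) b +
        (2 * Real.pi)⁻¹ * D.L σ (η + t • χ) (b + Pi.single κ 2))) t := by
  have hball : ∀ s ∈ Metric.ball t 1, ∀ i, -1 ≤ (η + s • χ) i := by
    intro s hs i
    have h1 := hη i
    have h2 : |(s - t) * χ i| ≤ 1 := by
      rw [abs_mul]
      exact mul_le_one₀ (by simpa [Real.dist_eq] using (Metric.mem_ball.1 hs).le)
        (abs_nonneg _) (hχ i)
    simp only [Pi.add_apply, Pi.smul_apply, smul_eq_mul] at h1 ⊢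
    have := (abs_le.1 h2).1
    nlinarith
  have hη1 := hball t (Metric.mem_ball_self one_pos)
  set A : ℕ → ℝ → ℝ × (Fin m → ℝ) → ℝ := fun n s z =>
    ∑ κ, χ κ.1 * (b κ * (D.om σ n z.2 * D.G σ (η + s • χ) b (D.sc n + z.1) z.2) +
        (2 * Real.pi)⁻¹ *
          (D.om σ n z.2 * D.G σ (η + s • χ) (b + Pi.single κ 2) (D.sc n + z.1) z.2)) with hA
  have hderiv : ∀ n s (z : ℝ × (Fin m → ℝ)), HasDerivAt
      (fun s : ℝ => D.om σ n z.2 * D.G σ (η + s • χ) b (D.sc n + z.1) z.2) (A n s z) s := by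
    intro n s z
    refine ((D.hasDerivAt_G σ η χ b (D.sc n + z.1) s z.2).const_mul (D.om σ n z.2)).congr_deriv ?_
    rw [hA]
    simp only [Finset.mul_sum]
    exact Finset.sum_congr rfl fun κ _ => by ring
  have hInt : ∀ n κ, Integrable (fun z : ℝ × (Fin m → ℝ) =>
      b κ * (D.om σ n z.2 * D.G σ (η + t • χ) b (D.sc n + z.1) z.2) +
        (2 * Real.pi)⁻¹ *
          (D.om σ n z.2 * D.G σ (η + t • χ) (b + Pi.single κ 2) (D.sc n + z.1) z.2))
      (mu m) := fun n κ => ((D.integrable_om_mul_G σ hη1 b n).const_mul _).add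
        ((D.integrable_om_mul_G σ hη1 (b + Pi.single κ 2) n).const_mul _)
  have hAval : ∀ n, ∫ z, A n t z ∂(mu m) = ∑ κ, χ κ.1 * (b κ *
      (∫ z : ℝ × (Fin m → ℝ), D.om σ n z.2 * D.G σ (η + t • χ) b (D.sc n + z.1) z.2 ∂(mu m)) +
      (2 * Real.pi)⁻¹ * ∫ z : ℝ × (Fin m → ℝ), D.om σ n z.2 *
        D.G σ (η + t • χ) (b + Pi.single κ 2) (D.sc n + z.1) z.2 ∂(mu m)) := by
    intro n
    rw [hA]
    rw [integral_finsetSum]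
    · refine Finset.sum_congr rfl fun κ _ => ?_
      rw [integral_const_mul, integral_add ((D.integrable_om_mul_G σ hη1 b n).const_mul _)
        ((D.integrable_om_mul_G σ hη1 (b + Pi.single κ 2) n).const_mul _)]
      simp only [integral_const_mul]
    · exact fun κ _ => (hInt n κ).const_mul _
  set K := ∑ κ, (b κ * scaleC b C₀ + (2 * Real.pi)⁻¹ * scaleC (b + Pi.single κ 2) C₀) with hK
  have hbd : ∀ n, ∀ᵐ z ∂(mu m), ∀ s ∈ Metric.ball t 1,
      ‖A n s z‖ ≤ K * Real.exp (D.lam n z.2) := by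
    intro n
    filter_upwards [ae_mem_mu] with z hz s hs
    rw [hA, hK, Finset.sum_mul]
    refine (norm_sum_le _ _).trans (Finset.sum_le_sum fun κ _ => ?_)
    have hb : ∀ b, |D.om σ n z.2 * D.G σ (η + s • χ) b (D.sc n + z.1) z.2| ≤
        scaleC b C₀ * Real.exp (D.lam n z.2) := fun b =>
      D.abs_om_mul_G_le σ b n z.2 fun i => by linarith [hball s hs i, hz.1]
    rw [Real.norm_eq_abs, abs_mul]
    refine (mul_le_of_le_one_left (abs_nonneg _) (hχ _)).trans ?_
    refine (abs_add_le _ _).trans ?_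
    rw [add_mul]
    refine add_le_add ?_ ?_
    · rw [abs_mul, Nat.abs_cast, mul_assoc]; exact mul_le_mul_of_nonneg_left (hb _) (by positivity)
    · rw [abs_mul, abs_of_pos (a := (2 * Real.pi)⁻¹) (by positivity), mul_assoc]
      exact mul_le_mul_of_nonneg_left (hb _) (by positivity)
  have hAm : ∀ n, Continuous (A n t) := by
    intro n
    have := fun b => D.continuous_om_mul_G σ (η + t • χ) b n
    rw [hA]
    fun_prop
  have main : ∀ n, HasDerivAt (fun t : ℝ => ∫ z : ℝ × (Fin m → ℝ),
      D.om σ n z.2 * D.G σ (η + t • χ) b (D.sc n + z.1) z.2 ∂(mu m))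
      (∫ z, A n t z ∂(mu m)) t := fun n =>
    (hasDerivAt_integral_of_dominated_loc_of_deriv_le (Metric.ball_mem_nhds t one_pos)
      (Filter.Eventually.of_forall fun s =>
        (D.continuous_om_mul_G σ (η + s • χ) b n).aestronglyMeasurable)
      (D.integrable_om_mul_G σ hη1 b n) (hAm n).aestronglyMeasurable (hbd n)
      (integrable_comp_snd_mu ((D.integrable_exp n).const_mul K))
      (Filter.Eventually.of_forall fun z s _ => hderiv n s z)).2
  refine (HasDerivAt.fun_sum (u := Finset.range D.N) fun n _ => main n).congr_deriv ?_
  simp only [hAval, L]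
  rw [Finset.sum_comm]
  refine Finset.sum_congr rfl fun κ _ => ?_
  simp only [Finset.mul_sum, ← Finset.sum_add_distrib]

end ScaleData
end SBL

namespace SBL

/-- The multi-index which equals `a` on both sides of the coordinate `l` and vanishes elsewhere. -/
def pairB {m : ℕ} (l : Fin m) (a : ℕ) : Fin m × Fin 2 → ℕ := fun κ => if κ.1 = l then a else 0

theorem sum_update_add_sum_update {m : ℕ} (l : Fin m) (f : Corner m → ℝ) :
    ∑ ε, ∑ j : Corner m, f (Function.update j l ε) = 2 * ∑ j : Corner m, f j := by
  have hinv : Function.Involutive fun j : Corner m => Function.update j l (1 - j l) := by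
    intro j
    ext i
    by_cases h : i = l
    · subst h; simp
    · simp [h]
  have h1 : ∑ j : Corner m, f (Function.update j l (1 - j l)) = ∑ j, f j :=
    Equiv.sum_comp hinv.toPerm f
  rw [Finset.sum_comm, two_mul]
  nth_rewrite 2 [← h1]
  rw [← Finset.sum_add_distrib]
  refine Finset.sum_congr rfl fun j _ => ?_
  have h2 : f j = f (Function.update j l (j l)) := by simp
  rw [Fin.sum_univ_two, h2]
  rcases Fin.exists_fin_two.1 ⟨j l, rfl⟩ with h | h <;> simp [h, add_comm]

namespace ScaleData

variable {m : ℕ} {C₀ : ℝ} (D : ScaleData m C₀) (σ : Fin m → Fin 2 → Fin 2)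

/-- The state obtained from `σ` by freezing the coordinate `l` at the value of the side `ε`. -/
def freeze (l : Fin m) (ε : Fin 2) : Fin m → Fin 2 → Fin 2 := Function.update σ l fun _ => σ l ε

theorem act_freeze (l : Fin m) (ε : Fin 2) (j : Corner m) :
    act (freeze σ l ε) j = act σ (Function.update j l ε) := by
  ext i
  by_cases h : i = l
  · subst h; simp [act, freeze]
  · simp [act, freeze, h]

theorem sum_lamS_freeze (l : Fin m) (n : ℕ) (p : Fin m → ℝ) :
    ∑ ε, D.lamS (freeze σ l ε) n p = 2 * D.lamS σ n p := by
  simp only [lamS, act_freeze]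
  exact sum_update_add_sum_update l fun j => D.β (act σ j) n p

/-- The relative scales after an application of the Cauchy--Schwarz inequality. -/
def shiftη (η : Fin m → ℝ) (l : Fin m) : Fin m → ℝ :=
  fun i => if i = l then η i else η i + Real.log 2

/-- The constant in the Cauchy--Schwarz inequality. -/
def csC (b : Fin m × Fin 2 → ℕ) : ℝ := ∏ κ, max 1 (2 * hermC (b κ))

theorem csC_nonneg (b : Fin m × Fin 2 → ℕ) : 0 ≤ csC b :=
  Finset.prod_nonneg fun _ _ => zero_le_one.trans (le_max_left _ _)

theorem G_pairB_nonneg {l : Fin m} (hl : σ l 0 = σ l 1) (η : Fin m → ℝ) (a : ℕ) (r : ℝ)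
    (p : Fin m → ℝ) : 0 ≤ D.G σ η (pairB l a) r p := by
  have hcont : ∀ b c s, Continuous (hermS b c s) := fun b c s =>
    (continuous_hermS b).comp (f := fun y : ℝ => (c, s, y)) (by fun_prop)
  have hl' : ∀ ε ε', σ l ε = σ l ε' := by
    intro ε ε'
    fin_cases ε <;> fin_cases ε' <;> simp [hl]
  refine gform_nonneg (l := l) (fun _ => D.continuous_F _)
    (fun _ => D.hasCompactSupport_F _) (fun κ => hcont _ _ _) ?_ ?_ ?_
  · intro j ε'
    have : act σ (Function.update j l ε') = act σ j := by
      ext i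
      by_cases h : i = l
      · subst h; simp [act, hl' ε' (j i)]
      · simp [act, h]
    change D.F (act σ (Function.update j l ε')) = D.F (act σ j)
    rw [this]
  · simp [JS, pairB, hl]
  · intro κ hκ y
    simp only [pairB, if_neg hκ]
    exact (hermS_zero_pos _ _ _).le

theorem abs_om_mul_G_le_freeze (η : Fin m → ℝ) (b : Fin m × Fin 2 → ℕ) (l : Fin m)
    (n : ℕ) (r : ℝ) (p : Fin m → ℝ) :
    |D.om σ n p * D.G σ η b r p| ≤ csC b * ∑ ε, D.om (freeze σ l ε) n p *
      D.G (freeze σ l ε) (shiftη η l) (pairB l (b (l, ε))) r p := by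
  set w : Fin m × Fin 2 → ℝ → ℝ := fun κ => hermS (b κ) (D.JS σ κ p) (r + η κ.1) with hw
  set W : Fin m × Fin 2 → ℝ → ℝ := fun κ y => max 1 (2 * hermC (b κ)) *
    hermS 0 (D.JS σ κ p) (r + shiftη η l κ.1) y with hW
  have hcont : ∀ b c s, Continuous (hermS b c s) := fun b c s =>
    (continuous_hermS b).comp (f := fun y : ℝ => (c, s, y)) (by fun_prop)
  have hwc : ∀ κ, Continuous (w κ) := fun κ => hcont _ _ _
  have hWc : ∀ κ, Continuous (W κ) := fun κ => continuous_const.mul (hcont _ _ _)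
  have hle : ∀ κ : Fin m × Fin 2, κ.1 ≠ l → ∀ y, |w κ y| ≤ W κ y := by
    intro κ hκ y
    refine (abs_hermS_le _ _ _ _).trans ?_
    simp only [hW, shiftη, if_neg hκ, ← add_assoc]
    exact mul_le_mul_of_nonneg_right (le_max_right _ _) (hermS_zero_pos _ _ _).le
  set a : Fin 2 → ℝ := fun ε => Real.exp ((D.lam n p - D.lamS (freeze σ l ε) n p) / 2) with ha
  have ha2 : ∀ ε, a ε ^ 2 = D.om (freeze σ l ε) n p := by
    intro ε
    rw [ha, om, sq]
    simp only
    rw [← Real.exp_add]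
    congr 1
    ring
  have hprod : ∏ ε, a ε = D.om σ n p := by
    rw [ha, om, ← Real.exp_sum]
    congr 1
    rw [← Finset.sum_div, Finset.sum_sub_distrib, sum_lamS_freeze]
    simp
    ring
  have key := mul_abs_gform_le (F := D.FS σ) (fun _ => D.continuous_F _)
    (fun _ => D.hasCompactSupport_F _) hwc hWc hle (a := a) (fun ε => (Real.exp_pos _).le)
  rw [hprod] at key
  have hfr : ∀ ε, freezeF (D.FS σ) l ε = D.FS (freeze σ l ε) := by
    intro ε
    funext j
    simp only [freezeF, FS, act_freeze]
  have hJ : ∀ ε κ, D.JS (freeze σ l ε) κ = if κ.1 = l then D.JS σ (l, ε) else D.JS σ κ := by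
    intro ε κ
    by_cases h : κ.1 = l
    · simp [JS, freeze, h]
    · simp [JS, freeze, h]
  set Q := ∏ κ : Fin m × Fin 2, if κ.1 = l then 1 else max 1 (2 * hermC (b κ)) with hQ
  have hg : ∀ ε, gform (cornerProd (freezeF (D.FS σ) l ε))
      (fun κ => if κ.1 = l then w (l, ε) else W κ) =
      Q * D.G (freeze σ l ε) (shiftη η l) (pairB l (b (l, ε))) r p := by
    intro ε
    rw [hfr, G, hform, gform, gform, ← integral_const_mul]
    congr 1
    funext x
    rw [mul_left_comm, hQ, ← Finset.prod_mul_distrib]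
    congr 1
    refine Finset.prod_congr rfl fun κ _ => ?_
    by_cases h : κ.1 = l
    · simp [h, hw, hJ, shiftη, pairB]
    · simp [h, hW, hJ, shiftη, pairB]
  have hQle : Q ≤ csC b := by
    refine Finset.prod_le_prod (fun κ _ => ?_) fun κ _ => ?_
    · split_ifs <;> simp
    · split_ifs <;> simp
  have hpos : 0 ≤ ∑ ε, D.om (freeze σ l ε) n p *
      D.G (freeze σ l ε) (shiftη η l) (pairB l (b (l, ε))) r p := by
    exact Finset.sum_nonneg fun ε _ => mul_nonneg (D.om_pos _ _ _).le
      (D.G_pairB_nonneg _ (by simp [freeze]) _ _ _ _)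
  rw [abs_mul, abs_of_pos (D.om_pos σ n p)]
  refine (key.trans (le_of_eq ?_)).trans (mul_le_mul_of_nonneg_right hQle hpos)
  rw [Finset.mul_sum]
  refine Finset.sum_congr rfl fun ε _ => ?_
  rw [ha2, hg]
  ring

/-- The Cauchy--Schwarz inequality for the multi-scale form. -/
theorem abs_L_le_freeze {η : Fin m → ℝ} (hη : ∀ i, 0 ≤ η i) (b : Fin m × Fin 2 → ℕ)
    (l : Fin m) :
    |D.L σ η b| ≤ csC b * ∑ ε, D.L (freeze σ l ε) (shiftη η l) (pairB l (b (l, ε))) := by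
  have hη1 : ∀ i, -1 ≤ η i := fun i => by linarith [hη i]
  have hη' : ∀ i, -1 ≤ shiftη η l i := fun i => by
    have := Real.log_nonneg (x := 2) (by norm_num)
    unfold shiftη
    split_ifs <;> linarith [hη i]
  have hInt := fun n ε =>
    D.integrable_om_mul_G (freeze σ l ε) hη' (pairB l (b (l, ε))) n
  simp only [L]
  rw [Finset.sum_comm, Finset.mul_sum]
  refine (Finset.abs_sum_le_sum_abs _ _).trans (Finset.sum_le_sum fun n _ => ?_)
  rw [← integral_finsetSum _ fun ε _ => hInt n ε, ← integral_const_mul]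
  refine abs_integral_le_integral_abs.trans (integral_mono (D.integrable_om_mul_G σ hη1 b n).abs
    ((integrable_finsetSum _ fun ε _ => hInt n ε).const_mul _) fun z => ?_)
  exact D.abs_om_mul_G_le_freeze σ η b l n _ _

theorem L_pairB_nonneg {l : Fin m} (hl : σ l 0 = σ l 1) (η : Fin m → ℝ) (a : ℕ) :
    0 ≤ D.L σ η (pairB l a) :=
  Finset.sum_nonneg fun _ _ => integral_nonneg fun _ =>
    mul_nonneg (D.om_pos _ _ _).le (D.G_pairB_nonneg σ hl η a _ _)

end ScaleData
end SBL

namespace SBL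
namespace ScaleData

variable {m : ℕ} {C₀ : ℝ} {σ : Fin m → Fin 2 → Fin 2}

/-! ### The inductive estimate for the multi-scale forms -/

/-- Admissible relative scales for the state `σ`: coordinates which are not frozen carry the
largest relative scale `ρ`. -/
def Adm (σ : Fin m → Fin 2 → Fin 2) (η : Fin m → ℝ) (ρ : ℝ) : Prop :=
  (∀ i, 0 ≤ η i ∧ η i ≤ ρ) ∧ ∀ l, σ l 0 ≠ σ l 1 → η l = ρ

/-- Quantities which are `O(exp ρ * I)` uniformly in the data. -/
def Bdd (σ : Fin m → Fin 2 → Fin 2) (f : ScaleData m C₀ → (Fin m → ℝ) → ℝ → ℝ) : Prop :=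
  ∃ C : ℝ, 0 ≤ C ∧ ∀ D η ρ, Adm σ η ρ → |f D η ρ| ≤ C * Real.exp ρ * D.I

theorem Bdd.add {f g : ScaleData m C₀ → (Fin m → ℝ) → ℝ → ℝ} (hf : Bdd σ f) (hg : Bdd σ g) :
    Bdd σ fun D η ρ => f D η ρ + g D η ρ := by
  obtain ⟨A, hA, hf⟩ := hf
  obtain ⟨B, hB, hg⟩ := hg
  refine ⟨A + B, add_nonneg hA hB, fun D η ρ h => (abs_add_le _ _).trans ?_⟩
  rw [add_mul, add_mul]
  exact add_le_add (hf D η ρ h) (hg D η ρ h)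

theorem Bdd.mul {f : ScaleData m C₀ → (Fin m → ℝ) → ℝ → ℝ} (hf : Bdd σ f) {K : ℝ}
    {c : ScaleData m C₀ → (Fin m → ℝ) → ℝ → ℝ} (hc : ∀ D η ρ, Adm σ η ρ → |c D η ρ| ≤ K) :
    Bdd σ fun D η ρ => c D η ρ * f D η ρ := by
  obtain ⟨A, hA, hf⟩ := hf
  refine ⟨|K| * A, mul_nonneg (abs_nonneg _) hA, fun D η ρ h => ?_⟩
  rw [abs_mul, mul_assoc, mul_assoc, ← mul_assoc A]
  exact mul_le_mul ((hc D η ρ h).trans (le_abs_self K)) (hf D η ρ h) (abs_nonneg _) (abs_nonneg _)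

theorem Bdd.const_mul {f : ScaleData m C₀ → (Fin m → ℝ) → ℝ → ℝ} (hf : Bdd σ f) (k : ℝ) :
    Bdd σ fun D η ρ => k * f D η ρ :=
  hf.mul fun _ _ _ _ => le_refl |k|

theorem Bdd.sub {f g : ScaleData m C₀ → (Fin m → ℝ) → ℝ → ℝ} (hf : Bdd σ f) (hg : Bdd σ g) :
    Bdd σ fun D η ρ => f D η ρ - g D η ρ := by
  simpa [sub_eq_add_neg] using hf.add (hg.const_mul (-1))

theorem Bdd.zero : Bdd σ fun (_ : ScaleData m C₀) _ _ => (0 : ℝ) :=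
  ⟨0, le_rfl, fun _ _ _ _ => by simp⟩

theorem Bdd.sum {ι : Type*} (s : Finset ι) {f : ι → ScaleData m C₀ → (Fin m → ℝ) → ℝ → ℝ}
    (hf : ∀ i ∈ s, Bdd σ (f i)) : Bdd σ fun D η ρ => ∑ i ∈ s, f i D η ρ := by
  classical
  induction s using Finset.induction_on with
  | empty => simpa using Bdd.zero
  | insert i s hi ih =>
    simp only [Finset.sum_insert hi]
    exact (hf i (Finset.mem_insert_self i s)).add
      (ih fun k hk => hf k (Finset.mem_insert_of_mem hk))

theorem Bdd.of_le {f g : ScaleData m C₀ → (Fin m → ℝ) → ℝ → ℝ} (hg : Bdd σ g)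
    (h : ∀ D η ρ, Adm σ η ρ → |f D η ρ| ≤ |g D η ρ|) : Bdd σ f := by
  obtain ⟨A, hA, hg⟩ := hg
  exact ⟨A, hA, fun D η ρ ha => (h D η ρ ha).trans (hg D η ρ ha)⟩

/-- The desired bound for the multi-scale form. -/
def UB (C₀ : ℝ) (σ : Fin m → Fin 2 → Fin 2) (b : Fin m × Fin 2 → ℕ) : Prop :=
  Bdd σ fun (D : ScaleData m C₀) η _ => D.L σ η b

theorem Adm.exp_sub_le {η : Fin m → ℝ} {ρ : ℝ} (h : Adm σ η ρ) (i : Fin m) :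
    |Real.exp (η i - ρ)| ≤ 1 := by
  rw [Real.abs_exp, Real.exp_le_one_iff]
  linarith [(h.1 i).2]

theorem eq_one_sub_of_ne {δ ε : Fin 2} (h : δ ≠ ε) : δ = 1 - ε := by
  revert δ ε
  decide

theorem sum_fin_two_eq (ε : Fin 2) (f : Fin 2 → ℝ) : ∑ δ, f δ = f ε + f (1 - ε) := by
  rw [Fin.sum_univ_two]
  rcases Fin.exists_fin_two.1 ⟨ε, rfl⟩ with h | h <;> simp [h, add_comm]

/-- The linear relations between the forms which come from translation invariance. -/
theorem exists_relation (σ : Fin m → Fin 2 → Fin 2) (ε : Corner m) (i : Fin m) :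
    ∃ c : ScaleData m C₀ → Fin m → ℝ, (∀ D l, |c D l| ≤ C₀ ^ 2) ∧
      ∀ b : Fin m × Fin 2 → ℕ, Bdd σ fun D η ρ =>
        (D.L σ η (b + Pi.single (i, ε i) 1) +
          if σ i 0 = σ i 1 then D.L σ η (b + Pi.single (i, 1 - ε i) 1) else 0) +
        Real.exp (η i - ρ) * ∑ l, if σ l 0 = σ l 1 then 0 else
          c D l * D.L σ η (b + Pi.single (l, 1 - ε l) 1) := by
  choose v hv1 hv2 using fun D : ScaleData m C₀ => D.exists_dual (act σ ε) i
  have hC : ∀ D : ScaleData m C₀, 0 ≤ C₀ := fun D => zero_le_one.trans D.one_le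
  refine ⟨fun D l => D.JS σ (l, 1 - ε l) (v D), fun D l => ?_, fun b => ?_⟩
  · refine (D.abs_J_le _ _).trans ?_
    rw [sq]
    exact mul_le_mul_of_nonneg_left (hv1 D) (hC D)
  refine ⟨Real.exp 1 * (2 * 2 ^ m) * scaleC b C₀ * |C₀|,
    mul_nonneg (mul_nonneg (by positivity) (scaleC_nonneg _ _)) (abs_nonneg _),
    fun D η ρ h => ?_⟩
  have key := D.abs_sum_JS_mul_L_le σ (fun i => (h.1 i).1) b (v D)
  have hJ : ∀ l, D.JS σ (l, ε l) (v D) = if l = i then 1 else 0 := fun l => hv2 D l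
  have hJ' : ∀ l, σ l 0 = σ l 1 → D.JS σ (l, 1 - ε l) (v D) = if l = i then 1 else 0 := by
    intro l hl
    rw [← hJ l]
    have : σ l (1 - ε l) = σ l (ε l) := by
      rcases Fin.exists_fin_two.1 ⟨ε l, rfl⟩ with h | h <;> simp [h, hl]
    simp [JS, this]
  have hsum : Real.exp (η i) * ∑ κ : Fin m × Fin 2, D.JS σ κ (v D) * Real.exp (-η κ.1) *
      D.L σ η (b + Pi.single κ 1) = (D.L σ η (b + Pi.single (i, ε i) 1) +
          if σ i 0 = σ i 1 then D.L σ η (b + Pi.single (i, 1 - ε i) 1) else 0) +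
        Real.exp (η i - ρ) * ∑ l, if σ l 0 = σ l 1 then 0 else
          D.JS σ (l, 1 - ε l) (v D) * D.L σ η (b + Pi.single (l, 1 - ε l) 1) := by
    rw [Fintype.sum_prod_type]
    simp only [fun l => sum_fin_two_eq (ε l) (fun δ => D.JS σ (l, δ) (v D) * Real.exp (-η l) *
      D.L σ η (b + Pi.single (l, δ) 1))]
    have h1 : ∀ l, D.JS σ (l, ε l) (v D) * Real.exp (-η l) *
        D.L σ η (b + Pi.single (l, ε l) 1) + D.JS σ (l, 1 - ε l) (v D) * Real.exp (-η l) *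
        D.L σ η (b + Pi.single (l, 1 - ε l) 1) =
        (if l = i then Real.exp (-η i) * (D.L σ η (b + Pi.single (i, ε i) 1) +
          if σ i 0 = σ i 1 then D.L σ η (b + Pi.single (i, 1 - ε i) 1) else 0) else 0) +
        Real.exp (-ρ) * if σ l 0 = σ l 1 then 0 else
          D.JS σ (l, 1 - ε l) (v D) * D.L σ η (b + Pi.single (l, 1 - ε l) 1) := by
      intro l
      rw [hJ l]
      by_cases hl : σ l 0 = σ l 1
      · rw [hJ' l hl]
        by_cases hli : l = i
        · subst hli; simp [hl]; ring
        · simp [hl, hli]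
      · rw [h.2 l hl]
        by_cases hli : l = i
        · subst hli; simp [hl, h.2 l hl]; ring
        · simp [hl, hli]; ring
    simp only [h1]
    rw [Finset.sum_add_distrib, ← Finset.mul_sum]
    simp only [Finset.sum_ite_eq', Finset.mem_univ, if_true]
    rw [mul_add, ← mul_assoc, ← mul_assoc, ← Real.exp_add, ← Real.exp_add]
    simp [sub_eq_add_neg]
  beta_reduce
  rw [← hsum, abs_mul, Real.abs_exp]
  have h2 : Real.exp (η i) ≤ Real.exp ρ := Real.exp_le_exp.2 (h.1 i).2
  have h3 : Real.exp 1 * (2 * 2 ^ m) * scaleC b C₀ * ‖v D‖ * D.I ≤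
      Real.exp 1 * (2 * 2 ^ m) * scaleC b C₀ * |C₀| * D.I := by
    refine mul_le_mul_of_nonneg_right (mul_le_mul_of_nonneg_left
      ((hv1 D).trans (le_abs_self _)) ?_) D.I_nonneg
    exact mul_nonneg (by positivity) (scaleC_nonneg _ _)
  refine (mul_le_mul h2 (key.trans h3) (abs_nonneg _) (Real.exp_pos _).le).trans (le_of_eq ?_)
  ring

/-- The degree of a multi-index in the coordinates which are not frozen. -/
def degF (σ : Fin m → Fin 2 → Fin 2) (b : Fin m × Fin 2 → ℕ) : ℕ :=
  ∑ κ : Fin m × Fin 2, if σ κ.1 0 = σ κ.1 1 then 0 else b κ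

theorem degF_add_single (σ : Fin m → Fin 2 → Fin 2) (b : Fin m × Fin 2 → ℕ)
    {κ : Fin m × Fin 2} (hκ : σ κ.1 0 ≠ σ κ.1 1) (a : ℕ) :
    degF σ (b + Pi.single κ a) = degF σ b + a := by
  have : ∀ κ' : Fin m × Fin 2, (if σ κ'.1 0 = σ κ'.1 1 then 0 else (b + Pi.single κ a : Fin m × Fin 2 → ℕ) κ') =
      (if σ κ'.1 0 = σ κ'.1 1 then 0 else b κ') + if κ' = κ then a else 0 := by
    intro κ'
    by_cases h : κ' = κ
    · subst h; simp [hκ]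
    · simp [h]
  unfold degF
  rw [Finset.sum_congr rfl fun κ' _ => this κ', Finset.sum_add_distrib]
  simp

theorem Adm.shiftη {η : Fin m → ℝ} {ρ : ℝ} (h : Adm σ η ρ) {σ' : Fin m → Fin 2 → Fin 2}
    (l : Fin m) (hl : σ' l 0 = σ' l 1) (hσ : ∀ i, i ≠ l → σ' i = σ i) :
    Adm σ' (shiftη η l) (ρ + Real.log 2) := by
  have h2 := Real.log_nonneg (x := 2) (by norm_num)
  refine ⟨fun i => ?_, fun i hi => ?_⟩
  · have := h.1 i
    unfold ScaleData.shiftη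
    split_ifs <;> constructor <;> linarith
  · have hil : i ≠ l := fun hil => hi (hil ▸ hl)
    rw [hσ i hil] at hi
    rw [ScaleData.shiftη, if_neg hil, h.2 i hi]

theorem UB.of_freeze (b : Fin m × Fin 2 → ℕ) (l : Fin m)
    (h : ∀ ε, UB C₀ (freeze σ l ε) (pairB l (b (l, ε)))) : UB C₀ σ b := by
  choose A hA h using h
  refine ⟨csC b * ∑ ε, A ε * 2, mul_nonneg (csC_nonneg b)
    (Finset.sum_nonneg fun ε _ => mul_nonneg (hA ε) zero_le_two), fun D η ρ ha => ?_⟩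
  refine (D.abs_L_le_freeze σ (fun i => (ha.1 i).1) b l).trans ?_
  rw [mul_assoc, mul_assoc]
  refine mul_le_mul_of_nonneg_left ?_ (csC_nonneg b)
  rw [Finset.sum_mul]
  refine Finset.sum_le_sum fun ε _ => ?_
  refine (le_abs_self _).trans ((h ε D _ _ (ha.shiftη l (by simp [freeze]) ?_)).trans
    (le_of_eq ?_))
  · intro i hi
    simp [freeze, hi]
  · rw [Real.exp_add, Real.exp_log two_pos]
    ring

theorem UB.of_high_degree
    (hX : ∀ l, σ l 0 ≠ σ l 1 → ∀ ε a, 1 ≤ a → UB C₀ (freeze σ l ε) (pairB l a)) (k : ℕ) :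
    ∀ b : Fin m × Fin 2 → ℕ, m + 1 ≤ degF σ b →
      (Finset.univ.filter fun l => b (l, 0) = 0 ∧ b (l, 1) = 0).card ≤ k → UB C₀ σ b := by
  have hpair : ∀ b : Fin m × Fin 2 → ℕ, ∀ l, σ l 0 ≠ σ l 1 → (∀ δ, 1 ≤ b (l, δ)) →
      UB C₀ σ b := fun b l hl hb => UB.of_freeze b l fun ε => hX l hl ε _ (hb ε)
  induction k using Nat.strong_induction_on with
  | _ k ih =>
  intro b hdeg hk
  by_cases hex : ∃ l, σ l 0 ≠ σ l 1 ∧ ∀ δ, 1 ≤ b (l, δ)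
  · obtain ⟨l, hl, hb⟩ := hex
    exact hpair b l hl hb
  push Not at hex
  set ε : Corner m := fun l => if b (l, 0) = 0 then 1 else 0 with hε
  have hε1 : ∀ l, σ l 0 ≠ σ l 1 → b (l, 1 - ε l) = 0 := by
    intro l hl
    obtain ⟨δ, hδ⟩ := hex l hl
    simp only [hε]
    by_cases h0 : b (l, 0) = 0
    · simp [h0]
    · fin_cases δ
      · simp at hδ; exact absurd hδ h0
      · simpa [h0] using hδ
  obtain ⟨l, hl⟩ : ∃ l, 1 < if σ l 0 = σ l 1 then 0 else b (l, ε l) := by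
    by_contra hcon
    push Not at hcon
    have h1 : degF σ b = ∑ l, if σ l 0 = σ l 1 then 0 else b (l, ε l) := by
      rw [degF, Fintype.sum_prod_type]
      refine Finset.sum_congr rfl fun l _ => ?_
      by_cases h : σ l 0 = σ l 1
      · simp [h]
      · have h2 := hε1 l h
        simp only [if_neg h, Fin.sum_univ_two]
        rcases Fin.exists_fin_two.1 ⟨ε l, rfl⟩ with h' | h' <;> rw [h'] at h2 ⊢ <;>
          simp at h2 <;> simp [h2]
    have h2 := Finset.sum_le_sum fun l (_ : l ∈ Finset.univ) => hcon l
    rw [← h1] at h2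
    simp at h2
    omega
  have hlS : σ l 0 ≠ σ l 1 := fun h => by simp [h] at hl
  rw [if_neg hlS] at hl
  set b' : Fin m × Fin 2 → ℕ := b - Pi.single (l, ε l) 1 with hb'
  have hbb : b = b' + Pi.single (l, ε l) 1 := by
    ext κ
    by_cases h : κ = (l, ε l)
    · subst h; simp [hb']; omega
    · simp [hb', h]
  have hb'pos : ∀ l', 1 ≤ b (l', ε l') → 1 ≤ b' (l', ε l') := by
    intro l' h
    by_cases h' : l' = l
    · subst h'; simp [hb']; omega
    · simpa [hb', h'] using h
  obtain ⟨c, hc, hrel⟩ := exists_relation (C₀ := C₀) σ ε l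
  have hrest : Bdd σ fun (D : ScaleData m C₀) η ρ => Real.exp (η l - ρ) * ∑ l', if σ l' 0 = σ l' 1
      then 0 else c D l' * D.L σ η (b' + Pi.single (l', 1 - ε l') 1) := by
    refine Bdd.mul (K := 1) ?_ fun D η ρ h => h.exp_sub_le l
    refine Bdd.sum _ fun l' _ => ?_
    by_cases hl' : σ l' 0 = σ l' 1
    · simpa [hl'] using Bdd.zero
    simp only [if_neg hl']
    refine Bdd.mul (K := C₀ ^ 2) (c := fun D _ _ => c D l') ?_ fun D _ _ _ => hc D l'
    by_cases hpos : 1 ≤ b (l', ε l')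
    · refine hpair _ l' hl' fun δ => ?_
      by_cases hδ : δ = ε l'
      · subst hδ
        exact (hb'pos l' hpos).trans (Nat.le_add_right _ _)
      · simp [eq_one_sub_of_ne hδ]
    · have hdeg' : m + 1 ≤ degF σ (b' + Pi.single (l', 1 - ε l') 1) := by
        rw [degF_add_single σ b' hl', ← degF_add_single σ b' (κ := (l, ε l)) hlS, ← hbb]
        exact hdeg
      have hzero : ∀ δ, b (l', δ) = 0 := by
        intro δ
        by_cases hδ : δ = ε l'
        · subst hδ; omega
        · rw [eq_one_sub_of_ne hδ]; exact hε1 l' hl'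
      have hcard : (Finset.univ.filter fun i =>
          (b' + Pi.single (l', 1 - ε l') 1 : Fin m × Fin 2 → ℕ) (i, 0) = 0 ∧
            (b' + Pi.single (l', 1 - ε l') 1 : Fin m × Fin 2 → ℕ) (i, 1) = 0).card <
          (Finset.univ.filter fun i => b (i, 0) = 0 ∧ b (i, 1) = 0).card := by
        refine Finset.card_lt_card ⟨fun i hi => ?_, fun hsub => ?_⟩
        · rw [Finset.mem_filter] at hi ⊢
          have hb'0 : ∀ δ, b' (i, δ) = 0 := by
            intro δ
            fin_cases δ
            · exact (Nat.add_eq_zero_iff.1 hi.2.1).1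
            · exact (Nat.add_eq_zero_iff.1 hi.2.2).1
          have hil : i ≠ l := by
            rintro rfl
            have := hb'pos i (by omega)
            rw [hb'0] at this
            omega
          have : ∀ δ, b (i, δ) = 0 := fun δ => by
            have := hb'0 δ
            simpa [hb', hil] using this
          exact ⟨Finset.mem_univ _, this 0, this 1⟩
        · have h1 : l' ∈ Finset.univ.filter fun i => b (i, 0) = 0 ∧ b (i, 1) = 0 := by
            simp [hzero]
          have h2 := (Finset.mem_filter.1 (hsub h1)).2
          rcases Fin.exists_fin_two.1 ⟨1 - ε l', rfl⟩ with h' | h' <;> simp [h'] at h2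
      exact ih _ (hcard.trans_le hk) _ hdeg' le_rfl
  have := (hrel b').sub hrest
  simp only [if_neg hlS, add_zero, add_sub_cancel_right, ← hbb] at this
  exact this

end ScaleData
end SBL

namespace SBL
namespace ScaleData

variable {m : ℕ} {C₀ : ℝ} {σ : Fin m → Fin 2 → Fin 2}

/-- The indicator function of the coordinates which are not frozen. -/
def freeInd (σ : Fin m → Fin 2 → Fin 2) : Fin m → ℝ := fun i => if σ i 0 = σ i 1 then 0 else 1

theorem sum_freeInd_mul (σ : Fin m → Fin 2 → Fin 2) (b : Fin m × Fin 2 → ℕ) :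
    ∑ κ : Fin m × Fin 2, freeInd σ κ.1 * (b κ : ℝ) = degF σ b := by
  rw [degF, Nat.cast_sum]
  refine Finset.sum_congr rfl fun κ _ => ?_
  unfold freeInd
  split_ifs <;> simp

theorem Adm.add_smul_freeInd {η : Fin m → ℝ} {ρ t : ℝ} (h : Adm σ η ρ) (ht : 0 ≤ t) :
    Adm σ (η + t • freeInd σ) (ρ + t) := by
  refine ⟨fun i => ?_, fun i hi => ?_⟩
  · have := h.1 i
    simp only [Pi.add_apply, Pi.smul_apply, freeInd, smul_eq_mul]
    split_ifs <;> constructor <;> linarith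
  · simp [freeInd, hi, h.2 i hi]

/-- Integration of the differential equation in the relative scale of the coordinates which are
not frozen. -/
theorem UB.of_add_two {b : Fin m × Fin 2 → ℕ} (hdeg : 2 ≤ degF σ b)
    (h : ∀ κ : Fin m × Fin 2, σ κ.1 0 ≠ σ κ.1 1 → UB C₀ σ (b + Pi.single κ 2)) :
    UB C₀ σ b := by
  have hB : Bdd σ fun (D : ScaleData m C₀) η _ =>
      ∑ κ : Fin m × Fin 2, freeInd σ κ.1 * ((2 * Real.pi)⁻¹ * D.L σ η (b + Pi.single κ 2)) := by
    refine Bdd.sum _ fun κ _ => ?_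
    by_cases hκ : σ κ.1 0 = σ κ.1 1
    · simpa [freeInd, hκ] using Bdd.zero
    · exact ((h κ hκ).const_mul _).const_mul _
  obtain ⟨K, hK, hB⟩ := hB
  refine ⟨K, hK, fun D η ρ ha => ?_⟩
  set d : ℝ := (degF σ b : ℝ) with hd
  have hd2 : (2 : ℝ) ≤ d := by rw [hd]; exact_mod_cast hdeg
  have hχ : ∀ i, |freeInd σ i| ≤ 1 := fun i => by unfold freeInd; split_ifs <;> simp
  set R : ℝ → ℝ := fun t => ∑ κ : Fin m × Fin 2, freeInd σ κ.1 *
    ((2 * Real.pi)⁻¹ * D.L σ (η + t • freeInd σ) (b + Pi.single κ 2)) with hR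
  set g : ℝ → ℝ := fun t => Real.exp (-d * t) * D.L σ (η + t • freeInd σ) b with hg
  have hderiv : ∀ t, 0 ≤ t → HasDerivAt g (Real.exp (-d * t) * R t) t := by
    intro t ht
    have h1 := D.hasDerivAt_L σ hχ (fun i => ((ha.add_smul_freeInd ht).1 i).1) b
    have h2 : HasDerivAt (fun t : ℝ => Real.exp (-d * t)) (Real.exp (-d * t) * (-d)) t := by
      have h3 : HasDerivAt (fun t : ℝ => -d * t) (-d) t := by
        simpa using (hasDerivAt_id t).const_mul (-d)
      exact h3.exp
    refine (h2.mul h1).congr_deriv ?_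
    have h4 : ∑ κ : Fin m × Fin 2, freeInd σ κ.1 * (b κ * D.L σ (η + t • freeInd σ) b +
        (2 * Real.pi)⁻¹ * D.L σ (η + t • freeInd σ) (b + Pi.single κ 2)) =
        d * D.L σ (η + t • freeInd σ) b + R t := by
      rw [hd, ← sum_freeInd_mul, Finset.sum_mul, hR, ← Finset.sum_add_distrib]
      exact Finset.sum_congr rfl fun κ _ => by ring
    rw [h4]
    ring
  set A : ℝ := K * Real.exp ρ * D.I with hA
  have hA0 : 0 ≤ A := mul_nonneg (mul_nonneg hK (Real.exp_pos _).le) D.I_nonneg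
  have hbound : ∀ t, 0 ≤ t → |Real.exp (-d * t) * R t| ≤ A * Real.exp (-t) := by
    intro t ht
    have h1 := hB D _ _ (ha.add_smul_freeInd ht)
    rw [abs_mul, Real.abs_exp]
    refine (mul_le_mul_of_nonneg_left h1 (Real.exp_pos _).le).trans ?_
    have h2 : Real.exp (-d * t) * (K * Real.exp (ρ + t) * D.I) =
        A * Real.exp (-d * t + t) := by
      rw [Real.exp_add, Real.exp_add, hA]; ring
    rw [h2]
    refine mul_le_mul_of_nonneg_left (Real.exp_le_exp.2 ?_) hA0
    nlinarith
  have hdiff : ∀ T, 0 ≤ T → |g T - g 0| ≤ A * (1 - Real.exp (-T)) := by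
    intro T hT
    refine image_norm_le_of_norm_deriv_right_le_deriv_boundary (a := 0) (b := T)
      (f := fun t => g t - g 0) (f' := fun t => Real.exp (-d * t) * R t)
      (B := fun t => A * (1 - Real.exp (-t))) (B' := fun t => A * Real.exp (-t)) ?_ ?_ ?_ ?_ ?_
      ⟨hT, le_rfl⟩
    · intro t ht
      exact ((hderiv t ht.1).continuousAt.sub continuousAt_const).continuousWithinAt
    · intro t ht
      exact ((hderiv t ht.1).sub_const _).hasDerivWithinAt
    · simp
    · intro t
      have h3 : HasDerivAt (fun t : ℝ => Real.exp (-t)) (-Real.exp (-t)) t := by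
        simpa using (hasDerivAt_neg t).exp
      exact ((h3.const_sub 1).const_mul A).congr_deriv (by ring)
    · intro t ht
      exact hbound t ht.1
  have hcrude : ∀ T, 0 ≤ T → |g T| ≤ Real.exp (-T) * (D.N * (scaleC b C₀ * D.I)) := by
    intro T hT
    rw [hg, abs_mul, Real.abs_exp]
    have h1 := D.abs_L_le σ (fun i => neg_one_lt_zero.le.trans
      ((ha.add_smul_freeInd hT).1 i).1) b
    refine mul_le_mul (Real.exp_le_exp.2 (by nlinarith)) h1 (abs_nonneg _) (Real.exp_pos _).le
  have hg0 : g 0 = D.L σ η b := by simp [hg]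
  have hall : ∀ T, 0 ≤ T → |D.L σ η b| ≤ Real.exp (-T) * (D.N * (scaleC b C₀ * D.I)) + A := by
    intro T hT
    rw [← hg0]
    have h1 := hdiff T hT
    have h2 := hcrude T hT
    have h3 : A * (1 - Real.exp (-T)) ≤ A := by
      nlinarith [Real.exp_pos (-T)]
    have h4 : |g 0| ≤ |g T - g 0| + |g T| := by
      rw [abs_sub_comm]
      simpa using abs_add_le (g 0 - g T) (g T)
    linarith
  have hlim : Filter.Tendsto (fun T : ℝ => Real.exp (-T) * (D.N * (scaleC b C₀ * D.I)) + A)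
      Filter.atTop (nhds (0 * (D.N * (scaleC b C₀ * D.I)) + A)) :=
    ((Real.tendsto_exp_neg_atTop_nhds_zero).mul_const _).add_const A
  rw [zero_mul, zero_add] at hlim
  refine ge_of_tendsto hlim ?_
  filter_upwards [Filter.eventually_ge_atTop 0] with T hT using hall T hT

theorem UB.of_two_le_degF
    (hX : ∀ l, σ l 0 ≠ σ l 1 → ∀ ε a, 1 ≤ a → UB C₀ (freeze σ l ε) (pairB l a)) (k : ℕ) :
    ∀ b : Fin m × Fin 2 → ℕ, 2 ≤ degF σ b → m + 1 ≤ degF σ b + k → UB C₀ σ b := by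
  induction k with
  | zero =>
    intro b _ hb
    refine UB.of_high_degree hX m b hb ?_
    exact (Finset.card_le_univ _).trans (by simp)
  | succ k ih =>
    intro b h2 hb
    refine UB.of_add_two h2 fun κ hκ => ih _ ?_ ?_ <;> rw [degF_add_single σ b hκ] <;> omega

/-- The second-order relation at a frozen coordinate. -/
theorem bdd_square (hX : ∀ l, σ l 0 ≠ σ l 1 → ∀ ε a, 1 ≤ a → UB C₀ (freeze σ l ε) (pairB l a))
    {i : Fin m} (hi : σ i 0 = σ i 1) (b : Fin m × Fin 2 → ℕ) :
    Bdd σ fun (D : ScaleData m C₀) η _ => D.L σ η (b + Pi.single (i, 0) 2) +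
      2 * D.L σ η (b + Pi.single (i, 0) 1 + Pi.single (i, 1) 1) +
      D.L σ η (b + Pi.single (i, 1) 2) := by
  obtain ⟨c, hc, hrel⟩ := exists_relation (C₀ := C₀) σ 0 i
  simp only [hi, if_true, Pi.zero_apply, sub_zero] at hrel
  have hinner : Bdd σ fun (D : ScaleData m C₀) η ρ => Real.exp (η i - ρ) * ∑ l,
      if σ l 0 = σ l 1 then 0 else c D l *
        (D.L σ η (b + Pi.single (i, 0) 1 + Pi.single (l, 1) 1) +
          D.L σ η (b + Pi.single (i, 1) 1 + Pi.single (l, 1) 1)) := by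
    refine Bdd.mul (K := 1) ?_ fun D η ρ h => h.exp_sub_le i
    refine Bdd.sum _ fun l _ => ?_
    by_cases hl : σ l 0 = σ l 1
    · simpa [hl] using Bdd.zero
    simp only [if_neg hl]
    refine Bdd.mul (K := C₀ ^ 2) (c := fun D _ _ => c D l) ?_ fun D _ _ _ => hc D l
    have h1 := hrel (b + Pi.single (l, 1) 1)
    have h2 : Bdd σ fun (D : ScaleData m C₀) η ρ => Real.exp (η i - ρ) * ∑ l',
        if σ l' 0 = σ l' 1 then 0 else
          c D l' * D.L σ η (b + Pi.single (l, 1) 1 + Pi.single (l', 1) 1) := by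
      refine Bdd.mul (K := 1) ?_ fun D η ρ h => h.exp_sub_le i
      refine Bdd.sum _ fun l' _ => ?_
      by_cases hl' : σ l' 0 = σ l' 1
      · simpa [hl'] using Bdd.zero
      simp only [if_neg hl']
      refine Bdd.mul (K := C₀ ^ 2) (c := fun D _ _ => c D l') ?_ fun D _ _ _ => hc D l'
      refine UB.of_two_le_degF hX (m + 1) _ ?_ ?_ <;>
        rw [degF_add_single _ _ hl', degF_add_single _ _ hl] <;> omega
    have h3 := h1.sub h2
    simpa only [add_sub_cancel_right, add_right_comm b (Pi.single (l, 1) 1)] using h3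
  have h := ((hrel (b + Pi.single (i, 0) 1)).add (hrel (b + Pi.single (i, 1) 1))).sub hinner
  have e1 : ∀ ε : Fin 2, b + Pi.single (i, ε) 1 + Pi.single (i, ε) 1 =
      b + Pi.single (i, ε) 2 := fun ε => by rw [add_assoc, ← Pi.single_add]
  have e2 : b + Pi.single (i, 1) 1 + Pi.single (i, 0) 1 =
      b + Pi.single (i, 0) 1 + Pi.single (i, 1) 1 := add_right_comm _ _ _
  refine h.of_le fun D η ρ _ => le_of_eq (congrArg _ ?_)
  simp only [e1, e2]
  have e3 : ∀ l, (if σ l 0 = σ l 1 then 0 else c D l *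
        (D.L σ η (b + Pi.single (i, 0) 1 + Pi.single (l, 1) 1) +
          D.L σ η (b + Pi.single (i, 1) 1 + Pi.single (l, 1) 1))) =
      (if σ l 0 = σ l 1 then 0 else c D l *
        D.L σ η (b + Pi.single (i, 0) 1 + Pi.single (l, 1) 1)) +
      (if σ l 0 = σ l 1 then 0 else c D l *
        D.L σ η (b + Pi.single (i, 1) 1 + Pi.single (l, 1) 1)) := fun l => by
    split_ifs <;> ring
  simp only [e3, Finset.sum_add_distrib]
  ring

/-- The dilation relation between the forms at frozen coordinates. -/
theorem bdd_dilation (hX : ∀ l, σ l 0 ≠ σ l 1 → ∀ ε a, 1 ≤ a → UB C₀ (freeze σ l ε) (pairB l a))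
    (b : Fin m × Fin 2 → ℕ) :
    Bdd σ fun (D : ScaleData m C₀) η _ => (∑ κ, (b κ : ℝ)) * D.L σ η b -
      Real.pi⁻¹ * ∑ i, if σ i 0 = σ i 1 then
        D.L σ η (b + Pi.single (i, 0) 1 + Pi.single (i, 1) 1) else 0 := by
  have h1 : Bdd σ fun (D : ScaleData m C₀) η _ =>
      ∑ κ, (b κ * D.L σ η b + (2 * Real.pi)⁻¹ * D.L σ η (b + Pi.single κ 2)) := by
    refine ⟨|scaleC b C₀ * (2 + 2 * 2 ^ m * Real.exp (2 * 2 ^ m * C₀))|, abs_nonneg _,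
      fun D η ρ h => (D.abs_dilation_le σ (fun i => (h.1 i).1) b).trans ?_⟩
    by_cases hm : 0 ≤ ρ
    · refine mul_le_mul_of_nonneg_right ?_ D.I_nonneg
      calc _ ≤ |scaleC b C₀ * (2 + 2 * 2 ^ m * Real.exp (2 * 2 ^ m * C₀))| * 1 := by
            rw [mul_one]; exact le_abs_self _
        _ ≤ _ := mul_le_mul_of_nonneg_left (Real.one_le_exp hm) (abs_nonneg _)
    · have := h.1 ⟨0, D.one_le_m⟩
      exact absurd (this.1.trans this.2) hm
  have h2 : Bdd σ fun (D : ScaleData m C₀) η _ => (2 * Real.pi)⁻¹ * ∑ i,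
      if σ i 0 = σ i 1 then D.L σ η (b + Pi.single (i, 0) 2) +
        2 * D.L σ η (b + Pi.single (i, 0) 1 + Pi.single (i, 1) 1) +
        D.L σ η (b + Pi.single (i, 1) 2) else
        D.L σ η (b + Pi.single (i, 0) 2) + D.L σ η (b + Pi.single (i, 1) 2) := by
    refine Bdd.const_mul (Bdd.sum _ fun i _ => ?_) _
    by_cases hi : σ i 0 = σ i 1
    · simpa only [if_pos hi] using bdd_square hX hi b
    · simp only [if_neg hi]
      have : ∀ ε, UB C₀ σ (b + Pi.single (i, ε) 2) := fun ε => by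
        refine UB.of_two_le_degF hX (m + 1) _ ?_ ?_ <;>
          rw [degF_add_single _ _ hi] <;> omega
      exact (this 0).add (this 1)
  refine (h1.sub h2).of_le fun D η ρ _ => le_of_eq (congrArg _ ?_)
  rw [Finset.sum_add_distrib, ← Finset.sum_mul, add_sub_assoc, sub_eq_add_neg, ← Finset.mul_sum, ← mul_sub]
  congr 1
  rw [Fintype.sum_prod_type, ← Finset.sum_sub_distrib]
  have : ∀ i, (∑ y, D.L σ η (b + Pi.single (i, y) 2)) - (if σ i 0 = σ i 1 then
      D.L σ η (b + Pi.single (i, 0) 2) +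
        2 * D.L σ η (b + Pi.single (i, 0) 1 + Pi.single (i, 1) 1) +
        D.L σ η (b + Pi.single (i, 1) 2) else
        D.L σ η (b + Pi.single (i, 0) 2) + D.L σ η (b + Pi.single (i, 1) 2)) =
      -2 * if σ i 0 = σ i 1 then
        D.L σ η (b + Pi.single (i, 0) 1 + Pi.single (i, 1) 1) else 0 := fun i => by
    rw [Fin.sum_univ_two]
    split_ifs <;> ring
  simp only [this, ← Finset.mul_sum]
  have hpi := Real.pi_ne_zero
  field_simp

theorem pairB_add (i : Fin m) (a : ℕ) :
    pairB i a + Pi.single (i, 0) 1 + Pi.single (i, 1) 1 = pairB i (a + 1) := by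
  ext ⟨l, ε⟩
  by_cases h : l = i
  · subst h
    fin_cases ε <;> simp [pairB]
  · simp [pairB, h]

theorem UB.pairB_of_freeze
    (hX : ∀ l, σ l 0 ≠ σ l 1 → ∀ ε a, 1 ≤ a → UB C₀ (freeze σ l ε) (pairB l a))
    {i : Fin m} (hi : σ i 0 = σ i 1) (a : ℕ) : UB C₀ σ (pairB i (a + 1)) := by
  have hone : ∀ i, σ i 0 = σ i 1 → UB C₀ σ (pairB i 1) := by
    intro i hi
    refine ((bdd_dilation hX 0).const_mul Real.pi).of_le fun D η ρ _ => ?_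
    have h0 : ∀ i, (0 : Fin m × Fin 2 → ℕ) + Pi.single (i, 0) 1 + Pi.single (i, 1) 1 =
        pairB i 1 := fun i => by
      have : (0 : Fin m × Fin 2 → ℕ) = pairB i 0 := by ext κ; simp [pairB]
      rw [this, pairB_add]
    simp only [h0, Pi.zero_apply, Nat.cast_zero, Finset.sum_const_zero, zero_mul, zero_sub,
      mul_neg, abs_neg]
    rw [← mul_assoc, mul_inv_cancel₀ Real.pi_ne_zero, one_mul]
    have hnn : ∀ k, 0 ≤ if σ k 0 = σ k 1 then D.L σ η (pairB k 1) else 0 := fun k => by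
      split_ifs with hk
      · exact D.L_pairB_nonneg σ hk η 1
      · exact le_rfl
    rw [abs_of_nonneg (D.L_pairB_nonneg σ hi η 1),
      abs_of_nonneg (Finset.sum_nonneg fun k _ => hnn k)]
    have := Finset.single_le_sum (fun k _ => hnn k) (Finset.mem_univ i)
    simpa only [if_pos hi] using this
  induction a with
  | zero => exact hone i hi
  | succ a ih =>
    have hother : Bdd σ fun (D : ScaleData m C₀) η _ => ∑ k ∈ Finset.univ.erase i,
        if σ k 0 = σ k 1 then
          D.L σ η (pairB i (a + 1) + Pi.single (k, 0) 1 + Pi.single (k, 1) 1) else 0 := by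
      refine Bdd.sum _ fun k hk => ?_
      by_cases hkS : σ k 0 = σ k 1
      · simp only [if_pos hkS]
        have hki := (Finset.mem_erase.1 hk).1
        refine UB.of_freeze _ k fun ε => ?_
        have h1 : freeze σ k ε = σ := by
          unfold freeze
          rw [Function.update_eq_self_iff]
          ext δ
          fin_cases ε <;> fin_cases δ <;> simp [hkS]
        have h2 : (pairB i (a + 1) + Pi.single (k, 0) 1 + Pi.single (k, 1) 1 :
            Fin m × Fin 2 → ℕ) (k, ε) = 1 := by
          fin_cases ε <;> simp [pairB, hki]
        rw [h1, h2]
        exact hone k hkS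
      · simpa only [if_neg hkS] using Bdd.zero
    have h1 := (((UB.eq_1 _ _ _ ▸ ih : Bdd σ fun (D : ScaleData m C₀) η _ => D.L σ η _).const_mul
      (∑ κ, (pairB i (a + 1) κ : ℝ))).sub (bdd_dilation hX (pairB i (a + 1)))).const_mul Real.pi
    refine (h1.sub hother).of_le fun D η ρ _ => le_of_eq (congrArg _ ?_)
    rw [← Finset.add_sum_erase _ _ (Finset.mem_univ i), if_pos hi, pairB_add, sub_sub_cancel,
      ← mul_assoc, mul_inv_cancel₀ Real.pi_ne_zero, one_mul, add_sub_cancel_right]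

/-- The main estimate for the multi-scale forms at frozen coordinates. -/
theorem UB.pairB (C₀ : ℝ) (k : ℕ) : ∀ σ : Fin m → Fin 2 → Fin 2,
    (Finset.univ.filter fun l => σ l 0 ≠ σ l 1).card ≤ k → ∀ i, σ i 0 = σ i 1 → ∀ a, 1 ≤ a →
      UB C₀ σ (pairB i a) := by
  induction k with
  | zero =>
    intro σ hσ i hi a ha
    obtain ⟨a, rfl⟩ := Nat.exists_eq_add_of_le' ha
    refine UB.pairB_of_freeze (fun l hl => ?_) hi a
    rw [Nat.le_zero, Finset.card_eq_zero] at hσ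
    have := Finset.filter_eq_empty_iff.1 hσ (Finset.mem_univ l)
    exact absurd hl this
  | succ k ih =>
    intro σ hσ i hi a ha
    obtain ⟨a, rfl⟩ := Nat.exists_eq_add_of_le' ha
    refine UB.pairB_of_freeze (fun l hl ε a ha => ih _ ?_ l (by simp [freeze]) a ha) hi a
    refine Nat.le_of_lt_succ (lt_of_lt_of_le (Finset.card_lt_card ?_) hσ)
    refine ⟨fun i hi' => ?_, fun hsub => ?_⟩
    · rw [Finset.mem_filter] at hi' ⊢
      by_cases h : i = l
      · subst h; simp [freeze] at hi'
      · simpa [freeze, h] using hi'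
    · have := (Finset.mem_filter.1 (hsub (Finset.mem_filter.2 ⟨Finset.mem_univ l, hl⟩))).2
      simp [freeze] at this

end ScaleData
end SBL

namespace SBL

/-- The Hardy–Littlewood maximal function on the line, over intervals with rational centre and
radius. -/
def hlMax (h : ℝ → ℝ≥0∞) (x : ℝ) : ℝ≥0∞ :=
  ⨆ κ : ℚ × ℚ, (Metric.closedBall (κ.1 : ℝ) κ.2).indicator
    (fun _ => (∫⁻ t in Metric.closedBall (κ.1 : ℝ) κ.2, h t) / ENNReal.ofReal (2 * κ.2)) x

theorem volume_lt_hlMax_le (h : ℝ → ℝ≥0∞) {a : ℝ≥0∞} (ha : 0 < a) (ha' : a ≠ ∞) :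
    volume {x | a < hlMax h x} ≤ 4 / a * ∫⁻ t, h t := by
  by_cases hh : ∫⁻ t, h t = ∞
  · rw [hh, ENNReal.mul_top]
    · exact le_top
    · exact (ENNReal.div_pos (by norm_num) ha').ne'
  set T : Set (ℚ × ℚ) := {κ | a * ENNReal.ofReal (2 * κ.2) <
    ∫⁻ t in Metric.closedBall (κ.1 : ℝ) κ.2, h t} with hT
  have hpos : ∀ κ ∈ T, (0 : ℝ) < κ.2 := by
    intro κ hκ
    by_contra hneg
    have : volume (Metric.closedBall (κ.1 : ℝ) κ.2) = 0 := by
      rw [Real.volume_closedBall, ENNReal.ofReal_eq_zero]; linarith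
    rw [hT, Set.mem_ofPred_eq, Measure.restrict_eq_zero.2 this] at hκ
    simp at hκ
  have hR : ∀ κ ∈ T, (κ.2 : ℝ) ≤ (∫⁻ t, h t / a).toReal := by
    intro κ hκ
    have h1 : a * ENNReal.ofReal (2 * κ.2) ≤ ∫⁻ t, h t :=
      hκ.le.trans (setLIntegral_le_lintegral _ _)
    have h2 : ENNReal.ofReal (2 * κ.2) ≤ ∫⁻ t, h t / a := by
      simp_rw [div_eq_mul_inv]
      rw [lintegral_mul_const' _ _ (ENNReal.inv_ne_top.2 ha.ne'), ← div_eq_mul_inv,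
        ENNReal.le_div_iff_mul_le (Or.inl ha.ne') (Or.inl ha'), mul_comm]
      exact h1
    have h3 : ∫⁻ t, h t / a ≠ ∞ := by
      simp_rw [div_eq_mul_inv]
      rw [lintegral_mul_const' _ _ (ENNReal.inv_ne_top.2 ha.ne')]
      exact ENNReal.mul_ne_top hh (ENNReal.inv_ne_top.2 ha.ne')
    have h4 := ENNReal.toReal_mono h3 h2
    rw [ENNReal.toReal_ofReal (by linarith [hpos κ hκ])] at h4
    linarith [hpos κ hκ]
  obtain ⟨U, hUT, hdisj, hcov⟩ := Vitali.exists_disjoint_subfamily_covering_enlargement_closedBall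
    T (fun κ => (κ.1 : ℝ)) (fun κ => (κ.2 : ℝ)) _ hR 4 (by norm_num)
  have hsub : {x | a < hlMax h x} ⊆ ⋃ κ ∈ U, Metric.closedBall (κ.1 : ℝ) (4 * κ.2) := by
    intro x hx
    have hx' : a < hlMax h x := hx
    obtain ⟨κ, hκ⟩ := lt_iSup_iff.1 hx'
    by_cases hxκ : x ∈ Metric.closedBall (κ.1 : ℝ) κ.2
    · rw [Set.indicator_of_mem hxκ] at hκ
      have hκT : κ ∈ T := ENNReal.mul_lt_of_lt_div hκ
      obtain ⟨b, hb, hsb⟩ := hcov κ hκT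
      exact Set.mem_biUnion hb (hsb hxκ)
    · rw [Set.indicator_of_notMem hxκ] at hκ
      exact absurd hκ not_lt_zero
  calc volume {x | a < hlMax h x}
      ≤ volume (⋃ κ ∈ U, Metric.closedBall (κ.1 : ℝ) (4 * κ.2)) := measure_mono hsub
    _ ≤ ∑' κ : U, volume (Metric.closedBall ((κ : ℚ × ℚ).1 : ℝ) (4 * (κ : ℚ × ℚ).2)) :=
        measure_biUnion_le _ U.to_countable _
    _ ≤ ∑' κ : U, 4 / a * ∫⁻ t in Metric.closedBall ((κ : ℚ × ℚ).1 : ℝ) (κ : ℚ × ℚ).2, h t := by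
        refine ENNReal.tsum_le_tsum fun κ => ?_
        have h1 : a * ENNReal.ofReal (2 * (κ : ℚ × ℚ).2) ≤ _ := (hUT κ.2).le
        rw [Real.volume_closedBall, show (2 * (4 * ((κ : ℚ × ℚ).2 : ℝ))) =
          4 * (2 * ((κ : ℚ × ℚ).2 : ℝ)) by ring, ENNReal.ofReal_mul (by norm_num)]
        calc ENNReal.ofReal 4 * ENNReal.ofReal (2 * (κ : ℚ × ℚ).2)
            = 4 / a * (a * ENNReal.ofReal (2 * (κ : ℚ × ℚ).2)) := by
              rw [← mul_assoc, ENNReal.div_mul_cancel ha.ne' ha']; norm_num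
          _ ≤ _ := by gcongr
    _ = 4 / a * ∫⁻ t in ⋃ κ ∈ U, Metric.closedBall (κ.1 : ℝ) κ.2, h t := by
        rw [ENNReal.tsum_mul_left, lintegral_biUnion U.to_countable
          (fun _ _ => Metric.isClosed_closedBall.measurableSet) hdisj]
    _ ≤ 4 / a * ∫⁻ t, h t := by gcongr; exact Measure.restrict_le_self

theorem hlMax_le_of_le {h : ℝ → ℝ≥0∞} {B : ℝ≥0∞} (hB : ∀ t, h t ≤ B) (x : ℝ) : hlMax h x ≤ B := by
  refine iSup_le fun κ => Set.indicator_apply_le' (fun _ => ?_) fun _ => zero_le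
  refine ENNReal.div_le_of_le_mul ?_
  calc ∫⁻ t in Metric.closedBall (κ.1 : ℝ) κ.2, h t
      ≤ ∫⁻ _ in Metric.closedBall (κ.1 : ℝ) κ.2, B := lintegral_mono hB
    _ = _ := by rw [setLIntegral_const, Real.volume_closedBall]

theorem hlMax_add_le (h g : ℝ → ℝ≥0∞) (hh : Measurable h) (x : ℝ) :
    hlMax (fun t => h t + g t) x ≤ hlMax h x + hlMax g x := by
  refine iSup_le fun κ => Set.indicator_apply_le' (fun hx => ?_) fun _ => zero_le
  rw [lintegral_add_left hh, ENNReal.add_div]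
  gcongr
  · refine le_trans ?_ (le_iSup _ κ); rw [Set.indicator_of_mem hx]
  · refine le_trans ?_ (le_iSup _ κ); rw [Set.indicator_of_mem hx]

theorem measurable_hlMax (h : ℝ → ℝ≥0∞) : Measurable (hlMax h) :=
  Measurable.iSup fun _ => measurable_const.indicator Metric.isClosed_closedBall.measurableSet

theorem setLIntegral_le_hlMax (h : ℝ → ℝ≥0∞) {a b x : ℝ} (hab : a < b) (hx : x ∈ Set.Icc a b) :
    ∫⁻ t in Set.Icc a b, h t ≤ 2 * ENNReal.ofReal (b - a) * hlMax h x := by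
  obtain ⟨r, hr1, hr2⟩ := exists_rat_btwn (show 3 * (b - a) / 4 < b - a by linarith)
  obtain ⟨c, hc1, hc2⟩ := exists_rat_btwn (show (a + b) / 2 - (b - a) / 8 < (a + b) / 2 + (b - a) / 8
    by linarith)
  have hsub : Set.Icc a b ⊆ Metric.closedBall (c : ℝ) r := by
    rw [Real.closedBall_eq_Icc]
    exact Set.Icc_subset_Icc (by linarith) (by linarith)
  have h1 : (∫⁻ t in Metric.closedBall (c : ℝ) r, h t) / ENNReal.ofReal (2 * r) ≤ hlMax h x := by
    refine le_trans ?_ (le_iSup _ (c, r)); rw [Set.indicator_of_mem (hsub hx)]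
  have hr : (0 : ℝ) < r := by linarith
  calc ∫⁻ t in Set.Icc a b, h t ≤ ∫⁻ t in Metric.closedBall (c : ℝ) r, h t :=
        lintegral_mono_set hsub
    _ = ENNReal.ofReal (2 * r) * ((∫⁻ t in Metric.closedBall (c : ℝ) r, h t) /
          ENNReal.ofReal (2 * r)) := by
        rw [ENNReal.mul_div_cancel (by simpa using hr) ENNReal.ofReal_ne_top]
    _ ≤ 2 * ENNReal.ofReal (b - a) * hlMax h x := by
        refine mul_le_mul' ?_ h1
        rw [ENNReal.ofReal_mul (by norm_num), ENNReal.ofReal_ofNat]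
        gcongr

theorem volume_lt_hlMax_le_indicator {h : ℝ → ℝ≥0∞} (hh : Measurable h) {a : ℝ≥0∞} (ha : 0 < a)
    (ha' : a ≠ ∞) :
    volume {x | 2 * a < hlMax h x} ≤ 4 / a * ∫⁻ t, {t | a < h t}.indicator h t := by
  refine le_trans (measure_mono fun x hx => ?_) (volume_lt_hlMax_le _ ha ha')
  have hsp : h = fun t => {t | a < h t}.indicator h t + {t | a < h t}ᶜ.indicator h t := by
    ext t; exact (Set.indicator_self_add_compl_apply _ _ _).symm
  have hm : MeasurableSet {t | a < h t} := measurableSet_lt measurable_const hh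
  have h1 := hlMax_add_le _ ({t | a < h t}ᶜ.indicator h) (hh.indicator hm) x
  rw [← hsp] at h1
  have h2 : hlMax ({t | a < h t}ᶜ.indicator h) x ≤ a :=
    hlMax_le_of_le (fun t => Set.indicator_apply_le' (fun ht => not_lt.1 ht) fun _ => zero_le) x
  have h3 : 2 * a < hlMax h x := hx
  by_contra hcon
  have h4 : hlMax ({t | a < h t}.indicator h) x ≤ a := not_lt.1 hcon
  have : hlMax h x ≤ 2 * a := h1.trans (by rw [two_mul]; exact add_le_add h4 h2)
  exact absurd h3 this.not_gt

end SBL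

namespace SBL

theorem setLIntegral_Ioo_rpow {r : ℝ} (hr : -1 < r) {c : ℝ} (hc : 0 ≤ c) :
    ∫⁻ t in Set.Ioo 0 c, ENNReal.ofReal (t ^ r) = ENNReal.ofReal (c ^ (r + 1) / (r + 1)) := by
  have h1 := intervalIntegral.intervalIntegrable_rpow' (a := 0) (b := c) hr
  rw [intervalIntegrable_iff_integrableOn_Ioo_of_le hc] at h1
  rw [← ofReal_integral_eq_lintegral_ofReal h1, ← integral_Ioc_eq_integral_Ioo,
    ← intervalIntegral.integral_of_le hc, integral_rpow (Or.inl hr), Real.zero_rpow (by linarith),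
    sub_zero]
  filter_upwards [self_mem_ae_restrict measurableSet_Ioo] with t ht
  exact Real.rpow_nonneg ht.1.le _

theorem lintegral_hlMax_rpow_le {r : ℝ} (hr : 1 < r) {h : ℝ → ℝ≥0∞} (hh : Measurable h) {B : ℝ≥0∞}
    (hB : B ≠ ∞) (hhB : ∀ t, h t ≤ B) :
    ∫⁻ x, hlMax h x ^ r ≤ ENNReal.ofReal (8 * 2 ^ (r - 1) * r / (r - 1)) * ∫⁻ x, h x ^ r := by
  have hr0 : 0 < r := by linarith
  have hfin : ∀ x, hlMax h x ≠ ∞ := fun x => ((hlMax_le_of_le hhB x).trans_lt hB.lt_top).ne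
  have hfin' : ∀ x, h x ≠ ∞ := fun x => ((hhB x).trans_lt hB.lt_top).ne
  have h1 : ∫⁻ x, hlMax h x ^ r = ∫⁻ x, ENNReal.ofReal ((hlMax h x).toReal ^ r) := by
    refine lintegral_congr fun x => ?_
    rw [← ENNReal.ofReal_rpow_of_nonneg ENNReal.toReal_nonneg hr0.le, ENNReal.ofReal_toReal (hfin x)]
  rw [h1, lintegral_rpow_eq_lintegral_meas_lt_mul _ (Filter.Eventually.of_forall fun _ =>
    ENNReal.toReal_nonneg) (measurable_hlMax h).ennreal_toReal.aemeasurable hr0]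
  have h2 : ∫⁻ t in Set.Ioi (0 : ℝ), volume {x | t < (hlMax h x).toReal} * ENNReal.ofReal (t ^ (r - 1))
      ≤ ∫⁻ t in Set.Ioi (0 : ℝ), ∫⁻ x, 8 * ENNReal.ofReal (t ^ (r - 2)) *
        {z : ℝ × ℝ | z.1 < 2 * (h z.2).toReal}.indicator (fun z => h z.2) (t, x) := by
    refine setLIntegral_mono' measurableSet_Ioi fun t ht => ?_
    have ht0 : 0 < t := ht
    have hsub : {x | t < (hlMax h x).toReal} ⊆ {x | 2 * ENNReal.ofReal (t / 2) < hlMax h x} := by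
      intro x hx
      have hx' : t < (hlMax h x).toReal := hx
      change 2 * ENNReal.ofReal (t / 2) < hlMax h x
      rw [← ENNReal.ofReal_ofNat, ← ENNReal.ofReal_mul (by norm_num), mul_div_cancel₀ _ (by norm_num)]
      exact (ENNReal.ofReal_lt_iff_lt_toReal ht0.le (hfin x)).2 hx'
    have h3 := (measure_mono hsub).trans (volume_lt_hlMax_le_indicator hh
      (ENNReal.ofReal_pos.2 (half_pos ht0)) ENNReal.ofReal_ne_top)
    have h4 : 4 / ENNReal.ofReal (t / 2) * ENNReal.ofReal (t ^ (r - 1)) =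
        8 * ENNReal.ofReal (t ^ (r - 2)) := by
      rw [← ENNReal.ofReal_ofNat, ← ENNReal.ofReal_ofNat, ← ENNReal.ofReal_div_of_pos (half_pos ht0),
        ← ENNReal.ofReal_mul (by positivity), ← ENNReal.ofReal_mul (by positivity),
        show r - 1 = (r - 2) + 1 by ring, Real.rpow_add_one ht0.ne']
      congr 1
      field_simp
      norm_num
    calc _ ≤ 4 / ENNReal.ofReal (t / 2) * (∫⁻ x, {x | ENNReal.ofReal (t / 2) < h x}.indicator h x) *
          ENNReal.ofReal (t ^ (r - 1)) := by gcongr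
      _ = 8 * ENNReal.ofReal (t ^ (r - 2)) *
          ∫⁻ x, {x | ENNReal.ofReal (t / 2) < h x}.indicator h x := by rw [← h4]; ring
      _ = _ := by
        rw [lintegral_const_mul _ (hh.indicator (measurableSet_lt measurable_const hh)) |>.symm]
        refine lintegral_congr fun x => ?_
        congr 1
        have hiff : ENNReal.ofReal (t / 2) < h x ↔ t < 2 * (h x).toReal := by
          rw [ENNReal.ofReal_lt_iff_lt_toReal (half_pos ht0).le (hfin' x), div_lt_iff₀' (by norm_num)]
        by_cases hx : t < 2 * (h x).toReal
        · rw [Set.indicator_of_mem (show x ∈ {x | ENNReal.ofReal (t / 2) < h x} from hiff.2 hx),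
            Set.indicator_of_mem (show (t, x) ∈ {z : ℝ × ℝ | z.1 < 2 * (h z.2).toReal} from hx)]
        · rw [Set.indicator_of_notMem (show x ∉ {x | ENNReal.ofReal (t / 2) < h x} from
            fun h' => hx (hiff.1 h')),
            Set.indicator_of_notMem (show (t, x) ∉ {z : ℝ × ℝ | z.1 < 2 * (h z.2).toReal} from hx)]
  have hS : MeasurableSet {z : ℝ × ℝ | z.1 < 2 * (h z.2).toReal} :=
    measurableSet_lt measurable_fst ((hh.comp measurable_snd).ennreal_toReal.const_mul 2)
  have hmeas : Measurable fun z : ℝ × ℝ => 8 * ENNReal.ofReal (z.1 ^ (r - 2)) *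
        {z : ℝ × ℝ | z.1 < 2 * (h z.2).toReal}.indicator (fun z => h z.2) z := by
    refine ((measurable_fst.pow_const _).ennreal_ofReal.const_mul _).mul ?_
    exact (hh.comp measurable_snd).indicator hS
  rw [lintegral_lintegral_swap hmeas.aemeasurable] at h2
  have h5 : ∀ x, ∫⁻ t in Set.Ioi (0 : ℝ), 8 * ENNReal.ofReal (t ^ (r - 2)) *
        {z : ℝ × ℝ | z.1 < 2 * (h z.2).toReal}.indicator (fun z => h z.2) (t, x) =
        ENNReal.ofReal (8 * 2 ^ (r - 1) / (r - 1)) * h x ^ r := by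
    intro x
    have hu : 0 ≤ (h x).toReal := ENNReal.toReal_nonneg
    have : ∀ t, 8 * ENNReal.ofReal (t ^ (r - 2)) *
        {z : ℝ × ℝ | z.1 < 2 * (h z.2).toReal}.indicator (fun z => h z.2) (t, x) =
        (Set.Iio (2 * (h x).toReal)).indicator (fun t => 8 * h x * ENNReal.ofReal (t ^ (r - 2))) t := by
      intro t
      by_cases hx : t < 2 * (h x).toReal
      · rw [Set.indicator_of_mem (show t ∈ Set.Iio (2 * (h x).toReal) from hx),
          Set.indicator_of_mem (show (t, x) ∈ {z : ℝ × ℝ | z.1 < 2 * (h z.2).toReal} from hx)]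
        ring
      · rw [Set.indicator_of_notMem (show t ∉ Set.Iio (2 * (h x).toReal) from hx),
          Set.indicator_of_notMem (show (t, x) ∉ {z : ℝ × ℝ | z.1 < 2 * (h z.2).toReal} from hx),
          mul_zero]
    simp_rw [this]
    rw [setLIntegral_indicator measurableSet_Iio, Set.Iio_inter_Ioi,
      lintegral_const_mul' _ _ (ENNReal.mul_ne_top (by simp) (hfin' x)),
      setLIntegral_Ioo_rpow (by linarith) (by positivity)]
    conv_lhs => rw [← ENNReal.ofReal_toReal (hfin' x)]
    conv_rhs => rw [← ENNReal.ofReal_toReal (hfin' x)]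
    rw [ENNReal.toReal_ofReal hu, ENNReal.ofReal_rpow_of_nonneg hu hr0.le,
      ← ENNReal.ofReal_ofNat, ← ENNReal.ofReal_mul (by norm_num), ← ENNReal.ofReal_mul (by positivity),
      ← ENNReal.ofReal_mul (div_nonneg (by positivity) (by linarith))]
    congr 1
    rw [show r - 2 + 1 = r - 1 by ring, Real.mul_rpow (by norm_num) hu]
    have : (h x).toReal ^ r = (h x).toReal * (h x).toReal ^ (r - 1) := by
      rw [mul_comm, ← Real.rpow_add_one' hu (by linarith)]; congr 1; ring
    rw [this]; ring
  simp_rw [h5] at h2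
  rw [lintegral_const_mul' _ _ ENNReal.ofReal_ne_top] at h2
  calc _ ≤ _ := mul_le_mul_right h2 _
    _ = _ := by
      rw [← mul_assoc, ← ENNReal.ofReal_mul hr0.le]
      congr 2; ring

variable {m : ℕ}

/-- The one-dimensional maximal function in the `i`-th coordinate. -/
def coordMax (i : Fin m) (f : (Fin m → ℝ) → ℝ≥0∞) (x : Fin m → ℝ) : ℝ≥0∞ :=
  hlMax (fun t => f (Function.update x i t)) (x i)

theorem measurable_coordMax (i : Fin m) {f : (Fin m → ℝ) → ℝ≥0∞} (hf : Measurable f) :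
    Measurable (coordMax i f) := by
  refine Measurable.iSup fun κ => ?_
  have h1 : Measurable fun x : Fin m → ℝ =>
      ∫⁻ t in Metric.closedBall (κ.1 : ℝ) κ.2, f (Function.update x i t) := by
    refine Measurable.lintegral_prod_right' (f := fun z : (Fin m → ℝ) × ℝ =>
      f (Function.update z.1 i z.2)) ?_
    exact hf.comp (measurable_pi_iff.2 fun k => by
      by_cases hk : k = i
      · subst hk; simpa using measurable_snd
      · simp only [Function.update_of_ne hk]; fun_prop)
  have h2 := (h1.div_const (ENNReal.ofReal (2 * κ.2))).indicator
    ((measurable_pi_apply i) (Metric.isClosed_closedBall (x := (κ.1 : ℝ)) (ε := (κ.2 : ℝ))).measurableSet)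
  exact h2

theorem lintegral_coordMax_rpow_le (i : Fin m) {r : ℝ} (hr : 1 < r) {f : (Fin m → ℝ) → ℝ≥0∞}
    (hf : Measurable f) {B : ℝ≥0∞} (hB : B ≠ ∞) (hfB : ∀ t, f t ≤ B) :
    ∫⁻ x, coordMax i f x ^ r ≤ ENNReal.ofReal (8 * 2 ^ (r - 1) * r / (r - 1)) * ∫⁻ x, f x ^ r := by
  rw [← lintegral_const_mul' _ _ ENNReal.ofReal_ne_top, volume_pi,
    lintegral_eq_lmarginal_univ (0 : Fin m → ℝ), lintegral_eq_lmarginal_univ (0 : Fin m → ℝ)]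
  refine lmarginal_le_of_subset (Finset.subset_univ {i})
    ((measurable_coordMax i hf).pow_const r) ((hf.pow_const r).const_mul _) ?_ 0
  rw [lmarginal_singleton, lmarginal_singleton]
  intro x
  have hm : Measurable fun t => f (Function.update x i t) := hf.comp (measurable_update x)
  simp only [coordMax, Function.update_idem, Function.update_self]
  rw [lintegral_const_mul' _ _ ENNReal.ofReal_ne_top]
  exact lintegral_hlMax_rpow_le hr hm hB fun t => hfB _

theorem exists_box_average_bound {r : ℝ} (hr : 1 < r) {f : (Fin m → ℝ) → ℝ≥0∞} (hf : Measurable f)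
    {B : ℝ≥0∞} (hB : B ≠ ∞) (hfB : ∀ t, f t ≤ B) (s : Finset (Fin m)) :
    ∃ g : (Fin m → ℝ) → ℝ≥0∞, Measurable g ∧ (∀ t, g t ≤ B) ∧
      (∫⁻ x, g x ^ r ≤ ENNReal.ofReal (8 * 2 ^ (r - 1) * r / (r - 1)) ^ s.card * ∫⁻ x, f x ^ r) ∧
      ∀ a b : Fin m → ℝ, (∀ i, a i < b i) → ∀ x : Fin m → ℝ, (∀ i ∈ s, x i ∈ Set.Icc (a i) (b i)) →
        (∫⋯∫⁻_s, f ∂(fun i => volume.restrict (Set.Icc (a i) (b i)))) x ≤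
          2 ^ s.card * (∏ i ∈ s, ENNReal.ofReal (b i - a i)) * g x := by
  induction s using Finset.induction_on with
  | empty => exact ⟨f, hf, hfB, by simp, fun a b _ x _ => by simp⟩
  | insert i s hi ih =>
    obtain ⟨g, hg, hgB, hgr, hgav⟩ := ih
    refine ⟨coordMax i g, measurable_coordMax i hg, fun t => hlMax_le_of_le (fun _ => hgB _) _, ?_, ?_⟩
    · refine (lintegral_coordMax_rpow_le i hr hg hB hgB).trans ?_
      rw [Finset.card_insert_of_notMem hi, pow_succ', mul_assoc (ENNReal.ofReal _)]
      exact mul_le_mul_right hgr _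
    · intro a b hab x hx
      rw [lmarginal_insert _ hf hi]
      have hc : 2 ^ s.card * (∏ i ∈ s, ENNReal.ofReal (b i - a i)) ≠ ∞ :=
        ENNReal.mul_ne_top (by simp) (ENNReal.prod_ne_top fun _ _ => ENNReal.ofReal_ne_top)
      calc _ ≤ ∫⁻ t in Set.Icc (a i) (b i), 2 ^ s.card * (∏ i ∈ s, ENNReal.ofReal (b i - a i)) *
              g (Function.update x i t) := by
            refine lintegral_mono fun t => hgav a b hab _ fun k hk => ?_
            rw [Function.update_of_ne (ne_of_mem_of_not_mem hk hi)]
            exact hx k (Finset.mem_insert_of_mem hk)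
        _ = 2 ^ s.card * (∏ i ∈ s, ENNReal.ofReal (b i - a i)) *
              ∫⁻ t in Set.Icc (a i) (b i), g (Function.update x i t) := by
            rw [lintegral_const_mul' _ _ hc]
        _ ≤ 2 ^ s.card * (∏ i ∈ s, ENNReal.ofReal (b i - a i)) *
              (2 * ENNReal.ofReal (b i - a i) * coordMax i g x) := by
            gcongr
            exact setLIntegral_le_hlMax _ (hab i) (hx i (Finset.mem_insert_self i s))
        _ = _ := by
            rw [Finset.card_insert_of_notMem hi, Finset.prod_insert hi, pow_succ]; ring

/-- The strong maximal theorem, in the form in which averages over boxes containing a point are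
dominated by a single function of the point. -/
theorem exists_strongMax {r : ℝ} (hr : 1 < r) {f : (Fin m → ℝ) → ℝ≥0∞} (hf : Measurable f)
    {B : ℝ≥0∞} (hB : B ≠ ∞) (hfB : ∀ t, f t ≤ B) :
    ∃ g : (Fin m → ℝ) → ℝ≥0∞, Measurable g ∧ (∀ t, g t ≤ B) ∧
      (∫⁻ x, g x ^ r ≤ ENNReal.ofReal (8 * 2 ^ (r - 1) * r / (r - 1)) ^ m * ∫⁻ x, f x ^ r) ∧
      ∀ a b : Fin m → ℝ, (∀ i, a i < b i) → ∀ x ∈ Set.Icc a b,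
        ∫⁻ y in Set.Icc a b, f y ≤ 2 ^ m * (∏ i, ENNReal.ofReal (b i - a i)) * g x := by
  obtain ⟨g, hg, hgB, hgr, hgav⟩ := exists_box_average_bound hr hf hB hfB Finset.univ
  rw [Finset.card_univ, Fintype.card_fin] at hgr
  refine ⟨g, hg, hgB, hgr, fun a b hab x hx => ?_⟩
  have h := hgav a b hab x fun i _ => ⟨hx.1 i, hx.2 i⟩
  rw [lmarginal_univ, Finset.card_univ, Fintype.card_fin] at h
  rwa [← Set.pi_univ_Icc, volume_pi, Measure.restrict_pi_pi]

end SBL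

namespace SBL

variable {m : ℕ}

/-- The average of `f` over the box with corners `a` and `b`. -/
def boxAvg (f : (Fin m → ℝ) → ℝ) (a b : Fin m → ℝ) : ℝ :=
  (∏ i, (b i - a i))⁻¹ * ∫ y in Set.Icc a b, f y

/-- The boxes containing the cube of half-side `r` around `y`. -/
def BoxAt (y : Fin m → ℝ) (r : ℝ) : Type :=
  {z : (Fin m → ℝ) × (Fin m → ℝ) // ∀ i, z.1 i ≤ y i - r ∧ y i + r ≤ z.2 i}

instance (y : Fin m → ℝ) (r : ℝ) : Nonempty (BoxAt y r) :=
  ⟨⟨(fun i => y i - r, fun i => y i + r), fun _ => ⟨le_rfl, le_rfl⟩⟩⟩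

/-- The largest average of `f` over a box containing the cube of half-side `r` around `y`. -/
def maxAvg (f : (Fin m → ℝ) → ℝ) (y : Fin m → ℝ) (r : ℝ) : ℝ :=
  ⨆ z : BoxAt y r, boxAvg f z.1.1 z.1.2

theorem boxAvg_le {f : (Fin m → ℝ) → ℝ} {K : ℝ} (hfK : ∀ x, f x ≤ K) (hfc : Continuous f)
    {a b : Fin m → ℝ} (hab : ∀ i, a i < b i) : boxAvg f a b ≤ K := by
  have hpos : 0 < ∏ i, (b i - a i) := Finset.prod_pos fun i _ => sub_pos.2 (hab i)
  rw [boxAvg, inv_mul_le_iff₀ hpos]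
  have hvol : volume.real (Set.Icc a b) = ∏ i, (b i - a i) := by
    rw [Measure.real, Real.volume_Icc_pi_toReal fun i => (hab i).le]
  calc ∫ y in Set.Icc a b, f y ≤ ∫ _ in Set.Icc a b, K :=
        setIntegral_mono_on (hfc.continuousOn.integrableOn_compact isCompact_Icc)
          (integrableOn_const isCompact_Icc.measure_lt_top.ne) measurableSet_Icc fun x _ => hfK x
    _ = (∏ i, (b i - a i)) * K := by rw [setIntegral_const, hvol, smul_eq_mul]

theorem BoxAt.lt {y : Fin m → ℝ} {r : ℝ} (hr : 0 < r) (z : BoxAt y r) (i : Fin m) :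
    z.1.1 i < z.1.2 i := by linarith [(z.2 i).1, (z.2 i).2]

/-- A nonnegative, continuous, compactly supported function that does not vanish identically. -/
structure IsBump (f : (Fin m → ℝ) → ℝ) : Prop where
  continuous : Continuous f
  hasCompactSupport : HasCompactSupport f
  nonneg : ∀ x, 0 ≤ f x
  exists_pos : ∃ x, 0 < f x

namespace IsBump

variable {f : (Fin m → ℝ) → ℝ}

theorem exists_le (hf : IsBump f) : ∃ K, ∀ x, f x ≤ K := by
  obtain ⟨K, hK⟩ := hf.hasCompactSupport.exists_bound_of_continuous hf.continuous
  exact ⟨K, fun x => (le_abs_self _).trans (hK x)⟩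

theorem bddAbove (hf : IsBump f) (y : Fin m → ℝ) {r : ℝ} (hr : 0 < r) :
    BddAbove (Set.range fun z : BoxAt y r => boxAvg f z.1.1 z.1.2) := by
  obtain ⟨K, hK⟩ := hf.exists_le
  refine ⟨K, ?_⟩
  rintro _ ⟨z, rfl⟩
  exact boxAvg_le hK hf.continuous (z.lt hr)

theorem boxAvg_le_maxAvg (hf : IsBump f) {y : Fin m → ℝ} {r : ℝ} (hr : 0 < r) {a b : Fin m → ℝ}
    (h : ∀ i, a i ≤ y i - r ∧ y i + r ≤ b i) : boxAvg f a b ≤ maxAvg f y r :=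
  le_ciSup (hf.bddAbove y hr) (⟨(a, b), h⟩ : BoxAt y r)

theorem maxAvg_pos (hf : IsBump f) (y : Fin m → ℝ) {r : ℝ} (hr : 0 < r) : 0 < maxAvg f y r := by
  obtain ⟨x, hx⟩ := hf.exists_pos
  set R : ℝ := r + ‖y - x‖ + 1 with hR
  have hR0 : 0 < R := by positivity
  refine lt_of_lt_of_le ?_ (hf.boxAvg_le_maxAvg hr (a := fun i => y i - R) (b := fun i => y i + R)
    fun i => ⟨by linarith [norm_nonneg (y - x)], by linarith [norm_nonneg (y - x)]⟩)
  refine mul_pos (inv_pos.2 (Finset.prod_pos fun i _ => by linarith)) ?_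
  have hInt : IntegrableOn f (Set.Icc (fun i => y i - R) fun i => y i + R) :=
    hf.continuous.continuousOn.integrableOn_compact isCompact_Icc
  rw [setIntegral_pos_iff_support_of_nonneg_ae (Filter.Eventually.of_forall hf.nonneg) hInt]
  have hopen : IsOpen (Function.support f ∩ Metric.ball x 1) :=
    (hf.continuous.isOpen_support).inter Metric.isOpen_ball
  refine lt_of_lt_of_le (hopen.measure_pos volume ⟨x, hx.ne', Metric.mem_ball_self one_pos⟩)
    (measure_mono (Set.inter_subset_inter_right _ fun z hz => ?_))
  have hz' : ∀ i, |y i - z i| ≤ R := fun i => by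
    have h1 : |(y - x) i| ≤ ‖y - x‖ := norm_le_pi_norm (y - x) i
    have h2 : |(z - x) i| ≤ ‖z - x‖ := norm_le_pi_norm (z - x) i
    have h3 : ‖z - x‖ < 1 := by simpa [dist_eq_norm] using hz
    have h4 : y i - z i = (y - x) i - (z - x) i := by simp
    rw [h4]
    have := abs_sub ((y - x) i) ((z - x) i)
    linarith
  exact ⟨fun i => by linarith [(abs_le.1 (hz' i)).2], fun i => by linarith [(abs_le.1 (hz' i)).1]⟩

theorem maxAvg_mono (hf : IsBump f) {y y' : Fin m → ℝ} {r r' : ℝ} (hr' : 0 < r') (h : ∀ i, |y i - y' i| + r' ≤ r) :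
    maxAvg f y r ≤ maxAvg f y' r' := by
  refine ciSup_le fun z => hf.boxAvg_le_maxAvg hr' fun i => ?_
  have h1 := abs_le.1 (show |y i - y' i| ≤ r - r' by linarith [h i])
  constructor <;> linarith [(z.2 i).1, (z.2 i).2]

theorem maxAvg_le_mul (hf : IsBump f) {y y' : Fin m → ℝ} {r r' h : ℝ} (hr : 0 < r) (hr' : 0 < r') (hh : 0 ≤ h)
    (hy : ∀ i, |y i - y' i| + r ≤ r' + h) :
    maxAvg f y' r' ≤ ((r' + h) / r') ^ m * maxAvg f y r := by
  refine ciSup_le fun z => ?_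
  obtain ⟨⟨a, b⟩, hz⟩ := z
  have hab : ∀ i, 2 * r' ≤ b i - a i := fun i => by
    have := hz i
    dsimp only at this
    linarith [this.1, this.2]
  have h1 : boxAvg f (fun i => a i - h) (fun i => b i + h) ≤ maxAvg f y r := by
    refine hf.boxAvg_le_maxAvg hr fun i => ?_
    have h1 := abs_le.1 (show |y i - y' i| ≤ r' + h - r by linarith [hy i])
    have h2 := hz i
    dsimp only at h2
    constructor <;> linarith [h2.1, h2.2]
  refine le_trans ?_ (mul_le_mul_of_nonneg_left h1 (by positivity))
  have hpos : 0 < ∏ i, (b i - a i) := Finset.prod_pos fun i _ => by linarith [hab i]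
  have hpos' : 0 < ∏ i, (b i + h - (a i - h)) := Finset.prod_pos fun i _ => by linarith [hab i]
  have hInt : ∫ y in Set.Icc a b, f y ≤ ∫ y in Set.Icc (fun i => a i - h) (fun i => b i + h), f y :=
    setIntegral_mono_set (hf.continuous.continuousOn.integrableOn_compact isCompact_Icc)
      (Filter.Eventually.of_forall fun x => hf.nonneg x)
      (Set.Icc_subset_Icc (fun i => by simpa using hh) (fun i => by simpa using hh)).eventuallyLE
  have hnn : 0 ≤ ∫ y in Set.Icc (fun i => a i - h) (fun i => b i + h), f y :=
    setIntegral_nonneg measurableSet_Icc fun x _ => hf.nonneg x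
  have hprod : ∏ i, (b i + h - (a i - h)) ≤ ((r' + h) / r') ^ m * ∏ i, (b i - a i) := by
    rw [← Fin.prod_const, ← Finset.prod_mul_distrib]
    refine Finset.prod_le_prod (fun i _ => by linarith [hab i]) fun i _ => ?_
    rw [div_mul_eq_mul_div, le_div_iff₀ hr']
    nlinarith [hab i]
  change (∏ i, (b i - a i))⁻¹ * _ ≤ _ * ((∏ i, (b i + h - (a i - h)))⁻¹ * _)
  rw [← mul_assoc]
  refine mul_le_mul ?_ hInt (setIntegral_nonneg measurableSet_Icc fun x _ => hf.nonneg x)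
    (mul_nonneg (by positivity) (inv_nonneg.2 hpos'.le))
  rw [inv_le_iff_one_le_mul₀ hpos]
  calc (1 : ℝ) = (∏ i, (b i + h - (a i - h)))⁻¹ * ∏ i, (b i + h - (a i - h)) :=
        (inv_mul_cancel₀ hpos'.ne').symm
    _ ≤ (∏ i, (b i + h - (a i - h)))⁻¹ * (((r' + h) / r') ^ m * ∏ i, (b i - a i)) := by gcongr
    _ = _ := by ring

theorem log_maxAvg_mono (hf : IsBump f) {y y' : Fin m → ℝ} {r r' : ℝ} (hr : 0 < r) (hr' : 0 < r')
    (h : ‖y - y'‖ + r' ≤ r) : Real.log (maxAvg f y r) ≤ Real.log (maxAvg f y' r') :=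
  Real.log_le_log (hf.maxAvg_pos y hr) (hf.maxAvg_mono hr' fun i =>
    le_trans (add_le_add_left (norm_le_pi_norm (y - y') i) r') h)

theorem log_maxAvg_le_add (hf : IsBump f) {y y' : Fin m → ℝ} {r r' h : ℝ} (hr : 0 < r) (hr' : 0 < r') (hh : 0 ≤ h)
    (hy : ‖y - y'‖ + r ≤ r' + h) :
    Real.log (maxAvg f y' r') ≤ Real.log (maxAvg f y r) + m * Real.log (1 + h / r') := by
  have h1 := Real.log_le_log (hf.maxAvg_pos y' hr') (hf.maxAvg_le_mul hr hr' hh fun i =>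
    le_trans (add_le_add_left (norm_le_pi_norm (y - y') i) r) hy)
  rw [Real.log_mul (by positivity) (hf.maxAvg_pos y hr).ne', Real.log_pow, add_div,
    div_self hr'.ne'] at h1
  linarith

theorem continuous_log_maxAvg (hf : IsBump f) {r : ℝ} (hr : 0 < r) : Continuous fun y => Real.log (maxAvg f y r) := by
  refine LipschitzWith.continuous (K := (m / r).toNNReal) (LipschitzWith.of_le_add_mul _ ?_)
  intro x y
  have h1 := hf.log_maxAvg_le_add (y := y) (y' := x) hr hr (norm_nonneg (y - x)) (by linarith)
  have h2 : Real.log (1 + ‖y - x‖ / r) ≤ ‖y - x‖ / r := by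
    have := Real.log_le_sub_one_of_pos (show 0 < 1 + ‖y - x‖ / r by positivity)
    linarith
  rw [dist_comm, dist_eq_norm]
  calc _ ≤ _ := h1
    _ ≤ Real.log (maxAvg f y r) + m * (‖y - x‖ / r) := by gcongr
    _ = _ := by rw [Real.coe_toNNReal _ (by positivity)]; ring

end IsBump

/-- Mollification at unit scale. -/
theorem exists_mollify (m : ℕ) : ∃ K : ℝ, 0 ≤ K ∧ ∀ h : (Fin m → ℝ) → ℝ, Continuous h →
    ∃ b : (Fin m → ℝ) → ℝ, ContDiff ℝ 1 b ∧
      (∀ u c, (∀ t, ‖t‖ ≤ 1 / 4 → c ≤ h (u - t)) → c ≤ b u) ∧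
      (∀ u c, (∀ t, ‖t‖ ≤ 1 / 4 → h (u - t) ≤ c) → b u ≤ c) ∧
      (∀ u c δ, (∀ t, ‖t‖ ≤ 1 / 4 → |h (u - t) - c| ≤ δ) → ∀ v, |fderiv ℝ b u v| ≤ K * δ * ‖v‖) ∧
      ∀ a L, (∀ t, h (t + a) ≤ h t + L) → ∀ u, b (u + a) ≤ b u + L := by
  let φ : ContDiffBump (0 : Fin m → ℝ) := ⟨1 / 8, 1 / 4, by norm_num, by norm_num⟩
  set θ := φ.normed volume with hθ
  have hθsupp : ∀ t, 1 / 4 < ‖t‖ → θ t = 0 := fun t ht => by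
    have : t ∉ Function.support θ := by
      rw [hθ, φ.support_normed_eq]
      simpa [φ] using ht.le
    simpa using this
  have hθc : HasCompactSupport θ := φ.hasCompactSupport_normed
  have hθ1 : ContDiff ℝ 1 θ := φ.contDiff_normed
  have hθ0 : ∀ t, 0 ≤ θ t := φ.nonneg_normed
  have hθi : ∫ t, θ t = 1 := φ.integral_normed
  have hdθ : Continuous (fderiv ℝ θ) := hθ1.continuous_fderiv one_ne_zero
  have hdθc : HasCompactSupport (fderiv ℝ θ) := hθc.fderiv ℝ
  have hdθi : Integrable fun t => ‖fderiv ℝ θ t‖ := (hdθ.integrable_of_hasCompactSupport hdθc).norm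
  have hdsupp : ∀ t, 1 / 4 < ‖t‖ → fderiv ℝ θ t = 0 := fun t ht => by
    have h1 : θ =ᶠ[nhds t] fun _ => 0 := by
      filter_upwards [(isOpen_lt continuous_const continuous_norm).mem_nhds ht] with s hs
      exact hθsupp s hs
    rw [h1.fderiv_eq]; simp
  refine ⟨∫ t, ‖fderiv ℝ θ t‖, integral_nonneg fun _ => norm_nonneg _, fun h hh => ?_⟩
  have hInt : ∀ u (g : (Fin m → ℝ) → ℝ), Continuous g → Integrable fun t => θ t * g (u - t) :=
    fun u g hg => (hθ1.continuous.mul (by fun_prop)).integrable_of_hasCompactSupport hθc.mul_right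
  have hmono : ∀ u (g g' : (Fin m → ℝ) → ℝ), Continuous g → Continuous g' →
      (∀ t, ‖t‖ ≤ 1 / 4 → g (u - t) ≤ g' (u - t)) →
      ∫ t, θ t * g (u - t) ≤ ∫ t, θ t * g' (u - t) := by
    intro u g g' hg hg' hgg
    refine integral_mono (hInt u g hg) (hInt u g' hg') fun t => ?_
    rcases le_or_gt ‖t‖ (1 / 4) with ht | ht
    · exact mul_le_mul_of_nonneg_left (hgg t ht) (hθ0 t)
    · simp [hθsupp t ht]
  have hconst : ∀ c : ℝ, ∫ t, θ t * c = c := fun c => by rw [integral_mul_const, hθi, one_mul]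
  set b : (Fin m → ℝ) → ℝ := convolution θ h (ContinuousLinearMap.lsmul ℝ ℝ) volume with hb
  have hbv : ∀ u, b u = ∫ t, θ t * h (u - t) := fun u => by rw [hb, convolution]; simp
  refine ⟨b, hθc.contDiff_convolution_left _ hθ1 hh.locallyIntegrable, ?_, ?_, ?_, ?_⟩
  · intro u c hc
    rw [hbv, ← hconst c]
    exact hmono u (fun _ => c) h continuous_const hh hc
  · intro u c hc
    rw [hbv, ← hconst c]
    exact hmono u h (fun _ => c) hh continuous_const hc
  · intro u c δ hδ v
    set b' : (Fin m → ℝ) → ℝ :=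
      convolution θ (fun x => h x - c) (ContinuousLinearMap.lsmul ℝ ℝ) volume with hb'
    have hbb' : b = fun x => b' x + c := by
      ext x
      have : b' x = ∫ t, θ t * (h (x - t) - c) := by rw [hb', convolution]; simp
      rw [hbv, this]
      simp_rw [mul_sub]
      rw [integral_sub (hInt x h hh) (hInt x (fun _ => c) continuous_const), hconst]
      ring
    have hd := hθc.hasFDerivAt_convolution_left (ContinuousLinearMap.lsmul ℝ ℝ) hθ1
      ((show Continuous fun x => h x - c by fun_prop).locallyIntegrable (μ := volume)) u
    have hd' : fderiv ℝ b u = convolution (fderiv ℝ θ) (fun x => h x - c)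
        ((ContinuousLinearMap.lsmul ℝ ℝ).precompL (Fin m → ℝ)) volume u := by
      rw [hbb', fderiv_add_const]
      exact hd.fderiv
    refine le_trans ((fderiv ℝ b u).le_opNorm v) (mul_le_mul_of_nonneg_right ?_ (norm_nonneg v))
    rw [hd', convolution, ← integral_mul_const]
    refine norm_integral_le_of_norm_le (hdθi.mul_const δ) (Filter.Eventually.of_forall fun t => ?_)
    rcases le_or_gt ‖t‖ (1 / 4) with ht | ht
    · refine ContinuousLinearMap.opNorm_le_bound _ (mul_nonneg (norm_nonneg _)
        ((abs_nonneg _).trans (hδ t ht))) fun w => ?_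
      rw [ContinuousLinearMap.precompL_apply, ContinuousLinearMap.lsmul_apply, norm_smul]
      calc ‖fderiv ℝ θ t w‖ * ‖h (u - t) - c‖ ≤ (‖fderiv ℝ θ t‖ * ‖w‖) * δ := by
            gcongr
            · exact (fderiv ℝ θ t).le_opNorm w
            · exact hδ t ht
        _ = _ := by ring
    · rw [hdsupp t ht]; simp
  · intro a L haL u
    rw [hbv, hbv, ← hconst L, ← integral_add (hInt u h hh) (hInt u (fun _ => L) continuous_const)]
    have h1 := hmono u (fun x => h (x + a)) (fun x => h x + L) (by fun_prop) (by fun_prop)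
      fun t _ => haL _
    refine le_of_eq_of_le ?_ (h1.trans (le_of_eq ?_))
    · congr 1; ext t; congr 2; abel
    · congr 1; ext t; ring

end SBL

namespace SBL

variable {m : ℕ}

/-- Averages of `|F|^q` over boxes are controlled by a function with the right `L^p` norm; the
function is written as `c * f ^ (1 / p)` to treat finite and infinite exponents together. -/
theorem exists_dominating (m : ℕ) {q : ℕ} (hq : q ≠ 0) {p : ℝ≥0∞} (hp : (q : ℝ≥0∞) < p) :
    ∃ C : ℝ≥0, ∀ F : (Fin m → ℝ) → ℝ, Continuous F → HasCompactSupport F →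
      ∃ (c : ℝ≥0) (f : (Fin m → ℝ) → ℝ≥0∞), Measurable f ∧ (∀ x, f x ≠ ∞) ∧
        c * (∫⁻ x, f x) ^ (p⁻¹).toReal ≤ C * eLpNorm F p volume ∧
        ∀ a b : Fin m → ℝ, (∀ i, a i < b i) → ∀ x ∈ Set.Icc a b,
          ∫⁻ y in Set.Icc a b, ‖F y‖ₑ ^ q ≤
            2 ^ m * (∏ i, ENNReal.ofReal (b i - a i)) * (c * f x ^ (p⁻¹).toReal) ^ q := by
  have hq0 : (0 : ℝ) < q := by exact_mod_cast Nat.pos_of_ne_zero hq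
  by_cases hpt : p = ∞
  · refine ⟨1, fun F hF hFc => ⟨(eLpNorm F ∞ volume).toNNReal, 0, measurable_const, by simp, ?_, ?_⟩⟩
    · have hfin : eLpNorm F ∞ volume ≠ ∞ := (hF.memLp_of_hasCompactSupport hFc).eLpNorm_ne_top
      rw [ENNReal.coe_toNNReal hfin]
      simp [hpt]
    · intro a b hab x hx
      have hfin : eLpNorm F ∞ volume ≠ ∞ := (hF.memLp_of_hasCompactSupport hFc).eLpNorm_ne_top
      rw [ENNReal.coe_toNNReal hfin]
      simp only [hpt, ENNReal.inv_top, ENNReal.toReal_zero, ENNReal.rpow_zero, mul_one]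
      calc ∫⁻ y in Set.Icc a b, ‖F y‖ₑ ^ q ≤ ∫⁻ _ in Set.Icc a b, eLpNorm F ∞ volume ^ q := by
            refine lintegral_mono_ae (ae_restrict_of_ae ?_)
            filter_upwards [ae_le_eLpNormEssSup (f := F) (μ := volume)] with y hy
            rw [eLpNorm_exponent_top]
            gcongr
        _ = (∏ i, ENNReal.ofReal (b i - a i)) * eLpNorm F ∞ volume ^ q := by
            rw [setLIntegral_const, Real.volume_Icc_pi, mul_comm]
        _ ≤ _ := by
            rw [mul_assoc]
            exact le_mul_of_one_le_left' (one_le_pow₀ one_le_two)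
  · set P := p.toReal with hP
    have hqP : (q : ℝ) < P := by
      have := (ENNReal.toReal_lt_toReal (ENNReal.natCast_ne_top q) hpt).2 hp
      simpa using this
    have hP0 : 0 < P := hq0.trans hqP
    have hp0 : p ≠ 0 := (zero_le.trans_lt hp).ne'
    have hw : (p⁻¹).toReal = P⁻¹ := ENNReal.toReal_inv p
    set r := P / q with hr
    have hr1 : 1 < r := (one_lt_div hq0).2 hqP
    set K := ENNReal.ofReal (8 * 2 ^ (r - 1) * r / (r - 1)) ^ m with hK
    have hKt : K ≠ ∞ := by simp [hK]
    have hKP : K ^ P⁻¹ ≠ ∞ := ENNReal.rpow_ne_top_of_nonneg (inv_nonneg.2 hP0.le) hKt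
    refine ⟨(K ^ P⁻¹).toNNReal, fun F hF hFc => ?_⟩
    obtain ⟨B, hB⟩ := hFc.exists_bound_of_continuous hF
    have hmeas : Measurable fun y => ‖F y‖ₑ ^ q := hF.measurable.enorm.pow_const q
    obtain ⟨g, hg, hgB, hgr, hgav⟩ := exists_strongMax hr1 hmeas
      (B := ENNReal.ofReal B ^ q) (by simp) (fun t => by
        gcongr
        rw [← ofReal_norm]
        exact ENNReal.ofReal_le_ofReal (hB t))
    have hgt : ∀ x, g x ≠ ∞ := fun x => ((hgB x).trans_lt (by simp)).ne
    refine ⟨1, fun x => g x ^ r, hg.pow_const r, fun x =>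
      ENNReal.rpow_ne_top_of_nonneg (by linarith) (hgt x), ?_, ?_⟩
    · rw [hw, ENNReal.coe_one, one_mul, ENNReal.coe_toNNReal hKP,
        eLpNorm_eq_lintegral_rpow_enorm_toReal hp0 hpt, ← hP, one_div,
        ← ENNReal.mul_rpow_of_nonneg _ _ (inv_nonneg.2 hP0.le)]
      refine ENNReal.rpow_le_rpow (hgr.trans (le_of_eq ?_)) (inv_nonneg.2 hP0.le)
      congr 1
      refine lintegral_congr fun x => ?_
      rw [← ENNReal.rpow_natCast, ← ENNReal.rpow_mul, hr, mul_div_cancel₀ _ hq0.ne']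
    · intro a b hab x hx
      refine (hgav a b hab x hx).trans (le_of_eq ?_)
      have h1 : P / q * (P⁻¹ * q) = 1 := by field_simp
      rw [hw, ENNReal.coe_one, one_mul, ← ENNReal.rpow_natCast ((g x ^ r) ^ P⁻¹) q,
        ← ENNReal.rpow_mul, ← ENNReal.rpow_mul, hr, h1, ENNReal.rpow_one]

/-- The parametrization `J` of the fibres: both bounded and bounded below on every corner. -/
structure IsNondeg (C : ℝ) (J : Fin m × Fin 2 → (Fin m → ℝ) →L[ℝ] ℝ) : Prop where
  one_le : 1 ≤ C
  abs_le : ∀ κ v, |J κ v| ≤ C * ‖v‖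
  norm_le : ∀ (j : Corner m) v, ‖v‖ ≤ C * ‖fun i => J (i, j i) v‖

/-- The linear map selecting the coordinates of the corner `j`. -/
def cornerMap (J : Fin m × Fin 2 → (Fin m → ℝ) →L[ℝ] ℝ) (j : Corner m) :
    (Fin m → ℝ) →L[ℝ] (Fin m → ℝ) := ContinuousLinearMap.pi fun i => J (i, j i)

theorem cornerMap_apply (J : Fin m × Fin 2 → (Fin m → ℝ) →L[ℝ] ℝ) (j : Corner m) (v : Fin m → ℝ) :
    cornerMap J j v = fun i => J (i, j i) v := rfl

namespace IsNondeg

variable {C : ℝ} {J : Fin m × Fin 2 → (Fin m → ℝ) →L[ℝ] ℝ}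

theorem norm_cornerMap_le (hJ : IsNondeg C J) (j : Corner m) (v : Fin m → ℝ) :
    ‖cornerMap J j v‖ ≤ C * ‖v‖ :=
  (pi_norm_le_iff_of_nonneg (mul_nonneg (zero_le_one.trans hJ.one_le) (norm_nonneg v))).2
    fun _ => hJ.abs_le _ v

theorem injective_cornerMap (hJ : IsNondeg C J) (j : Corner m) : Function.Injective (cornerMap J j) := by
  refine (injective_iff_map_eq_zero _).2 fun v hv => ?_
  have h := hJ.norm_le j v
  rw [← cornerMap_apply, hv, norm_zero, mul_zero] at h
  exact norm_le_zero_iff.1 h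

theorem det_ne_zero (hJ : IsNondeg C J) (j : Corner m) :
    LinearMap.det (cornerMap J j : (Fin m → ℝ) →ₗ[ℝ] (Fin m → ℝ)) ≠ 0 := by
  have h := LinearMap.injective_iff_surjective.1 (show Function.Injective
    (cornerMap J j : (Fin m → ℝ) →ₗ[ℝ] (Fin m → ℝ)) from hJ.injective_cornerMap j)
  have := (LinearEquiv.ofBijective _ ⟨hJ.injective_cornerMap j, h⟩).isUnit_det'
  exact this.ne_zero

theorem lintegral_comp_cornerMap_le (hJ : IsNondeg C J) (j : Corner m) {f : (Fin m → ℝ) → ℝ≥0∞}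
    (hf : Measurable f) : ∫⁻ v, f (cornerMap J j v) ≤ ENNReal.ofReal (C ^ m) * ∫⁻ y, f y := by
  have hC : 0 < C := zero_lt_one.trans_le hJ.one_le
  set T : (Fin m → ℝ) →ₗ[ℝ] (Fin m → ℝ) := (cornerMap J j).toLinearMap with hT
  have hmap : Measure.map (cornerMap J j) volume =
      ENNReal.ofReal |(LinearMap.det T)⁻¹| • (volume : Measure (Fin m → ℝ)) :=
    Measure.map_linearMap_addHaar_eq_smul_addHaar volume (hJ.det_ne_zero j)
  have h1 : ∫⁻ v, f (cornerMap J j v) = ENNReal.ofReal |(LinearMap.det T)⁻¹| * ∫⁻ y, f y := by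
    rw [← lintegral_map hf (cornerMap J j).continuous.measurable, hmap, lintegral_smul_measure,
      smul_eq_mul]
  rw [h1]
  gcongr
  have h2 := Measure.addHaar_preimage_linearMap (volume : Measure (Fin m → ℝ)) (hJ.det_ne_zero j)
    (Metric.closedBall 0 1)
  have h3 : T ⁻¹' Metric.closedBall 0 1 ⊆ Metric.closedBall 0 C := by
    intro v hv
    have hv' : ‖cornerMap J j v‖ ≤ 1 := by simpa [hT] using hv
    have := hJ.norm_le j v
    rw [← cornerMap_apply] at this
    rw [mem_closedBall_zero_iff]
    exact this.trans (by nlinarith)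
  have h4 := measure_mono (μ := volume) h3
  rw [h2, Measure.addHaar_closedBall' _ _ hC.le, Module.finrank_fin_fun] at h4
  have hb0 : volume (Metric.closedBall (0 : Fin m → ℝ) 1) ≠ 0 :=
    (Metric.measure_closedBall_pos _ _ one_pos).ne'
  have hbt : volume (Metric.closedBall (0 : Fin m → ℝ) 1) ≠ ∞ := measure_closedBall_lt_top.ne
  exact (ENNReal.ofReal_le_ofReal_iff (by positivity)).1 ((ENNReal.mul_le_mul_iff_left hb0 hbt).1 h4)

theorem exists_dual (hJ : IsNondeg C J) (j : Corner m) (i : Fin m) : ∃ v : Fin m → ℝ, ‖v‖ ≤ C ∧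
    ∀ i', J (i', j i') v = if i' = i then 1 else 0 := by
  obtain ⟨v, hv⟩ := LinearMap.injective_iff_surjective.1 (show Function.Injective
    (cornerMap J j : (Fin m → ℝ) →ₗ[ℝ] (Fin m → ℝ)) from hJ.injective_cornerMap j)
    (fun i' => if i' = i then 1 else 0)
  have hv' : ∀ i', J (i', j i') v = if i' = i then 1 else 0 := fun i' => congrFun hv i'
  refine ⟨v, (hJ.norm_le j v).trans ?_, hv'⟩
  refine mul_le_of_le_one_right (zero_le_one.trans hJ.one_le) ?_
  refine (pi_norm_le_iff_of_nonneg zero_le_one).2 fun i' => ?_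
  rw [hv']
  split_ifs <;> simp

theorem lintegral_prod_le (hJ : IsNondeg C J) {w : Corner m → ℝ} (hw : ∀ j, 0 ≤ w j)
    (hw1 : ∑ j, w j = 1) {f : Corner m → (Fin m → ℝ) → ℝ≥0∞} (hf : ∀ j, Measurable (f j))
    (c : Corner m → ℝ≥0) :
    ∫⁻ v, ∏ j, (c j * f j (cornerMap J j v) ^ w j) ≤
      ENNReal.ofReal (C ^ m) * ∏ j, (c j * (∫⁻ y, f j y) ^ w j) := by
  have hA : ∀ j, Measurable fun v => f j (cornerMap J j v) := fun j =>
    (hf j).comp (cornerMap J j).continuous.measurable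
  simp_rw [Finset.prod_mul_distrib]
  rw [lintegral_const_mul' _ _ (ENNReal.prod_ne_top fun _ _ => ENNReal.coe_ne_top)]
  calc (∏ j, (c j : ℝ≥0∞)) * ∫⁻ v, ∏ j, f j (cornerMap J j v) ^ w j
      ≤ (∏ j, (c j : ℝ≥0∞)) * ∏ j, (∫⁻ v, f j (cornerMap J j v)) ^ w j := by
        gcongr
        exact ENNReal.lintegral_prod_norm_pow_le _ (fun j _ => (hA j).aemeasurable) hw1
          fun j _ => hw j
    _ ≤ (∏ j, (c j : ℝ≥0∞)) * ∏ j, (ENNReal.ofReal (C ^ m) * ∫⁻ y, f j y) ^ w j := by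
        gcongr with j
        · exact hw j
        · exact hJ.lintegral_comp_cornerMap_le j (hf j)
    _ = _ := by
        simp_rw [ENNReal.mul_rpow_of_nonneg _ _ (hw _)]
        have hC0 : 0 < C ^ m := pow_pos (zero_lt_one.trans_le hJ.one_le) m
        simp_rw [ENNReal.ofReal_rpow_of_pos hC0]
        rw [Finset.prod_mul_distrib, ← ENNReal.ofReal_prod_of_nonneg fun j _ =>
          Real.rpow_nonneg hC0.le _, ← Real.rpow_sum_of_pos hC0, hw1, Real.rpow_one]
        ring

end IsNondeg

end SBL

namespace SBL

variable {m : ℕ}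

/-- The logarithm of the maximal average at scale `exp s`. -/
def logAvg (f : (Fin m → ℝ) → ℝ) (y : Fin m → ℝ) (s : ℝ) : ℝ := Real.log (maxAvg f y (Real.exp s))

namespace IsBump

variable {f : (Fin m → ℝ) → ℝ}

theorem exp_logAvg (hf : IsBump f) (y : Fin m → ℝ) (s : ℝ) :
    Real.exp (logAvg f y s) = maxAvg f y (Real.exp s) :=
  Real.exp_log (hf.maxAvg_pos y (Real.exp_pos s))

theorem continuous_logAvg (hf : IsBump f) (s : ℝ) : Continuous fun y => logAvg f y s :=
  hf.continuous_log_maxAvg (Real.exp_pos s)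

theorem logAvg_anti (hf : IsBump f) (y : Fin m → ℝ) {s s' : ℝ} (h : s ≤ s') :
    logAvg f y s' ≤ logAvg f y s :=
  hf.log_maxAvg_mono (Real.exp_pos _) (Real.exp_pos _) (by simpa using h)

theorem logAvg_le_add (hf : IsBump f) (y : Fin m → ℝ) {s s' : ℝ} (h : s ≤ s') :
    logAvg f y s ≤ logAvg f y s' + m * (s' - s) := by
  have h1 := hf.log_maxAvg_le_add (y := y) (y' := y) (r := Real.exp s') (r' := Real.exp s)
    (h := Real.exp s' - Real.exp s) (Real.exp_pos _) (Real.exp_pos _)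
    (sub_nonneg.2 (Real.exp_le_exp.2 h)) (by simp)
  have h2 : 1 + (Real.exp s' - Real.exp s) / Real.exp s = Real.exp (s' - s) := by
    rw [Real.exp_sub]; field_simp; ring
  rwa [h2, Real.log_exp] at h1

end IsBump

/-- A smoothed version of the logarithmic averages at scale `exp s`. -/
theorem exists_weight (m : ℕ) : ∃ K : ℝ, 0 ≤ K ∧ ∀ f : (Fin m → ℝ) → ℝ, IsBump f → ∀ s : ℝ,
    ∃ b : (Fin m → ℝ) → ℝ, ContDiff ℝ 1 b ∧ (∀ y, logAvg f y (s + 1) ≤ b y) ∧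
      (∀ y, b y ≤ logAvg f y (s - 1)) ∧
      (∀ y v, Real.exp s * |fderiv ℝ b y v| ≤
        K * (logAvg f y (s - 1) - logAvg f y (s + 1)) * ‖v‖) ∧
      ∀ y a, b (y + a) ≤ b y + m * Real.log (1 + ‖a‖ / Real.exp s) := by
  obtain ⟨K, hK, hmol⟩ := exists_mollify m
  refine ⟨K, hK, fun f hf s => ?_⟩
  set R := Real.exp s with hR
  have hR0 : 0 < R := Real.exp_pos s
  have he : (2 : ℝ) ≤ Real.exp 1 := by linarith [Real.add_one_le_exp (1 : ℝ)]
  have hR1 : 2 * R ≤ Real.exp (s + 1) := by rw [Real.exp_add]; nlinarith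
  have hR2 : Real.exp (s - 1) ≤ R / 2 := by
    rw [Real.exp_sub]; exact div_le_div_of_nonneg_left hR0.le two_pos he
  obtain ⟨b, hb1, hlo, hup, hd, hsh⟩ := hmol (fun u => logAvg f (R • u) s)
    ((hf.continuous_logAvg s).comp (continuous_const_smul R))
  have hnear : ∀ y t : Fin m → ℝ, ‖t‖ ≤ 1 / 4 → R • (R⁻¹ • y - t) = y - R • t := fun y t _ => by
    rw [smul_sub, smul_inv_smul₀ hR0.ne']
  have hnorm : ∀ t : Fin m → ℝ, ‖t‖ ≤ 1 / 4 → ‖R • t‖ ≤ R / 4 := fun t ht => by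
    rw [norm_smul, Real.norm_of_nonneg hR0.le]; nlinarith
  have hlo' : ∀ y t : Fin m → ℝ, ‖t‖ ≤ 1 / 4 →
      logAvg f y (s + 1) ≤ logAvg f (R • (R⁻¹ • y - t)) s := fun y t ht => by
    rw [hnear y t ht]
    refine hf.log_maxAvg_mono (Real.exp_pos _) (Real.exp_pos _) ?_
    rw [sub_sub_cancel]
    linarith [hnorm t ht]
  have hup' : ∀ y t : Fin m → ℝ, ‖t‖ ≤ 1 / 4 →
      logAvg f (R • (R⁻¹ • y - t)) s ≤ logAvg f y (s - 1) := fun y t ht => by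
    rw [hnear y t ht]
    refine hf.log_maxAvg_mono (Real.exp_pos _) (Real.exp_pos _) ?_
    rw [sub_sub_cancel_left, norm_neg]
    linarith [hnorm t ht]
  refine ⟨fun y => b (R⁻¹ • y), hb1.comp (contDiff_const_smul R⁻¹), fun y => hlo _ _ (hlo' y),
    fun y => hup _ _ (hup' y), fun y v => ?_, fun y a => ?_⟩
  · have h1 : fderiv ℝ (fun y => b (R⁻¹ • y)) y v = R⁻¹ * fderiv ℝ b (R⁻¹ • y) v := by
      have h2 : HasFDerivAt (fun y => b (R⁻¹ • y))
          ((fderiv ℝ b (R⁻¹ • y)).comp (R⁻¹ • ContinuousLinearMap.id ℝ (Fin m → ℝ))) y :=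
        HasFDerivAt.comp y ((hb1.differentiable one_ne_zero) _).hasFDerivAt
          ((hasFDerivAt_id y).const_smul R⁻¹)
      rw [h2.fderiv]
      simp
    rw [h1, abs_mul, abs_of_pos (inv_pos.2 hR0), ← mul_assoc, mul_inv_cancel₀ hR0.ne', one_mul]
    refine hd _ (logAvg f y (s + 1)) _ (fun t ht => ?_) v
    rw [abs_of_nonneg (sub_nonneg.2 (hlo' y t ht))]
    linarith [hup' y t ht]
  · have h1 := hsh (R⁻¹ • a) (m * Real.log (1 + ‖a‖ / R)) (fun t => ?_) (R⁻¹ • y)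
    · simpa [smul_add] using h1
    · rw [smul_add, smul_inv_smul₀ hR0.ne']
      refine hf.log_maxAvg_le_add (Real.exp_pos _) (Real.exp_pos _) (norm_nonneg a) ?_
      rw [sub_add_cancel_left, norm_neg, add_comm]

theorem isBump_abs_pow {q : ℕ} (hq : q ≠ 0) {F : (Fin m → ℝ) → ℝ} (hF : Continuous F)
    (hFc : HasCompactSupport F) (hF0 : F ≠ 0) : IsBump fun y => |F y| ^ q where
  continuous := hF.abs.pow q
  hasCompactSupport := by
    have h1 : HasCompactSupport fun y => |F y| := hFc.norm
    exact h1.comp_left (g := fun t : ℝ => t ^ q) (zero_pow hq)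
  nonneg x := by positivity
  exists_pos := by
    obtain ⟨x, hx⟩ := Function.ne_iff.1 hF0
    exact ⟨x, pow_pos (abs_pos.2 hx) q⟩

/-- The maximal averages are controlled by the dominating function. -/
theorem maxAvg_le_of_lintegral_le {q : ℕ} {F : (Fin m → ℝ) → ℝ} (hF : Continuous F)
    (A : (Fin m → ℝ) → ℝ≥0∞) (hAt : ∀ x, A x ≠ ∞)
    (hA : ∀ a b : Fin m → ℝ, (∀ i, a i < b i) → ∀ x ∈ Set.Icc a b,
          ∫⁻ y in Set.Icc a b, ‖F y‖ₑ ^ q ≤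
            2 ^ m * (∏ i, ENNReal.ofReal (b i - a i)) * A x ^ q)
    (y : Fin m → ℝ) {r : ℝ} (hr : 0 < r) :
    maxAvg (fun y => |F y| ^ q) y r ≤ 2 ^ m * (A y).toReal ^ q := by
  refine ciSup_le fun z => ?_
  have hz := z.2
  have hab := z.lt hr
  have hpos : 0 < ∏ i, (z.1.2 i - z.1.1 i) := Finset.prod_pos fun i _ => sub_pos.2 (hab i)
  have hm : AEStronglyMeasurable (fun x => |F x| ^ q)
      (volume.restrict (Set.Icc z.1.1 z.1.2)) :=
    (show Continuous fun x => |F x| ^ q from hF.abs.pow q).aestronglyMeasurable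
  have h1 := hA z.1.1 z.1.2 hab y ⟨fun i => by linarith [(hz i).1], fun i => by linarith [(hz i).2]⟩
  rw [boxAvg, inv_mul_le_iff₀ hpos, integral_eq_lintegral_of_nonneg_ae
    (Filter.Eventually.of_forall fun x => by positivity) hm]
  have h2 : ∀ x, ENNReal.ofReal (|F x| ^ q) = ‖F x‖ₑ ^ q := fun x => by
    rw [ENNReal.ofReal_pow (abs_nonneg _), ← Real.norm_eq_abs, ofReal_norm]
  simp_rw [h2]
  refine (ENNReal.toReal_mono ?_ h1).trans (le_of_eq ?_)
  · exact ENNReal.mul_ne_top (ENNReal.mul_ne_top (by simp)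
      (ENNReal.prod_ne_top fun _ _ => ENNReal.ofReal_ne_top)) (ENNReal.pow_ne_top (hAt y))
  · rw [ENNReal.toReal_mul, ENNReal.toReal_mul, ENNReal.toReal_pow, ENNReal.toReal_pow,
      ENNReal.toReal_prod]
    have : ∀ i, (ENNReal.ofReal (z.1.2 i - z.1.1 i)).toReal = z.1.2 i - z.1.1 i := fun i =>
      ENNReal.toReal_ofReal (sub_pos.2 (hab i)).le
    simp_rw [this]
    simp only [ENNReal.toReal_ofNat]
    ring

end SBL

namespace SBL

variable {m : ℕ}

/-- An integrable majorant for the products of maximal averages over the corners. -/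
theorem exists_majorant {q : ℕ} (hq : q ≠ 0) {p : Corner m → ℝ≥0∞}
    (hp : ∀ j, (q : ℝ≥0∞) < p j) (hp1 : ∑ j, (p j)⁻¹ = 1) (C₁ : ℝ) :
    ∃ C : ℝ≥0, ∀ J : Fin m × Fin 2 → (Fin m → ℝ) →L[ℝ] ℝ, IsNondeg C₁ J →
      ∀ F : Corner m → (Fin m → ℝ) → ℝ, (∀ j, Continuous (F j)) →
      (∀ j, HasCompactSupport (F j)) → (∀ j, F j ≠ 0) →
      ∃ Y : (Fin m → ℝ) → ℝ, Integrable Y ∧ (∀ v, 0 ≤ Y v) ∧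
        ENNReal.ofReal (∫ v, Y v) ≤ C * ∏ j, eLpNorm (F j) (p j) volume ∧
        ∀ v s, Real.exp ((q : ℝ)⁻¹ * ∑ j, logAvg (fun y => |F j y| ^ q) (cornerMap J j v) s) ≤ Y v := by
  choose C hC using fun j => exists_dominating m hq (hp j)
  refine ⟨(2 ^ m) ^ Fintype.card (Corner m) * (Real.toNNReal (C₁ ^ m) * ∏ j, C j),
    fun J hJ F hF hFc hF0 => ?_⟩
  choose c f hf hft hfn hA using fun j => hC j (F j) (hF j) (hFc j)
  have hw1 : ∑ j, ((p j)⁻¹).toReal = 1 := by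
    rw [← ENNReal.toReal_sum, hp1, ENNReal.toReal_one]
    intro j _
    exact ENNReal.inv_ne_top.2 (pos_of_gt (hp j)).ne'
  set Z : (Fin m → ℝ) → ℝ≥0∞ := fun v => ∏ j, (c j * f j (cornerMap J j v) ^ ((p j)⁻¹).toReal)
    with hZ
  have hZle : ∫⁻ v, Z v ≤ (Real.toNNReal (C₁ ^ m) * ∏ j, C j : ℝ≥0) *
      ∏ j, eLpNorm (F j) (p j) volume := by
    refine (hJ.lintegral_prod_le (fun j => ENNReal.toReal_nonneg) hw1 hf c).trans ?_
    push_cast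
    rw [mul_assoc, ← Finset.prod_mul_distrib]
    exact mul_le_mul' le_rfl (Finset.prod_le_prod' fun j _ => hfn j)
  have hZt : ∫⁻ v, Z v ≠ ∞ := by
    refine ne_top_of_le_ne_top (ENNReal.mul_ne_top ENNReal.coe_ne_top ?_) hZle
    exact ENNReal.prod_ne_top fun j _ => ((hF j).memLp_of_hasCompactSupport (hFc j)).eLpNorm_ne_top
  have hZm : Measurable Z := by
    refine Finset.measurable_prod _ fun j _ => ?_
    exact (((hf j).comp (cornerMap J j).continuous.measurable).pow_const _).const_mul _
  have hfin : ∀ j x, (c j * f j x ^ ((p j)⁻¹).toReal : ℝ≥0∞) ≠ ∞ := fun j x =>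
    ENNReal.mul_ne_top ENNReal.coe_ne_top (ENNReal.rpow_ne_top_of_nonneg ENNReal.toReal_nonneg (hft j x))
  refine ⟨fun v => (2 ^ m) ^ Fintype.card (Corner m) * (Z v).toReal,
    (integrable_toReal_of_lintegral_ne_top hZm.aemeasurable hZt).const_mul _,
    fun v => by positivity, ?_, fun v s => ?_⟩
  · rw [integral_const_mul, integral_toReal hZm.aemeasurable
      (Filter.Eventually.of_forall fun v => (ENNReal.prod_ne_top fun j _ => hfin j _).lt_top),
      ENNReal.ofReal_mul (by positivity), ENNReal.ofReal_toReal hZt, ENNReal.coe_mul, mul_assoc]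
    refine mul_le_mul' (le_of_eq ?_) hZle
    rw [ENNReal.ofReal_pow (by positivity), ENNReal.ofReal_pow (by positivity)]
    simp
  · simp only [hZ]
    rw [ENNReal.toReal_prod, ← Finset.card_univ, ← Finset.prod_const, ← Finset.prod_mul_distrib,
      Finset.mul_sum, Real.exp_sum]
    refine Finset.prod_le_prod (fun _ _ => (Real.exp_pos _).le) fun j _ => ?_
    have h1 := maxAvg_le_of_lintegral_le (hF j) (fun x => c j * f j x ^ ((p j)⁻¹).toReal)
      (hfin j) (hA j) (cornerMap J j v) (Real.exp_pos s)
    rw [← (isBump_abs_pow hq (hF j) (hFc j) (hF0 j)).exp_logAvg] at h1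
    refine le_of_pow_le_pow_left₀ hq (by positivity) ?_
    rw [← Real.exp_nat_mul, mul_inv_cancel_left₀ (Nat.cast_ne_zero.2 hq), mul_pow]
    refine h1.trans (mul_le_mul_of_nonneg_right ?_ (by positivity))
    exact le_self_pow₀ (one_le_pow₀ one_le_two) hq

theorem exp_mul_sub_le {a b T : ℝ} (hab : b ≤ a) (hT : a - b ≤ T) :
    Real.exp a * (a - b) ≤ Real.exp T * (Real.exp a - Real.exp b) := by
  have h1 : Real.exp b * (a - b + 1) ≤ Real.exp a := by
    calc Real.exp b * (a - b + 1) ≤ Real.exp b * Real.exp (a - b) := by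
          gcongr; exact Real.add_one_le_exp _
      _ = Real.exp a := by rw [← Real.exp_add]; ring_nf
  have h2 : Real.exp a ≤ Real.exp T * Real.exp b := by
    rw [← Real.exp_add]; exact Real.exp_le_exp.2 (by linarith)
  calc Real.exp a * (a - b) ≤ Real.exp T * Real.exp b * (a - b) := by
        gcongr
    _ = Real.exp T * (Real.exp b * (a - b)) := by ring
    _ ≤ _ := by gcongr; linarith

theorem sum_range_sub_shift_three (x : ℕ → ℝ) (N : ℕ) :
    ∑ n ∈ Finset.range N, (x n - x (n + 3)) = x 0 + x 1 + x 2 - (x N + x (N + 1) + x (N + 2)) := by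
  induction N with
  | zero => simp
  | succ k ih => rw [Finset.sum_range_succ, ih]; ring_nf

theorem exists_scaleData (hm : 1 ≤ m) {p : Corner m → ℝ≥0∞}
    (hp : ∀ j, (2 : ℝ≥0∞) ^ (m - 1) < p j) (hp1 : ∑ j, (p j)⁻¹ = 1) {C₁ : ℝ} (hC₁ : 1 ≤ C₁) :
    ∃ (C₀ : ℝ) (C : ℝ≥0), C₁ ≤ C₀ ∧
      ∀ J : Fin m × Fin 2 → (Fin m → ℝ) →L[ℝ] ℝ, IsNondeg C₁ J →
      ∀ F : Corner m → (Fin m → ℝ) → ℝ, (∀ j, Continuous (F j)) →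
      (∀ j, HasCompactSupport (F j)) → (∀ j, F j ≠ 0) → ∃ I : ℝ, 
      ENNReal.ofReal I ≤ C * ∏ j, eLpNorm (F j) (p j) volume ∧ ∀ (s₀ : ℝ) (N : ℕ),
      ∃ D : ScaleData m C₀, D.J = J ∧ D.F = F ∧ D.s₀ = s₀ ∧ D.N = N ∧ D.I = I ∧
        ∀ j n v w, D.β j n (v + w) ≤ D.β j n v + m * Real.log (1 + C₁ * ‖w‖ / Real.exp (s₀ + n)) := by
  set q : ℕ := 2 ^ (m - 1) with hq
  have hq0 : q ≠ 0 := by positivity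
  have hq1 : (1 : ℝ) ≤ q := by exact_mod_cast Nat.one_le_iff_ne_zero.2 hq0
  have hqi : (q : ℝ)⁻¹ ≤ 1 := inv_le_one_of_one_le₀ hq1
  have hqi0 : (0 : ℝ) ≤ (q : ℝ)⁻¹ := by positivity
  obtain ⟨C, hC⟩ := exists_majorant (m := m) hq0 (p := p)
    (fun j => by rw [hq]; exact_mod_cast hp j) hp1 C₁
  obtain ⟨K, hK0, hK⟩ := exists_weight m
  set T : ℝ := 3 * m * 2 ^ m with hT
  have hT0 : 0 ≤ T := by positivity
  set K' : ℝ := K * C₁ + 1 with hK'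
  have hKC : 0 ≤ K * C₁ := by positivity
  have hK'0 : 0 ≤ K' := by positivity
  set B : ℝ := 3 * (K' * q * Real.exp T) + 1 with hB
  have hB0 : 0 ≤ B := by positivity
  refine ⟨C₁ + K' * T + Real.exp (2 * m), Real.toNNReal B * C, ?_, fun J hJ F hF hFc hF0 => ?_⟩
  · have := Real.exp_pos (2 * (m : ℝ)); nlinarith
  obtain ⟨Y, hY, hY0, hYle, hYb⟩ := hC J hJ F hF hFc hF0
  have hYI : 0 ≤ ∫ v, Y v := integral_nonneg hY0
  refine ⟨B * ∫ v, Y v, ?_, fun s₀ N => ?_⟩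
  · rw [ENNReal.ofReal_mul hB0, ENNReal.coe_mul, mul_assoc]
    exact mul_le_mul' le_rfl hYle
  have hbump : ∀ j, IsBump fun y => |F j y| ^ q := fun j => isBump_abs_pow hq0 (hF j) (hFc j) (hF0 j)
  choose b hb hblo hbhi hbd hbs using fun j (n : ℕ) => hK _ (hbump j) (s₀ + n)
  set g : Corner m → ℕ → (Fin m → ℝ) → ℝ := fun j n v =>
    logAvg (fun y => |F j y| ^ q) (cornerMap J j v) (s₀ + n - 1) with hg
  have hgc : ∀ j n, Continuous (g j n) := fun j n =>
    ((hbump j).continuous_logAvg _).comp (cornerMap J j).continuous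
  have hgm : ∀ j v {n k : ℕ}, n ≤ k → g j k v ≤ g j n v := fun j v n k h =>
    (hbump j).logAvg_anti _ (by have : (n : ℝ) ≤ k := by exact_mod_cast h
                                linarith)
  have hgl : ∀ j v (n k : ℕ), g j n v ≤ g j (n + k) v + m * k := fun j v n k => by
    have h := (hbump j).logAvg_le_add (cornerMap J j v) (s := s₀ + n - 1) (s' := s₀ + (n + k : ℕ) - 1)
      (by push_cast; have : (0 : ℝ) ≤ k := Nat.cast_nonneg k
          linarith)
    refine h.trans (le_of_eq ?_)
    simp only [hg]; push_cast; ring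
  have hlo : ∀ j n v, g j (n + 2) v ≤ b j n (cornerMap J j v) := fun j n v => by
    refine le_trans (le_of_eq ?_) (hblo j n (cornerMap J j v))
    simp only [hg]; congr 1; push_cast; ring
  have hhi : ∀ j n v, b j n (cornerMap J j v) ≤ g j n v := fun j n v => hbhi j n (cornerMap J j v)
  set Dn : ℕ → (Fin m → ℝ) → ℝ := fun n v => ∑ j, (g j n v - g j (n + 3) v) with hDn
  have hD0 : ∀ n v, 0 ≤ Dn n v := fun n v =>
    Finset.sum_nonneg fun j _ => sub_nonneg.2 (hgm j v (by lia))
  have hDj : ∀ j n v, g j n v - g j (n + 3) v ≤ Dn n v := fun j n v =>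
    Finset.single_le_sum (f := fun j => g j n v - g j (n + 3) v)
      (fun j _ => sub_nonneg.2 (hgm j v (by lia))) (Finset.mem_univ j)
  have hDT : ∀ n v, Dn n v ≤ T := fun n v => by
    calc Dn n v ≤ ∑ _j : Corner m, (3 * m : ℝ) := Finset.sum_le_sum fun j _ => by
          have := hgl j v n 3; push_cast at this; linarith
      _ = T := by simp [hT, Corner]; ring
  have hDc : ∀ n, Continuous (Dn n) := fun n =>
    continuous_finsetSum _ fun j _ => (hgc j n).sub (hgc j (n + 3))
  set β : Corner m → ℕ → (Fin m → ℝ) → ℝ := fun j n v => (q : ℝ)⁻¹ * b j n (cornerMap J j v) with hβ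
  have hβd : ∀ j n, ContDiff ℝ 1 (β j n) := fun j n =>
    contDiff_const.mul ((hb j n).comp (cornerMap J j).contDiff)
  set x : ℕ → (Fin m → ℝ) → ℝ := fun n v => Real.exp ((q : ℝ)⁻¹ * ∑ j, g j n v) with hx
  have hxY : ∀ n v, x n v ≤ Y v := fun n v => hYb v _
  have hxc : ∀ n, Continuous (x n) := fun n =>
    Real.continuous_exp.comp (continuous_const.mul (continuous_finsetSum _ fun j _ => hgc j n))
  have hxi : ∀ n, Integrable (x n) := fun n =>
    hY.mono' (hxc n).aestronglyMeasurable (Filter.Eventually.of_forall fun v => by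
      rw [Real.norm_of_nonneg (Real.exp_pos _).le]; exact hxY n v)
  have hβx : ∀ n v, Real.exp (∑ j, β j n v) ≤ x n v := fun n v => by
    refine Real.exp_le_exp.2 ?_
    rw [Finset.mul_sum]
    exact Finset.sum_le_sum fun j _ => mul_le_mul_of_nonneg_left (hhi j n v) hqi0
  have hβc : ∀ n, Continuous fun v => Real.exp (∑ j, β j n v) := fun n =>
    Real.continuous_exp.comp (continuous_finsetSum _ fun j _ => (hβd j n).continuous)
  have hβi : ∀ n, Integrable fun v => Real.exp (∑ j, β j n v) := fun n =>
    (hxi n).mono' (hβc n).aestronglyMeasurable (Filter.Eventually.of_forall fun v => by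
      rw [Real.norm_of_nonneg (Real.exp_pos _).le]; exact hβx n v)
  have hkey : ∀ n v, Real.exp (∑ j, β j n v) * (K' * Dn n v) ≤
      K' * q * Real.exp T * (x n v - x (n + 3) v) := fun n v => by
    have h1 : (q : ℝ)⁻¹ * ∑ j, g j n v - (q : ℝ)⁻¹ * ∑ j, g j (n + 3) v = (q : ℝ)⁻¹ * Dn n v := by
      rw [← mul_sub, ← Finset.sum_sub_distrib]
    have h2 := exp_mul_sub_le (a := (q : ℝ)⁻¹ * ∑ j, g j n v) (b := (q : ℝ)⁻¹ * ∑ j, g j (n + 3) v)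
      (T := T) (by have := mul_nonneg hqi0 (hD0 n v); linarith)
      (by rw [h1]; exact (mul_le_of_le_one_left (hD0 n v) hqi).trans (hDT n v))
    rw [h1] at h2
    have h3 : (q : ℝ) * (x n v * ((q : ℝ)⁻¹ * Dn n v)) = x n v * Dn n v := by field_simp
    calc Real.exp (∑ j, β j n v) * (K' * Dn n v) ≤ x n v * (K' * Dn n v) :=
          mul_le_mul_of_nonneg_right (hβx n v) (mul_nonneg hK'0 (hD0 n v))
      _ = K' * (q * (x n v * ((q : ℝ)⁻¹ * Dn n v))) := by rw [h3]; ring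
      _ ≤ K' * (q * (Real.exp T * (x n v - x (n + 3) v))) := by gcongr
      _ = _ := by ring
  have hei : ∀ n, Integrable fun v => Real.exp (∑ j, β j n v) * (K' * Dn n v) := fun n => by
    refine ((hβi n).mul_const (K' * T)).mono'
      ((hβc n).mul (continuous_const.mul (hDc n))).aestronglyMeasurable
      (Filter.Eventually.of_forall fun v => ?_)
    rw [Real.norm_of_nonneg (mul_nonneg (Real.exp_pos _).le (mul_nonneg hK'0 (hD0 n v)))]
    gcongr
    exact hDT n v
  have hIle : ∫ v, Y v ≤ B * ∫ v, Y v :=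
    le_mul_of_one_le_left hYI (by rw [hB]; have : 0 ≤ 3 * (K' * q * Real.exp T) := by positivity
                                  linarith)
  refine ⟨{ J := J, F := F, s₀ := s₀, N := N, β := β, e := fun n v => K' * Dn n v,
            I := B * ∫ v, Y v
            one_le := ?_
            one_le_m := hm
            continuous_F := hF
            hasCompactSupport_F := hFc
            abs_J_le := ?_
            exists_dual := ?_
            contDiff_β := hβd
            integral_box_le := ?_
            abs_fderiv_β_le := ?_
            abs_β_sub_le := ?_
            e_le := ?_
            integrable_exp := hβi
            integral_exp_le := ?_
            integrable_exp_mul := hei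
            sum_integral_le := ?_ }, rfl, rfl, rfl, rfl, rfl, ?_⟩
  · have := Real.exp_pos (2 * (m : ℝ)); nlinarith [mul_nonneg hK'0 hT0]
  · intro κ v
    refine (hJ.abs_le κ v).trans (mul_le_mul_of_nonneg_right ?_ (norm_nonneg _))
    have := Real.exp_pos (2 * (m : ℝ)); nlinarith [mul_nonneg hK'0 hT0]
  · intro j i
    obtain ⟨v, hv, hv'⟩ := hJ.exists_dual j i
    refine ⟨v, hv.trans ?_, hv'⟩
    have := Real.exp_pos (2 * (m : ℝ)); nlinarith [mul_nonneg hK'0 hT0]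
  · intro j n v s hs
    have hspos : ∀ i, 0 < s i := fun i => (Real.exp_pos _).trans_le (hs i)
    have hP : 0 < ∏ i, (2 * s i) := Finset.prod_pos fun i _ => mul_pos two_pos (hspos i)
    have h1 := (hbump j).boxAvg_le_maxAvg (y := cornerMap J j v) (Real.exp_pos (s₀ + n - 1))
      (a := fun i => J (i, j i) v - s i) (b := fun i => J (i, j i) v + s i)
      (fun i => ⟨by rw [cornerMap_apply]; linarith [hs i], by rw [cornerMap_apply]; linarith [hs i]⟩)
    rw [← (hbump j).exp_logAvg, boxAvg] at h1
    have h2 : ∀ i, J (i, j i) v + s i - (J (i, j i) v - s i) = 2 * s i := fun i => by ring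
    simp_rw [h2] at h1
    rw [inv_mul_le_iff₀ hP] at h1
    refine h1.trans ?_
    rw [mul_comm]
    refine mul_le_mul_of_nonneg_right ?_ hP.le
    have h3 : (q : ℝ) * β j n v = b j n (cornerMap J j v) := by
      simp only [hβ]; rw [mul_inv_cancel_left₀ (by positivity)]
    rw [h3]
    have h4 : Real.exp (g j n v) ≤ Real.exp (2 * m) * Real.exp (b j n (cornerMap J j v)) := by
      rw [← Real.exp_add]
      have h5 := hgl j v n 2
      have h6 := hlo j n v
      push_cast at h5
      exact Real.exp_le_exp.2 (by linarith)
    refine h4.trans (mul_le_mul_of_nonneg_right ?_ (Real.exp_pos _).le)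
    nlinarith [mul_nonneg hK'0 hT0]
  · intro j n v w
    have h1 : fderiv ℝ (β j n) v w = (q : ℝ)⁻¹ * fderiv ℝ (b j n) (cornerMap J j v) (cornerMap J j w) := by
      have h2 : HasFDerivAt (β j n) ((q : ℝ)⁻¹ •
          (fderiv ℝ (b j n) (cornerMap J j v)).comp (cornerMap J j)) v :=
        ((((hb j n).differentiable one_ne_zero _).hasFDerivAt).comp v
          (cornerMap J j).hasFDerivAt).const_mul _
      rw [h2.fderiv]; rfl
    have h3 := hbd j n (cornerMap J j v) (cornerMap J j w)
    have h4 : logAvg (fun y => |F j y| ^ q) (cornerMap J j v) (s₀ + n - 1) -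
        logAvg (fun y => |F j y| ^ q) (cornerMap J j v) (s₀ + n + 1) ≤ Dn n v := by
      refine le_trans (sub_le_sub_left ?_ _) (hDj j n v)
      refine (hbump j).logAvg_anti _ (by push_cast; linarith)
    rw [h1, abs_mul, abs_of_nonneg hqi0]
    calc Real.exp (s₀ + n) * ((q : ℝ)⁻¹ * |fderiv ℝ (b j n) (cornerMap J j v) (cornerMap J j w)|)
        = (q : ℝ)⁻¹ * (Real.exp (s₀ + n) * |fderiv ℝ (b j n) (cornerMap J j v) (cornerMap J j w)|) := by
          ring
      _ ≤ Real.exp (s₀ + n) * |fderiv ℝ (b j n) (cornerMap J j v) (cornerMap J j w)| :=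
          mul_le_of_le_one_left (by positivity) hqi
      _ ≤ K * Dn n v * (C₁ * ‖w‖) := by
          refine h3.trans ?_
          have := hD0 n v
          gcongr
          exact hJ.norm_cornerMap_le j w
      _ ≤ K' * Dn n v * ‖w‖ := by
          rw [hK']
          nlinarith [mul_nonneg (hD0 n v) (norm_nonneg w)]
  · intro j n v
    have h1 := hlo j n v
    have h2 := hhi j n v
    have h3 := hlo j (n + 1) v
    have h4 := hhi j (n + 1) v
    have h5 := hgm j v (n := n) (k := n + 1) (by lia)
    have h6 := hgm j v (n := n + 2) (k := n + 3) (by lia)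
    have h7 : |b j (n + 1) (cornerMap J j v) - b j n (cornerMap J j v)| ≤ Dn n v := by
      refine le_trans ?_ (hDj j n v)
      rw [abs_le]
      constructor
      · have : g j (n + 1 + 2) v = g j (n + 3) v := rfl
        linarith
      · linarith
    simp only [hβ]
    rw [← mul_sub, abs_mul, abs_of_nonneg hqi0]
    calc (q : ℝ)⁻¹ * |b j (n + 1) (cornerMap J j v) - b j n (cornerMap J j v)|
        ≤ |b j (n + 1) (cornerMap J j v) - b j n (cornerMap J j v)| :=
          mul_le_of_le_one_left (abs_nonneg _) hqi
      _ ≤ Dn n v := h7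
      _ ≤ K' * Dn n v := le_mul_of_one_le_left (hD0 n v) (by rw [hK']; linarith)
  · intro n v
    have h1 := mul_le_mul_of_nonneg_left (hDT n v) hK'0
    have := Real.exp_pos (2 * (m : ℝ))
    linarith
  · intro n
    exact (integral_mono (hβi n) hY fun v => (hβx n v).trans (hxY n v)).trans hIle
  · rw [← integral_finsetSum _ fun n _ => hei n]
    calc ∫ v, ∑ n ∈ Finset.range N, Real.exp (∑ j, β j n v) * (K' * Dn n v)
        ≤ ∫ v, 3 * (K' * q * Real.exp T) * Y v := by
          refine integral_mono (integrable_finsetSum _ fun n _ => hei n) (hY.const_mul _) fun v => ?_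
          dsimp only
          refine (Finset.sum_le_sum fun n _ => hkey n v).trans ?_
          rw [← Finset.mul_sum, sum_range_sub_shift_three fun n => x n v]
          have h1 := hxY 0 v
          have h2 := hxY 1 v
          have h3 := hxY 2 v
          have h4 : ∀ n, 0 ≤ x n v := fun n => (Real.exp_pos _).le
          have h5 : 0 ≤ K' * q * Real.exp T := by positivity
          have h6 := mul_le_mul_of_nonneg_left (show x 0 v + x 1 v + x 2 v -
            (x N v + x (N + 1) v + x (N + 2) v) ≤ 3 * Y v by
              linarith [h4 N, h4 (N + 1), h4 (N + 2)]) h5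
          linarith
      _ ≤ B * ∫ v, Y v := by
          rw [integral_const_mul, hB]
          exact mul_le_mul_of_nonneg_right (by linarith) hYI
  · intro j n v w
    have h1 := hbs j n (cornerMap J j v) (cornerMap J j w)
    have h2 : Real.log (1 + ‖cornerMap J j w‖ / Real.exp (s₀ + n)) ≤
        Real.log (1 + C₁ * ‖w‖ / Real.exp (s₀ + n)) := by
      refine Real.log_le_log (by positivity) ?_
      gcongr
      exact hJ.norm_cornerMap_le j w
    have h3 : 0 ≤ Real.log (1 + ‖cornerMap J j w‖ / Real.exp (s₀ + n)) :=
      Real.log_nonneg (by have : 0 ≤ ‖cornerMap J j w‖ / Real.exp (s₀ + n) := by positivity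
                          linarith)
    simp only [hβ]
    rw [map_add]
    calc (q : ℝ)⁻¹ * b j n (cornerMap J j v + cornerMap J j w)
        ≤ (q : ℝ)⁻¹ * (b j n (cornerMap J j v) +
            m * Real.log (1 + ‖cornerMap J j w‖ / Real.exp (s₀ + n))) := by gcongr
      _ = (q : ℝ)⁻¹ * b j n (cornerMap J j v) + (q : ℝ)⁻¹ *
            (m * Real.log (1 + ‖cornerMap J j w‖ / Real.exp (s₀ + n))) := by ring
      _ ≤ (q : ℝ)⁻¹ * b j n (cornerMap J j v) +
            m * Real.log (1 + ‖cornerMap J j w‖ / Real.exp (s₀ + n)) := by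
          exact add_le_add le_rfl (mul_le_of_le_one_left (by positivity) hqi)
      _ ≤ _ := by gcongr

end SBL

namespace SBL

theorem herm_zero_sub_le {u R : ℝ} (hu : |u| ≤ R) (y : ℝ) :
    herm 0 (y - u) ≤ Real.exp Real.pi * herm 0 (y / (2 * (1 + R))) := by
  have hR : 0 ≤ R := (abs_nonneg u).trans hu
  rw [herm_zero, herm_zero, ← Real.exp_add]
  refine Real.exp_le_exp.2 ?_
  have key : (y / (2 * (1 + R))) ^ 2 ≤ (y - u) ^ 2 + 1 := by
    rcases le_total |y| (2 * (1 + R)) with h | h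
    · have h1 : |y / (2 * (1 + R))| ≤ 1 := by
        rw [abs_div, abs_of_pos (show 0 < 2 * (1 + R) by positivity)]
        exact (div_le_one (by positivity)).2 h
      have h2 := (sq_le_one_iff_abs_le_one _).2 h1
      nlinarith [sq_nonneg (y - u)]
    · have h1 : |y / (2 * (1 + R))| ≤ |y - u| := by
        rw [abs_div, abs_of_pos (show 0 < 2 * (1 + R) by positivity), div_le_iff₀ (by positivity)]
        have h3 : |y| ≤ |y - u| + |u| := by
          have := abs_add_le (y - u) u
          simpa using this
        have h4 := abs_nonneg (y - u)
        nlinarith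
      nlinarith [sq_le_sq.2 h1]
  nlinarith [Real.pi_pos]

theorem hermS_zero_add_le {u R : ℝ} (hu : |u| ≤ R) (c s y : ℝ) :
    hermS 0 (c + Real.exp s * u) s y ≤
      2 * (1 + R) * Real.exp Real.pi * hermS 0 c (s + Real.log (2 * (1 + R))) y := by
  have hR : 0 ≤ R := (abs_nonneg u).trans hu
  have hR' : 0 < 2 * (1 + R) := by positivity
  have h1 : Real.exp (-(s + Real.log (2 * (1 + R)))) = Real.exp (-s) / (2 * (1 + R)) := by
    rw [neg_add, Real.exp_add, Real.exp_neg (Real.log _), Real.exp_log hR', div_eq_mul_inv]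
  have h2 : Real.exp (-s) * (y - (c + Real.exp s * u)) = Real.exp (-s) * (y - c) - u := by
    have : Real.exp (-s) * Real.exp s = 1 := by rw [← Real.exp_add]; simp
    linear_combination (-u) * this
  rw [hermS, hermS, h1, h2]
  have h3 := herm_zero_sub_le hu (Real.exp (-s) * (y - c))
  calc Real.exp (-s) * herm 0 (Real.exp (-s) * (y - c) - u)
      ≤ Real.exp (-s) * (Real.exp Real.pi * herm 0 (Real.exp (-s) * (y - c) / (2 * (1 + R)))) := by
        gcongr
    _ = _ := by
        rw [div_mul_eq_mul_div]
        field_simp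

namespace ScaleData

variable {m : ℕ} {C₀ : ℝ} (D : ScaleData m C₀)

/-- The slow variation of the weights along translations. -/
def Slow (C₁ : ℝ) : Prop := ∀ j n v w,
  D.β j n (v + w) ≤ D.β j n v + m * Real.log (1 + C₁ * ‖w‖ / Real.exp (D.s₀ + n))

theorem om_le_of_slow {C₁ : ℝ} (hC₁ : 0 ≤ C₁) (hD : D.Slow C₁) (σ : Fin m → Fin 2 → Fin 2) (n : ℕ)
    (v w : Fin m → ℝ) :
    D.om σ n v ≤ (1 + C₁ * ‖w‖ / Real.exp (D.sc n)) ^ (2 * (2 ^ m * m)) * D.om σ n (v + w) := by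
  set X := 1 + C₁ * ‖w‖ / Real.exp (D.sc n) with hX
  have hX0 : 0 < X := by positivity
  have h1 : ∀ j, D.β j n v ≤ D.β j n (v + w) + m * Real.log X := fun j => by
    have := hD j n (v + w) (-w)
    rwa [add_neg_cancel_right, norm_neg] at this
  have h2 : D.lam n v ≤ D.lam n (v + w) + 2 ^ m * (m * Real.log X) := by
    calc D.lam n v ≤ ∑ j, (D.β j n (v + w) + m * Real.log X) := Finset.sum_le_sum fun j _ => h1 j
      _ = _ := by rw [Finset.sum_add_distrib]; simp [lam, Corner]
  have h3 : D.lamS σ n (v + w) ≤ D.lamS σ n v + 2 ^ m * (m * Real.log X) := by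
    calc D.lamS σ n (v + w) ≤ ∑ j, (D.β (act σ j) n v + m * Real.log X) :=
          Finset.sum_le_sum fun j _ => hD _ n v w
      _ = _ := by rw [Finset.sum_add_distrib]; simp [lamS, Corner]
  have h4 : X ^ (2 * (2 ^ m * m)) = Real.exp (2 * (2 ^ m * m) * Real.log X) := by
    rw [← Real.exp_log hX0, ← Real.exp_nat_mul, Real.log_exp]
    push_cast
    ring_nf
  rw [om, om, h4, ← Real.exp_add]
  exact Real.exp_le_exp.2 (by linarith)

/-- The frozen form at a single coordinate dominates the translated form. -/
theorem abs_hform_shift_le {C₁ : ℝ} (hC₁ : 0 ≤ C₁) (hD : D.Slow C₁) (l : Fin m)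
    (u : Fin m × Fin 2 → ℝ) {a : ℝ} (hu : ∀ κ, |u κ| ≤ a) (w : Fin 2 → Fin m → ℝ)
    (hw : ∀ ε, D.J (l, ε) (w ε) = u (l, ε)) (hwn : ∀ ε, ‖w ε‖ ≤ C₀ * a) (n : ℕ) {s : ℝ}
    (hs : s ≤ D.sc n + 1) (p : Fin m → ℝ) :
    |hform (cornerProd D.F) (pairB l 1) (fun κ => D.J κ p + Real.exp s * u κ) (fun _ => s)| ≤
      (1 + Real.exp 1 * C₁ * (C₀ * a)) ^ (2 * (2 ^ m * m)) *
      (2 * (2 * (1 + (a + C₀ * (C₀ * a))) * Real.exp Real.pi) ^ (2 * m)) *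
      ∑ ε, D.om (freeze (fun _ ε => ε) l ε) n (p + Real.exp s • w ε) *
        D.G (freeze (fun _ ε => ε) l ε)
          (fun i => if i = l then 0 else Real.log (2 * (1 + (a + C₀ * (C₀ * a))))) (pairB l 1) s
          (p + Real.exp s • w ε) := by
  have ha : 0 ≤ a := (abs_nonneg _).trans (hu (l, 0))
  have hC₀ : 0 ≤ C₀ := zero_le_one.trans D.one_le
  set R := a + C₀ * (C₀ * a) with hR
  have hR0 : 0 ≤ R := by positivity
  set A := 2 * (1 + R) * Real.exp Real.pi with hA
  have hA1 : 1 ≤ A := by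
    have := Real.one_le_exp Real.pi_pos.le
    nlinarith
  set σ : Fin m → Fin 2 → Fin 2 := fun _ ε => ε with hσ
  set x : Fin m × Fin 2 → ℝ → ℝ := fun κ =>
    hermS (pairB l 1 κ) (D.J κ p + Real.exp s * u κ) s with hx
  have hcont : ∀ b c s, Continuous (hermS b c s) := fun b c s =>
    (continuous_hermS b).comp (f := fun y : ℝ => (c, s, y)) (by fun_prop)
  set q : Fin 2 → Fin m → ℝ := fun ε => p + Real.exp s • w ε with hq
  set b : Fin 2 → ℝ := fun ε => Real.exp ((D.lam n p - D.lamS (freeze σ l ε) n p) / 2) with hb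
  have hb2 : ∀ ε, b ε ^ 2 = D.om (freeze σ l ε) n p := by
    intro ε
    simp only [hb, om, sq]
    rw [← Real.exp_add]
    congr 1
    ring
  have hprod : ∏ ε, b ε = 1 := by
    simp only [hb]
    rw [← Real.exp_sum, ← Finset.sum_div, Finset.sum_sub_distrib, sum_lamS_freeze,
      ← Real.exp_zero]
    congr 1
    have : D.lamS σ n p = D.lam n p := rfl
    rw [this]
    simp
  have hxpos : ∀ κ : Fin m × Fin 2, κ.1 ≠ l → ∀ y, |x κ y| ≤ x κ y := by
    intro κ hκ y
    refine (abs_of_pos ?_).le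
    simp only [hx, pairB, if_neg hκ]
    exact hermS_zero_pos _ _ _
  have key := mul_abs_gform_le (F := D.F) D.continuous_F D.hasCompactSupport_F
    (fun κ => hcont _ _ _ : ∀ κ, Continuous (x κ)) (fun κ => hcont _ _ _) hxpos
    (a := b) (fun ε => (Real.exp_pos _).le)
  rw [hprod, one_mul] at key
  have hfr : ∀ ε, freezeF D.F l ε = D.FS (freeze σ l ε) := by
    intro ε
    funext j
    simp only [freezeF, FS, act_freeze]
    rfl
  have hJ : ∀ ε κ, D.JS (freeze σ l ε) κ = if κ.1 = l then D.J (l, ε) else D.J κ := by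
    intro ε κ
    by_cases h : κ.1 = l
    · simp [JS, freeze, h, hσ]
    · simp [JS, freeze, h, hσ]
  set ηR : Fin m → ℝ := fun i => if i = l then 0 else Real.log (2 * (1 + R)) with hηR
  set W : Fin 2 → Fin m × Fin 2 → ℝ → ℝ := fun ε κ y =>
    A * hermS 0 (D.J κ (q ε)) (s + Real.log (2 * (1 + R))) y with hW
  have hGnn : ∀ ε v, 0 ≤ D.G (freeze σ l ε) ηR (pairB l 1) s v := fun ε v =>
    D.G_pairB_nonneg _ (by simp [freeze]) _ _ _ _
  have hterm : ∀ ε, gform (cornerProd (freezeF D.F l ε))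
      (fun κ => if κ.1 = l then x (l, ε) else x κ) ≤
        2 * A ^ (2 * m) * D.G (freeze σ l ε) ηR (pairB l 1) s (q ε) := by
    intro ε
    have hle : ∀ κ : Fin m × Fin 2, κ.1 ≠ l → ∀ y,
        |(if κ.1 = l then x (l, ε) else x κ) y| ≤ W ε κ y := by
      intro κ hκ y
      rw [if_neg hκ]
      refine (hxpos κ hκ y).trans ?_
      have h1 : D.J κ p + Real.exp s * u κ =
          D.J κ (q ε) + Real.exp s * (u κ - D.J κ (w ε)) := by
        simp only [hq, map_add, map_smul, smul_eq_mul]; ring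
      have h2 : |u κ - D.J κ (w ε)| ≤ R := by
        refine (abs_sub _ _).trans (add_le_add (hu κ) ((D.abs_J_le κ (w ε)).trans ?_))
        gcongr
        exact hwn ε
      simp only [hx, hW, pairB, if_neg hκ]
      rw [h1]
      exact hermS_zero_add_le h2 _ _ _
    have key2 := mul_abs_gform_le (F := freezeF D.F l ε) (fun j => D.continuous_F _)
      (fun j => D.hasCompactSupport_F _)
      (w := fun κ => if κ.1 = l then x (l, ε) else x κ) (W := W ε)
      (fun κ => by
        split_ifs
        · exact hcont _ _ _
        · exact hcont _ _ _)
      (fun κ => continuous_const.mul (hcont _ _ _)) hle (a := fun _ => 1) (fun _ => zero_le_one)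
    have hff : ∀ ε', freezeF (freezeF D.F l ε) l ε' = freezeF D.F l ε := fun ε' => by
      funext j
      simp [freezeF]
    simp only [Finset.prod_const_one, one_mul, one_pow, hff, if_true, Finset.sum_const,
      Finset.card_univ, Fintype.card_fin, nsmul_eq_mul, Nat.cast_ofNat] at key2
    refine (le_abs_self _).trans (key2.trans ?_)
    rw [mul_assoc]
    refine mul_le_mul_of_nonneg_left ?_ two_pos.le
    set Q := ∏ κ : Fin m × Fin 2, if κ.1 = l then 1 else A with hQ
    have hg : gform (cornerProd (freezeF D.F l ε))
        (fun κ => if κ.1 = l then x (l, ε) else W ε κ) =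
        Q * D.G (freeze σ l ε) ηR (pairB l 1) s (q ε) := by
      rw [hfr, G, hform, gform, gform, ← integral_const_mul]
      congr 1
      funext y
      rw [mul_left_comm, hQ, ← Finset.prod_mul_distrib]
      congr 1
      refine Finset.prod_congr rfl fun κ _ => ?_
      by_cases h : κ.1 = l
      · have h1 : D.J (l, ε) (q ε) = D.J (l, ε) p + Real.exp s * u (l, ε) := by
          simp only [hq, map_add, map_smul, smul_eq_mul, hw]
        simp [h, hx, hJ, hηR, pairB, h1]
      · simp [h, hW, hJ, hηR, pairB]
    rw [hg]
    refine mul_le_mul_of_nonneg_right ?_ (hGnn ε _)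
    calc Q ≤ ∏ _κ : Fin m × Fin 2, A := Finset.prod_le_prod
          (fun κ _ => by split_ifs <;> positivity) fun κ _ => by split_ifs; exacts [hA1, le_rfl]
      _ = A ^ (2 * m) := by simp [mul_comm]
  refine key.trans ?_
  rw [Finset.mul_sum]
  refine Finset.sum_le_sum fun ε _ => ?_
  rw [hb2]
  have hom : D.om (freeze σ l ε) n p ≤ (1 + Real.exp 1 * C₁ * (C₀ * a)) ^ (2 * (2 ^ m * m)) *
      D.om (freeze σ l ε) n (q ε) := by
    refine (D.om_le_of_slow hC₁ hD _ n p (Real.exp s • w ε)).trans ?_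
    refine mul_le_mul_of_nonneg_right (pow_le_pow_left₀ (by positivity) ?_ _) (D.om_pos _ _ _).le
    have h1 : Real.exp s ≤ Real.exp 1 * Real.exp (D.sc n) := by
      rw [← Real.exp_add]; exact Real.exp_le_exp.2 (by linarith)
    rw [norm_smul, Real.norm_of_nonneg (Real.exp_pos s).le]
    refine add_le_add le_rfl ?_
    rw [div_le_iff₀ (Real.exp_pos _)]
    calc C₁ * (Real.exp s * ‖w ε‖) ≤ C₁ * (Real.exp 1 * Real.exp (D.sc n) * (C₀ * a)) := by
          gcongr
          exact hwn ε
      _ = _ := by ring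
  refine (mul_le_mul hom (hterm ε) ?_ (by have := (D.om_pos (freeze σ l ε) n (q ε)).le; positivity)).trans
    (le_of_eq (by ring))
  refine gform_nonneg (F := freezeF D.F l ε) (fun j => D.continuous_F _)
    (fun j => D.hasCompactSupport_F _) (l := l) (fun κ => ?_) (fun j ε' => ?_) (by simp) ?_
  · split_ifs
    · exact hcont _ _ _
    · exact hcont _ _ _
  · simp [freezeF]
  · intro κ hκ y
    rw [if_neg hκ]
    exact (abs_nonneg _).trans (hxpos κ hκ y)

end ScaleData
end SBL

namespace SBL

theorem setLIntegral_Icc_le_sum (f : ℝ → ℝ≥0∞) (s₀ : ℝ) (N : ℕ) :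
    ∫⁻ s in Set.Icc s₀ (s₀ + N), f s ≤
      ∑ n ∈ Finset.range N, ∫⁻ θ in Set.Icc (0 : ℝ) 1, f (s₀ + n + θ) := by
  induction N with
  | zero => simp
  | succ k ih =>
    have h1 : Set.Icc s₀ (s₀ + (k + 1 : ℕ)) ⊆ Set.Icc s₀ (s₀ + k) ∪ Set.Icc (s₀ + k) (s₀ + k + 1) := by
      push_cast
      rw [← add_assoc]
      exact Set.Icc_subset_Icc_union_Icc
    have h2 : ∫⁻ s in Set.Icc (s₀ + k) (s₀ + k + 1), f s =
        ∫⁻ θ in Set.Icc (0 : ℝ) 1, f (s₀ + k + θ) := by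
      rw [← lintegral_indicator measurableSet_Icc, ← lintegral_indicator measurableSet_Icc,
        ← lintegral_add_left_eq_self _ (s₀ + k)]
      congr 1
      funext θ
      simp only [Set.indicator_apply, Set.mem_Icc]
      congr 1
      simp [add_assoc]
    rw [Finset.sum_range_succ, ← h2]
    exact ((lintegral_mono_set h1).trans (lintegral_union_le _ _ _)).trans (add_le_add_left ih _)

theorem lintegral_le_of_sum_le {f : ℝ → ℝ≥0∞} {B : ℝ≥0∞}
    (h : ∀ (s₀ : ℝ) (N : ℕ),
      ∑ n ∈ Finset.range N, ∫⁻ θ in Set.Icc (0 : ℝ) 1, f (s₀ + n + θ) ≤ B) : ∫⁻ s, f s ≤ B := by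
  have h1 : (⋃ n : ℕ, Set.Icc (-(n : ℝ)) n) = Set.univ := by
    refine Set.eq_univ_of_forall fun x => Set.mem_iUnion.2 ?_
    obtain ⟨n, hn⟩ := exists_nat_ge |x|
    exact ⟨n, abs_le.1 hn⟩
  rw [← setLIntegral_univ, ← h1, setLIntegral_iUnion_of_directed]
  · refine iSup_le fun n => ?_
    have h2 := (setLIntegral_Icc_le_sum f (-n) (2 * n)).trans (h (-n) (2 * n))
    have h3 : -(n : ℝ) + (2 * n : ℕ) = n := by push_cast; ring
    rwa [h3] at h2
  · refine Monotone.directed_le fun a b hab => Set.Icc_subset_Icc ?_ ?_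
    · simpa using hab
    · exact_mod_cast hab

namespace ScaleData

theorem lintegral_mu_shift {m : ℕ} {f : ℝ × (Fin m → ℝ) → ℝ≥0∞} (hf : Measurable f)
    {h : ℝ → Fin m → ℝ} (hh : Continuous h) :
    ∫⁻ z : ℝ × (Fin m → ℝ), f (z.1, z.2 + h z.1) ∂(mu m) = ∫⁻ z, f z ∂(mu m) := by
  have hs : Measurable fun z : ℝ × (Fin m → ℝ) => (z.1, z.2 + h z.1) :=
    Continuous.measurable (by fun_prop)
  rw [mu, lintegral_prod _ hf.aemeasurable,
    lintegral_prod (fun z : ℝ × (Fin m → ℝ) => f (z.1, z.2 + h z.1)) (hf.comp hs).aemeasurable]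
  exact lintegral_congr fun θ => lintegral_add_right_eq_self (fun p => f (θ, p)) (h θ)

variable {m : ℕ} {C₀ : ℝ} (D : ScaleData m C₀)

theorem lintegral_om_mul_G_shift {σ : Fin m → Fin 2 → Fin 2} {l : Fin m} (hl : σ l 0 = σ l 1)
    {η : Fin m → ℝ} (hη : ∀ i, 0 ≤ η i) (a n : ℕ) (w : Fin m → ℝ) :
    ∫⁻ z : ℝ × (Fin m → ℝ), ENNReal.ofReal (D.om σ n (z.2 + Real.exp (D.sc n + z.1) • w) *
        D.G σ η (pairB l a) (D.sc n + z.1) (z.2 + Real.exp (D.sc n + z.1) • w)) ∂(mu m) =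
      ENNReal.ofReal (∫ z : ℝ × (Fin m → ℝ),
        D.om σ n z.2 * D.G σ η (pairB l a) (D.sc n + z.1) z.2 ∂(mu m)) := by
  have hm : Measurable fun z : ℝ × (Fin m → ℝ) =>
      ENNReal.ofReal (D.om σ n z.2 * D.G σ η (pairB l a) (D.sc n + z.1) z.2) :=
    (D.continuous_om_mul_G σ η (pairB l a) n).measurable.ennreal_ofReal
  have h1 := ofReal_integral_eq_lintegral_ofReal
    (D.integrable_om_mul_G σ (fun i => (by linarith [hη i])) (pairB l a) n)
    (Filter.Eventually.of_forall fun z => mul_nonneg (D.om_pos σ n z.2).le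
      (D.G_pairB_nonneg σ hl η a (D.sc n + z.1) z.2))
  rw [h1]
  exact lintegral_mu_shift hm (h := fun θ => Real.exp (D.sc n + θ) • w) (by fun_prop)

end ScaleData

theorem one_add_mul_le {a x : ℝ} (ha : 0 ≤ a) (hx : 0 ≤ x) : 1 + a * x ≤ (1 + a) * (1 + x) := by
  nlinarith

variable {m : ℕ}

/-- The estimate for the translated forms, integrated over all scales. -/
theorem exists_shift_estimate (hm : 1 ≤ m) {p : Corner m → ℝ≥0∞}
    (hp : ∀ j, (2 : ℝ≥0∞) ^ (m - 1) < p j) (hp1 : ∑ j, (p j)⁻¹ = 1) {C₁ : ℝ} (hC₁ : 1 ≤ C₁) :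
    ∃ C : ℝ≥0, ∀ J : Fin m × Fin 2 → (Fin m → ℝ) →L[ℝ] ℝ, IsNondeg C₁ J →
      ∀ F : Corner m → (Fin m → ℝ) → ℝ, (∀ j, Continuous (F j)) →
      (∀ j, HasCompactSupport (F j)) → (∀ j, F j ≠ 0) → ∀ (l : Fin m) (u : Fin m × Fin 2 → ℝ),
      ∫⁻ s : ℝ, ∫⁻ v : Fin m → ℝ, ‖hform (cornerProd F) (pairB l 1)
          (fun κ => J κ v + Real.exp s * u κ) (fun _ => s)‖ₑ ≤
        C * ENNReal.ofReal ((1 + ‖u‖) ^ (2 * m + 1 + 2 * (2 ^ m * m))) *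
          ∏ j, eLpNorm (F j) (p j) volume := by
  obtain ⟨C₀, C, hC₀, hC⟩ := exists_scaleData hm hp hp1 hC₁
  have hC₀1 : 1 ≤ C₀ := hC₁.trans hC₀
  choose CU hCU0 hCU using fun (l : Fin m) (ε : Fin 2) =>
    ScaleData.UB.pairB C₀ _ (ScaleData.freeze (fun _ ε => ε) l ε) le_rfl l
      (by simp [ScaleData.freeze]) 1 le_rfl
  set S : ℝ := ∑ l, ∑ ε, CU l ε with hS
  have hS0 : 0 ≤ S := Finset.sum_nonneg fun l _ => Finset.sum_nonneg fun ε _ => hCU0 l ε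
  have hSl : ∀ l, ∑ ε, CU l ε ≤ S := fun l =>
    Finset.single_le_sum (f := fun l => ∑ ε, CU l ε)
      (fun l _ => Finset.sum_nonneg fun ε _ => hCU0 l ε) (Finset.mem_univ l)
  set c₁ : ℝ := 1 + Real.exp 1 * C₁ * C₀ with hc₁
  set c₂ : ℝ := 2 * (1 + (1 + C₀ * C₀)) with hc₂
  set B : ℝ := c₁ ^ (2 * (2 ^ m * m)) * (2 * (c₂ * Real.exp Real.pi) ^ (2 * m)) * (S * c₂) with hB
  have hB0 : 0 ≤ B := by positivity
  refine ⟨Real.toNNReal B * C, fun J hJ F hF hFc hF0 l u => ?_⟩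
  obtain ⟨I, hI, hD⟩ := hC J hJ F hF hFc hF0
  refine lintegral_le_of_sum_le fun s₀ N => ?_
  obtain ⟨D, rfl, rfl, rfl, rfl, rfl, hslow⟩ := hD s₀ N
  have hsl : D.Slow C₁ := hslow
  set a := ‖u‖ with ha
  have ha0 : 0 ≤ a := norm_nonneg u
  have hu : ∀ κ, |u κ| ≤ a := fun κ => norm_le_pi_norm u κ
  have hw : ∀ ε : Fin 2, ∃ w : Fin m → ℝ, D.J (l, ε) w = u (l, ε) ∧ ‖w‖ ≤ C₀ * a := by
    intro ε
    obtain ⟨v, hv, hv'⟩ := D.exists_dual (fun _ => ε) l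
    refine ⟨u (l, ε) • v, ?_, ?_⟩
    · rw [map_smul, hv' l, if_pos rfl, smul_eq_mul, mul_one]
    · rw [norm_smul, mul_comm]
      exact mul_le_mul hv (hu _) (norm_nonneg _) (by linarith)
  choose w hw hwn using hw
  set R := a + C₀ * (C₀ * a) with hR
  have hR0 : 0 ≤ R := by positivity
  set ηR : Fin m → ℝ := fun i => if i = l then 0 else Real.log (2 * (1 + R)) with hηR
  have hlog : 0 ≤ Real.log (2 * (1 + R)) := Real.log_nonneg (by linarith)
  have hη0 : ∀ i, 0 ≤ ηR i := fun i => by simp only [hηR]; split_ifs; exacts [le_rfl, hlog]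
  set B₁ : ℝ := (1 + Real.exp 1 * C₁ * (C₀ * a)) ^ (2 * (2 ^ m * m)) *
      (2 * (2 * (1 + R) * Real.exp Real.pi) ^ (2 * m)) with hB₁
  have hB₁0 : 0 ≤ B₁ := by positivity
  set X : Fin 2 → ℕ → ℝ × (Fin m → ℝ) → ℝ := fun ε n z =>
    D.om (ScaleData.freeze (fun _ ε => ε) l ε) n (z.2 + Real.exp (D.sc n + z.1) • w ε) *
        D.G (ScaleData.freeze (fun _ ε => ε) l ε) ηR (pairB l 1) (D.sc n + z.1)
          (z.2 + Real.exp (D.sc n + z.1) • w ε) with hX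
  have hX0 : ∀ ε n z, 0 ≤ X ε n z := fun ε n z => mul_nonneg (D.om_pos _ _ _).le
    (D.G_pairB_nonneg _ (by simp [ScaleData.freeze]) _ _ _ _)
  have hXm : ∀ ε n, Measurable (X ε n) := fun ε n =>
    ((D.continuous_om_mul_G (ScaleData.freeze (fun _ ε => ε) l ε) ηR (pairB l 1) n).comp
      (g := fun z : ℝ × (Fin m → ℝ) => D.om (ScaleData.freeze (fun _ ε => ε) l ε) n z.2 *
        D.G (ScaleData.freeze (fun _ ε => ε) l ε) ηR (pairB l 1) (D.sc n + z.1) z.2)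
      (f := fun z : ℝ × (Fin m → ℝ) => (z.1, z.2 + Real.exp (D.sc n + z.1) • w ε))
      (by fun_prop)).measurable
  have hn : ∀ n : ℕ, ∫⁻ θ in Set.Icc (0 : ℝ) 1, ∫⁻ v : Fin m → ℝ, ‖hform (cornerProd D.F) (pairB l 1)
      (fun κ => D.J κ v + Real.exp (D.s₀ + n + θ) * u κ) (fun _ => D.s₀ + n + θ)‖ₑ ≤
      ENNReal.ofReal B₁ * ∑ ε, ENNReal.ofReal (∫ z : ℝ × (Fin m → ℝ),
        D.om (ScaleData.freeze (fun _ ε => ε) l ε) n z.2 *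
        D.G (ScaleData.freeze (fun _ ε => ε) l ε) ηR (pairB l 1) (D.sc n + z.1) z.2 ∂(ScaleData.mu m)) := by
    intro n
    have h1 : ∀ ε, ENNReal.ofReal (∫ z : ℝ × (Fin m → ℝ),
        D.om (ScaleData.freeze (fun _ ε => ε) l ε) n z.2 *
        D.G (ScaleData.freeze (fun _ ε => ε) l ε) ηR (pairB l 1) (D.sc n + z.1) z.2 ∂(ScaleData.mu m)) =
        ∫⁻ z, ENNReal.ofReal (X ε n z) ∂(ScaleData.mu m) := fun ε =>
      (D.lintegral_om_mul_G_shift (by simp [ScaleData.freeze]) hη0 1 n (w ε)).symm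
    simp_rw [h1]
    rw [← lintegral_finsetSum _ fun ε _ => (hXm ε n).ennreal_ofReal,
      ← lintegral_const_mul _ (Finset.measurable_sum _ fun ε _ => (hXm ε n).ennreal_ofReal), ScaleData.mu,
      lintegral_prod _ (Measurable.aemeasurable (Measurable.const_mul
        (Finset.measurable_sum _ fun ε _ => (hXm ε n).ennreal_ofReal) _))]
    refine setLIntegral_mono' measurableSet_Icc fun θ hθ => lintegral_mono fun v => ?_
    dsimp only
    rw [← ENNReal.ofReal_sum_of_nonneg fun ε _ => hX0 ε n _, ← ENNReal.ofReal_mul hB₁0,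
      ← ofReal_norm]
    refine ENNReal.ofReal_le_ofReal ?_
    have hs : D.sc n + θ ≤ D.sc n + 1 := by linarith [hθ.2]
    exact D.abs_hform_shift_le (zero_le_one.trans hC₁) hsl l u hu w hw hwn n hs v
  have hadm : ∀ ε, ScaleData.Adm (ScaleData.freeze (fun _ ε => ε) l ε) ηR (Real.log (2 * (1 + R))) := by
    intro ε
    refine ⟨fun i => ⟨hη0 i, ?_⟩, fun i hi => ?_⟩
    · simp only [hηR]; split_ifs; exacts [hlog, le_rfl]
    · have : i ≠ l := by rintro rfl; simp [ScaleData.freeze] at hi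
      simp [hηR, this]
  have hL : ∀ ε, ∑ n ∈ Finset.range D.N, ENNReal.ofReal (∫ z : ℝ × (Fin m → ℝ),
        D.om (ScaleData.freeze (fun _ ε => ε) l ε) n z.2 *
        D.G (ScaleData.freeze (fun _ ε => ε) l ε) ηR (pairB l 1) (D.sc n + z.1) z.2 ∂(ScaleData.mu m)) ≤
      ENNReal.ofReal (CU l ε * (2 * (1 + R)) * D.I) := by
    intro ε
    rw [← ENNReal.ofReal_sum_of_nonneg fun n _ => integral_nonneg fun z => mul_nonneg (D.om_pos _ _ _).le
      (D.G_pairB_nonneg _ (by simp [ScaleData.freeze]) _ _ _ _)]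
    refine ENNReal.ofReal_le_ofReal ?_
    have h1 := hCU l ε D ηR _ (hadm ε)
    rw [Real.exp_log (by positivity)] at h1
    exact (le_abs_self _).trans h1
  have hBle : B₁ * (S * (2 * (1 + R))) ≤ B * (1 + a) ^ (2 * m + 1 + 2 * (2 ^ m * m)) := by
    have h1 : 1 + Real.exp 1 * C₁ * (C₀ * a) ≤ c₁ * (1 + a) := by
      rw [← mul_assoc]
      exact one_add_mul_le (by positivity) ha0
    have h2 : 2 * (1 + R) ≤ c₂ * (1 + a) := by
      have := one_add_mul_le (a := 1 + C₀ * C₀) (by positivity) ha0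
      rw [hc₂, hR]
      linarith
    calc B₁ * (S * (2 * (1 + R)))
        ≤ (c₁ * (1 + a)) ^ (2 * (2 ^ m * m)) *
          (2 * (c₂ * (1 + a) * Real.exp Real.pi) ^ (2 * m)) * (S * (c₂ * (1 + a))) := by
          rw [hB₁]; gcongr
      _ = B * (1 + a) ^ (2 * m + 1 + 2 * (2 ^ m * m)) := by
          rw [hB, pow_add, pow_add]
          generalize 2 * (2 ^ m * m) = k
          generalize 2 * m = k'
          generalize 1 + a = y
          clear_value c₁ c₂
          rw [mul_pow, mul_pow, mul_pow, mul_pow]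
          ring
  calc _ ≤ ∑ n ∈ Finset.range D.N, ENNReal.ofReal B₁ * ∑ ε, ENNReal.ofReal (∫ z : ℝ × (Fin m → ℝ),
        D.om (ScaleData.freeze (fun _ ε => ε) l ε) n z.2 *
        D.G (ScaleData.freeze (fun _ ε => ε) l ε) ηR (pairB l 1) (D.sc n + z.1) z.2 ∂(ScaleData.mu m)) :=
        Finset.sum_le_sum fun n _ => hn n
    _ ≤ ENNReal.ofReal B₁ * ∑ ε, ENNReal.ofReal (CU l ε * (2 * (1 + R)) * D.I) := by
        rw [← Finset.mul_sum, Finset.sum_comm]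
        exact mul_le_mul' le_rfl (Finset.sum_le_sum fun ε _ => hL ε)
    _ = ENNReal.ofReal (B₁ * ((∑ ε, CU l ε) * (2 * (1 + R)))) * ENNReal.ofReal D.I := by
        rw [← ENNReal.ofReal_sum_of_nonneg fun ε _ => mul_nonneg (mul_nonneg (hCU0 l ε)
          (by positivity)) D.I_nonneg, ← Finset.sum_mul, ← Finset.sum_mul,
          ← ENNReal.ofReal_mul hB₁0, ← ENNReal.ofReal_mul (mul_nonneg hB₁0 (mul_nonneg
          (Finset.sum_nonneg fun ε _ => hCU0 l ε) (by positivity)))]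
        congr 1; ring
    _ ≤ ENNReal.ofReal (B * (1 + a) ^ (2 * m + 1 + 2 * (2 ^ m * m))) *
          (C * ∏ j, eLpNorm (D.F j) (p j) volume) := by
        refine mul_le_mul' (ENNReal.ofReal_le_ofReal (le_trans ?_ hBle)) hI
        gcongr
        exact hSl l
    _ = _ := by
        rw [ENNReal.ofReal_mul hB0, ENNReal.coe_mul]
        change ENNReal.ofReal B * _ * _ = ENNReal.ofReal B * _ * _ * _
        ring

end SBL

namespace SBL

/-- The character `t ↦ exp (2 π i t)`. -/
def osc (t : ℝ) : ℂ := Complex.exp (2 * Real.pi * Complex.I * t)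

theorem osc_add (s t : ℝ) : osc (s + t) = osc s * osc t := by
  rw [osc, osc, osc, ← Complex.exp_add]; push_cast; ring_nf

theorem osc_sum {ι : Type*} (S : Finset ι) (f : ι → ℝ) : osc (∑ i ∈ S, f i) = ∏ i ∈ S, osc (f i) := by
  simp only [osc, ← Complex.exp_sum]
  push_cast
  rw [Finset.mul_sum]

theorem norm_osc (t : ℝ) : ‖osc t‖ = 1 := by
  have : 2 * Real.pi * Complex.I * t = ((2 * Real.pi * t : ℝ) : ℂ) * Complex.I := by
    push_cast; ring
  rw [osc, this, Complex.norm_exp_ofReal_mul_I]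

@[fun_prop]
theorem continuous_osc : Continuous osc := by unfold osc; fun_prop

/-- The Fourier transform of the `b`-th derivative of the Gaussian. -/
def gaussSymbol (b : ℕ) (t : ℝ) : ℂ :=
  (2 * Real.pi * Complex.I * t) ^ b * Complex.exp (-Real.pi * t ^ 2)

theorem integrable_herm (b : ℕ) : Integrable (herm b) := by
  have h0 : Integrable fun x : ℝ => herm 0 (x / 2) := by
    have := integrable_exp_neg_mul_sq (b := Real.pi / 4) (by positivity)
    refine this.congr (Filter.Eventually.of_forall fun x => ?_)
    simp only [herm_zero]
    congr 1; ring
  refine (h0.const_mul (hermC b)).mono' (continuous_herm b).aestronglyMeasurable ?_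
  exact Filter.Eventually.of_forall fun x => abs_herm_le b x

theorem integral_herm_mul_osc (b : ℕ) (ξ : ℝ) :
    ∫ y : ℝ, (herm b y : ℂ) * osc (-(y * ξ)) = gaussSymbol b ξ := by
  have hF : ∀ b, FourierTransform.fourier (fun y : ℝ => (herm b y : ℂ)) = gaussSymbol b := by
    intro b
    induction b with
    | zero =>
      have h := fourier_gaussian_pi (b := 1) (by simp)
      funext t
      have h' := congrFun h t
      simp only [mul_one, Complex.one_cpow, div_one] at h'
      rw [gaussSymbol, pow_zero, one_mul, ← one_mul (Complex.exp _), ← h']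
      have hz : (fun y : ℝ => (herm 0 y : ℂ)) = fun y : ℝ => Complex.exp (-Real.pi * y ^ 2) := by
        funext y
        rw [herm_zero]
        push_cast
        rfl
      rw [hz]
    | succ b ih =>
      have hd : ∀ y : ℝ, HasDerivAt (fun y : ℝ => (herm b y : ℂ)) (herm (b + 1) y : ℂ) y :=
        fun y => (hasDerivAt_herm b y).ofReal_comp
      have hd' : deriv (fun y : ℝ => (herm b y : ℂ)) = fun y => (herm (b + 1) y : ℂ) :=
        funext fun y => (hd y).deriv
      have h := Real.fourier_deriv (f := fun y : ℝ => (herm b y : ℂ)) (integrable_herm b).ofReal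
        (fun y => (hd y).differentiableAt) (by rw [hd']; exact (integrable_herm (b + 1)).ofReal)
      rw [hd', ih] at h
      rw [h]
      funext t
      simp only [gaussSymbol, smul_eq_mul, pow_succ]
      ring
  rw [← hF, Real.fourier_real_eq_integral_exp_smul]
  refine integral_congr_ae (Filter.Eventually.of_forall fun y => ?_)
  simp only [osc, smul_eq_mul]
  rw [mul_comm]
  push_cast
  ring_nf

theorem integral_hermS_mul_osc (b : ℕ) (s x ξ : ℝ) :
    ∫ c : ℝ, (hermS b c s x : ℂ) * osc (c * ξ) =
      osc (x * ξ) * gaussSymbol b (Real.exp s * ξ) := by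
  have h1 := integral_sub_left_eq_self (fun c : ℝ => (hermS b c s x : ℂ) * osc (c * ξ)) volume x
  have h2 := Measure.integral_comp_mul_left
    (fun c : ℝ => (hermS b (x - c) s x : ℂ) * osc ((x - c) * ξ)) (Real.exp s)
  rw [h1] at h2
  have hs : |(Real.exp s)⁻¹| = Real.exp (-s) := by
    rw [Real.exp_neg, abs_of_pos (inv_pos.2 (Real.exp_pos s))]
  have h3 : ∀ y : ℝ, (hermS b (x - Real.exp s * y) s x : ℂ) * osc ((x - Real.exp s * y) * ξ) =
      (Real.exp (-s) * osc (x * ξ)) * ((herm b y : ℂ) * osc (-(y * (Real.exp s * ξ)))) := by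
    intro y
    have e1 : Real.exp (-s) * (x - (x - Real.exp s * y)) = y := by
      rw [sub_sub_cancel, ← mul_assoc, ← Real.exp_add]; simp
    have e2 : (x - Real.exp s * y) * ξ = x * ξ + -(y * (Real.exp s * ξ)) := by ring
    rw [hermS, e1, e2, osc_add]
    push_cast
    ring
  simp only [h3] at h2
  rw [integral_const_mul, integral_herm_mul_osc, hs, Complex.real_smul, mul_assoc] at h2
  have hne : ((Real.exp (-s) : ℝ) : ℂ) ≠ 0 := by exact_mod_cast (Real.exp_pos _).ne'
  exact (mul_left_cancel₀ hne h2).symm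

variable {m : ℕ}

theorem hermProd_eq (b : Fin m × Fin 2 → ℕ) (s : ℝ) (c x : Fin m → Fin 2 → ℝ) :
    hermProd b (fun κ => c κ.1 κ.2) (fun _ => s) x =
      ∏ i, ∏ ε, hermS (b (i, ε)) (c i ε) s (x i ε) := by
  rw [hermProd, Fintype.prod_prod_type]

theorem integrable_hermS_zero (b : ℕ) (s : ℝ) : Integrable fun c => hermS b c s 0 := by
  have h := ((integrable_herm b).comp_mul_left' (R := Real.exp (-s)) (Real.exp_pos _).ne').comp_neg
  refine (h.const_mul (Real.exp (-s))).congr (Filter.Eventually.of_forall fun c => ?_)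
  simp [hermS]

theorem integrable_mul_hermProd_prod {H : (Fin m → Fin 2 → ℝ) → ℝ} (hH : Integrable H)
    (b : Fin m × Fin 2 → ℕ) (s : ℝ) :
    Integrable fun z : (Fin m → Fin 2 → ℝ) × (Fin m → Fin 2 → ℝ) =>
      H z.2 * hermProd b (fun κ => z.1 κ.1 κ.2) (fun _ => s) z.2 := by
  have h1 : Integrable fun c : Fin m → Fin 2 → ℝ => ∏ i, ∏ ε, hermS (b (i, ε)) (c i ε) s 0 :=
    Integrable.fintype_prod (f := fun i (y : Fin 2 → ℝ) => ∏ ε, hermS (b (i, ε)) (y ε) s 0)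
      fun i => Integrable.fintype_prod fun ε => integrable_hermS_zero _ _
  have h2 := hH.convolution_integrand (ContinuousLinearMap.mul ℝ ℝ) h1
  refine h2.congr (Filter.Eventually.of_forall fun z => ?_)
  simp only [hermProd_eq, ContinuousLinearMap.mul_apply']
  congr 1
  refine Finset.prod_congr rfl fun i _ => Finset.prod_congr rfl fun ε _ => ?_
  simp [hermS]

theorem integrable_hform {H : (Fin m → Fin 2 → ℝ) → ℝ} (hH : Integrable H)
    (b : Fin m × Fin 2 → ℕ) (s : ℝ) :
    Integrable fun c : Fin m → Fin 2 → ℝ => hform H b (fun κ => c κ.1 κ.2) (fun _ => s) :=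
  (integrable_mul_hermProd_prod hH b s).integral_prod_left

/-- The Fourier transform of a Hermite form in its centres. -/
theorem integral_hform_mul_osc {H : (Fin m → Fin 2 → ℝ) → ℝ} (hH : Integrable H)
    (b : Fin m × Fin 2 → ℕ) (s : ℝ) (ξ : Fin m → Fin 2 → ℝ) :
    ∫ c : Fin m → Fin 2 → ℝ, (hform H b (fun κ => c κ.1 κ.2) (fun _ => s) : ℂ) *
        osc (∑ i, ∑ ε, c i ε * ξ i ε) =
      (∫ x : Fin m → Fin 2 → ℝ, (H x : ℂ) * osc (∑ i, ∑ ε, x i ε * ξ i ε)) *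
        ∏ i, ∏ ε, gaussSymbol (b (i, ε)) (Real.exp s * ξ i ε) := by
  have hI : Integrable fun z : (Fin m → Fin 2 → ℝ) × (Fin m → Fin 2 → ℝ) =>
      ((H z.2 * hermProd b (fun κ => z.1 κ.1 κ.2) (fun _ => s) z.2 : ℝ) : ℂ) *
        osc (∑ i, ∑ ε, z.1 i ε * ξ i ε) := by
    refine (integrable_mul_hermProd_prod hH b s).ofReal.mul_bdd (c := 1)
      (Continuous.aestronglyMeasurable (by fun_prop)) ?_
    exact Filter.Eventually.of_forall fun z => (norm_osc _).le
  have h1 : ∀ c : Fin m → Fin 2 → ℝ, (hform H b (fun κ => c κ.1 κ.2) (fun _ => s) : ℂ) *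
      osc (∑ i, ∑ ε, c i ε * ξ i ε) = ∫ x : Fin m → Fin 2 → ℝ,
      ((H x * hermProd b (fun κ => c κ.1 κ.2) (fun _ => s) x : ℝ) : ℂ) *
        osc (∑ i, ∑ ε, c i ε * ξ i ε) := by
    intro c
    rw [integral_mul_const, hform_eq]
    congr 1
    exact integral_ofReal.symm
  simp only [h1]
  rw [integral_integral_swap hI, ← integral_mul_const]
  refine integral_congr_ae (Filter.Eventually.of_forall fun x => ?_)
  have h2 : ∀ c : Fin m → Fin 2 → ℝ,
      ((H x * hermProd b (fun κ => c κ.1 κ.2) (fun _ => s) x : ℝ) : ℂ) *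
        osc (∑ i, ∑ ε, c i ε * ξ i ε) =
      (H x : ℂ) * ∏ i, ∏ ε, ((hermS (b (i, ε)) (c i ε) s (x i ε) : ℂ) * osc (c i ε * ξ i ε)) := by
    intro c
    rw [hermProd_eq, osc_sum]
    simp only [osc_sum, Finset.prod_mul_distrib]
    push_cast
    ring
  simp only [h2]
  rw [integral_const_mul, integral_fintype_prod_volume_eq_prod (fun i (y : Fin 2 → ℝ) =>
    ∏ ε, ((hermS (b (i, ε)) (y ε) s (x i ε) : ℂ) * osc (y ε * ξ i ε)))]
  have h3 : ∀ i, ∫ y : Fin 2 → ℝ, ∏ ε, ((hermS (b (i, ε)) (y ε) s (x i ε) : ℂ) *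
      osc (y ε * ξ i ε)) = ∏ ε, (osc (x i ε * ξ i ε) *
        gaussSymbol (b (i, ε)) (Real.exp s * ξ i ε)) := by
    intro i
    rw [integral_fintype_prod_volume_eq_prod (fun ε (c : ℝ) =>
      (hermS (b (i, ε)) c s (x i ε) : ℂ) * osc (c * ξ i ε))]
    exact Finset.prod_congr rfl fun ε _ => integral_hermS_mul_osc _ _ _ _
  simp only [h3]
  simp only [Finset.prod_mul_distrib, osc_sum]
  ring

end SBL

namespace SBL

variable {m : ℕ}

/-- The matrix whose `i`-th row is the `i`-th row of `A (j i)`. -/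
def cornerMat (A : Fin 2 → Matrix (Fin m) (Fin m) ℝ) (j : Corner m) : Matrix (Fin m) (Fin m) ℝ :=
  of fun i k => A (j i) i k

/-- All the matrices `cornerMat A j` are invertible, with quantitative bounds. -/
structure IsRegFamily (E : ℝ) (A : Fin 2 → Matrix (Fin m) (Fin m) ℝ) : Prop where
  one_le : 1 ≤ E
  det_ne : ∀ j, (cornerMat A j).det ≠ 0
  abs_le : ∀ ε i k, |A ε i k| ≤ E
  abs_inv_le : ∀ j i k, |(cornerMat A j)⁻¹ i k| ≤ E

theorem abs_apply_le_opNorm (A : Matrix (Fin m) (Fin m) ℝ) (i k : Fin m) : |A i k| ≤ opNorm A := by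
  have h := (Matrix.toEuclideanLin A).toContinuousLinearMap.le_opNorm (EuclideanSpace.single k 1)
  rw [PiLp.norm_single, norm_one, mul_one] at h
  refine le_trans ?_ h
  have h2 := PiLp.norm_apply_le
    ((Matrix.toEuclideanLin A).toContinuousLinearMap (EuclideanSpace.single k 1)) i
  refine le_trans (le_of_eq ?_) h2
  simp [Matrix.toLpLin_apply]

theorem isRegFamily_of_isReg {Δ : ℝ} (hΔ : 1 < Δ) {A : Fin 2 → Matrix (Fin m) (Fin m) ℝ}
    (h : ∀ j, IsReg Δ (cornerMat A j)) : IsRegFamily (Δ * (m.factorial * Δ ^ m)) A := by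
  have hf : (1 : ℝ) ≤ m.factorial := by exact_mod_cast Nat.one_le_iff_ne_zero.2 m.factorial_ne_zero
  have hp : 1 ≤ Δ ^ m := one_le_pow₀ hΔ.le
  have hE : 1 ≤ m.factorial * Δ ^ m := by nlinarith
  have hA : ∀ ε i k, |A ε i k| ≤ Δ := fun ε i k =>
    (abs_apply_le_opNorm (cornerMat A fun _ => ε) i k).trans (h fun _ => ε).1
  refine ⟨by nlinarith, fun j => (h j).2.1, fun ε i k => (hA ε i k).trans (by nlinarith),
    fun j i k => ?_⟩
  have hadj : |(cornerMat A j).adjugate i k| ≤ m.factorial * Δ ^ m := by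
    rw [adjugate_apply]
    have := Matrix.det_le (A := (cornerMat A j).updateRow k (Pi.single i 1))
      (abv := AbsoluteValue.abs) (x := Δ) (fun a b => by
        change |_| ≤ Δ
        rw [updateRow_apply]
        split_ifs
        · rw [Pi.single_apply]
          split_ifs <;> simp <;> linarith
        · exact hA _ _ _)
    simpa [nsmul_eq_mul] using this
  rw [Matrix.inv_def, Matrix.smul_apply, smul_eq_mul, abs_mul, Ring.inverse_eq_inv', abs_inv]
  exact mul_le_mul (h j).2.2 hadj (abs_nonneg _) (by linarith)

theorem norm_vecMul_le {E : ℝ} {M : Matrix (Fin m) (Fin m) ℝ} (hM : ∀ i k, |M i k| ≤ E)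
    (v : Fin m → ℝ) : ‖v ᵥ* M‖ ≤ m * E * ‖v‖ := by
  rcases isEmpty_or_nonempty (Fin m) with h | ⟨⟨i₀⟩⟩
  · have : ‖v ᵥ* M‖ = 0 := by rw [Subsingleton.elim (v ᵥ* M) 0, norm_zero]
    rw [this, Subsingleton.elim v 0, norm_zero, mul_zero]
  have hE : 0 ≤ E := (abs_nonneg _).trans (hM i₀ i₀)
  refine (pi_norm_le_iff_of_nonneg (by positivity)).2 fun k => ?_
  calc ‖(v ᵥ* M) k‖ = |∑ i, v i * M i k| := rfl
    _ ≤ ∑ i, |v i * M i k| := Finset.abs_sum_le_sum_abs _ _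
    _ ≤ ∑ _i : Fin m, ‖v‖ * E := Finset.sum_le_sum fun i _ => by
        rw [abs_mul]; exact mul_le_mul (norm_le_pi_norm v i) (hM i k) (abs_nonneg _) (norm_nonneg _)
    _ = m * E * ‖v‖ := by simp; ring

theorem norm_mulVec_le {E : ℝ} {M : Matrix (Fin m) (Fin m) ℝ} (hM : ∀ i k, |M i k| ≤ E)
    (v : Fin m → ℝ) : ‖M *ᵥ v‖ ≤ m * E * ‖v‖ := by
  rw [← vecMul_transpose]
  exact norm_vecMul_le (fun i k => hM k i) v

/-- The parametrisation of the kernel of `c ↦ ∑ i, ∑ ε, c i ε * A ε i` by its coordinates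
`c i 1`. -/
def kerMap (A : Fin 2 → Matrix (Fin m) (Fin m) ℝ) (κ : Fin m × Fin 2) : (Fin m → ℝ) →L[ℝ] ℝ :=
  LinearMap.toContinuousLinearMap (if κ.2 = 1 then LinearMap.proj κ.1 else
    -(LinearMap.proj κ.1 ∘ₗ (A 1 * (A 0)⁻¹).vecMulLinear))

theorem kerMap_one (A : Fin 2 → Matrix (Fin m) (Fin m) ℝ) (i : Fin m) (p : Fin m → ℝ) :
    kerMap A (i, 1) p = p i := by simp [kerMap]

theorem kerMap_zero (A : Fin 2 → Matrix (Fin m) (Fin m) ℝ) (i : Fin m) (p : Fin m → ℝ) :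
    kerMap A (i, 0) p = -((p ᵥ* A 1) ᵥ* (A 0)⁻¹) i := by simp [kerMap]

namespace IsRegFamily

variable {E : ℝ} {A : Fin 2 → Matrix (Fin m) (Fin m) ℝ}

theorem isUnit_det (h : IsRegFamily E A) (j : Corner m) : IsUnit (cornerMat A j).det := (h.det_ne j).isUnit

theorem isUnit_det_zero (h : IsRegFamily E A) : IsUnit (A 0).det := h.isUnit_det fun _ => 0

theorem abs_inv_zero_le (h : IsRegFamily E A) (i k : Fin m) : |(A 0)⁻¹ i k| ≤ E := h.abs_inv_le (fun _ => 0) i k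

theorem abs_cornerMat_le (h : IsRegFamily E A) (j : Corner m) (i k : Fin m) : |cornerMat A j i k| ≤ E := h.abs_le _ _ _

theorem kerMap_vecMul (h : IsRegFamily E A) (p : Fin m → ℝ) :
    (fun i => kerMap A (i, 0) p) ᵥ* A 0 + (fun i => kerMap A (i, 1) p) ᵥ* A 1 = 0 := by
  have h0 : (fun i => kerMap A (i, 0) p) = -((p ᵥ* A 1) ᵥ* (A 0)⁻¹) :=
    funext fun i => kerMap_zero A i p
  have h1 : (fun i => kerMap A (i, 1) p) = p := funext fun i => kerMap_one A i p
  rw [h0, h1, neg_vecMul, vecMul_vecMul, nonsing_inv_mul _ h.isUnit_det_zero, vecMul_one]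
  simp

theorem kerMap_vecMul_corner (h : IsRegFamily E A) (p : Fin m → ℝ) (j : Corner m) :
    (fun i => kerMap A (i, j i) p) ᵥ* cornerMat A j =
      -((fun i => kerMap A (i, opp j i) p) ᵥ* cornerMat A (opp j)) := by
  rw [eq_neg_iff_add_eq_zero]
  funext k
  have h1 := congrFun (h.kerMap_vecMul p) k
  rw [← h1]
  change (∑ i, kerMap A (i, j i) p * A (j i) i k) + ∑ i, kerMap A (i, opp j i) p * A (opp j i) i k =
    (∑ i, kerMap A (i, 0) p * A 0 i k) + ∑ i, kerMap A (i, 1) p * A 1 i k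
  rw [← Finset.sum_add_distrib, ← Finset.sum_add_distrib]
  refine Finset.sum_congr rfl fun i _ => ?_
  rcases Fin.exists_fin_two.1 ⟨j i, rfl⟩ with hj | hj
  · simp [opp, hj]
  · simp [opp, hj, add_comm]

theorem isNondeg (h : IsRegFamily E A) (hm : 1 ≤ m) : IsNondeg ((m * E) ^ 2) (kerMap A) := by
  have hm1 : (1 : ℝ) ≤ m := by exact_mod_cast hm
  have hE := h.one_le
  have hmE : 1 ≤ m * E := by nlinarith
  have hC : 1 ≤ (m * E) ^ 2 := one_le_pow₀ hmE
  refine ⟨hC, fun κ v => ?_, fun j v => ?_⟩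
  · obtain ⟨i, ε⟩ := κ
    fin_cases ε
    · change |kerMap A (i, 0) v| ≤ _
      rw [kerMap_zero, abs_neg]
      refine (norm_le_pi_norm ((v ᵥ* A 1) ᵥ* (A 0)⁻¹) i).trans
        ((norm_vecMul_le h.abs_inv_zero_le _).trans ?_)
      rw [pow_two, mul_assoc (m * E)]
      exact mul_le_mul_of_nonneg_left (norm_vecMul_le (h.abs_le 1) v) (by linarith)
    · change |kerMap A (i, 1) v| ≤ _
      rw [kerMap_one]
      exact (norm_le_pi_norm v i).trans (le_mul_of_one_le_left (norm_nonneg _) hC)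
  · set c : Fin m → ℝ := fun i => kerMap A (i, j i) v with hc
    have h1 : (fun i => kerMap A (i, opp j i) v) = -((c ᵥ* cornerMat A j) ᵥ* (cornerMat A (opp j))⁻¹) := by
      rw [h.kerMap_vecMul_corner, neg_vecMul, vecMul_vecMul, mul_nonsing_inv _ (h.isUnit_det _),
        vecMul_one, neg_neg]
    have h2 : ‖fun i => kerMap A (i, opp j i) v‖ ≤ (m * E) ^ 2 * ‖c‖ := by
      rw [h1, norm_neg, pow_two, mul_assoc (m * E)]
      exact (norm_vecMul_le (h.abs_inv_le _) _).trans
        (mul_le_mul_of_nonneg_left (norm_vecMul_le (h.abs_cornerMat_le j) c) (by linarith))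
    refine (pi_norm_le_iff_of_nonneg (by positivity)).2 fun i => ?_
    rcases Fin.exists_fin_two.1 ⟨j i, rfl⟩ with hj | hj
    · have : v i = kerMap A (i, opp j i) v := by rw [opp, hj, sub_zero, kerMap_one]
      rw [this]
      exact (norm_le_pi_norm (fun i => kerMap A (i, opp j i) v) i).trans h2
    · have : v i = c i := by simp only [hc, hj, kerMap_one]
      rw [this]
      exact (norm_le_pi_norm c i).trans (le_mul_of_one_le_left (norm_nonneg _) hC)

theorem norm_le_of_corner (h : IsRegFamily E A) (j : Corner m) (η : Fin m → ℝ) :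
    ‖η‖ ≤ m * E * ‖fun i => (A (j i) *ᵥ η) i‖ := by
  have h1 : (fun i => (A (j i) *ᵥ η) i) = cornerMat A j *ᵥ η := rfl
  have h2 : η = (cornerMat A j)⁻¹ *ᵥ (cornerMat A j *ᵥ η) := by
    rw [mulVec_mulVec, nonsing_inv_mul _ (h.isUnit_det j), one_mulVec]
  rw [h1]
  conv_lhs => rw [h2]
  exact norm_mulVec_le (h.abs_inv_le j) _

theorem norm_le_vecMul_zero (h : IsRegFamily E A) (y : Fin m → ℝ) : ‖y‖ ≤ m * E * ‖y ᵥ* A 0‖ := by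
  have h2 : y = (y ᵥ* A 0) ᵥ* (A 0)⁻¹ := by
    rw [vecMul_vecMul, mul_nonsing_inv _ h.isUnit_det_zero, vecMul_one]
  conv_lhs => rw [h2]
  exact norm_vecMul_le h.abs_inv_zero_le _

end IsRegFamily

/-- The quartic form whose level sets decompose the frequency space. -/
def quart (ξ : Fin m → Fin 2 → ℝ) : ℝ := ∑ l, (ξ l 0 * ξ l 1) ^ 2

theorem quart_nonneg (ξ : Fin m → Fin 2 → ℝ) : 0 ≤ quart ξ :=
  Finset.sum_nonneg fun _ _ => sq_nonneg _

theorem quart_smul (t : ℝ) (ξ : Fin m → Fin 2 → ℝ) : quart (t • ξ) = t ^ 4 * quart ξ := by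
  simp only [quart, Finset.mul_sum, Pi.smul_apply, smul_eq_mul]
  exact Finset.sum_congr rfl fun l _ => by ring

theorem exists_corner_abs_le {t : ℝ} (ht : 0 ≤ t) {ξ : Fin m → Fin 2 → ℝ} (hξ : quart ξ ≤ t ^ 4) :
    ∃ j : Corner m, ∀ i, |ξ i (j i)| ≤ t := by
  have h : ∀ i, ∃ ε, |ξ i ε| ≤ t := by
    intro i
    by_contra! hc
    have h1 : (ξ i 0 * ξ i 1) ^ 2 ≤ t ^ 4 :=
      (Finset.single_le_sum (f := fun l => (ξ l 0 * ξ l 1) ^ 2) (fun l _ => sq_nonneg _)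
        (Finset.mem_univ i)).trans hξ
    have h2 : t * t < |ξ i 0| * |ξ i 1| := mul_lt_mul'' (hc 0) (hc 1) ht ht
    have h3 : (t * t) ^ 2 < (|ξ i 0| * |ξ i 1|) ^ 2 := pow_lt_pow_left₀ h2 (by positivity) two_ne_zero
    rw [← abs_mul, sq_abs] at h3
    nlinarith
  choose j hj using h
  exact ⟨j, hj⟩

/-- The frequency variables attached to `η`. -/
def freq (A : Fin 2 → Matrix (Fin m) (Fin m) ℝ) (η : Fin m → ℝ) : Fin m → Fin 2 → ℝ :=
  fun i ε => (A ε *ᵥ η) i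

theorem freq_smul (A : Fin 2 → Matrix (Fin m) (Fin m) ℝ) (t : ℝ) (η : Fin m → ℝ) :
    freq A (t • η) = t • freq A η := by
  funext i ε
  simp [freq, mulVec_smul]

namespace IsRegFamily

variable {E : ℝ} {A : Fin 2 → Matrix (Fin m) (Fin m) ℝ}

theorem norm_le_of_quart_le (h : IsRegFamily E A) {t : ℝ} (ht : 0 ≤ t) {η : Fin m → ℝ} (hη : quart (freq A η) ≤ t ^ 4) :
    ‖η‖ ≤ m * E * t := by
  obtain ⟨j, hj⟩ := exists_corner_abs_le ht hη
  have := h.one_le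
  exact (h.norm_le_of_corner j η).trans (mul_le_mul_of_nonneg_left
    ((pi_norm_le_iff_of_nonneg ht).2 hj) (by positivity))

theorem norm_freq_le (h : IsRegFamily E A) (η : Fin m → ℝ) : ‖freq A η‖ ≤ m * E * ‖η‖ := by
  have := h.one_le
  have h0 : 0 ≤ m * E * ‖η‖ := by positivity
  exact (pi_norm_le_iff_of_nonneg h0).2 fun i => (pi_norm_le_iff_of_nonneg h0).2 fun ε =>
    (norm_le_pi_norm (A ε *ᵥ η) i).trans (norm_mulVec_le (h.abs_le ε) η)

theorem quart_freq_le (h : IsRegFamily E A) (η : Fin m → ℝ) : quart (freq A η) ≤ m * (m * E * ‖η‖) ^ 4 := by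
  have h1 : ∀ i ε, |freq A η i ε| ≤ m * E * ‖η‖ := fun i ε =>
    ((norm_le_pi_norm (freq A η i) ε).trans (norm_le_pi_norm (freq A η) i)).trans (h.norm_freq_le η)
  have hE := h.one_le
  calc quart (freq A η) ≤ ∑ _l : Fin m, (m * E * ‖η‖) ^ 4 := by
        refine Finset.sum_le_sum fun l _ => ?_
        rw [← sq_abs, abs_mul, show (m * E * ‖η‖) ^ 4 = (m * E * ‖η‖ * (m * E * ‖η‖)) ^ 2 by ring]
        exact pow_le_pow_left₀ (by positivity) (mul_le_mul (h1 l 0) (h1 l 1) (abs_nonneg _)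
          (by positivity)) 2
    _ = _ := by simp

theorem quart_freq_pos (h : IsRegFamily E A) {η : Fin m → ℝ} (hη : η ≠ 0) : 0 < quart (freq A η) := by
  refine (quart_nonneg _).lt_of_ne' fun h0 => hη ?_
  have := h.norm_le_of_quart_le le_rfl (η := η) (by rw [h0]; simp)
  rw [mul_zero] at this
  exact norm_le_zero_iff.1 this

end IsRegFamily

end SBL

namespace SBL

variable {m : ℕ}

/-- Minus the standard scalar product, as a continuous bilinear map. -/
def negDot (m : ℕ) : (Fin m → ℝ) →L[ℝ] (Fin m → ℝ) →L[ℝ] ℝ :=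
  -∑ i, (ContinuousLinearMap.proj i : (Fin m → ℝ) →L[ℝ] ℝ).smulRight
    (ContinuousLinearMap.proj i : (Fin m → ℝ) →L[ℝ] ℝ)

theorem negDot_apply (x y : Fin m → ℝ) : negDot m x y = -∑ i, y i * x i := by
  simp [negDot, mul_comm]

theorem fourierIntegral_negDot (f : (Fin m → ℝ) → ℂ) (v : Fin m → ℝ) :
    VectorFourier.fourierIntegral Real.fourierChar volume (negDot m).toLinearMap₁₂ f v =
      ∫ η, f η * osc (∑ i, v i * η i) := by
  rw [VectorFourier.fourierIntegral]
  refine integral_congr_ae (Filter.Eventually.of_forall fun η => ?_)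
  change Real.fourierChar (-(negDot m η v)) • f η = _
  rw [negDot_apply, neg_neg, Circle.smul_def, Real.fourierChar_apply, smul_eq_mul, mul_comm]
  simp only [osc]
  push_cast
  ring_nf

theorem integral_norm_le_of_closedBall {F : Type*} [NormedAddCommGroup F] {g : (Fin m → ℝ) → F}
    {R B : ℝ} (hR : ∀ η, R < ‖η‖ → g η = 0) (hB : ∀ η, ‖g η‖ ≤ B) :
    ∫ η, ‖g η‖ ≤ volume.real (Metric.closedBall (0 : Fin m → ℝ) R) * B := by
  rw [← setIntegral_eq_integral_of_forall_compl_eq_zero (s := Metric.closedBall (0 : Fin m → ℝ) R)]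
  · have h := norm_setIntegral_le_of_norm_le_const (μ := volume) (f := fun η => ‖g η‖) (C := B)
      (s := Metric.closedBall (0 : Fin m → ℝ) R) measure_closedBall_lt_top
      (fun η _ => by rw [norm_norm]; exact hB η)
    rw [mul_comm]
    exact (le_abs_self _).trans h
  · intro η hη
    rw [mem_closedBall_zero_iff, not_le] at hη
    rw [hR η hη, norm_zero]

/-- Decay of the inverse Fourier transform of a smooth function supported in a ball. -/
theorem norm_integral_mul_osc_le {k : ℕ} {R B : ℝ} {f : (Fin m → ℝ) → ℂ} (hf : ContDiff ℝ k f)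
    (hR : ∀ η, R < ‖η‖ → f η = 0) (hB : ∀ i ≤ k, ∀ η, ‖iteratedFDeriv ℝ i f η‖ ≤ B)
    (v : Fin m → ℝ) :
    ‖∫ η, f η * osc (∑ i, v i * η i)‖ ≤
      2 ^ k * (volume.real (Metric.closedBall (0 : Fin m → ℝ) R) * B) / (1 + ‖v‖) ^ k := by
  set M := volume.real (Metric.closedBall (0 : Fin m → ℝ) R) * B with hM
  have hB0 : 0 ≤ B := (norm_nonneg _).trans (hB 0 k.zero_le 0)
  have hM0 : 0 ≤ M := mul_nonneg measureReal_nonneg hB0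
  have hsupp : tsupport f ⊆ Metric.closedBall 0 R := by
    refine closure_minimal (fun η hη => ?_) Metric.isClosed_closedBall
    rw [mem_closedBall_zero_iff]
    by_contra! h
    exact hη (hR η h)
  have hRi : ∀ i η, R < ‖η‖ → iteratedFDeriv ℝ i f η = 0 := by
    intro i η hη
    by_contra h
    have h1 := hsupp (support_iteratedFDeriv_subset i (Function.mem_support.2 h))
    rw [mem_closedBall_zero_iff] at h1
    linarith
  have hc : HasCompactSupport f :=
    HasCompactSupport.of_support_subset_isCompact (isCompact_closedBall 0 R)
      ((subset_tsupport f).trans hsupp)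
  have hInt : ∀ i : ℕ, (i : ℕ∞) ≤ (k : ℕ∞) → Integrable (iteratedFDeriv ℝ i f) volume := fun i hi =>
    (hf.continuous_iteratedFDeriv (by exact_mod_cast hi)).integrable_of_hasCompactSupport
      (hc.iteratedFDeriv i)
  have h0 : ‖∫ η, f η * osc (∑ i, v i * η i)‖ ≤ M := by
    rw [← fourierIntegral_negDot]
    refine (VectorFourier.norm_fourierIntegral_le_integral_norm _ _ _ _ _).trans
      (integral_norm_le_of_closedBall hR fun η => ?_)
    simpa using hB 0 k.zero_le η
  have hk : ‖v‖ ^ k * ‖∫ η, f η * osc (∑ i, v i * η i)‖ ≤ M := by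
    rcases eq_or_ne v 0 with hv | hv
    · rcases Nat.eq_zero_or_pos k with hk | hk
      · simpa [hk] using h0
      · simpa [hv, hk.ne'] using hM0
    have hne : Nonempty (Fin m) := by
      by_contra h
      rw [not_nonempty_iff] at h
      exact hv (Subsingleton.elim _ _)
    obtain ⟨i₀, hi₀⟩ : ∃ i, |v i| = ‖v‖ := by
      obtain ⟨i, -, hi⟩ := Finset.exists_mem_eq_sup' Finset.univ_nonempty fun i => ‖v i‖₊
      refine ⟨i, ?_⟩
      rw [Pi.norm_def, ← Finset.sup'_eq_sup Finset.univ_nonempty, hi]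
      rfl
    have h1 := congrFun (VectorFourier.fourierIntegral_iteratedFDeriv (negDot m) (N := (k : ℕ∞))
      (by exact_mod_cast hf) hInt le_rfl) v
    have h2 : ‖VectorFourier.fourierPowSMulRight (-(negDot m).flip)
        (VectorFourier.fourierIntegral Real.fourierChar volume (negDot m).toLinearMap₁₂ f) v k
        (fun _ => Pi.single i₀ 1)‖ ≤ M := by
      rw [← h1]
      refine (ContinuousMultilinearMap.le_opNorm _ _).trans ?_
      simp only [Pi.norm_single, norm_one, Finset.prod_const_one, mul_one]
      exact (VectorFourier.norm_fourierIntegral_le_integral_norm _ _ _ _ _).trans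
        (integral_norm_le_of_closedBall (hRi k) (hB k le_rfl))
    rw [VectorFourier.fourierPowSMulRight_apply, fourierIntegral_negDot] at h2
    have h3 : (-(negDot m).flip) v (Pi.single i₀ (1 : ℝ) : Fin m → ℝ) = v i₀ := by
      simp [negDot_apply, Pi.single_apply]
    simp only [Finset.prod_const, Finset.card_univ, Fintype.card_fin, norm_smul, norm_pow,
      norm_neg, Real.norm_eq_abs] at h2
    rw [h3, hi₀] at h2
    refine le_trans (le_mul_of_one_le_left (by positivity) (one_le_pow₀ ?_)) h2
    simp [abs_of_pos Real.pi_pos]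
    linarith [Real.pi_gt_three]
  rw [le_div_iff₀ (by positivity)]
  have hv0 := norm_nonneg v
  have h4 : (1 + ‖v‖) ^ k ≤ 2 ^ k * max 1 (‖v‖ ^ k) := by
    rcases le_total ‖v‖ 1 with h | h
    · calc (1 + ‖v‖) ^ k ≤ 2 ^ k := pow_le_pow_left₀ (by linarith) (by linarith) k
        _ ≤ _ := le_mul_of_one_le_right (by positivity) (le_max_left _ _)
    · calc (1 + ‖v‖) ^ k ≤ (2 * ‖v‖) ^ k := pow_le_pow_left₀ (by linarith) (by linarith) k
        _ = 2 ^ k * ‖v‖ ^ k := mul_pow _ _ _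
        _ ≤ _ := mul_le_mul_of_nonneg_left (le_max_right _ _) (by positivity)
  set X := ‖∫ η, f η * osc (∑ i, v i * η i)‖
  calc X * (1 + ‖v‖) ^ k ≤ X * (2 ^ k * max 1 (‖v‖ ^ k)) :=
        mul_le_mul_of_nonneg_left h4 (norm_nonneg _)
    _ = 2 ^ k * (max 1 (‖v‖ ^ k) * X) := by ring
    _ ≤ 2 ^ k * M := by
        refine mul_le_mul_of_nonneg_left ?_ (by positivity)
        rcases max_choice 1 (‖v‖ ^ k) with h | h <;> rw [h]
        · simpa using h0
        · exact hk

theorem norm_le_en (η : Fin m → ℝ) : ‖η‖ ≤ en η := by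
  refine (pi_norm_le_iff_of_nonneg (Real.sqrt_nonneg _)).2 fun i => ?_
  rw [Real.norm_eq_abs, ← Real.sqrt_sq_eq_abs]
  exact Real.sqrt_le_sqrt (Finset.single_le_sum (f := fun i => η i ^ 2)
    (fun _ _ => sq_nonneg _) (Finset.mem_univ i))

theorem IsCZ.mono {n k : ℕ} {K : (Fin m → ℝ) → ℂ} (hK : IsCZ n K) (hk : k ≤ n) : IsCZ k K :=
  ⟨hK.1.of_le (by exact_mod_cast hk), fun i hi => hK.2 i (hi.trans hk)⟩

theorem IsCZ.comp_smul {n : ℕ} {K : (Fin m → ℝ) → ℂ} (hK : IsCZ n K) {a : ℝ} (ha : 0 < a) :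
    IsCZ n fun η => K (a • η) := by
  set g : (Fin m → ℝ) →L[ℝ] (Fin m → ℝ) := a • ContinuousLinearMap.id ℝ _ with hg
  have hgn : ‖g‖ ≤ a := by
    rw [hg, norm_smul, Real.norm_eq_abs, abs_of_pos ha]
    exact mul_le_of_le_one_right ha.le ContinuousLinearMap.norm_id_le
  have hpre : g ⁻¹' {0}ᶜ = ({0}ᶜ : Set (Fin m → ℝ)) := by
    ext η
    simp [hg, ha.ne']
  have hopen : IsOpen ({0}ᶜ : Set (Fin m → ℝ)) := isOpen_compl_singleton
  have hcomp : (fun η => K (a • η)) = K ∘ g := by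
    funext η
    simp [hg]
  rw [hcomp]
  refine ⟨?_, fun k hk η hη => ?_⟩
  · have := hK.1.comp_continuousLinearMap g
    rwa [hpre] at this
  · have h1 := g.iteratedFDerivWithin_comp_right hK.1 hopen.uniqueDiffOn
      (by rw [hpre]; exact hopen.uniqueDiffOn) (x := η)
      (by rw [hg]; simpa [ha.ne'] using hη) (i := k) (by exact_mod_cast hk)
    rw [hpre] at h1
    rw [h1]
    have hgη : g η = a • η := by simp [hg]
    have h2 := hK.2 k hk (g η) (by rw [hgη]; exact smul_ne_zero ha.ne' hη)
    have hen : en (g η) = a * en η := by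
      rw [hgη]
      simp only [en, Pi.smul_apply, smul_eq_mul, mul_pow, ← Finset.mul_sum]
      rw [Real.sqrt_mul (sq_nonneg a), Real.sqrt_sq ha.le]
    have hen0 : 0 < en η := (norm_pos_iff.2 hη).trans_le (norm_le_en η)
    refine (ContinuousMultilinearMap.norm_compContinuousLinearMap_le _ _).trans ?_
    rw [hen, Real.rpow_neg (by positivity), Real.rpow_natCast] at h2
    rw [Real.rpow_neg hen0.le, Real.rpow_natCast]
    simp only [Finset.prod_const, Finset.card_univ, Fintype.card_fin]
    calc _ ≤ ((a * en η) ^ k)⁻¹ * a ^ k := mul_le_mul h2 (pow_le_pow_left₀ (norm_nonneg _) hgn k)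
          (by positivity) (by positivity)
      _ = (en η ^ k)⁻¹ := by
          rw [mul_pow, mul_inv, mul_comm, ← mul_assoc, mul_inv_cancel₀ (by positivity), one_mul]

end SBL

namespace SBL

variable {m : ℕ}

/-- A smooth bump around `1`, selecting a single dyadic-type scale. -/
def scaleBump : ContDiffBump (1 : ℝ) := ⟨1 / 4, 1 / 2, by norm_num, by norm_num⟩

theorem scaleBump_eq_zero {t : ℝ} (h : t ≤ 1 / 2 ∨ 3 / 2 ≤ t) : scaleBump t = 0 := by
  refine scaleBump.zero_of_le_dist ?_
  change 1 / 2 ≤ dist t 1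
  rw [Real.dist_eq]
  rcases h with h | h
  · exact (by linarith : (1 : ℝ) / 2 ≤ -(t - 1)).trans (neg_le_abs _)
  · exact (by linarith : (1 : ℝ) / 2 ≤ t - 1).trans (le_abs_self _)

/-- A smooth cutoff equal to one on the ball of radius `R`. -/
def ballBump (m : ℕ) (R : ℝ) : ContDiffBump (0 : Fin m → Fin 2 → ℝ) :=
  ⟨|R| + 1, |R| + 2, by positivity, by linarith⟩

theorem ballBump_eq_one {R : ℝ} {ξ : Fin m → Fin 2 → ℝ} (h : ‖ξ‖ ≤ R) : ballBump m R ξ = 1 := by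
  refine (ballBump m R).one_of_mem_closedBall ?_
  rw [mem_closedBall_zero_iff]
  exact h.trans ((le_abs_self R).trans (le_add_of_nonneg_right zero_le_one))

/-- The smooth compactly supported factor which, multiplied by the Gaussian symbol with
derivatives in the `l`-th pair of variables, yields the `l`-th part of a cutoff to one scale. -/
def window (R : ℝ) (l : Fin m) (ξ : Fin m → Fin 2 → ℝ) : ℂ :=
  ((ξ l 0 * ξ l 1 * Real.exp (Real.pi * ∑ i, ∑ ε, ξ i ε ^ 2) * scaleBump (quart ξ) *
    ballBump m R ξ : ℝ) : ℂ)

theorem contDiff_window (R : ℝ) (l : Fin m) {n : ℕ} : ContDiff ℝ n (window R l) := by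
  have h1 : ContDiff ℝ n fun ξ : Fin m → Fin 2 → ℝ => scaleBump (quart ξ) := by
    refine scaleBump.contDiff.comp ?_
    unfold quart
    fun_prop
  have h2 : ContDiff ℝ n fun ξ : Fin m → Fin 2 → ℝ => ballBump m R ξ := (ballBump m R).contDiff
  have h3 : ContDiff ℝ n fun ξ : Fin m → Fin 2 → ℝ =>
      ξ l 0 * ξ l 1 * Real.exp (Real.pi * ∑ i, ∑ ε, ξ i ε ^ 2) := by fun_prop
  exact Complex.ofRealCLM.contDiff.comp ((h3.mul h1).mul h2)

theorem hasCompactSupport_window (R : ℝ) (l : Fin m) : HasCompactSupport (window R l) := by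
  refine (ballBump m R).hasCompactSupport.mono fun ξ hξ h => hξ ?_
  rw [window, h, mul_zero, Complex.ofReal_zero]

theorem window_eq_zero {R : ℝ} {l : Fin m} {ξ : Fin m → Fin 2 → ℝ}
    (h : quart ξ ≤ 1 / 2 ∨ 3 / 2 ≤ quart ξ) : window R l ξ = 0 := by
  rw [window, scaleBump_eq_zero h, mul_zero, zero_mul, Complex.ofReal_zero]

theorem exists_window_deriv_bound (R : ℝ) (l : Fin m) (k : ℕ) :
    ∃ B, 0 ≤ B ∧ ∀ i ≤ k, ∀ ξ, ‖iteratedFDeriv ℝ i (window R l) ξ‖ ≤ B := by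
  have h : ∀ i, ∃ C, ∀ ξ, ‖iteratedFDeriv ℝ i (window R l) ξ‖ ≤ C := fun i =>
    ((contDiff_window R l (n := i)).continuous_iteratedFDeriv le_rfl).bounded_above_of_compact_support
      ((hasCompactSupport_window R l).iteratedFDeriv i)
  choose C hC using h
  refine ⟨∑ i ∈ Finset.range (k + 1), |C i|, Finset.sum_nonneg fun _ _ => abs_nonneg _,
    fun i hi ξ => ((hC i ξ).trans (le_abs_self _)).trans ?_⟩
  exact Finset.single_le_sum (f := fun i => |C i|) (fun _ _ => abs_nonneg _)
    (Finset.mem_range.2 (Nat.lt_succ_of_le hi))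

/-- `freq A` as a continuous linear map. -/
def freqL (A : Fin 2 → Matrix (Fin m) (Fin m) ℝ) : (Fin m → ℝ) →L[ℝ] (Fin m → Fin 2 → ℝ) :=
  ContinuousLinearMap.pi fun i => ContinuousLinearMap.pi fun ε =>
    (ContinuousLinearMap.proj i).comp (LinearMap.toContinuousLinearMap (A ε).mulVecLin)

theorem freqL_apply (A : Fin 2 → Matrix (Fin m) (Fin m) ℝ) (η : Fin m → ℝ) :
    freqL A η = freq A η := rfl

/-- The multiplier localized to the unit scale. -/
def unitMult (R : ℝ) (l : Fin m) (A : Fin 2 → Matrix (Fin m) (Fin m) ℝ) (K : (Fin m → ℝ) → ℂ)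
    (η : Fin m → ℝ) : ℂ :=
  window R l (freq A η) * K η

namespace IsRegFamily

variable {E R : ℝ} {A : Fin 2 → Matrix (Fin m) (Fin m) ℝ} {K : (Fin m → ℝ) → ℂ} {l : Fin m}
  {k : ℕ}

theorem unitMult_eq_zero_of_lt (h : IsRegFamily E A) {η : Fin m → ℝ} (hη : m * E * 2 < ‖η‖) :
    unitMult R l A K η = 0 := by
  rw [unitMult, window_eq_zero, zero_mul]
  right
  by_contra! hq
  exact absurd (h.norm_le_of_quart_le zero_le_two (hq.le.trans (by norm_num))) (not_le.2 hη)

theorem unitMult_eq_zero_of_gt (h : IsRegFamily E A) (hm : 1 ≤ m) {η : Fin m → ℝ}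
    (hη : ‖η‖ < (2 * m * (m * E))⁻¹) : unitMult R l A K η = 0 := by
  rw [unitMult, window_eq_zero, zero_mul]
  left
  have hm1 : (1 : ℝ) ≤ m := by exact_mod_cast hm
  have hE := h.one_le
  have hmE : 0 < m * E := by positivity
  refine (h.quart_freq_le η).trans ?_
  have h1 : m * E * ‖η‖ ≤ (2 * m : ℝ)⁻¹ := by
    calc m * E * ‖η‖ ≤ m * E * (2 * m * (m * E))⁻¹ := mul_le_mul_of_nonneg_left hη.le hmE.le
      _ = (2 * m : ℝ)⁻¹ := by field_simp
  calc (m : ℝ) * (m * E * ‖η‖) ^ 4 ≤ m * ((2 * m : ℝ)⁻¹) ^ 4 := by gcongr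
    _ = 1 / 16 * ((m : ℝ)⁻¹) ^ 3 := by field_simp; norm_num
    _ ≤ 1 / 16 * 1 := by
        gcongr
        exact pow_le_one₀ (by positivity) (inv_le_one_of_one_le₀ hm1)
    _ ≤ 1 / 2 := by norm_num

theorem unitMult_eventuallyEq_zero (h : IsRegFamily E A) (hm : 1 ≤ m) {η : Fin m → ℝ}
    (hη : ‖η‖ < (2 * m * (m * E))⁻¹) : unitMult R l A K =ᶠ[nhds η] fun _ => 0 := by
  filter_upwards [(isOpen_lt continuous_norm continuous_const).mem_nhds hη] with x hx
  exact h.unitMult_eq_zero_of_gt hm hx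

theorem contDiff_unitMult (h : IsRegFamily E A) (hm : 1 ≤ m) (hK : IsCZ k K) :
    ContDiff ℝ k (unitMult R l A K) := by
  rw [contDiff_iff_contDiffAt]
  intro η
  rcases eq_or_ne η 0 with rfl | hη
  · refine contDiffAt_const.congr_of_eventuallyEq (h.unitMult_eventuallyEq_zero hm ?_)
    have hm1 : (1 : ℝ) ≤ m := by exact_mod_cast hm
    have hE := h.one_le
    rw [norm_zero]
    positivity
  · refine ContDiffAt.mul ?_ (hK.1.contDiffAt (isOpen_compl_singleton.mem_nhds hη))
    exact ((contDiff_window R l).comp (freqL A).contDiff).contDiffAt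

theorem hasCompactSupport_unitMult (h : IsRegFamily E A) :
    HasCompactSupport (unitMult R l A K) := by
  refine HasCompactSupport.of_support_subset_isCompact (isCompact_closedBall 0 (m * E * 2))
    fun η hη => ?_
  rw [mem_closedBall_zero_iff]
  by_contra! h1
  exact hη (h.unitMult_eq_zero_of_lt h1)

theorem norm_iteratedFDeriv_unitMult_le (h : IsRegFamily E A) (hm : 1 ≤ m) (hK : IsCZ k K)
    {B : ℝ} (hB0 : 0 ≤ B) (hB : ∀ i ≤ k, ∀ ξ, ‖iteratedFDeriv ℝ i (window R l) ξ‖ ≤ B)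
    {n : ℕ} (hn : n ≤ k) (η : Fin m → ℝ) :
    ‖iteratedFDeriv ℝ n (unitMult R l A K) η‖ ≤
      2 ^ k * (B * (m * E) ^ k * (2 * m * (m * E)) ^ k) := by
  have hm1 : (1 : ℝ) ≤ m := by exact_mod_cast hm
  have hE := h.one_le
  have hmE : 1 ≤ m * E := one_le_mul_of_one_le_of_one_le hm1 hE
  have h2mE : 1 ≤ 2 * m * (m * E) := one_le_mul_of_one_le_of_one_le (by linarith) hmE
  rcases lt_or_ge ‖η‖ (2 * m * (m * E))⁻¹ with hη | hη
  · rw [((h.unitMult_eventuallyEq_zero hm hη).iteratedFDeriv ℝ n).eq_of_nhds,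
      iteratedFDeriv_fun_zero]
    simp only [Pi.zero_apply, norm_zero]
    positivity
  have hη0 : η ≠ 0 := by
    rintro rfl
    rw [norm_zero] at hη
    exact absurd hη (not_le.2 (by positivity))
  have hopen : IsOpen ({0}ᶜ : Set (Fin m → ℝ)) := isOpen_compl_singleton
  rw [← iteratedFDerivWithin_of_isOpen n hopen (show η ∈ ({0}ᶜ : Set (Fin m → ℝ)) from hη0)]
  have hW : ContDiff ℝ k fun η => window R l (freq A η) :=
    (contDiff_window R l).comp (freqL A).contDiff
  refine (norm_iteratedFDerivWithin_mul_le (N := (k : WithTop ℕ∞)) hW.contDiffOn hK.1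
    hopen.uniqueDiffOn hη0 (by exact_mod_cast hn)).trans ?_
  have hg : ‖freqL A‖ ≤ m * E := ContinuousLinearMap.opNorm_le_bound _ (by positivity) fun x => by
    rw [freqL_apply]
    exact h.norm_freq_le x
  have h1 : ∀ i ≤ k, ‖iteratedFDerivWithin ℝ i (fun η => window R l (freq A η)) {0}ᶜ η‖ ≤
      B * (m * E) ^ k := by
    intro i hi
    rw [iteratedFDerivWithin_of_isOpen i hopen (show η ∈ ({0}ᶜ : Set (Fin m → ℝ)) from hη0)]
    have h2 := (freqL A).iteratedFDeriv_comp_right (contDiff_window R l (n := k)) η (i := i)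
      (by exact_mod_cast hi)
    change ‖iteratedFDeriv ℝ i (window R l ∘ freqL A) η‖ ≤ _
    rw [h2]
    refine (ContinuousMultilinearMap.norm_compContinuousLinearMap_le _ _).trans ?_
    simp only [Finset.prod_const, Finset.card_univ, Fintype.card_fin]
    refine mul_le_mul (hB i hi _) ?_ (by positivity) hB0
    exact (pow_le_pow_left₀ (norm_nonneg _) hg i).trans (pow_le_pow_right₀ hmE hi)
  have h3 : ∀ i ≤ k, ‖iteratedFDerivWithin ℝ i K {0}ᶜ η‖ ≤ (2 * m * (m * E)) ^ k := by
    intro i hi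
    refine (hK.2 i hi η hη0).trans ?_
    have hen : 0 < en η := (norm_pos_iff.2 hη0).trans_le (norm_le_en η)
    rw [Real.rpow_neg hen.le, Real.rpow_natCast, ← inv_pow]
    refine le_trans (pow_le_pow_left₀ (by positivity) ?_ i) (pow_le_pow_right₀ h2mE hi)
    rw [inv_le_comm₀ hen (by positivity)]
    exact hη.trans (norm_le_en η)
  calc _ ≤ ∑ i ∈ Finset.range (n + 1), (n.choose i : ℝ) *
        (B * (m * E) ^ k * (2 * m * (m * E)) ^ k) := by
        refine Finset.sum_le_sum fun i hi => ?_
        rw [mul_assoc]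
        refine mul_le_mul_of_nonneg_left ?_ (Nat.cast_nonneg _)
        have := Finset.mem_range.1 hi
        exact mul_le_mul (h1 i (by omega)) (h3 (n - i) (by omega)) (norm_nonneg _)
          (by positivity)
    _ = 2 ^ n * (B * (m * E) ^ k * (2 * m * (m * E)) ^ k) := by
        rw [← Finset.sum_mul]
        congr 1
        exact_mod_cast Nat.sum_range_choose n
    _ ≤ _ := mul_le_mul_of_nonneg_right (pow_le_pow_right₀ one_le_two hn) (by positivity)

end IsRegFamily

/-- The inverse Fourier transforms of the unit scale multipliers decay uniformly. -/
theorem exists_unitMult_decay (hm : 1 ≤ m) {E : ℝ} (hE : 0 ≤ E) (R : ℝ) (l : Fin m) (k : ℕ) :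
    ∃ C : ℝ, 0 ≤ C ∧ ∀ A : Fin 2 → Matrix (Fin m) (Fin m) ℝ, IsRegFamily E A →
      ∀ K, IsCZ k K → ∀ v : Fin m → ℝ,
        ‖∫ η, unitMult R l A K η * osc (∑ i, v i * η i)‖ ≤ C / (1 + ‖v‖) ^ k := by
  obtain ⟨B, hB0, hB⟩ := exists_window_deriv_bound R l k
  refine ⟨_, ?_, fun A hA K hK v => norm_integral_mul_osc_le (hA.contDiff_unitMult hm hK)
    (fun η hη => hA.unitMult_eq_zero_of_lt hη)
    (fun i hi η => hA.norm_iteratedFDeriv_unitMult_le hm hK hB0 hB hi η) v⟩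
  positivity

end SBL

namespace SBL

variable {m : ℕ}

theorem lintegral_comp_exp_smul {f : (Fin m → ℝ) → ℝ≥0∞} (hf : Measurable f) (s : ℝ) :
    ∫⁻ x, f x = ENNReal.ofReal (Real.exp s ^ m) * ∫⁻ x, f (Real.exp s • x) := by
  have h := Measure.map_addHaar_smul (volume : Measure (Fin m → ℝ)) (Real.exp_ne_zero s)
  rw [← lintegral_map (g := fun x : Fin m → ℝ => Real.exp s • x) hf (measurable_const_smul _), h,
    lintegral_smul_measure, smul_eq_mul, ← mul_assoc, abs_of_pos (by positivity),
    Module.finrank_fin_fun, ← ENNReal.ofReal_mul (by positivity),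
    mul_inv_cancel₀ (by positivity), ENNReal.ofReal_one, one_mul]

theorem lintegral_eq_lintegral_pairs {g : (Fin m → Fin 2 → ℝ) → ℝ≥0∞} (hg : Measurable g) :
    ∫⁻ c, g c = ∫⁻ p : Fin m → ℝ, ∫⁻ q : Fin m → ℝ, g fun i ε => if ε = 0 then q i else p i := by
  have hm : Measurable fun z : (Fin m → ℝ) × (Fin m → ℝ) =>
      g fun i ε => if ε = 0 then z.2 i else z.1 i := by
    refine hg.comp (measurable_pi_lambda _ fun i => measurable_pi_lambda _ fun ε => ?_)
    split_ifs <;> fun_prop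
  have h := (measurePreserving_corner_opp (fun _ : Fin m => (1 : Fin 2))).lintegral_comp hm
  rw [← lintegral_prod _ hm.aemeasurable, ← Measure.volume_eq_prod, ← h]
  refine lintegral_congr fun c => congrArg g ?_
  funext i ε
  fin_cases ε <;> simp [opp]

/-- The shift by `y` in the variables with upper index `0`. -/
def lowShift (y : Fin m → ℝ) (κ : Fin m × Fin 2) : ℝ := if κ.2 = 0 then y κ.1 else 0

theorem norm_lowShift_le (y : Fin m → ℝ) : ‖lowShift y‖ ≤ ‖y‖ := by
  refine (pi_norm_le_iff_of_nonneg (norm_nonneg _)).2 fun κ => ?_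
  unfold lowShift
  split_ifs
  · exact norm_le_pi_norm y κ.1
  · rw [norm_zero]; exact norm_nonneg _

/-- Coordinates adapted to the kernel of the dual map. -/
theorem lintegral_eq_lintegral_kerMap (A : Fin 2 → Matrix (Fin m) (Fin m) ℝ)
    {g : (Fin m → Fin 2 → ℝ) → ℝ≥0∞} (hg : Measurable g) (s : ℝ) :
    ∫⁻ c, g c = ENNReal.ofReal (Real.exp s ^ m) * ∫⁻ y : Fin m → ℝ, ∫⁻ p : Fin m → ℝ,
      g fun i ε => kerMap A (i, ε) p + Real.exp s * lowShift y (i, ε) := by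
  have hm : Measurable fun z : (Fin m → ℝ) × (Fin m → ℝ) =>
      g fun i ε => kerMap A (i, ε) z.1 + Real.exp s * lowShift z.2 (i, ε) := by
    refine hg.comp (measurable_pi_lambda _ fun i => measurable_pi_lambda _ fun ε => ?_)
    unfold lowShift
    split_ifs <;> fun_prop
  rw [lintegral_lintegral_swap (f := fun y p : Fin m → ℝ =>
      g fun i ε => kerMap A (i, ε) p + Real.exp s * lowShift y (i, ε))
      (hm.comp measurable_swap).aemeasurable,
    lintegral_eq_lintegral_pairs hg, ← lintegral_const_mul _ hm.lintegral_prod_right']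
  refine lintegral_congr fun p => ?_
  have hq : Measurable fun q : Fin m → ℝ => g fun i ε => kerMap A (i, ε) p + lowShift q (i, ε) := by
    refine hg.comp (measurable_pi_lambda _ fun i => measurable_pi_lambda _ fun ε => ?_)
    unfold lowShift
    split_ifs <;> fun_prop
  rw [← lintegral_add_right_eq_self _ fun i => kerMap A (i, 0) p]
  have h1 := lintegral_comp_exp_smul hq s
  calc _ = ∫⁻ q : Fin m → ℝ, g fun i ε => kerMap A (i, ε) p + lowShift q (i, ε) := by
        refine lintegral_congr fun q => congrArg g ?_
        funext i ε
        fin_cases ε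
        · simp [lowShift, add_comm]
        · simp [lowShift, kerMap_one]
    _ = _ := by
        rw [h1]
        congr 1
        refine lintegral_congr fun q => congrArg g ?_
        funext i ε
        simp [lowShift]

/-- The transpose of `freq A`. -/
def coFreq (A : Fin 2 → Matrix (Fin m) (Fin m) ℝ) (c : Fin m → Fin 2 → ℝ) : Fin m → ℝ :=
  (fun i => c i 0) ᵥ* A 0 + (fun i => c i 1) ᵥ* A 1

theorem sum_mul_freq (A : Fin 2 → Matrix (Fin m) (Fin m) ℝ) (c : Fin m → Fin 2 → ℝ)
    (η : Fin m → ℝ) : ∑ i, ∑ ε, c i ε * freq A η i ε = ∑ i, coFreq A c i * η i := by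
  have h : ∀ ε, (∑ i, c i ε * (A ε *ᵥ η) i) = ∑ i, ((fun i => c i ε) ᵥ* A ε) i * η i := fun ε =>
    Matrix.dotProduct_mulVec (fun i => c i ε) (A ε) η
  simp only [Fin.sum_univ_two, Finset.sum_add_distrib, freq, coFreq, Pi.add_apply, add_mul, h]

theorem continuous_coFreq (A : Fin 2 → Matrix (Fin m) (Fin m) ℝ) : Continuous (coFreq A) := by
  unfold coFreq
  refine Continuous.add ?_ ?_ <;>
    exact Continuous.matrix_vecMul (by fun_prop) continuous_const

theorem IsRegFamily.coFreq_kerMap {E : ℝ} {A : Fin 2 → Matrix (Fin m) (Fin m) ℝ}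
    (h : IsRegFamily E A) (p y : Fin m → ℝ) (a : ℝ) :
    coFreq A (fun i ε => kerMap A (i, ε) p + a * lowShift y (i, ε)) = a • (y ᵥ* A 0) := by
  have h0 : (fun i => kerMap A (i, 0) p + a * lowShift y (i, 0)) =
      (fun i => kerMap A (i, 0) p) + a • y := by
    funext i
    simp [lowShift]
  have h1 : (fun i => kerMap A (i, 1) p + a * lowShift y (i, 1)) =
      (fun i => kerMap A (i, 1) p) := by
    funext i
    simp [lowShift]
  rw [coFreq, h0, h1, add_vecMul, smul_vecMul, add_right_comm, h.kerMap_vecMul, zero_add]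

/-- The Fourier transform of `H` restricted to the range of `freq A`. -/
def restrictedFourier (H : (Fin m → Fin 2 → ℝ) → ℝ) (A : Fin 2 → Matrix (Fin m) (Fin m) ℝ)
    (η : Fin m → ℝ) : ℂ :=
  ∫ x, (H x : ℂ) * osc (∑ i, ∑ ε, x i ε * freq A η i ε)

/-- The part of the form at scale `s` with derivatives in the `l`-th pair of variables. -/
def scalePiece (H : (Fin m → Fin 2 → ℝ) → ℝ) (A : Fin 2 → Matrix (Fin m) (Fin m) ℝ)
    (K : (Fin m → ℝ) → ℂ) (R : ℝ) (l : Fin m) (s : ℝ) : ℂ :=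
  ∫ η, (restrictedFourier H A η *
    ∏ i, ∏ ε, gaussSymbol (pairB l 1 (i, ε)) (Real.exp s * freq A η i ε)) *
      unitMult R l A (fun η => K (Real.exp (-s) • η)) (Real.exp s • η)

theorem IsRegFamily.integrable_unitMult {E R : ℝ} {A : Fin 2 → Matrix (Fin m) (Fin m) ℝ}
    (h : IsRegFamily E A) (hm : 1 ≤ m) {K : (Fin m → ℝ) → ℂ} {k : ℕ} (hK : IsCZ k K) (l : Fin m) :
    Integrable (unitMult R l A K) :=
  (h.contDiff_unitMult hm hK).continuous.integrable_of_hasCompactSupport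
    h.hasCompactSupport_unitMult

theorem integral_comp_exp_smul_mul_osc (f : (Fin m → ℝ) → ℂ) (v : Fin m → ℝ) (s : ℝ) :
    ∫ η, f (Real.exp s • η) * osc (∑ i, v i * η i) =
      ((Real.exp s ^ m)⁻¹ : ℝ) • ∫ η, f η * osc (∑ i, (Real.exp (-s) • v) i * η i) := by
  have h := Measure.integral_comp_smul (volume : Measure (Fin m → ℝ))
    (fun η => f η * osc (∑ i, (Real.exp (-s) • v) i * η i)) (Real.exp s)
  rw [Module.finrank_fin_fun, abs_of_pos (by positivity)] at h
  rw [← h]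
  refine integral_congr_ae (Filter.Eventually.of_forall fun η => ?_)
  simp only [Pi.smul_apply, smul_eq_mul]
  congr 3
  funext i
  rw [mul_mul_mul_comm, ← Real.exp_add, neg_add_cancel, Real.exp_zero, one_mul]

theorem IsRegFamily.integrable_hform_mul_unitMult {E R : ℝ}
    {A : Fin 2 → Matrix (Fin m) (Fin m) ℝ}
    (h : IsRegFamily E A) (hm : 1 ≤ m) {K : (Fin m → ℝ) → ℂ} {k : ℕ} (hK : IsCZ k K)
    {H : (Fin m → Fin 2 → ℝ) → ℝ} (hH : Integrable H) (l : Fin m) (s : ℝ) :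
    Integrable (fun z : (Fin m → ℝ) × (Fin m → Fin 2 → ℝ) =>
      (hform H (pairB l 1) (fun κ => z.2 κ.1 κ.2) (fun _ => s) : ℂ) *
        osc (∑ i, ∑ ε, z.2 i ε * freq A z.1 i ε) *
          unitMult R l A (fun η => K (Real.exp (-s) • η)) (Real.exp s • z.1))
      (volume.prod volume) := by
  have hn : Integrable fun η => unitMult R l A (fun η => K (Real.exp (-s) • η)) (Real.exp s • η) :=
    (h.integrable_unitMult hm (hK.comp_smul (Real.exp_pos (-s))) l).comp_smul (Real.exp_ne_zero s)
  have hf : Integrable fun c : Fin m → Fin 2 → ℝ =>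
      (hform H (pairB l 1) (fun κ => c κ.1 κ.2) (fun _ => s) : ℂ) :=
    (integrable_hform hH (pairB l 1) s).ofReal
  have hcont : Continuous fun z : (Fin m → ℝ) × (Fin m → Fin 2 → ℝ) =>
      osc (∑ i, ∑ ε, z.2 i ε * freq A z.1 i ε) := by
    have h1 : Continuous fun z : (Fin m → ℝ) × (Fin m → Fin 2 → ℝ) => freq A z.1 :=
      (freqL A).continuous.comp continuous_fst
    exact continuous_osc.comp (by fun_prop)
  have hInt := (hn.mul_prod hf).bdd_mul (c := 1) hcont.aestronglyMeasurable
    (Filter.Eventually.of_forall fun z => (norm_osc _).le)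
  refine hInt.congr (Filter.Eventually.of_forall fun z => ?_)
  simp only
  ring

theorem IsRegFamily.integrable_scalePiece {E R : ℝ} {A : Fin 2 → Matrix (Fin m) (Fin m) ℝ}
    (h : IsRegFamily E A) (hm : 1 ≤ m) {K : (Fin m → ℝ) → ℂ} {k : ℕ} (hK : IsCZ k K)
    {H : (Fin m → Fin 2 → ℝ) → ℝ} (hH : Integrable H) (l : Fin m) (s : ℝ) :
    Integrable fun η => (restrictedFourier H A η *
      ∏ i, ∏ ε, gaussSymbol (pairB l 1 (i, ε)) (Real.exp s * freq A η i ε)) *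
        unitMult R l A (fun η => K (Real.exp (-s) • η)) (Real.exp s • η) := by
  unfold restrictedFourier
  simp only [← integral_hform_mul_osc hH, ← integral_mul_const]
  exact (h.integrable_hform_mul_unitMult hm hK hH l s).integral_prod_left

theorem IsRegFamily.scalePiece_eq {E R : ℝ} {A : Fin 2 → Matrix (Fin m) (Fin m) ℝ}
    (h : IsRegFamily E A) (hm : 1 ≤ m) {K : (Fin m → ℝ) → ℂ} {k : ℕ} (hK : IsCZ k K)
    {H : (Fin m → Fin 2 → ℝ) → ℝ} (hH : Integrable H) (l : Fin m) (s : ℝ) :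
    scalePiece H A K R l s =
      ∫ c : Fin m → Fin 2 → ℝ, (hform H (pairB l 1) (fun κ => c κ.1 κ.2) (fun _ => s) : ℂ) *
        ((Real.exp s ^ m)⁻¹ : ℝ) • ∫ η, unitMult R l A (fun η => K (Real.exp (-s) • η)) η *
          osc (∑ i, (Real.exp (-s) • coFreq A c) i * η i) := by
  unfold scalePiece restrictedFourier
  simp only [← integral_hform_mul_osc hH, ← integral_mul_const]
  rw [integral_integral_swap (h.integrable_hform_mul_unitMult hm hK hH l s)]
  refine integral_congr_ae (Filter.Eventually.of_forall fun c => ?_)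
  simp only [sum_mul_freq, ← integral_comp_exp_smul_mul_osc]
  rw [← integral_const_mul]
  refine integral_congr_ae (Filter.Eventually.of_forall fun η => ?_)
  simp only
  ring

theorem IsRegFamily.enorm_scalePiece_le {E R C : ℝ} {A : Fin 2 → Matrix (Fin m) (Fin m) ℝ}
    (h : IsRegFamily E A) (hm : 1 ≤ m) {K : (Fin m → ℝ) → ℂ} {k : ℕ} (hK : IsCZ k K)
    {H : (Fin m → Fin 2 → ℝ) → ℝ} (hH : Integrable H) {l : Fin m}
    (hC : ∀ K, IsCZ k K → ∀ v : Fin m → ℝ,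
      ‖∫ η, unitMult R l A K η * osc (∑ i, v i * η i)‖ ≤ C / (1 + ‖v‖) ^ k) (s : ℝ) :
    ‖scalePiece H A K R l s‖ₑ ≤ ∫⁻ y : Fin m → ℝ, ENNReal.ofReal (C / (1 + ‖y ᵥ* A 0‖) ^ k) *
      ∫⁻ p : Fin m → ℝ, ‖hform H (pairB l 1)
        (fun κ => kerMap A κ p + Real.exp s * lowShift y κ) (fun _ => s)‖ₑ := by
  rw [h.scalePiece_eq hm hK hH]
  refine (enorm_integral_le_lintegral_enorm _).trans ?_
  have hc : Continuous fun c : Fin m → Fin 2 → ℝ =>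
      hform H (pairB l 1) (fun κ => c κ.1 κ.2) (fun _ => s) :=
    (continuous_hform hH (pairB l 1)).comp
      (Continuous.prodMk (f := fun c : Fin m → Fin 2 → ℝ => fun κ : Fin m × Fin 2 => c κ.1 κ.2)
        (g := fun _ => fun _ => s) (by fun_prop) continuous_const)
  have hg : Measurable fun c : Fin m → Fin 2 → ℝ =>
      ENNReal.ofReal ((Real.exp s ^ m)⁻¹ * (C / (1 + ‖Real.exp (-s) • coFreq A c‖) ^ k)) *
        ‖hform H (pairB l 1) (fun κ => c κ.1 κ.2) (fun _ => s)‖ₑ := by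
    refine Measurable.mul ?_ hc.measurable.enorm
    have := (continuous_coFreq A).measurable
    fun_prop
  calc _ ≤ ∫⁻ c : Fin m → Fin 2 → ℝ,
        ENNReal.ofReal ((Real.exp s ^ m)⁻¹ * (C / (1 + ‖Real.exp (-s) • coFreq A c‖) ^ k)) *
        ‖hform H (pairB l 1) (fun κ => c κ.1 κ.2) (fun _ => s)‖ₑ := by
        refine lintegral_mono fun c => ?_
        rw [enorm_mul, mul_comm]
        refine mul_le_mul' ?_ (le_of_eq ?_)
        · rw [← ofReal_norm, norm_smul, Real.norm_of_nonneg (by positivity)]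
          exact ENNReal.ofReal_le_ofReal (mul_le_mul_of_nonneg_left
            (hC _ (hK.comp_smul (Real.exp_pos (-s))) _) (by positivity))
        · rw [← ofReal_norm, ← ofReal_norm, Complex.norm_real]
    _ = _ := by
        rw [lintegral_eq_lintegral_kerMap A hg s, ← lintegral_const_mul']
        · refine lintegral_congr fun y => ?_
          rw [← lintegral_const_mul' _ _ ENNReal.ofReal_ne_top,
            ← lintegral_const_mul' _ _ ENNReal.ofReal_ne_top]
          refine lintegral_congr fun p => ?_
          rw [h.coFreq_kerMap, smul_smul, ← Real.exp_add, neg_add_cancel, Real.exp_zero, one_smul,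
            ← mul_assoc, ← ENNReal.ofReal_mul (by positivity), ← mul_assoc,
            mul_inv_cancel₀ (by positivity), one_mul]
        · exact ENNReal.ofReal_ne_top

end SBL

namespace SBL

variable {m : ℕ}

/-- The exponent with which the estimates grow under translations. -/
def shiftExp (m : ℕ) : ℕ := 2 * m + 1 + 2 * (2 ^ m * m)

theorem lintegral_one_add_norm_lt_top (m : ℕ) (C : ℝ) :
    ∫⁻ y : Fin m → ℝ, ENNReal.ofReal (C * (1 + ‖y‖) ^ (-((m + 1 : ℕ) : ℝ))) < ∞ := by
  refine Integrable.lintegral_lt_top ((integrable_one_add_norm ?_).const_mul C)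
  rw [Module.finrank_fin_fun]
  exact_mod_cast Nat.lt_succ_self m

theorem IsRegFamily.decay_mul_le {E C : ℝ} {A : Fin 2 → Matrix (Fin m) (Fin m) ℝ}
    (h : IsRegFamily E A) (hm : 1 ≤ m) (hC : 0 ≤ C) (y : Fin m → ℝ) :
    C / (1 + ‖y ᵥ* A 0‖) ^ (shiftExp m + (m + 1)) * (1 + ‖lowShift y‖) ^ shiftExp m ≤
      C * (m * E) ^ (shiftExp m + (m + 1)) * (1 + ‖y‖) ^ (-((m + 1 : ℕ) : ℝ)) := by
  have hm1 : (1 : ℝ) ≤ m := by exact_mod_cast hm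
  have hmE : 1 ≤ m * E := one_le_mul_of_one_le_of_one_le hm1 h.one_le
  have hy := norm_nonneg y
  have h1 : 1 + ‖y‖ ≤ m * E * (1 + ‖y ᵥ* A 0‖) := by
    have := h.norm_le_vecMul_zero y
    linarith
  rw [Real.rpow_neg (by positivity), Real.rpow_natCast, div_mul_eq_mul_div, mul_assoc C, mul_div_assoc]
  refine mul_le_mul_of_nonneg_left ?_ hC
  rw [div_le_iff₀ (by positivity), ← div_eq_mul_inv, div_mul_eq_mul_div, le_div_iff₀ (by positivity),
    ← mul_pow]
  calc (1 + ‖lowShift y‖) ^ shiftExp m * (1 + ‖y‖) ^ (m + 1)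
      ≤ (1 + ‖y‖) ^ shiftExp m * (1 + ‖y‖) ^ (m + 1) := by
        gcongr
        exact norm_lowShift_le y
    _ = (1 + ‖y‖) ^ (shiftExp m + (m + 1)) := (pow_add _ _ _).symm
    _ ≤ _ := by gcongr

theorem continuous_lowShift : Continuous (lowShift : (Fin m → ℝ) → Fin m × Fin 2 → ℝ) := by
  refine continuous_pi fun κ => ?_
  unfold lowShift
  split_ifs <;> fun_prop

/-- The single scale pieces are integrable over all scales, uniformly. -/
theorem exists_scalePiece_estimate (hm : 1 ≤ m) {p : Corner m → ℝ≥0∞}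
    (hp : ∀ j, (2 : ℝ≥0∞) ^ (m - 1) < p j) (hp1 : ∑ j, (p j)⁻¹ = 1) {E : ℝ} (hE : 1 ≤ E) (R : ℝ)
    (l : Fin m) :
    ∃ C : ℝ≥0, ∀ A : Fin 2 → Matrix (Fin m) (Fin m) ℝ, IsRegFamily E A →
      ∀ K, IsCZ (shiftExp m + (m + 1)) K →
      ∀ F : Corner m → (Fin m → ℝ) → ℝ, (∀ j, Continuous (F j)) →
      (∀ j, HasCompactSupport (F j)) → (∀ j, F j ≠ 0) →
      ∃ g : ℝ → ℝ≥0∞, Measurable g ∧ (∀ s, ‖scalePiece (cornerProd F) A K R l s‖ₑ ≤ g s) ∧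
        ∫⁻ s, g s ≤ C * ∏ j, eLpNorm (F j) (p j) volume := by
  have hm1 : (1 : ℝ) ≤ m := by exact_mod_cast hm
  have hmE : 1 ≤ m * E := one_le_mul_of_one_le_of_one_le hm1 hE
  obtain ⟨C₁, hC₁⟩ := exists_shift_estimate hm hp hp1 (one_le_pow₀ hmE (n := 2))
  obtain ⟨C₂, hC₂0, hC₂⟩ := exists_unitMult_decay hm (zero_le_one.trans hE) R l
    (shiftExp m + (m + 1))
  have hfin := lintegral_one_add_norm_lt_top m (C₂ * (m * E) ^ (shiftExp m + (m + 1)))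
  refine ⟨C₁ * (∫⁻ y : Fin m → ℝ, ENNReal.ofReal (C₂ * (m * E) ^ (shiftExp m + (m + 1)) *
      (1 + ‖y‖) ^ (-((m + 1 : ℕ) : ℝ)))).toNNReal, fun A hA K hK F hF hFc hF0 => ?_⟩
  have hH := integrable_cornerProd hF hFc
  have hc : Continuous fun z : (ℝ × (Fin m → ℝ)) × (Fin m → ℝ) =>
      hform (cornerProd F) (pairB l 1)
        (fun κ => kerMap A κ z.2 + Real.exp z.1.1 * lowShift z.1.2 κ) (fun _ => z.1.1) := by
    have hs : Continuous fun z : (ℝ × (Fin m → ℝ)) × (Fin m → ℝ) => lowShift z.1.2 :=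
      continuous_lowShift.comp (by fun_prop)
    exact (continuous_hform hH (pairB l 1)).comp
      (Continuous.prodMk (f := fun z : (ℝ × (Fin m → ℝ)) × (Fin m → ℝ) =>
        fun κ => kerMap A κ z.2 + Real.exp z.1.1 * lowShift z.1.2 κ)
        (g := fun z => fun _ => z.1.1) (by fun_prop) (by fun_prop))
  have hinner := (hc.measurable.enorm).lintegral_prod_right' (ν := volume)
  have hw : Measurable fun y : Fin m → ℝ =>
      ENNReal.ofReal (C₂ / (1 + ‖y ᵥ* A 0‖) ^ (shiftExp m + (m + 1))) := by
    have : Continuous fun y : Fin m → ℝ => y ᵥ* A 0 :=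
      Continuous.matrix_vecMul continuous_id continuous_const
    have := this.measurable
    fun_prop
  have hprod : Measurable fun z : ℝ × (Fin m → ℝ) =>
      ENNReal.ofReal (C₂ / (1 + ‖z.2 ᵥ* A 0‖) ^ (shiftExp m + (m + 1))) *
      ∫⁻ p : Fin m → ℝ, ‖hform (cornerProd F) (pairB l 1)
        (fun κ => kerMap A κ p + Real.exp z.1 * lowShift z.2 κ) (fun _ => z.1)‖ₑ :=
    (hw.comp measurable_snd).mul hinner
  refine ⟨_, hprod.lintegral_prod_right' (ν := volume),
    fun s => hA.enorm_scalePiece_le hm hK hH (hC₂ A hA) s, ?_⟩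
  rw [lintegral_lintegral_swap hprod.aemeasurable]
  have hstep : ∀ y : Fin m → ℝ, ∫⁻ s : ℝ,
      ENNReal.ofReal (C₂ / (1 + ‖y ᵥ* A 0‖) ^ (shiftExp m + (m + 1))) *
      ∫⁻ p : Fin m → ℝ, ‖hform (cornerProd F) (pairB l 1)
        (fun κ => kerMap A κ p + Real.exp s * lowShift y κ) (fun _ => s)‖ₑ ≤
      ENNReal.ofReal (C₂ * (m * E) ^ (shiftExp m + (m + 1)) *
        (1 + ‖y‖) ^ (-((m + 1 : ℕ) : ℝ))) * (C₁ * ∏ j, eLpNorm (F j) (p j) volume) := by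
    intro y
    rw [lintegral_const_mul' _ _ ENNReal.ofReal_ne_top]
    calc _ ≤ ENNReal.ofReal (C₂ / (1 + ‖y ᵥ* A 0‖) ^ (shiftExp m + (m + 1))) *
          (C₁ * ENNReal.ofReal ((1 + ‖lowShift y‖) ^ shiftExp m) *
            ∏ j, eLpNorm (F j) (p j) volume) := by
          gcongr
          exact hC₁ _ (hA.isNondeg hm) F hF hFc hF0 l (lowShift y)
      _ = ENNReal.ofReal (C₂ / (1 + ‖y ᵥ* A 0‖) ^ (shiftExp m + (m + 1)) *
          (1 + ‖lowShift y‖) ^ shiftExp m) * (C₁ * ∏ j, eLpNorm (F j) (p j) volume) := by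
          rw [ENNReal.ofReal_mul (by positivity)]
          ring
      _ ≤ _ := by
          exact mul_le_mul_left (ENNReal.ofReal_le_ofReal (hA.decay_mul_le hm hC₂0 y)) _
  refine (lintegral_mono hstep).trans ?_
  rw [lintegral_mul_const _ (by fun_prop), ENNReal.coe_mul, ENNReal.coe_toNNReal hfin.ne]
  exact le_of_eq (by ring)

/-- The cutoff in the scale parameter. -/
def scaleCut (t : ℝ) : ℝ := t * scaleBump t

theorem continuous_scaleCut : Continuous scaleCut := continuous_id.mul scaleBump.continuous

theorem scaleCut_nonneg {t : ℝ} (ht : 0 ≤ t) : 0 ≤ scaleCut t := mul_nonneg ht scaleBump.nonneg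

theorem hasCompactSupport_scaleCut_exp : HasCompactSupport fun s => scaleCut (Real.exp (4 * s)) := by
  refine HasCompactSupport.of_support_subset_isCompact (isCompact_Icc (a := -1) (b := 1))
    fun s hs => ?_
  have h : ¬(Real.exp (4 * s) ≤ 1 / 2 ∨ 3 / 2 ≤ Real.exp (4 * s)) := fun h => hs (by
    simp only [scaleCut, scaleBump_eq_zero h, mul_zero])
  push Not at h
  constructor
  · by_contra! h1
    have h2 : Real.exp (4 * s) ≤ Real.exp (-1) := Real.exp_le_exp.2 (by linarith)
    have h3 := Real.exp_neg_one_lt_d9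
    linarith
  · by_contra! h1
    have h2 := Real.add_one_le_exp (4 * s)
    linarith

/-- The normalization of the integral over scales. -/
def scaleConst : ℝ := ∫ s, scaleCut (Real.exp (4 * s))

theorem continuous_scaleCut_exp : Continuous fun s => scaleCut (Real.exp (4 * s)) :=
  continuous_scaleCut.comp (by fun_prop)

theorem scaleConst_pos : 0 < scaleConst := by
  refine continuous_scaleCut_exp.integral_pos_of_hasCompactSupport_nonneg_nonzero
    hasCompactSupport_scaleCut_exp (fun s => scaleCut_nonneg (Real.exp_pos _).le) (x := 0) ?_
  have h : scaleBump 1 = 1 := scaleBump.one_of_mem_closedBall (by simp [scaleBump.rIn_pos.le])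
  simp [scaleCut, h]

theorem scaleCut_exp_mul {N : ℝ} (hN : 0 < N) (s : ℝ) :
    scaleCut (Real.exp s ^ 4 * N) = scaleCut (Real.exp (4 * (s + Real.log N / 4))) := by
  rw [show 4 * (s + Real.log N / 4) = (4 : ℕ) * s + Real.log N by push_cast; ring, Real.exp_add,
    Real.exp_log hN, Real.exp_nat_mul]

theorem integrable_scaleCut {N : ℝ} (hN : 0 < N) :
    Integrable fun s => scaleCut (Real.exp s ^ 4 * N) := by
  simp only [scaleCut_exp_mul hN]
  exact (continuous_scaleCut_exp.integrable_of_hasCompactSupport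
    hasCompactSupport_scaleCut_exp).comp_add_right _

theorem integral_scaleCut {N : ℝ} (hN : 0 < N) :
    ∫ s, scaleCut (Real.exp s ^ 4 * N) = scaleConst := by
  simp only [scaleCut_exp_mul hN]
  exact integral_add_right_eq_self (fun s => scaleCut (Real.exp (4 * s))) _

theorem prod_gaussSymbol_pairB (l : Fin m) (ξ : Fin m → Fin 2 → ℝ) :
    ∏ i, ∏ ε, gaussSymbol (pairB l 1 (i, ε)) (ξ i ε) =
      (2 * Real.pi * Complex.I) ^ 2 *
        ((ξ l 0 * ξ l 1 * Real.exp (-(Real.pi * ∑ i, ∑ ε, ξ i ε ^ 2)) : ℝ) : ℂ) := by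
  simp only [gaussSymbol, Finset.prod_mul_distrib, ← Complex.exp_sum, Complex.ofReal_mul,
    Complex.ofReal_exp]
  have h1 : ∏ i, ∏ ε, (2 * Real.pi * Complex.I * (ξ i ε : ℂ)) ^ pairB l 1 (i, ε) =
      (2 * Real.pi * Complex.I) ^ 2 * (ξ l 0 * ξ l 1) := by
    rw [Finset.prod_eq_single l (fun i _ hi => by simp [pairB, hi]) (by simp)]
    simp only [pairB, if_true, pow_one, Fin.prod_univ_two]
    ring
  have h2 : ∑ i, ∑ ε, -(Real.pi : ℂ) * (ξ i ε : ℂ) ^ 2 =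
      ((-(Real.pi * ∑ i, ∑ ε, ξ i ε ^ 2) : ℝ) : ℂ) := by
    push_cast
    simp only [neg_mul, Finset.mul_sum, Finset.sum_neg_distrib]
  rw [h1, h2, mul_assoc]

theorem IsRegFamily.sum_gauss_mul_unitMult {E : ℝ} {A : Fin 2 → Matrix (Fin m) (Fin m) ℝ}
    (h : IsRegFamily E A) (K : (Fin m → ℝ) → ℂ) (s : ℝ) (η : Fin m → ℝ) :
    ∑ l, (∏ i, ∏ ε, gaussSymbol (pairB l 1 (i, ε)) (Real.exp s * freq A η i ε)) *
        unitMult (m * E * (m * E * 2)) l A (fun η => K (Real.exp (-s) • η)) (Real.exp s • η) =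
      (2 * Real.pi * Complex.I) ^ 2 *
        ((scaleCut (Real.exp s ^ 4 * quart (freq A η)) : ℝ) : ℂ) * K η := by
  have hK : Real.exp (-s) • Real.exp s • η = η := by
    rw [smul_smul, ← Real.exp_add, neg_add_cancel, Real.exp_zero, one_smul]
  set ξ := freq A (Real.exp s • η) with hξ
  have hξ' : ∀ i ε, Real.exp s * freq A η i ε = ξ i ε := fun i ε => by
    rw [hξ, freq_smul]; rfl
  have hq : Real.exp s ^ 4 * quart (freq A η) = quart ξ := by rw [hξ, freq_smul, quart_smul]
  simp only [hξ', prod_gaussSymbol_pairB, unitMult, hK, hq, ← hξ]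
  have hcut : quart ξ * (scaleBump (quart ξ) * ballBump m (m * E * (m * E * 2)) ξ) =
      scaleCut (quart ξ) := by
    rw [scaleCut]
    rcases lt_or_ge (quart ξ) (3 / 2) with h1 | h1
    · have h2 := h.norm_le_of_quart_le zero_le_two (h1.le.trans (by norm_num))
      have hmE : 0 ≤ m * E := mul_nonneg m.cast_nonneg (zero_le_one.trans h.one_le)
      rw [ballBump_eq_one ((h.norm_freq_le _).trans (mul_le_mul_of_nonneg_left h2 hmE)), mul_one]
    · rw [scaleBump_eq_zero (Or.inr h1), zero_mul]
  have hsum : scaleCut (quart ξ) = ∑ l, (ξ l 0 * ξ l 1) ^ 2 *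
      (scaleBump (quart ξ) * ballBump m (m * E * (m * E * 2)) ξ) := by
    rw [← Finset.sum_mul]
    exact hcut.symm
  have hexp : Real.exp (-(Real.pi * ∑ i, ∑ ε, ξ i ε ^ 2)) *
      Real.exp (Real.pi * ∑ i, ∑ ε, ξ i ε ^ 2) = 1 := by
    rw [← Real.exp_add, neg_add_cancel, Real.exp_zero]
  rw [hsum, Complex.ofReal_sum]
  symm
  rw [Finset.mul_sum, Finset.sum_mul]
  refine Finset.sum_congr rfl fun l _ => ?_
  have hx : (ξ l 0 * ξ l 1) ^ 2 * (scaleBump (quart ξ) * ballBump m (m * E * (m * E * 2)) ξ) =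
      ξ l 0 * ξ l 1 * Real.exp (-(Real.pi * ∑ i, ∑ ε, ξ i ε ^ 2)) *
      (ξ l 0 * ξ l 1 * Real.exp (Real.pi * ∑ i, ∑ ε, ξ i ε ^ 2) * scaleBump (quart ξ) *
        ballBump m (m * E * (m * E * 2)) ξ) := by
    linear_combination -(ξ l 0 * ξ l 1) ^ 2 * scaleBump (quart ξ) *
      ballBump m (m * E * (m * E * 2)) ξ * hexp
  rw [window, hx, Complex.ofReal_mul]
  ring

end SBL

namespace SBL

variable {m : ℕ}

theorem continuous_quart_freq (A : Fin 2 → Matrix (Fin m) (Fin m) ℝ) :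
    Continuous fun η => quart (freq A η) := by
  have h : Continuous (freq A) := (freqL A).continuous
  unfold quart
  fun_prop

theorem IsRegFamily.sum_scalePiece_eq {E : ℝ} {A : Fin 2 → Matrix (Fin m) (Fin m) ℝ}
    (h : IsRegFamily E A) (hm : 1 ≤ m) {K : (Fin m → ℝ) → ℂ} {k : ℕ} (hK : IsCZ k K)
    {H : (Fin m → Fin 2 → ℝ) → ℝ} (hH : Integrable H) (s : ℝ) :
    ∑ l, scalePiece H A K (m * E * (m * E * 2)) l s =
      ∫ η, (2 * Real.pi * Complex.I) ^ 2 *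
        (scaleCut (Real.exp s ^ 4 * quart (freq A η)) • (restrictedFourier H A η * K η)) := by
  unfold scalePiece
  rw [← integral_finsetSum _ fun l _ => h.integrable_scalePiece hm hK hH l s]
  refine integral_congr_ae (Filter.Eventually.of_forall fun η => ?_)
  simp only [mul_assoc]
  rw [← Finset.mul_sum]
  have h1 := h.sum_gauss_mul_unitMult K s η
  simp only [mul_assoc] at h1
  rw [h1, Complex.real_smul]
  ring

theorem IsRegFamily.integral_sum_scalePiece {E : ℝ} {A : Fin 2 → Matrix (Fin m) (Fin m) ℝ}
    (h : IsRegFamily E A) (hm : 1 ≤ m) {K : (Fin m → ℝ) → ℂ} {k : ℕ} (hK : IsCZ k K)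
    {H : (Fin m → Fin 2 → ℝ) → ℝ} (hH : Integrable H)
    (hI : Integrable fun η => restrictedFourier H A η * K η) :
    ∫ s, ∑ l, scalePiece H A K (m * E * (m * E * 2)) l s =
      (2 * Real.pi * Complex.I) ^ 2 * (scaleConst • ∫ η, restrictedFourier H A η * K η) := by
  have hne : ∀ᵐ η : Fin m → ℝ, 0 < quart (freq A η) := by
    have : Nonempty (Fin m) := ⟨⟨0, hm⟩⟩
    filter_upwards [(measure_eq_zero_iff_ae_notMem.1 (measure_singleton (0 : Fin m → ℝ)))] with η hη
    exact h.quart_freq_pos hη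
  have hcont : Continuous fun z : ℝ × (Fin m → ℝ) =>
      scaleCut (Real.exp z.1 ^ 4 * quart (freq A z.2)) := by
    have := (continuous_quart_freq A).comp (continuous_snd (X := ℝ))
    exact continuous_scaleCut.comp (by fun_prop)
  have hInt : Integrable (fun z : ℝ × (Fin m → ℝ) =>
      scaleCut (Real.exp z.1 ^ 4 * quart (freq A z.2)) •
        (restrictedFourier H A z.2 * K z.2)) (volume.prod volume) := by
    have hmeas : AEStronglyMeasurable (fun z : ℝ × (Fin m → ℝ) =>
        scaleCut (Real.exp z.1 ^ 4 * quart (freq A z.2)) •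
          (restrictedFourier H A z.2 * K z.2)) (volume.prod volume) :=
      hcont.aestronglyMeasurable.smul (g := fun z : ℝ × (Fin m → ℝ) =>
        restrictedFourier H A z.2 * K z.2) hI.1.comp_snd
    refine (integrable_prod_iff' hmeas).2 ⟨?_, ?_⟩
    · filter_upwards [hne] with η hη
      exact (integrable_scaleCut hη).smul_const _
    · refine (hI.norm.const_mul scaleConst).congr ?_
      filter_upwards [hne] with η hη
      simp only [norm_smul]
      rw [integral_mul_const, ← integral_scaleCut hη]
      congr 1
      refine integral_congr_ae (Filter.Eventually.of_forall fun s => ?_)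
      exact (Real.norm_of_nonneg (scaleCut_nonneg (by positivity))).symm
  simp only [h.sum_scalePiece_eq hm hK hH, integral_const_mul]
  rw [integral_integral_swap hInt, ← integral_smul]
  congr 1
  refine integral_congr_ae ?_
  filter_upwards [hne] with η hη
  rw [integral_smul_const, integral_scaleCut hη]

/-- The main estimate, in coordinates grouped into pairs. -/
theorem exists_form_estimate (hm : 1 ≤ m) {p : Corner m → ℝ≥0∞}
    (hp : ∀ j, (2 : ℝ≥0∞) ^ (m - 1) < p j) (hp1 : ∑ j, (p j)⁻¹ = 1) {E : ℝ} (hE : 1 ≤ E) :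
    ∃ C : ℝ≥0, ∀ A : Fin 2 → Matrix (Fin m) (Fin m) ℝ, IsRegFamily E A →
      ∀ K, IsCZ (shiftExp m + (m + 1)) K →
      ∀ F : Corner m → (Fin m → ℝ) → ℝ, (∀ j, Continuous (F j)) →
      (∀ j, HasCompactSupport (F j)) → (∀ j, F j ≠ 0) →
      ‖∫ η, restrictedFourier (cornerProd F) A η * K η‖ₑ ≤
        C * ∏ j, eLpNorm (F j) (p j) volume := by
  choose C hC using exists_scalePiece_estimate hm hp hp1 hE (m * E * (m * E * 2))
  set a : ℂ := (2 * Real.pi * Complex.I) ^ 2 * scaleConst with ha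
  have ha0 : a ≠ 0 := by
    simp [ha, scaleConst_pos.ne', Real.pi_ne_zero, Complex.I_ne_zero]
  refine ⟨‖a‖₊⁻¹ * ∑ l, C l, fun A hA K hK F hF hFc hF0 => ?_⟩
  have hH := integrable_cornerProd hF hFc
  by_cases hI : Integrable fun η => restrictedFourier (cornerProd F) A η * K η
  swap
  · rw [integral_undef hI, enorm_zero]
    exact zero_le
  choose g hgm hg hgi using fun l => hC l A hA K hK F hF hFc hF0
  have h1 : ‖a * ∫ η, restrictedFourier (cornerProd F) A η * K η‖ₑ ≤
      (∑ l, C l : ℝ≥0) * ∏ j, eLpNorm (F j) (p j) volume := by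
    have h2 := hA.integral_sum_scalePiece hm hK hH hI
    rw [Complex.real_smul, ← mul_assoc (_ ^ 2), ← ha] at h2
    rw [← h2]
    calc _ ≤ ∫⁻ s, ‖∑ l, scalePiece (cornerProd F) A K (m * E * (m * E * 2)) l s‖ₑ :=
          enorm_integral_le_lintegral_enorm _
      _ ≤ ∫⁻ s, ∑ l, g l s := lintegral_mono fun s =>
          (enorm_sum_le _ _).trans (Finset.sum_le_sum fun l _ => hg l s)
      _ = ∑ l, ∫⁻ s, g l s := lintegral_finsetSum _ fun l _ => hgm l
      _ ≤ ∑ l, C l * ∏ j, eLpNorm (F j) (p j) volume := Finset.sum_le_sum fun l _ => hgi l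
      _ = _ := by rw [← Finset.sum_mul]; push_cast; rfl
  rw [enorm_mul] at h1
  have ha1 : (‖a‖₊ : ℝ≥0∞) ≠ 0 := by simpa using ha0
  rw [ENNReal.coe_mul, ENNReal.coe_inv (by simpa using ha0), mul_assoc]
  refine le_trans (le_of_eq ?_) (mul_le_mul_right h1 _)
  rw [← mul_assoc, enorm_eq_nnnorm a, ENNReal.inv_mul_cancel ha1 ENNReal.coe_ne_top, one_mul]

end SBL

namespace SBL

variable {m : ℕ}

/-- The two `m × m` blocks of the transpose of an `m × 2m` matrix. -/
def transposeBlock (P : Matrix (Fin m) (Idx m) ℝ) (ε : Fin 2) : Matrix (Fin m) (Fin m) ℝ :=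
  of fun i k => P k (if ε = 0 then Sum.inl i else Sum.inr i)

theorem projM_mul_transpose (P : Matrix (Fin m) (Idx m) ℝ) (j : Corner m) :
    projM j * P.transpose = cornerMat (transposeBlock P) j := by
  ext i k
  rcases Fin.exists_fin_two.1 ⟨j i, rfl⟩ with h | h <;>
    simp [projM, cornerMat, transposeBlock, Matrix.mul_apply, sel, h]

/-- The point of `ℝ^{2m}` whose coordinates are listed as `m` pairs. -/
def ofPairs (x : Fin m → Fin 2 → ℝ) : Idx m → ℝ :=
  Sum.elim (fun i => x i 0) fun i => x i 1

theorem measurePreserving_ofPairs :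
    MeasurePreserving (ofPairs : (Fin m → Fin 2 → ℝ) → Idx m → ℝ) volume volume := by
  have h := (volume_measurePreserving_sumPiEquivProdPi_symm fun _ : Idx m => ℝ).comp
    (measurePreserving_corner_opp (fun _ : Fin m => (0 : Fin 2)))
  convert h using 1
  funext x k
  cases k <;> rfl

theorem proj_ofPairs (j : Corner m) (x : Fin m → Fin 2 → ℝ) :
    proj j (ofPairs x) = fun i => x i (j i) := by
  funext i
  rcases Fin.exists_fin_two.1 ⟨j i, rfl⟩ with h | h <;> simp [proj, sel, ofPairs, h]

theorem sum_ofPairs_mul (P : Matrix (Fin m) (Idx m) ℝ) (x : Fin m → Fin 2 → ℝ) (η : Fin m → ℝ) :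
    ∑ k, ofPairs x k * (P.transpose *ᵥ η) k =
      ∑ i, ∑ ε, x i ε * freq (transposeBlock P) η i ε := by
  simp [Fintype.sum_sum_type, Fin.sum_univ_two, Finset.sum_add_distrib, ofPairs, freq,
    transposeBlock, mulVec, dotProduct]

theorem continuous_proj (j : Corner m) : Continuous (proj j) := by
  unfold proj
  fun_prop

theorem fourierT_eq_restrictedFourier (P : Matrix (Fin m) (Idx m) ℝ)
    {F : Corner m → (Fin m → ℝ) → ℝ} (hF : ∀ j, Continuous (F j)) (η : Fin m → ℝ) :
    fourierT (fun x => ∏ j, F j (proj j x)) (-(P.transpose *ᵥ η)) =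
      restrictedFourier (cornerProd F) (transposeBlock P) η := by
  have hc : Continuous fun x : Idx m → ℝ =>
      Complex.exp (-2 * Real.pi * Complex.I * (∑ k, x k * (-(P.transpose *ᵥ η)) k : ℝ)) *
        ((∏ j, F j (proj j x) : ℝ) : ℂ) := by
    have := fun j => (hF j).comp (continuous_proj j)
    have h2 : Continuous fun x : Idx m → ℝ => ∏ j, F j (proj j x) :=
      continuous_finsetProd _ fun j _ => this j
    fun_prop
  have hmp := measurePreserving_ofPairs (m := m)
  have h := integral_map hmp.aemeasurable (hc.aestronglyMeasurable (μ := volume.map ofPairs))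
  rw [hmp.map_eq] at h
  have h0 : fourierT (fun x => ∏ j, F j (proj j x)) (-(P.transpose *ᵥ η)) =
      ∫ x : Idx m → ℝ, Complex.exp (-2 * Real.pi * Complex.I *
        (∑ k, x k * (-(P.transpose *ᵥ η)) k : ℝ)) * ((∏ j, F j (proj j x) : ℝ) : ℂ) := by
    simp [fourierT]
  rw [h0, h, restrictedFourier]
  refine integral_congr_ae (.of_forall fun x => ?_)
  simp only [Pi.neg_apply, mul_neg, Finset.sum_neg_distrib, sum_ofPairs_mul, proj_ofPairs, osc,
    cornerProd]
  rw [mul_comm]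
  congr 2
  push_cast
  ring

theorem pv_eq_integral (P : Matrix (Fin m) (Idx m) ℝ) (K : (Fin m → ℝ) → ℂ)
    {F : Corner m → (Fin m → ℝ) → ℝ} (hF : ∀ j, Continuous (F j)) :
    pv P K F = ∫ η, restrictedFourier (cornerProd F) (transposeBlock P) η * K η := by
  simp only [pv, fourierT_eq_restrictedFourier P hF]

theorem pv_eq_zero (P : Matrix (Fin m) (Idx m) ℝ) (K : (Fin m → ℝ) → ℂ)
    {F : Corner m → (Fin m → ℝ) → ℝ} {j : Corner m} (hj : F j = 0) : pv P K F = 0 := by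
  have h (x : Idx m → ℝ) : ∏ j, F j (proj j x) = 0 :=
    Finset.prod_eq_zero (Finset.mem_univ j) (by simp [hj])
  simp [pv, fourierT, h]

theorem shiftExp_add_le (hm : 2 ≤ m) : shiftExp m + (m + 1) ≤ 2 ^ (6 * m) := by
  have h1 : m < 2 ^ m := Nat.lt_two_pow_self
  have h2 : 2 ^ (6 * m) = (2 ^ m) ^ 6 := by rw [← pow_mul, mul_comm]
  rw [h2, shiftExp]
  generalize 2 ^ m = N at h1 ⊢
  have h3 : N * m ≤ N * N := Nat.mul_le_mul_left _ h1.le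
  have h4 : 3 * 3 ≤ N * N := Nat.mul_le_mul (by omega) (by omega)
  have h5 : N * 3 ≤ N * N := Nat.mul_le_mul_left _ (by omega)
  have h6 : N ^ 6 = (N * N) * ((N * N) * (N * N)) := by ring
  have h7 : 9 * 9 ≤ (N * N) * (N * N) := Nat.mul_le_mul (by omega) (by omega)
  have h8 : (N * N) * 81 ≤ (N * N) * ((N * N) * (N * N)) := Nat.mul_le_mul_left _ (by omega)
  omega

end SBL

namespace SBL

/-- Theorem 1 (main `L^p` theorem for singular Brascamp–Lieb forms with cubical structure). -/
theorem statement0 (m : ℕ) (hm : 2 ≤ m) (Δ : ℝ) (hΔ : 1 < Δ)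
    (p : Corner m → ℝ≥0∞) (hp : ∀ j, (2:ℝ≥0∞)^(m-1) < p j)
    (hp1 : ∑ j : Corner m, (p j)⁻¹ = 1) :
    ∃ C : ℝ≥0, ∀ P : Matrix (Fin m) (Idx m) ℝ,
      (∀ j : Corner m, IsReg Δ (projM j * P.transpose)) →
      ∀ Khat : (Fin m → ℝ) → ℂ, IsCZ (2^(6*m)) Khat →
      ∀ F : Corner m → (Fin m → ℝ) → ℝ,
        (∀ j, ContDiff ℝ (⊤ : ℕ∞) (F j) ∧ HasCompactSupport (F j)) →
        ENNReal.ofReal ‖pv P Khat F‖ ≤ C * ∏ j : Corner m, eLpNorm (F j) (p j) volume := by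
  have hf : (1 : ℝ) ≤ m.factorial := by
    exact_mod_cast Nat.one_le_iff_ne_zero.2 m.factorial_ne_zero
  have hE : 1 ≤ Δ * (m.factorial * Δ ^ m) :=
    one_le_mul_of_one_le_of_one_le hΔ.le
      (one_le_mul_of_one_le_of_one_le hf (one_le_pow₀ hΔ.le))
  obtain ⟨C, hC⟩ := exists_form_estimate (by omega) hp hp1 hE
  refine ⟨C, fun P hP K hK F hF => ?_⟩
  by_cases h0 : ∃ j, F j = 0
  · obtain ⟨j, hj⟩ := h0
    simp [pv_eq_zero P K hj]
  · push Not at h0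
    rw [ofReal_norm, pv_eq_integral P K fun j => (hF j).1.continuous]
    exact hC _ (isRegFamily_of_isReg hΔ fun j => projM_mul_transpose P j ▸ hP j) K
      (hK.mono (shiftExp_add_le hm)) F (fun j => (hF j).1.continuous) (fun j => (hF j).2) h0

end SBL
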